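/- Let Γ ⊂ ℂ be a bounded quasicircle with interior Ω and let f : 𝔻 → Ω be a conformal bijection. Then ∬_𝔻 |f''(z)/f'(z)|² dA(z) < ∞ (Γ is a Weil–Petersson quasicircle) if and only if Γ is rectifiable and has finite Möbius energy, i.e., Möb(Γ) = ∬_{Γ×Γ} (1/|x−y|² − 1/ℓ(x,y)²) dH¹(x) dH¹(y) < ∞ (Bishop). -/

import Mathlib

/-!
STATEMENT 7 (Bishop): a bounded quasicircle `Γ` is Weil–Petersson
(`∬_𝔻 |f''/f'|² dA < ∞` for the interior Riemann map `f`) if and only if `Γ` is rectifiable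
and has finite Möbius energy `Möb(Γ) = ∬_{Γ×Γ} (1/|x−y|² − 1/ℓ(x,y)²) dH¹ dH¹ < ∞`.
(The Möbius energy is written via a constant-speed parametrization `w` of `Γ`, under which
`H¹` becomes `(ℓ/2π) dθ` and the arc distance `ℓ(x,y)` becomes `(ℓ/2π)` times the circle
distance of the parameters.)
-/

open MeasureTheory Metric Real

section

open Set
open Complex (I normSq_eq_norm_sq norm_real norm_I normSq_apply abs_re_le_norm abs_im_le_norm reCLM
  imCLM real_smul measurableEquivRealProd conjCLE re_add_im re_le_norm norm_exp_ofReal_mul_I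
  exp_mul_I continuous_conj)
open ENNReal (ofReal ofReal_mul ofReal_le_ofReal ofReal_ne_top ofReal_lt_top mul_lt_top ofReal_add
  ofReal_pow ofReal_le_ofReal_iff measurable_ofReal continuous_ofReal toReal_nonneg ofReal_toReal
  ofReal_inv_of_pos ofReal_coe_nnreal)
open Filter (Eventually Tendsto atTop image_mem_map mem_of_superset)
open Function (Periodic uncurry)
open Bornology (IsBounded)
open scoped Topology ComplexConjugate

local notation "𝔻" => ball (0 : ℂ) 1

lemma lintegral_ofReal_mul {α : Type*} [MeasurableSpace α] {μ : Measure α} {c : ℝ}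
    {f : α → ENNReal} :
    ∫⁻ a, ofReal c * f a ∂μ = ofReal c * ∫⁻ a, f a ∂μ :=
  lintegral_const_mul' _ _ ofReal_ne_top

/-- Fundamental theorem of calculus for complex-valued Lipschitz functions. -/
lemma LipschitzOnWith.integral_eq_sub_of_ae_hasDerivAt {f g : ℝ → ℂ} {K : NNReal} {a b : ℝ}
    (hf : LipschitzOnWith K f (uIcc a b))
    (hg : ∀ᵐ x, x ∈ uIcc a b → HasDerivAt f (g x) x) :
    IntervalIntegrable g volume a b ∧ ∫ x in a..b, g x = f b - f a := by
  have hre : LipschitzOnWith K (fun x => (f x).re) (uIcc a b) := by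
    have := (LipschitzWith.of_dist_le_mul (K := 1) (f := fun z : ℂ => z.re) (fun x y => by
      simpa [dist_eq, Complex.dist_eq] using abs_re_le_norm (x - y))).comp_lipschitzOnWith hf
    simpa [Function.comp_def] using this
  have him : LipschitzOnWith K (fun x => (f x).im) (uIcc a b) := by
    have := (LipschitzWith.of_dist_le_mul (K := 1) (f := fun z : ℂ => z.im) (fun x y => by
      simpa [dist_eq, Complex.dist_eq] using abs_im_le_norm (x - y))).comp_lipschitzOnWith hf
    simpa [Function.comp_def] using this
  have hre' := hre.absolutelyContinuousOnInterval
  have him' := him.absolutelyContinuousOnInterval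
  have e1 : ∀ᵐ x, x ∈ uIoc a b → deriv (fun x => (f x).re) x = (g x).re := by
    filter_upwards [hg] with x hx hxm
    have h1 := hx (uIoc_subset_uIcc hxm)
    exact ((reCLM.hasFDerivAt (x := f x)).comp_hasDerivAt x h1).deriv
  have e2 : ∀ᵐ x, x ∈ uIoc a b → deriv (fun x => (f x).im) x = (g x).im := by
    filter_upwards [hg] with x hx hxm
    have h1 := hx (uIoc_subset_uIcc hxm)
    exact ((imCLM.hasFDerivAt (x := f x)).comp_hasDerivAt x h1).deriv
  have i1 := hre'.intervalIntegrable_deriv.congr_ae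
    ((ae_restrict_iff' measurableSet_uIoc).2 e1)
  have i2 := him'.intervalIntegrable_deriv.congr_ae
    ((ae_restrict_iff' measurableSet_uIoc).2 e2)
  have h1 := hre'.integral_deriv_eq_sub
  have h2 := him'.integral_deriv_eq_sub
  rw [intervalIntegral.integral_congr_ae e1] at h1
  rw [intervalIntegral.integral_congr_ae e2] at h2
  have i : IntervalIntegrable g volume a b := by
    have := IntervalIntegrable.add (μ := volume) (f := fun x => ((g x).re : ℂ))
      (g := fun x => ((g x).im : ℂ) * I) ⟨i1.1.ofReal, i1.2.ofReal⟩
      ⟨i2.1.ofReal.mul_const _, i2.2.ofReal.mul_const _⟩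
    refine this.congr (fun x _ => ?_)
    simp [re_add_im]
  refine ⟨i, ?_⟩
  apply Complex.ext
  · rw [← Complex.reCLM_apply, ← reCLM.intervalIntegral_comp_comm i]
    simpa using h1
  · rw [← Complex.imCLM_apply, ← imCLM.intervalIntegral_comp_comm i]
    simpa using h2

/-- Holomorphic change of variables. -/
lemma lintegral_image_eq_lintegral_norm_deriv_sq {f : ℂ → ℂ} {s : Set ℂ} (hs : MeasurableSet s)
    (hf : ∀ z ∈ s, DifferentiableAt ℂ f z) (hi : InjOn f s) (g : ℂ → ENNReal) :
    ∫⁻ z in f '' s, g z = ∫⁻ z in s, ofReal (‖deriv f z‖ ^ 2) * g (f z) := by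
  have main := lintegral_image_eq_lintegral_abs_det_fderiv_mul volume hs
    (f' := fun z => ((fderiv ℂ f z).restrictScalars ℝ))
    (fun z hz => ((hf z hz).hasFDerivAt.restrictScalars ℝ).hasFDerivWithinAt) hi g
  rw [main]
  refine setLIntegral_congr_fun hs (fun z _ => ?_)
  have : ((fderiv ℂ f z).restrictScalars ℝ).det = ‖deriv f z‖ ^ 2 := by
    simp only [ContinuousLinearMap.det, ContinuousLinearMap.coe_restrictScalars,
      LinearMap.det_restrictScalars, LinearMap.det_ring]
    simp [Algebra.norm_complex_eq, normSq_eq_norm_sq]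
  rw [this, abs_of_nonneg (by positivity)]

/-- The derivative of an injective holomorphic function does not vanish. -/
lemma deriv_ne_zero_of_differentiableOn_of_injOn {f : ℂ → ℂ} {U : Set ℂ} (hU : IsOpen U)
    (hf : DifferentiableOn ℂ f U) (hi : InjOn f U) {a : ℂ} (ha : a ∈ U) : deriv f a ≠ 0 := by
  have hop : ∀ z ∈ U, nhds (f z) ≤ Filter.map f (nhds z) := by
    intro z hz
    refine ((hf.analyticAt (hU.mem_nhds hz)).eventually_constant_or_nhds_le_map_nhds).resolve_left ?_
    intro h
    have h2 : ∀ᶠ w in nhdsWithin z {z}ᶜ, f w = f z ∧ w ∈ U :=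
      (h.and (hU.mem_nhds hz)).filter_mono nhdsWithin_le_nhds
    obtain ⟨w, ⟨h3, h4⟩, h5⟩ := (h2.and self_mem_nhdsWithin).exists
    exact h5 (hi h4 hz h3)
  set V := f '' U
  have hVo : IsOpen V := by
    rw [isOpen_iff_mem_nhds]
    rintro _ ⟨z, hz, rfl⟩
    exact hop z hz (image_mem_map (hU.mem_nhds hz))
  set g := Function.invFunOn f U
  have hgf : ∀ z ∈ U, g (f z) = z := fun z hz => hi.leftInvOn_invFunOn hz
  have hgc : ∀ z ∈ U, ContinuousAt g (f z) := by
    intro z hz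
    rw [ContinuousAt, hgf z hz, Filter.tendsto_def]
    intro s hs
    refine hop z hz (Filter.mem_map.2 ?_)
    filter_upwards [hs, hU.mem_nhds hz] with w hw hwU
    simpa [hgf w hwU] using hw
  have hgd : ∀ z ∈ U, deriv f z ≠ 0 → DifferentiableAt ℂ g (f z) := by
    intro z hz h
    have h1 : HasDerivAt f (deriv f z) (g (f z)) := by
      rw [hgf z hz]; exact (hf.differentiableAt (hU.mem_nhds hz)).hasDerivAt
    refine (HasDerivAt.of_local_left_inverse (hgc z hz) h1 h ?_).differentiableAt
    filter_upwards [hVo.mem_nhds ⟨z, hz, rfl⟩]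
    rintro _ ⟨w, hw, rfl⟩
    rw [hgf w hw]
  have hda : AnalyticAt ℂ (deriv f) a := (hf.analyticAt (hU.mem_nhds ha)).deriv
  have hev : ∀ᶠ z in nhdsWithin a {a}ᶜ, deriv f z ≠ 0 := by
    refine hda.eventually_eq_zero_or_eventually_ne_zero.resolve_left ?_
    intro h
    obtain ⟨r, hr, hrU⟩ := Metric.eventually_nhds_iff_ball.1 (h.and (hU.mem_nhds ha))
    obtain ⟨w, hw, hwa⟩ : ∃ w ∈ ball a r, w ≠ a := by
      refine ⟨a + (r / 2 : ℝ), ?_, ?_⟩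
      · simp only [mem_ball, dist_self_add_left, norm_real, norm_eq_abs]
        rw [abs_of_pos (by positivity)]; linarith
      · simp [hr.ne']
    have := (convex_ball a r).is_const_of_fderivWithin_eq_zero (𝕜 := ℂ) (f := f)
      (hf.mono (fun z hz => (hrU z hz).2)) (fun z hz => ?_) hw (mem_ball_self hr)
    · exact hwa (hi (hrU w hw).2 ha this)
    · rw [fderivWithin_of_isOpen isOpen_ball hz]
      ext; simpa using (hrU z hz).1
  have hga : AnalyticAt ℂ g (f a) := by
    refine Complex.analyticAt_of_differentiable_on_punctured_nhds_of_continuousAt ?_ (hgc a ha)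
    have : ∀ᶠ z in nhds a, z ≠ a → (deriv f z ≠ 0 ∧ z ∈ U) :=
      (eventually_nhdsWithin_iff.1 hev).and (hU.mem_nhds ha) |>.mono fun z hz h => ⟨hz.1 h, hz.2⟩
    have h2 := hop a ha (image_mem_map this)
    rw [eventually_nhdsWithin_iff]
    filter_upwards [h2]
    rintro _ ⟨z, hz, rfl⟩ hza
    have hz' := hz (fun h => hza (by simp [h]))
    exact hgd z hz'.2 hz'.1
  have h1 : HasDerivAt (g ∘ f) (deriv g (f a) * deriv f a) a :=
    (hga.differentiableAt.hasDerivAt).comp a (hf.differentiableAt (hU.mem_nhds ha)).hasDerivAt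
  have h2 : HasDerivAt (g ∘ f) 1 a := by
    refine (hasDerivAt_id a).congr_of_eventuallyEq ?_
    filter_upwards [hU.mem_nhds ha] with z hz using hgf z hz
  intro h
  have := h1.unique h2
  simp [h] at this

/-- Area sub-mean value inequality for the square of the norm of a holomorphic function. -/
lemma ofReal_norm_sq_mul_le_lintegral_ball {h : ℂ → ℂ} {a : ℂ} {r : ℝ}
    (hr : 0 < r) (hh : DifferentiableOn ℂ h (ball a r)) :
    ofReal (‖h a‖ ^ 2 * (π * r ^ 2)) ≤
      ∫⁻ z in ball a r, ofReal (‖h z‖ ^ 2) := by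
  have circ : ∀ ρ ∈ Ioo 0 r, ofReal (2 * π * ‖h a‖ ^ 2) ≤
      ∫⁻ θ in Ioo (-π) π, ofReal (‖h (circleMap a ρ θ)‖ ^ 2) := by
    intro ρ hρ
    have hd : DifferentiableOn ℂ (fun z => h z ^ 2) (closedBall a ρ) :=
      (hh.mono (closedBall_subset_ball hρ.2)).pow 2
    have hc : Continuous fun θ => h (circleMap a ρ θ) := by
      refine hh.continuousOn.comp_continuous (continuous_circleMap a ρ) (fun θ => ?_)
      exact closedBall_subset_ball hρ.2 (circleMap_mem_closedBall _ hρ.1.le _)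
    have h1 : circleAverage (fun z => h z ^ 2) a ρ = h a ^ 2 := by
      refine DiffContOnCl.circleAverage ?_
      rw [abs_of_pos hρ.1]
      exact DifferentiableOn.diffContOnCl_ball (U := closedBall a ρ) hd subset_rfl
    have h2 : 2 * π * ‖h a‖ ^ 2 ≤ ∫ θ in (-π)..π, ‖h (circleMap a ρ θ)‖ ^ 2 := by
      have per : Periodic (fun θ => h (circleMap a ρ θ) ^ 2) (2 * π) := fun θ => by
        simp [periodic_circleMap a ρ θ]
      have := per.intervalIntegral_add_eq (-π) 0
      rw [show -π + 2 * π = π by ring, zero_add] at this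
      rw [circleAverage_def, ← this] at h1
      have h3 : ‖(2 * π)⁻¹ • ∫ θ in (-π)..π, h (circleMap a ρ θ) ^ 2‖ = ‖h a‖ ^ 2 := by
        rw [h1, norm_pow]
      rw [norm_smul, norm_eq_abs, abs_of_pos (by positivity)] at h3
      rw [← h3, ← mul_assoc, mul_inv_cancel₀ (by positivity), one_mul]
      refine (intervalIntegral.norm_integral_le_integral_norm (by linarith [pi_pos])).trans_eq ?_
      simp
    refine (ofReal_le_ofReal h2).trans ?_
    rw [intervalIntegral.integral_of_le (by linarith [pi_pos]), integral_Ioc_eq_integral_Ioo,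
      ofReal_integral_eq_lintegral_ofReal]
    · exact ((hc.norm.pow 2).integrableOn_Icc (a := -π) (b := π)).mono_set Ioo_subset_Icc_self
    · exact Eventually.of_forall fun _ => by positivity
  set f : ℂ → ENNReal := (ball 0 r).indicator (fun z => ofReal (‖h (a + z)‖ ^ 2)) with hf
  have hsh : ∫⁻ z in ball a r, ofReal (‖h z‖ ^ 2) = ∫⁻ z, f z := by
    rw [← lintegral_indicator measurableSet_ball, ← lintegral_add_left_eq_self _ a]
    refine lintegral_congr fun z => ?_
    simp only [hf, indicator]
    congr 1
    simp [mem_ball, dist_eq_norm]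
  have hfm : Measurable f := by
    classical
    have hco : ContinuousOn (fun z => ofReal (‖h (a + z)‖ ^ 2)) (ball 0 r) := by
      refine continuous_ofReal.comp_continuousOn ((ContinuousOn.norm ?_).pow 2)
      refine hh.continuousOn.comp (by fun_prop) (fun z hz => ?_)
      simpa [mem_ball, dist_eq_norm] using hz
    have := hco.measurable_piecewise (g := fun _ => (0 : ENNReal)) continuousOn_const measurableSet_ball
    rw [hf, ← piecewise_eq_indicator]
    exact this
  rw [hsh, ← Complex.lintegral_comp_polarCoord_symm, polarCoord_target]
  have hm : Measurable fun p : ℝ × ℝ => ofReal p.1 • f (Complex.polarCoord.symm p) := by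
    have : Continuous fun p : ℝ × ℝ => (Complex.polarCoord.symm p : ℂ) := by
      simp only [Complex.polarCoord_symm_apply]; fun_prop
    exact (measurable_ofReal.comp measurable_fst).mul (hfm.comp this.measurable)
  rw [Measure.volume_eq_prod, setLIntegral_prod _ hm.aemeasurable]
  have hlow : ∫⁻ ρ in Ioo 0 r, ofReal ρ * ofReal (2 * π * ‖h a‖ ^ 2) ≤
      ∫⁻ ρ in Ioi (0 : ℝ), ∫⁻ θ in Ioo (-π) π,
        ofReal (ρ, θ).1 • f (Complex.polarCoord.symm (ρ, θ)) := by
    refine le_trans (setLIntegral_mono' measurableSet_Ioo (fun ρ hρ => ?_))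
      (lintegral_mono_set (Ioo_subset_Ioi_self))
    simp only [smul_eq_mul]
    rw [lintegral_ofReal_mul]
    gcongr
    refine (circ ρ hρ).trans_eq (lintegral_congr fun θ => ?_)
    have e : a + Complex.polarCoord.symm (ρ, θ) = circleMap a ρ θ := by
      rw [Complex.polarCoord_symm_apply]
      simp [circleMap, exp_mul_I]
    have : Complex.polarCoord.symm (ρ, θ) ∈ ball (0 : ℂ) r := by
      rw [mem_ball, dist_eq_norm, sub_zero, Complex.norm_polarCoord_symm, abs_of_pos hρ.1]
      exact hρ.2
    simp only [hf, indicator_of_mem this, e]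
  refine le_trans ?_ hlow
  rw [lintegral_mul_const _ measurable_ofReal]
  have : ∫⁻ ρ in Ioo 0 r, ofReal ρ = ofReal (r ^ 2 / 2) := by
    rw [← ofReal_integral_eq_lintegral_ofReal, ← integral_Ioc_eq_integral_Ioo,
      ← intervalIntegral.integral_of_le hr.le]
    · simp
    · exact (continuous_id.integrableOn_Icc (a := 0) (b := r)).mono_set Ioo_subset_Icc_self
    · exact (ae_restrict_iff' measurableSet_Ioo).2 (Eventually.of_forall fun x hx => hx.1.le)
  rw [this, ← ofReal_mul (by positivity)]
  apply ofReal_le_ofReal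
  apply le_of_eq; ring

lemma setLIntegral_Ioc_add_right (g : ℝ → ENNReal) (a b c : ℝ) :
    ∫⁻ x in Ioc a b, g (x + c) = ∫⁻ x in Ioc (a + c) (b + c), g x := by
  rw [← lintegral_indicator measurableSet_Ioc, ← lintegral_indicator measurableSet_Ioc,
    ← lintegral_add_right_eq_self ((Ioc (a + c) (b + c)).indicator g) c]
  refine lintegral_congr fun x => ?_
  simp [indicator]

lemma Function.Periodic.setLIntegral_Ioc_eq {g : ℝ → ENNReal} {T : ℝ} (hT : 0 < T)
    (hg : Periodic g T) (a b : ℝ) :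
    ∫⁻ x in Ioc a (a + T), g x = ∫⁻ x in Ioc b (b + T), g x := by
  have : VAddInvariantMeasure (AddSubgroup.zmultiples T) ℝ volume :=
    ⟨fun c s _ => measure_preimage_add _ _ _⟩
  refine (isAddFundamentalDomain_Ioc hT a).setLIntegral_eq (isAddFundamentalDomain_Ioc hT b) _ ?_
  rintro ⟨c, hc⟩ x
  obtain ⟨n, rfl⟩ := AddSubgroup.mem_zmultiples_iff.1 hc
  have := hg.zsmul n x
  rw [add_comm] at this
  simpa [AddSubgroup.vadd_def] using this

lemma Function.Periodic.setLIntegral_Ioc_add {g : ℝ → ENNReal} {T : ℝ} (hT : 0 < T)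
    (hg : Periodic g T) (a c : ℝ) :
    ∫⁻ x in Ioc a (a + T), g (x + c) = ∫⁻ x in Ioc a (a + T), g x := by
  rw [setLIntegral_Ioc_add_right, add_right_comm]
  exact hg.setLIntegral_Ioc_eq hT _ _

/-- A closed Jordan curve of length `2 * π` parametrized by arclength. -/
structure UnitCurve (w : ℝ → ℂ) : Prop where
  lip : LipschitzWith 1 w
  per : Periodic w (2 * π)
  inj : InjOn w (Ico 0 (2 * π))
  der : ∀ᵐ θ : ℝ, ∃ v : ℂ, HasDerivAt w v θ ∧ ‖v‖ = 1

/-- The Möbius energy of a closed curve of length `2 * π` parametrized by arclength. -/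
noncomputable def moebiusEnergy (w : ℝ → ℂ) : ENNReal :=
  ∫⁻ θ in Ioc 0 (2 * π), ∫⁻ L in Ioc (-π) π,
    ofReal (1 / ‖w (θ + L) - w θ‖ ^ 2 - 1 / L ^ 2)

lemma min_abs_eq_abs_toIocMod {x : ℝ} (hx : |x| < 2 * π) :
    min |x| (2 * π - |x|) = |toIocMod two_pi_pos (-π) x| := by
  have hp := pi_pos
  rcases abs_lt.1 hx with ⟨h1, h2⟩
  by_cases h3 : x ≤ -π
  · have : toIocMod two_pi_pos (-π) x = x + 2 * π := by
      rw [toIocMod_eq_iff]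
      exact ⟨⟨by linarith, by linarith⟩, -1, by simp⟩
    rw [this, abs_of_nonpos (by linarith : x ≤ 0), abs_of_nonneg (by linarith), min_eq_right] <;>
      linarith
  · by_cases h4 : x ≤ π
    · have : toIocMod two_pi_pos (-π) x = x := by
        rw [toIocMod_eq_self]; exact ⟨by linarith, by linarith⟩
      rw [this, min_eq_left]
      have := abs_le.2 ⟨(not_le.1 h3).le, h4⟩
      linarith
    · have : toIocMod two_pi_pos (-π) x = x - 2 * π := by
        rw [toIocMod_eq_iff]
        exact ⟨⟨by linarith, by linarith⟩, 1, by simp⟩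
      rw [this, abs_of_nonneg (by linarith : 0 ≤ x), abs_of_nonpos (by linarith), min_eq_right] <;>
        linarith

lemma lintegral_moebius_eq_moebiusEnergy {w : ℝ → ℂ} {c : ℝ} (hc : 0 < c)
    (hp : ∀ θ, w (θ + 2 * π) = w θ) :
    (∫⁻ θ in Ioc 0 (2 * π), ∫⁻ σ in Ioc 0 (2 * π),
      ofReal ((1 / ‖w θ - w σ‖ ^ 2 -
        1 / (c * min |θ - σ| (2 * π - |θ - σ|)) ^ 2) * c ^ 2)) =
      moebiusEnergy (fun θ => w θ / c) := by
  refine setLIntegral_congr_fun measurableSet_Ioc (fun θ hθ => ?_)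
  set g : ℝ → ENNReal := fun σ => ofReal (1 / ‖w σ / c - w θ / c‖ ^ 2 -
    1 / (toIocMod two_pi_pos (-π) (σ - θ)) ^ 2) with hg
  have hper : Periodic g (2 * π) := by
    intro σ
    simp only [hg, hp]
    rw [show σ + 2 * π - θ = σ - θ + 2 * π by ring, toIocMod_add_right]
  have h1 : ∀ σ ∈ Ioc 0 (2 * π), ofReal ((1 / ‖w θ - w σ‖ ^ 2 -
        1 / (c * min |θ - σ| (2 * π - |θ - σ|)) ^ 2) * c ^ 2) = g σ := by
    intro σ hσ
    have hx : |σ - θ| < 2 * π := by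
      rw [abs_lt]; constructor <;> linarith [hσ.1, hσ.2, hθ.1, hθ.2]
    rw [abs_sub_comm θ σ, min_abs_eq_abs_toIocMod hx, mul_pow, sq_abs]
    simp only [hg]
    congr 1
    rw [← sub_div, norm_div, norm_real, norm_eq_abs, abs_of_pos hc, norm_sub_rev (w σ)]
    rw [sub_mul]
    congr 1
    · field_simp
    · rw [one_div_mul_eq_div, div_mul_cancel_left₀ (by positivity), one_div]
  rw [setLIntegral_congr_fun measurableSet_Ioc h1]
  have h2 := hper.setLIntegral_Ioc_eq two_pi_pos 0 (-π + θ)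
  rw [zero_add, show -π + θ + 2 * π = π + θ by ring] at h2
  rw [h2, ← setLIntegral_Ioc_add_right]
  refine setLIntegral_congr_fun measurableSet_Ioc (fun L hL => ?_)
  simp only [hg]
  rw [add_sub_cancel_right, (toIocMod_eq_self two_pi_pos).2, add_comm]
  exact ⟨hL.1, by linarith [hL.2]⟩

namespace UnitCurve
variable {w : ℝ → ℂ} (hw : UnitCurve w)
include hw

lemma continuous : Continuous w := hw.lip.continuous

lemma norm_sub_le (s t : ℝ) : ‖w s - w t‖ ≤ |s - t| := by
  have := hw.lip.dist_le_mul s t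
  simpa [dist_eq_norm, dist_eq] using this

lemma hasDerivAt : ∀ᵐ θ : ℝ, HasDerivAt w (deriv w θ) θ ∧ ‖deriv w θ‖ = 1 := by
  filter_upwards [hw.der] with θ ⟨v, h1, h2⟩
  rw [h1.deriv]; exact ⟨h1, h2⟩

lemma norm_deriv_le (θ : ℝ) : ‖deriv w θ‖ ≤ 1 := by
  simpa using norm_deriv_le_of_lipschitz (x₀ := θ) hw.lip

lemma deriv_periodic : Periodic (deriv w) (2 * π) := by
  intro θ
  have : (fun x => w (x + 2 * π)) = w := funext hw.per
  rw [← deriv_comp_add_const, this]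

omit hw in
lemma measurable_deriv : Measurable (deriv w) := _root_.measurable_deriv w

lemma intervalIntegrable_deriv (a b : ℝ) : IntervalIntegrable (deriv w) volume a b :=
  (hw.lip.lipschitzOnWith.integral_eq_sub_of_ae_hasDerivAt (a := a) (b := b)
    (hw.hasDerivAt.mono fun _ h _ => h.1)).1

lemma integral_deriv (a b : ℝ) : ∫ x in a..b, deriv w x = w b - w a :=
  (hw.lip.lipschitzOnWith.integral_eq_sub_of_ae_hasDerivAt (a := a) (b := b)
    (hw.hasDerivAt.mono fun _ h _ => h.1)).2

lemma injective_Ico (a : ℝ) : InjOn w (Ico a (a + 2 * π)) := by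
  intro x hx y hy hxy
  have key : ∀ z, w (toIcoMod two_pi_pos 0 z) = w z := fun z => by
    rw [toIcoMod]
    simpa using hw.per.sub_zsmul_eq (x := z) (toIcoDiv two_pi_pos 0 z)
  have hm : ∀ z, toIcoMod two_pi_pos 0 z ∈ Ico 0 (2 * π) := fun z => by
    simpa using toIcoMod_mem_Ico two_pi_pos 0 z
  have h := hw.inj (hm x) (hm y) (by rw [key, key, hxy])
  rw [toIcoMod_eq_toIcoMod] at h
  obtain ⟨n, hn⟩ := h
  rcases hx with ⟨hx1, hx2⟩
  rcases hy with ⟨hy1, hy2⟩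
  rw [zsmul_eq_mul] at hn
  have h1 : (n : ℝ) < 1 := by
    by_contra hcon
    nlinarith [pi_pos]
  have h2 : (-1 : ℝ) < n := by
    by_contra hcon
    nlinarith [pi_pos]
  have : n = 0 := by
    have h1' : n < 1 := by exact_mod_cast h1
    have h2' : -1 < n := by exact_mod_cast h2
    omega
  simp [this] at hn
  linarith

end UnitCurve

lemma lintegral_lintegral_norm_sub_sq {k : ℝ → ℂ} (hk : Measurable k) (h1 : ∀ᵐ x, ‖k x‖ = 1)
    {a b : ℝ} (hab : a ≤ b) :
    ∫⁻ x in Ioc a b, ∫⁻ y in Ioc a b, ofReal (‖k x - k y‖ ^ 2) =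
      ofReal (2 * ((b - a) ^ 2 - ‖∫ x in a..b, k x‖ ^ 2)) := by
  have hki : ∀ a b : ℝ, IntegrableOn k (Ioc a b) := fun a b =>
    (integrableOn_const (C := (1 : ℝ)) (by simp)).mono' hk.aestronglyMeasurable
      (ae_restrict_of_ae (h1.mono fun x hx => by simp [hx]))
  set D := ∫ x in a..b, k x
  have hDi : D = ∫ x in Ioc a b, k x := intervalIntegral.integral_of_le hab
  have lin : ∀ c : ℂ, ∫ y in Ioc a b, (2 - 2 * (c * conj (k y)).re) =
      2 * (b - a) - 2 * (c * conj D).re ∧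
      IntegrableOn (fun y => 2 - 2 * (c * conj (k y)).re) (Ioc a b) := by
    intro c
    have i1 : IntegrableOn (fun y => c * conj (k y)) (Ioc a b) :=
      ((conjCLE.toContinuousLinearMap.integrable_comp (hki a b))).const_mul c
    have i2 : IntegrableOn (fun y => 2 * (c * conj (k y)).re) (Ioc a b) :=
      i1.re.const_mul 2
    have i3 : IntegrableOn (fun _ : ℝ => (2 : ℝ)) (Ioc a b) := integrableOn_const (by simp)
    refine ⟨?_, i3.sub i2⟩
    rw [integral_sub i3 i2, integral_const_mul]
    have : ∫ y in Ioc a b, (c * conj (k y)).re = (c * conj D).re := by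
      have := reCLM.integral_comp_comm i1
      simp only [Complex.reCLM_apply] at this
      rw [this, integral_const_mul, hDi, integral_conj]
    rw [this]
    simp [hab, mul_comm]
  have exp : ∀ c d : ℂ, ‖c‖ = 1 → ‖d‖ = 1 → ‖c - d‖ ^ 2 = 2 - 2 * (c * conj d).re := by
    intro c d hc hd
    rw [← normSq_eq_norm_sq, Complex.normSq_sub, normSq_eq_norm_sq,
      normSq_eq_norm_sq, hc, hd]
    norm_num
  have inner : ∀ x, ‖k x‖ = 1 → ∫⁻ y in Ioc a b, ofReal (‖k x - k y‖ ^ 2) =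
      ofReal (2 * (b - a) - 2 * (k x * conj D).re) := by
    intro x hx
    rw [← (lin (k x)).1, ofReal_integral_eq_lintegral_ofReal (lin (k x)).2]
    · refine lintegral_congr_ae (ae_restrict_of_ae ?_)
      filter_upwards [h1] with y hy
      rw [exp _ _ hx hy]
    · refine ae_restrict_of_ae ?_
      filter_upwards [h1] with y hy
      rw [← exp _ _ hx hy]; positivity
  rw [lintegral_congr_ae (ae_restrict_of_ae (h1.mono inner))]
  have hDn : ‖D‖ ≤ b - a := by
    rw [hDi]
    have := norm_setIntegral_le_of_norm_le_const_ae (μ := volume) (s := Ioc a b) (f := k) (C := 1)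
      (by simp) (ae_restrict_of_ae (h1.mono fun x hx => hx.le))
    simpa [hab] using this
  rw [← ofReal_integral_eq_lintegral_ofReal]
  · congr 1
    have e : ∀ x, 2 * (b - a) - 2 * (k x * conj D).re =
        (2 - 2 * (D * conj (k x)).re) + (2 * (b - a) - 2) := fun x => by
      simp only [Complex.mul_re, Complex.conj_re, Complex.conj_im]; ring
    simp_rw [e]
    rw [integral_add (lin D).2 (integrableOn_const (by simp)), (lin D).1, Complex.mul_conj,
      normSq_eq_norm_sq]
    simp [hab]
    norm_cast
    ring
  · have := (lin D).2.add (integrableOn_const (C := (2 * (b - a) - 2)) (by simp))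
    refine this.congr (Eventually.of_forall fun x => ?_)
    simp only [Pi.add_apply, Complex.mul_re, Complex.conj_re, Complex.conj_im]; ring
  · refine ae_restrict_of_ae ?_
    filter_upwards [h1] with x hx
    have : (k x * conj D).re ≤ ‖D‖ := by
      refine (re_le_norm _).trans ?_
      simp [hx]
    simp only [Pi.zero_apply]
    linarith

namespace UnitCurve
variable {w : ℝ → ℂ} (hw : UnitCurve w)
include hw

lemma lintegral_deriv_sub (s : ℝ) {L : ℝ} (hL : 0 ≤ L) :
    ∫⁻ x in Ioc s (s + L), ∫⁻ y in Ioc s (s + L),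
      ofReal (‖deriv w x - deriv w y‖ ^ 2) =
      ofReal (2 * (L ^ 2 - ‖w (s + L) - w s‖ ^ 2)) := by
  rw [lintegral_lintegral_norm_sub_sq (measurable_deriv) (hw.hasDerivAt.mono fun _ h => h.2)
    (by linarith), hw.integral_deriv]
  simp

omit hw in
/-- The mean square oscillation of the tangent at distance `h`. -/
noncomputable def rho (w : ℝ → ℂ) (h : ℝ) : ENNReal :=
  ∫⁻ s in Ioc 0 (2 * π), ofReal (‖deriv w (s + h) - deriv w s‖ ^ 2)

lemma lintegral_rho (L : ℝ) (hL : 0 ≤ L) :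
    ∫⁻ s in Ioc 0 (2 * π), ofReal (2 * (L ^ 2 - ‖w (s + L) - w s‖ ^ 2)) =
      ∫⁻ x in Ioc 0 L, ∫⁻ y in Ioc 0 L, rho w (y - x) := by
  calc _ = ∫⁻ s in Ioc 0 (2 * π), ∫⁻ x in Ioc 0 L, ∫⁻ y in Ioc 0 L,
        ofReal (‖deriv w (s + y) - deriv w (s + x)‖ ^ 2) := by
        refine lintegral_congr fun s => ?_
        rw [← hw.lintegral_deriv_sub s hL]
        have h1 := setLIntegral_Ioc_add_right (fun x => ∫⁻ y in Ioc s (s + L),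
          ofReal (‖deriv w x - deriv w y‖ ^ 2)) 0 L s
        rw [zero_add, add_comm L s] at h1
        rw [← h1]
        refine lintegral_congr fun x => ?_
        have h2 := setLIntegral_Ioc_add_right (fun y =>
          ofReal (‖deriv w (x + s) - deriv w y‖ ^ 2)) 0 L s
        rw [zero_add, add_comm L s] at h2
        rw [← h2]
        refine lintegral_congr fun y => ?_
        rw [norm_sub_rev, add_comm x s, add_comm y s]
    _ = ∫⁻ x in Ioc 0 L, ∫⁻ s in Ioc 0 (2 * π), ∫⁻ y in Ioc 0 L,
        ofReal (‖deriv w (s + y) - deriv w (s + x)‖ ^ 2) := by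
        refine lintegral_lintegral_swap (Measurable.aemeasurable ?_)
        refine Measurable.lintegral_prod_right' (f := fun p : (ℝ × ℝ) × ℝ =>
          ofReal (‖deriv w (p.1.1 + p.2) - deriv w (p.1.1 + p.1.2)‖ ^ 2)) ?_
        fun_prop
    _ = ∫⁻ x in Ioc 0 L, ∫⁻ y in Ioc 0 L, ∫⁻ s in Ioc 0 (2 * π),
        ofReal (‖deriv w (s + y) - deriv w (s + x)‖ ^ 2) := by
        refine lintegral_congr fun x => lintegral_lintegral_swap (Measurable.aemeasurable ?_)
        fun_prop
    _ = _ := by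
        refine lintegral_congr fun x => lintegral_congr fun y => ?_
        have hper : Periodic (fun s => ofReal
            (‖deriv w (s + (y - x)) - deriv w s‖ ^ 2)) (2 * π) := fun s => by
          simp only [hw.deriv_periodic s]
          rw [add_right_comm, hw.deriv_periodic]
        have := hper.setLIntegral_Ioc_add two_pi_pos 0 x
        rw [zero_add] at this
        rw [rho, ← this]
        refine lintegral_congr fun s => ?_
        rw [show s + x + (y - x) = s + y by ring]

omit hw in
lemma measurable_rho : Measurable (rho w) := by
  refine Measurable.lintegral_prod_right' (f := fun p : ℝ × ℝ =>
    ofReal (‖deriv w (p.2 + p.1) - deriv w p.2‖ ^ 2)) ?_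
  fun_prop

lemma rho_neg (h : ℝ) : rho w (-h) = rho w h := by
  have hper : Periodic (fun s => ofReal
      (‖deriv w (s + (-h)) - deriv w s‖ ^ 2)) (2 * π) := fun s => by
    simp only [hw.deriv_periodic s]
    rw [add_right_comm, hw.deriv_periodic]
  have := hper.setLIntegral_Ioc_add two_pi_pos 0 h
  rw [zero_add] at this
  rw [rho, ← this, rho]
  refine lintegral_congr fun s => ?_
  rw [add_neg_cancel_right, norm_sub_rev]

lemma le_lintegral_rho {L : ℝ} (hL : 0 ≤ L) :
    ofReal (L / 2) * ∫⁻ h in Ioc 0 (L / 2), rho w h ≤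
      ∫⁻ s in Ioc 0 (2 * π), ofReal (2 * (L ^ 2 - ‖w (s + L) - w s‖ ^ 2)) := by
  rw [hw.lintegral_rho L hL]
  have : ∀ x ∈ Ioc 0 (L / 2), ∫⁻ h in Ioc 0 (L / 2), rho w h ≤
      ∫⁻ y in Ioc 0 L, rho w (y - x) := by
    intro x hx
    have h1 := setLIntegral_Ioc_add_right (rho w) 0 L (-x)
    simp only [← sub_eq_add_neg] at h1
    rw [h1]
    refine lintegral_mono_set (Ioc_subset_Ioc ?_ ?_) <;> linarith [hx.1, hx.2]
  calc _ = ∫⁻ x in Ioc 0 (L / 2), ∫⁻ h in Ioc 0 (L / 2), rho w h := by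
        rw [setLIntegral_const, volume_Ioc, sub_zero, mul_comm]
    _ ≤ ∫⁻ x in Ioc 0 (L / 2), ∫⁻ y in Ioc 0 L, rho w (y - x) :=
        setLIntegral_mono' measurableSet_Ioc this
    _ ≤ _ := lintegral_mono_set (Ioc_subset_Ioc le_rfl (by linarith))

lemma lintegral_rho_le_moebiusEnergy :
    ∫⁻ h in Ioc 0 (π / 4), ofReal (1 / (128 * h ^ 2)) * rho w h ≤ moebiusEnergy w := by
  have hcont := hw.continuous
  have hpi := pi_pos
  have step1 : ∫⁻ L in Ioc 0 π, ofReal (1 / (4 * L ^ 3)) *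
      ∫⁻ h in Ioc 0 (L / 2), rho w h ≤ moebiusEnergy w := by
    calc _ ≤ ∫⁻ L in Ioc 0 π, ∫⁻ s in Ioc 0 (2 * π),
          ofReal (1 / ‖w (s + L) - w s‖ ^ 2 - 1 / L ^ 2) := by
          refine setLIntegral_mono' measurableSet_Ioc (fun L hL => ?_)
          have hL0 : 0 < L := hL.1
          have e : ofReal (1 / (4 * L ^ 3)) = ofReal (1 / (2 * L ^ 4)) *
              ofReal (L / 2) := by
            rw [← ofReal_mul (by positivity)]; congr 1; field_simp; norm_num
          rw [e, mul_assoc]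
          refine (mul_le_mul_right (hw.le_lintegral_rho hL0.le) _).trans ?_
          rw [← lintegral_ofReal_mul]
          refine lintegral_mono fun s => ?_
          dsimp only
          rw [← ofReal_mul (by positivity)]
          rcases eq_or_ne (‖w (s + L) - w s‖) 0 with h0 | h0
          · exfalso
            have h1 := hw.injective_Ico s (⟨le_rfl, by linarith⟩ : s ∈ Ico s (s + 2 * π))
              (⟨by linarith, by linarith [hL.2]⟩ : s + L ∈ Ico s (s + 2 * π))
              (sub_eq_zero.1 (norm_eq_zero.1 h0)).symm
            linarith
          · apply ofReal_le_ofReal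
            have hle : ‖w (s + L) - w s‖ ≤ L := by
              have := hw.norm_sub_le (s + L) s
              rwa [add_sub_cancel_left, abs_of_pos hL0] at this
            set n := ‖w (s + L) - w s‖
            have h2 : n ^ 2 ≤ L ^ 2 := by gcongr
            have e1 : 1 / (2 * L ^ 4) * (2 * (L ^ 2 - n ^ 2)) = (L ^ 2 - n ^ 2) / (L ^ 2 * L ^ 2) := by
              field_simp
            have e2 : 1 / n ^ 2 - 1 / L ^ 2 = (L ^ 2 - n ^ 2) / (n ^ 2 * L ^ 2) := by
              field_simp
            rw [e1, e2]
            gcongr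
      _ = ∫⁻ s in Ioc 0 (2 * π), ∫⁻ L in Ioc 0 π,
          ofReal (1 / ‖w (s + L) - w s‖ ^ 2 - 1 / L ^ 2) := by
          refine lintegral_lintegral_swap (Measurable.aemeasurable ?_)
          have : Measurable w := hcont.measurable
          fun_prop
      _ ≤ _ := by
          refine lintegral_mono fun s => lintegral_mono_set (Ioc_subset_Ioc ?_ le_rfl)
          linarith
  refine le_trans ?_ step1
  have hrm := measurable_rho (w := w)
  have meas : Measurable (uncurry fun h L : ℝ => (Ioc (2 * h) (4 * h)).indicator
      (fun L => ofReal (1 / (4 * L ^ 3)) * rho w h) L) := by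
    have : (uncurry fun h L : ℝ => (Ioc (2 * h) (4 * h)).indicator
      (fun L => ofReal (1 / (4 * L ^ 3)) * rho w h) L) =
      ({p : ℝ × ℝ | 2 * p.1 < p.2} ∩ {p : ℝ × ℝ | p.2 ≤ 4 * p.1}).indicator
        (fun p => ofReal (1 / (4 * p.2 ^ 3)) * rho w p.1) := by
      ext p; simp [uncurry, indicator]
    rw [this]
    refine Measurable.indicator (by fun_prop) ?_
    exact (measurableSet_lt (by fun_prop) (by fun_prop)).inter
      (measurableSet_le (by fun_prop) (by fun_prop))
  calc _ ≤ ∫⁻ h in Ioc 0 (π / 4), ∫⁻ L in Ioc 0 π, (Ioc (2 * h) (4 * h)).indicator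
          (fun L => ofReal (1 / (4 * L ^ 3)) * rho w h) L := by
        refine setLIntegral_mono' measurableSet_Ioc (fun h hh => ?_)
        have hh0 : 0 < h := hh.1
        rw [lintegral_indicator measurableSet_Ioc, Measure.restrict_restrict measurableSet_Ioc,
          inter_eq_left.2 (Ioc_subset_Ioc (by linarith) (by linarith [hh.2])),
          lintegral_mul_const _ (by fun_prop)]
        gcongr
        have : ∫⁻ L in Ioc (2 * h) (4 * h), ofReal (1 / (4 * (4 * h) ^ 3)) ≤
            ∫⁻ L in Ioc (2 * h) (4 * h), ofReal (1 / (4 * L ^ 3)) := by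
          refine setLIntegral_mono' measurableSet_Ioc (fun L hL => ofReal_le_ofReal ?_)
          have : 0 < L := by linarith [hL.1]
          have := hL.2
          gcongr
        refine le_trans (le_of_eq ?_) this
        rw [setLIntegral_const, volume_Ioc, ← ofReal_mul (by positivity)]
        congr 1
        field_simp
        norm_num
    _ = ∫⁻ L in Ioc 0 π, ∫⁻ h in Ioc 0 (π / 4), (Ioc (2 * h) (4 * h)).indicator
          (fun L => ofReal (1 / (4 * L ^ 3)) * rho w h) L :=
        lintegral_lintegral_swap meas.aemeasurable
    _ ≤ _ := by
        refine lintegral_mono fun L => ?_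
        rw [← lintegral_ofReal_mul,
          ← lintegral_indicator measurableSet_Ioc, ← lintegral_indicator measurableSet_Ioc]
        refine lintegral_mono fun h => ?_
        simp only [indicator]
        split_ifs with h1 h2 h3 <;> first | exact le_rfl | exact zero_le | skip
        exact absurd ⟨h1.1, by linarith [h2.1]⟩ h3

omit hw in
/-- The local tangent energy at parameter `v`. -/
noncomputable def tanEnergy (w : ℝ → ℂ) (v : ℝ) : ENNReal :=
  ∫⁻ u in Ioc (-π) π, ofReal (‖deriv w (v + u) - deriv w v‖ ^ 2 / u ^ 2)

lemma tanEnergy_periodic : Periodic (tanEnergy w) (2 * π) := by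
  intro v
  simp only [tanEnergy, hw.deriv_periodic v]
  refine lintegral_congr fun u => ?_
  rw [add_right_comm, hw.deriv_periodic]

lemma rho_le (h : ℝ) : rho w h ≤ ofReal (8 * π) := by
  calc rho w h ≤ ∫⁻ s in Ioc 0 (2 * π), ofReal 4 := by
        refine lintegral_mono fun s => ofReal_le_ofReal ?_
        have h1 := (_root_.norm_sub_le (deriv w (s + h)) (deriv w s)).trans
          (add_le_add (hw.norm_deriv_le _) (hw.norm_deriv_le _))
        nlinarith [norm_nonneg (deriv w (s + h) - deriv w s)]
    _ = _ := by
        rw [setLIntegral_const, volume_Ioc, ← ofReal_mul (by norm_num)]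
        congr 1; ring

lemma lintegral_tanEnergy_lt_top (hE : moebiusEnergy w < ⊤) :
    ∫⁻ v in Ioc 0 (2 * π), tanEnergy w v < ⊤ := by
  have hpi := pi_pos
  have e1 : ∫⁻ v in Ioc 0 (2 * π), tanEnergy w v =
      ∫⁻ u in Ioc (-π) π, ofReal (1 / u ^ 2) * rho w u := by
    simp only [tanEnergy]
    rw [lintegral_lintegral_swap (Measurable.aemeasurable (by fun_prop))]
    refine lintegral_congr fun u => ?_
    rw [rho, ← lintegral_ofReal_mul]
    refine lintegral_congr fun s => ?_
    rw [← ofReal_mul (by positivity)]; congr 1; ring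
  have small : ∫⁻ u in Ioc 0 (π / 4), ofReal (1 / u ^ 2) * rho w u < ⊤ := by
    have h1 : ∀ u ∈ Ioc 0 (π / 4), ofReal (1 / u ^ 2) * rho w u =
        ofReal 128 * (ofReal (1 / (128 * u ^ 2)) * rho w u) := by
      intro u hu
      have := hu.1
      rw [← mul_assoc, ← ofReal_mul (by norm_num)]
      congr 2; field_simp
    rw [setLIntegral_congr_fun measurableSet_Ioc h1, lintegral_ofReal_mul]
    exact mul_lt_top ofReal_lt_top (hw.lintegral_rho_le_moebiusEnergy.trans_lt hE)
  have big : ∫⁻ u in Ioc (π / 4) π, ofReal (1 / u ^ 2) * rho w u < ⊤ := by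
    calc _ ≤ ∫⁻ u in Ioc (π / 4) π, ofReal (1 / (π / 4) ^ 2) * ofReal (8 * π) := by
          refine setLIntegral_mono' measurableSet_Ioc (fun u hu => ?_)
          have := hu.1
          gcongr
          exact hw.rho_le u
      _ < ⊤ := by
          rw [setLIntegral_const, volume_Ioc]
          exact mul_lt_top (mul_lt_top ofReal_lt_top ofReal_lt_top)
            ofReal_lt_top
  have pos : ∫⁻ u in Ioc 0 π, ofReal (1 / u ^ 2) * rho w u < ⊤ := by
    rw [← Ioc_union_Ioc_eq_Ioc (by linarith : (0 : ℝ) ≤ π / 4) (by linarith : π / 4 ≤ π)]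
    exact (lintegral_union_le _ _ _).trans_lt (ENNReal.add_lt_top.2 ⟨small, big⟩)
  have neg : ∫⁻ u in Ioc (-π) 0, ofReal (1 / u ^ 2) * rho w u < ⊤ := by
    have : ∫⁻ u in Ioc (-π) 0, ofReal (1 / u ^ 2) * rho w u =
        ∫⁻ u in Ico 0 π, ofReal (1 / u ^ 2) * rho w u := by
      rw [← lintegral_indicator measurableSet_Ioc, ← lintegral_indicator measurableSet_Ico,
        ← lintegral_neg_eq_self]
      refine lintegral_congr fun u => ?_
      simp only [indicator, mem_Ioc, mem_Ico, hw.rho_neg, neg_sq]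
      congr 1
      apply propext; constructor <;> rintro ⟨h1, h2⟩ <;> constructor <;> linarith
    rw [this, restrict_Ico_eq_restrict_Ioc]
    exact pos
  rw [e1, ← Ioc_union_Ioc_eq_Ioc (by linarith : -π ≤ 0) hpi.le]
  exact (lintegral_union_le _ _ _).trans_lt (ENNReal.add_lt_top.2 ⟨neg, pos⟩)

lemma exists_forall_lintegral_tanEnergy_lt (hE : moebiusEnergy w < ⊤) {ε : ENNReal} (hε : 0 < ε) :
    ∃ δ > 0, δ ≤ π ∧ ∀ s, ∫⁻ v in Ioc (s - δ) (s + δ), tanEnergy w v < ε := by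
  obtain ⟨δ, hδ, h⟩ := exists_pos_setLIntegral_lt_of_measure_lt
    (μ := volume.restrict (Ioc 0 (2 * π))) (f := tanEnergy w)
    (hw.lintegral_tanEnergy_lt_top hE).ne hε.ne'
  obtain ⟨η, hη0, hη⟩ : ∃ η : ℝ, 0 < η ∧ ofReal (2 * η) < δ := by
    rcases eq_or_ne δ ⊤ with rfl | ht
    · exact ⟨1, one_pos, ofReal_lt_top⟩
    · refine ⟨δ.toReal / 4, by have := ENNReal.toReal_pos hδ.ne' ht; positivity, ?_⟩
      rw [ENNReal.ofReal_lt_iff_lt_toReal _ ht] <;> have := ENNReal.toReal_pos hδ.ne' ht <;> linarith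
  refine ⟨min η π, lt_min hη0 pi_pos, min_le_right _ _, fun s => ?_⟩
  have hp := hw.tanEnergy_periodic
  set d := min η π
  have hdη : d ≤ η := min_le_left _ _
  have hdπ : d ≤ π := min_le_right _ _
  set S := Ioc (s - d) (s + d)
  have hper : Periodic (fun v => (S.indicator 1 (toIocMod two_pi_pos (s - d) v)) *
      tanEnergy w v) (2 * π) := by
    intro v; simp only [toIocMod_add_right, hp v]
  have h1 := hper.setLIntegral_Ioc_eq two_pi_pos (s - d) 0
  have hsub : S ⊆ Ioc (s - d) (s - d + 2 * π) := Ioc_subset_Ioc le_rfl (by linarith)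
  have e1 : ∫⁻ v in S, tanEnergy w v = ∫⁻ v in Ioc (s - d) (s - d + 2 * π),
      (S.indicator 1 (toIocMod two_pi_pos (s - d) v)) * tanEnergy w v := by
    have : ∀ v ∈ Ioc (s - d) (s - d + 2 * π), (S.indicator 1 (toIocMod two_pi_pos (s - d) v)) *
        tanEnergy w v = S.indicator (tanEnergy w) v := by
      intro v hv
      rw [(toIocMod_eq_self two_pi_pos).2 hv]
      by_cases hvI : v ∈ S <;> simp [hvI]
    rw [setLIntegral_congr_fun measurableSet_Ioc this, lintegral_indicator measurableSet_Ioc,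
      Measure.restrict_restrict measurableSet_Ioc, inter_eq_left.2 hsub]
  set J := {v | toIocMod two_pi_pos (s - d) v ∈ S} with hJ
  have hmJ : Measurable (toIocMod two_pi_pos (s - d)) := by
    have : toIocMod two_pi_pos (s - d) = fun v => v - (toIocDiv two_pi_pos (s - d) v : ℝ) * (2 * π) := by
      ext v; rw [toIocMod, zsmul_eq_mul]
    rw [this]
    simp only [toIocDiv_eq_neg_floor]
    fun_prop
  have hJm : MeasurableSet J := hmJ measurableSet_Ioc
  have e2 : ∀ μ : Measure ℝ, ∫⁻ v, (S.indicator 1 (toIocMod two_pi_pos (s - d) v)) * tanEnergy w v ∂μ =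
      ∫⁻ v in J, tanEnergy w v ∂μ := by
    intro μ
    rw [← lintegral_indicator hJm]
    refine lintegral_congr fun v => ?_
    simp only [indicator, hJ, mem_ofPred_eq]
    split_ifs <;> simp
  rw [e1, h1, e2, zero_add]
  refine h J ?_
  have hper2 : Periodic (fun v => (S.indicator (1 : ℝ → ENNReal)
      (toIocMod two_pi_pos (s - d) v))) (2 * π) := by
    intro v; simp only [toIocMod_add_right]
  have h3 := hper2.setLIntegral_Ioc_eq two_pi_pos (s - d) 0
  have e3 : ∫⁻ v in Ioc 0 (2 * π), (S.indicator (1 : ℝ → ENNReal)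
      (toIocMod two_pi_pos (s - d) v)) = volume.restrict (Ioc 0 (2 * π)) J := by
    rw [← lintegral_indicator_one hJm]
    rfl
  have e4 : ∫⁻ v in Ioc (s - d) (s - d + 2 * π), (S.indicator (1 : ℝ → ENNReal)
      (toIocMod two_pi_pos (s - d) v)) = volume S := by
    have : ∀ v ∈ Ioc (s - d) (s - d + 2 * π), (S.indicator (1 : ℝ → ENNReal)
        (toIocMod two_pi_pos (s - d) v)) = S.indicator 1 v := by
      intro v hv
      rw [(toIocMod_eq_self two_pi_pos).2 hv]
    rw [setLIntegral_congr_fun measurableSet_Ioc this, lintegral_indicator_one measurableSet_Ioc,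
      Measure.restrict_apply measurableSet_Ioc, inter_eq_left.2 hsub]
  rw [zero_add, e3, e4] at h3
  rw [← h3, volume_Ioc]
  refine lt_of_le_of_lt (ofReal_le_ofReal ?_) hη
  linarith

end UnitCurve

namespace UnitCurve
variable {w : ℝ → ℂ} (hw : UnitCurve w)
include hw

lemma ofReal_sq_sub_chord_sq_le (s : ℝ) {L : ℝ} (hL : 0 ≤ L) (hLπ : L ≤ π) :
    ofReal (2 * (L ^ 2 - ‖w (s + L) - w s‖ ^ 2)) ≤
      ofReal (L ^ 2) * ∫⁻ v in Ioc s (s + L), tanEnergy w v := by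
  rw [← hw.lintegral_deriv_sub s hL, ← lintegral_ofReal_mul]
  refine setLIntegral_mono' measurableSet_Ioc (fun x hx => ?_)
  rw [tanEnergy, ← lintegral_ofReal_mul]
  have h1 := setLIntegral_Ioc_add_right (fun y =>
    ofReal (‖deriv w x - deriv w y‖ ^ 2)) (s - x) (s + L - x) x
  rw [sub_add_cancel, sub_add_cancel] at h1
  rw [← h1]
  calc _ ≤ ∫⁻ u in Ioc (s - x) (s + L - x), ofReal (L ^ 2) *
        ofReal (‖deriv w (x + u) - deriv w x‖ ^ 2 / u ^ 2) := by
        refine setLIntegral_mono' measurableSet_Ioc (fun u hu => ?_)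
        rw [← ofReal_mul (by positivity)]
        apply ofReal_le_ofReal
        rw [norm_sub_rev, add_comm u x]
        rcases eq_or_ne u 0 with rfl | hu0
        · simp
        · rw [mul_div_assoc', le_div_iff₀ (by positivity), mul_comm]
          have : u ^ 2 ≤ L ^ 2 := by
            rw [sq_le_sq, abs_of_nonneg hL, abs_le]
            constructor <;> linarith [hu.1, hu.2, hx.1, hx.2]
          gcongr
    _ ≤ _ := lintegral_mono_set (Ioc_subset_Ioc (by linarith [hx.2]) (by linarith [hx.1]))

lemma exists_local_chord_arc (hE : moebiusEnergy w < ⊤) :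
    ∃ δ > 0, δ ≤ π ∧ ∀ s L, 0 ≤ L → L ≤ δ → L / 2 ≤ ‖w (s + L) - w s‖ := by
  obtain ⟨δ, hδ, hδπ, h⟩ := hw.exists_forall_lintegral_tanEnergy_lt hE one_pos
  refine ⟨δ, hδ, hδπ, fun s L hL hLδ => ?_⟩
  have h1 := hw.ofReal_sq_sub_chord_sq_le s hL (hLδ.trans hδπ)
  have h2 : ∫⁻ v in Ioc s (s + L), tanEnergy w v ≤ 1 :=
    (lintegral_mono_set (Ioc_subset_Ioc (by linarith) (by linarith))).trans (h s).le
  have h3 : ofReal (2 * (L ^ 2 - ‖w (s + L) - w s‖ ^ 2)) ≤ ofReal (L ^ 2) :=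
    h1.trans ((mul_le_mul_right h2 _).trans_eq (mul_one _))
  rw [ofReal_le_ofReal_iff (by positivity)] at h3
  refine abs_le_of_sq_le_sq' ?_ (norm_nonneg _) |>.2
  nlinarith

lemma exists_chord_arc (hE : moebiusEnergy w < ⊤) :
    ∃ κ > 0, κ ≤ 1 ∧ ∀ s L, |L| ≤ π → κ * |L| ≤ ‖w (s + L) - w s‖ := by
  obtain ⟨δ, hδ, hδπ, h⟩ := hw.exists_local_chord_arc hE
  have hc := hw.continuous
  obtain ⟨⟨s0, L0⟩, hm0, hmin⟩ := (isCompact_Icc (a := (0 : ℝ)) (b := 2 * π)).prod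
    (isCompact_Icc (a := δ) (b := π)) |>.exists_isMinOn
    (f := fun p : ℝ × ℝ => ‖w (p.1 + p.2) - w p.1‖)
    (⟨(0, π), ⟨by simp; positivity, by simp [hδπ]⟩⟩) (by fun_prop)
  set m := ‖w (s0 + L0) - w s0‖ with hm
  have hmpos : 0 < m := by
    rw [hm, norm_pos_iff, sub_ne_zero]
    intro he
    have := hw.injective_Ico s0 (⟨by linarith [hm0.2.1], by linarith [hm0.2.2]⟩ :
      s0 + L0 ∈ Ico s0 (s0 + 2 * π)) (⟨le_rfl, by linarith⟩ : s0 ∈ Ico s0 (s0 + 2 * π)) he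
    linarith [hm0.2.1]
  have hbig : ∀ s L, δ ≤ L → L ≤ π → m ≤ ‖w (s + L) - w s‖ := by
    intro s L h1 h2
    have key : w (toIcoMod two_pi_pos 0 s) = w s ∧ w (toIcoMod two_pi_pos 0 s + L) = w (s + L) := by
      rw [toIcoMod, sub_add_eq_add_sub]
      exact ⟨hw.per.sub_zsmul_eq _, hw.per.sub_zsmul_eq _⟩
    rw [← key.1, ← key.2]
    have hmem := toIcoMod_mem_Ico two_pi_pos 0 s
    rw [zero_add] at hmem
    exact hmin (show (toIcoMod two_pi_pos 0 s, L) ∈ _ from ⟨⟨hmem.1, hmem.2.le⟩, ⟨h1, h2⟩⟩)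
  have hpos : ∀ s L, 0 ≤ L → L ≤ π → min (1 / 2) (m / π) * L ≤ ‖w (s + L) - w s‖ := by
    intro s L h1 h2
    rcases le_total L δ with h3 | h3
    · refine le_trans ?_ (h s L h1 h3)
      have := min_le_left (1 / 2) (m / π)
      nlinarith
    · refine le_trans ?_ (hbig s L h3 h2)
      calc _ ≤ m / π * π := by
            have := min_le_right (1 / 2) (m / π); gcongr
        _ = m := by field_simp
  refine ⟨min (1 / 2) (m / π), by positivity, (min_le_left _ _).trans (by norm_num), ?_⟩
  intro s L hL
  rcases le_total 0 L with h0 | h0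
  · rw [abs_of_nonneg h0] at hL ⊢; exact hpos s L h0 hL
  · rw [abs_of_nonpos h0] at hL ⊢
    have := hpos (s + L) (-L) (by linarith) hL
    rwa [add_neg_cancel_right, norm_sub_rev] at this

end UnitCurve

theorem integral_primitive_div_cube_le {G : ℝ → ℝ} (hG : ∀ u, 0 ≤ G u)
    (hi : ∀ a b, IntervalIntegrable G volume a b) {d : ℝ} (hd : 0 < d) {T : ℝ} (hT : 0 ≤ T) :
    ∫ u in 0..T, (∫ s in 0..u, G s) / (d + u) ^ 3 ≤ 1 / 2 * ∫ u in 0..T, G u / (d + u) ^ 2 := by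
  have hA : AbsolutelyContinuousOnInterval (fun u => ∫ s in 0..u, G s) 0 T :=
    (hi 0 T).absolutelyContinuousOnInterval_intervalIntegral left_mem_uIcc
  have hsub : ∀ u ∈ uIcc 0 T, 0 < d + u := by
    intro u hu
    rw [uIcc_of_le hT] at hu
    linarith [hu.1]
  have hBd : ∀ u, 0 < d + u →
      HasDerivAt (fun u => -(1 / 2) * (d + u) ^ (-2 : ℤ)) ((d + u) ^ (-3 : ℤ)) u := by
    intro u hu
    have h1 : HasDerivAt (fun u => d + u) 1 u := (hasDerivAt_id u).const_add d
    have h2 := ((hasDerivAt_zpow (-2) (d + u) (Or.inl hu.ne')).comp u h1).const_mul (-(1 / 2))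
    refine h2.congr_deriv ?_
    norm_num
    ring
  have hB : ContDiffOn ℝ 1 (fun u => -(1 / 2) * (d + u) ^ (-2 : ℤ)) (uIcc 0 T) := by
    have h : ContDiffOn ℝ 1 (fun u => -(1 / 2) * ((d + u) ^ 2)⁻¹) (uIcc 0 T) := by
      refine contDiffOn_const.mul (ContDiffOn.inv ?_ ?_)
      · fun_prop
      · intro u hu
        have := hsub u hu
        positivity
    refine h.congr fun u _ => ?_
    norm_cast
  have key := hA.integral_mul_deriv_eq_deriv_mul hB.absolutelyContinuousOnInterval
  have e1 : ∫ u in 0..T, (∫ s in 0..u, G s) * deriv (fun u => -(1 / 2) * (d + u) ^ (-2 : ℤ)) u =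
      ∫ u in 0..T, (∫ s in 0..u, G s) / (d + u) ^ 3 := by
    refine intervalIntegral.integral_congr fun u hu => ?_
    rw [(hBd u (hsub u hu)).deriv, div_eq_mul_inv]
    norm_cast
  have e2 : ∫ u in 0..T, deriv (fun u => ∫ s in 0..u, G s) u * (-(1 / 2) * (d + u) ^ (-2 : ℤ)) =
      -(1 / 2) * ∫ u in 0..T, G u / (d + u) ^ 2 := by
    rw [← intervalIntegral.integral_const_mul]
    refine intervalIntegral.integral_congr_ae ?_
    filter_upwards [(hi 0 T).ae_hasDerivAt_integral] with u hu hmem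
    rw [(hu (uIoc_subset_uIcc hmem) 0 left_mem_uIcc).deriv]
    have : (d + u) ^ (-2 : ℤ) = ((d + u) ^ 2)⁻¹ := by norm_cast
    rw [this]
    ring
  rw [e1, e2] at key
  rw [key]
  have h0 : 0 ≤ ∫ s in 0..T, G s := intervalIntegral.integral_nonneg hT fun u _ => hG u
  have h1 : 0 ≤ (d + T) ^ (-2 : ℤ) := by positivity
  simp only [intervalIntegral.integral_same]
  nlinarith [mul_nonneg h0 h1]

theorem intervalIntegral_neg_self_eq_add {E : Type*} [NormedAddCommGroup E] [NormedSpace ℝ E]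
    {f : ℝ → E} {T : ℝ} (hf : IntervalIntegrable f volume (-T) T) (hT : 0 ≤ T) :
    ∫ u in -T..T, f u = (∫ u in 0..T, f (-u)) + ∫ u in 0..T, f u := by
  have h0 : (0 : ℝ) ∈ uIcc (-T) T := by
    rw [uIcc_of_le (by linarith)]
    exact ⟨by linarith, hT⟩
  rw [← intervalIntegral.integral_add_adjacent_intervals (b := 0)
    (hf.mono_set (uIcc_subset_uIcc_left h0)) (hf.mono_set (uIcc_subset_uIcc_right h0))]
  simp [intervalIntegral.integral_comp_neg]

theorem integral_abs_primitive_div_cube_le {G : ℝ → ℝ} (hG : ∀ u, 0 ≤ G u)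
    (hi : ∀ a b, IntervalIntegrable G volume a b) {d : ℝ} (hd : 0 < d) {T : ℝ} (hT : 0 ≤ T) :
    ∫ u in -T..T, |∫ s in 0..u, G s| / (d + |u|) ^ 3
      ≤ 1 / 2 * ∫ u in -T..T, G u / (d + |u|) ^ 2 := by
  have hpos : ∀ u : ℝ, d + |u| ≠ 0 := fun u => by positivity
  have hc : ∀ n : ℕ, Continuous fun u : ℝ => ((d + |u|) ^ n)⁻¹ := fun n =>
    Continuous.inv₀ (by fun_prop) fun u => pow_ne_zero _ (hpos u)
  have hP : Continuous fun u => ∫ s in 0..u, G s :=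
    intervalIntegral.continuous_primitive hi 0
  have hi' : ∀ a b, IntervalIntegrable (fun u => G (-u)) volume a b := fun a b => by
    have := (hi (-a) (-b)).comp_sub_left 0
    simpa using this
  have i1 : IntervalIntegrable (fun u => |∫ s in 0..u, G s| / (d + |u|) ^ 3) volume (-T) T := by
    simp_rw [div_eq_mul_inv]
    exact (hP.abs.mul (hc 3)).intervalIntegrable _ _
  have i2 : IntervalIntegrable (fun u => G u / (d + |u|) ^ 2) volume (-T) T := by
    simp_rw [div_eq_mul_inv]
    exact (hi _ _).mul_continuousOn (hc 2).continuousOn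
  rw [intervalIntegral_neg_self_eq_add i1 hT, intervalIntegral_neg_self_eq_add i2 hT]
  have a1 := integral_primitive_div_cube_le hG hi hd hT
  have a2 := integral_primitive_div_cube_le (fun u => hG (-u)) hi' hd hT
  have c1 : ∫ u in 0..T, |∫ s in 0..u, G s| / (d + |u|) ^ 3 =
      ∫ u in 0..T, (∫ s in 0..u, G s) / (d + u) ^ 3 := by
    refine intervalIntegral.integral_congr fun u hu => ?_
    rw [uIcc_of_le hT] at hu
    simp only [abs_of_nonneg hu.1]
    rw [abs_of_nonneg (intervalIntegral.integral_nonneg hu.1 fun u _ => hG u)]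
  have c2 : ∫ u in 0..T, |∫ s in 0..(-u), G s| / (d + |-u|) ^ 3 =
      ∫ u in 0..T, (∫ s in 0..u, G (-s)) / (d + u) ^ 3 := by
    refine intervalIntegral.integral_congr fun u hu => ?_
    rw [uIcc_of_le hT] at hu
    simp only [abs_neg, abs_of_nonneg hu.1]
    rw [intervalIntegral.integral_comp_neg (fun s => G s), neg_zero,
      intervalIntegral.integral_symm, abs_neg, abs_of_nonneg
        (intervalIntegral.integral_nonneg (by linarith [hu.1]) fun u _ => hG u)]
  have c3 : ∫ u in 0..T, G u / (d + |u|) ^ 2 = ∫ u in 0..T, G u / (d + u) ^ 2 := by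
    refine intervalIntegral.integral_congr fun u hu => ?_
    rw [uIcc_of_le hT] at hu
    simp only [abs_of_nonneg hu.1]
  have c4 : ∫ u in 0..T, G (-u) / (d + |-u|) ^ 2 = ∫ u in 0..T, G (-u) / (d + u) ^ 2 := by
    refine intervalIntegral.integral_congr fun u hu => ?_
    rw [uIcc_of_le hT] at hu
    simp only [abs_neg, abs_of_nonneg hu.1]
  rw [c1, c2, c3, c4]
  linarith

theorem integral_one_div_add_abs_sq {d : ℝ} (hd : 0 < d) {T : ℝ} (hT : 0 ≤ T) :
    ∫ u in -T..T, 1 / (d + |u|) ^ 2 = 2 * (1 / d - 1 / (d + T)) := by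
  have hpos : ∀ u : ℝ, d + |u| ≠ 0 := fun u => by positivity
  have hc : Continuous fun u : ℝ => 1 / (d + |u|) ^ 2 :=
    continuous_const.div (by fun_prop) fun u => pow_ne_zero _ (hpos u)
  rw [intervalIntegral_neg_self_eq_add (hc.intervalIntegrable _ _) hT]
  have h : ∫ u in 0..T, 1 / (d + |u|) ^ 2 = 1 / d - 1 / (d + T) := by
    have hsub : ∀ u ∈ uIcc 0 T, 0 < d + u := by
      intro u hu
      rw [uIcc_of_le hT] at hu
      linarith [hu.1]
    rw [intervalIntegral.integral_eq_sub_of_hasDerivAt (f := fun u => -(d + u)⁻¹)]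
    · simp; ring
    · intro u hu
      have h1 : HasDerivAt (fun u => d + u) 1 u := (hasDerivAt_id u).const_add d
      refine (h1.inv (hsub u hu).ne').neg.congr_deriv ?_
      rw [uIcc_of_le hT] at hu
      rw [abs_of_nonneg hu.1]
      ring
    · exact hc.intervalIntegrable _ _
  simp_rw [abs_neg, h]
  ring

/-- The integrals `∫ conj k / ((w - p)^i conj (w - p)^j)` over one period. -/
noncomputable def conjCauchy (w : ℝ → ℂ) (i j : ℕ) (p : ℂ) : ℂ :=
  ∫ u in (-π)..π, conj (deriv w u) / ((w u - p) ^ i * conj (w u - p) ^ j)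

/-- `2πi` times the index of `w` around `p`. -/
noncomputable def cauchyIndex (w : ℝ → ℂ) (p : ℂ) : ℂ :=
  ∫ u in (-π)..π, deriv w u / (w u - p)

/-- Near `w 0` the curve `w` is close to the line through `w 0` of direction `e`, at the scale of the
point `p` whose nearest point on the curve is `w 0`. -/
structure LocallyFlat (w : ℝ → ℂ) (κ d b : ℝ) (p e : ℂ) : Prop where
  curve : UnitCurve w
  kpos : 0 < κ
  kle : κ ≤ 1
  dpos : 0 < d
  dle : d ≤ 1 / 2
  norm_sub_zero : ‖p - w 0‖ = d
  nearest : ∀ u, d ≤ ‖w u - p‖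
  chord_arc : ∀ u, |u| ≤ π → κ * |u| ≤ ‖w u - w 0‖
  norm_e : ‖e‖ = 1
  flat : ∫ u in (-π)..π, ‖deriv w u - e‖ / (d + |u|) ^ 2 ≤ b / d
  small : 8 * b ≤ (κ / 6) ^ 4

theorem div_sub_div_eq_of_eq_mul_add {A A' Q N N' k k' η : ℂ} (hA : A ≠ 0) (hA' : A' ≠ 0)
    (hQ : Q ≠ 0) (h1 : A' = η * Q + N) (h2 : k' = η * k + N') (i : ℕ) :
    k' / (A ^ (i + 1) * A' ^ 1) - k / (A ^ (i + 1) * Q) =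
      1 / A ^ i * (N' / (A * A') - k * N / (A * A' * Q)) := by
  obtain rfl : N = A' - η * Q := by rw [h1]; ring
  subst h2
  field_simp
  ring

namespace LocallyFlat

variable {w : ℝ → ℂ} {κ d b : ℝ} {p e : ℂ} (h : LocallyFlat w κ d b p e)

include h

theorem intervalIntegrable_norm (x y : ℝ) :
    IntervalIntegrable (fun u => ‖deriv w u - e‖) volume x y :=
  ((h.curve.intervalIntegrable_deriv x y).sub intervalIntegrable_const).norm

theorem add_abs_pos (u : ℝ) : 0 < d + |u| := by
  have := h.dpos
  positivity

theorem continuous_weight (n : ℕ) :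
    Continuous fun u : ℝ => ((d + |u|) ^ n)⁻¹ :=
  Continuous.inv₀ (by fun_prop) fun u => pow_ne_zero _ (h.add_abs_pos u).ne'

theorem intervalIntegrable_weight (x y : ℝ) :
    IntervalIntegrable (fun u => ‖deriv w u - e‖ / (d + |u|) ^ 2) volume x y := by
  simp_rw [div_eq_mul_inv]
  exact (h.intervalIntegrable_norm x y).mul_continuousOn (h.continuous_weight 2).continuousOn

theorem b_nonneg : 0 ≤ b := by
  have h1 : 0 ≤ ∫ u in (-π)..π, ‖deriv w u - e‖ / (d + |u|) ^ 2 :=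
    intervalIntegral.integral_nonneg (by linarith [pi_pos]) fun u _ => by positivity
  have h2 := h1.trans h.flat
  rcases lt_or_ge b 0 with hb | hb
  · exact absurd h2 (not_le.2 (div_neg_of_neg_of_pos hb h.dpos))
  · exact hb

theorem b_le : b ≤ κ ^ 2 / 36 / 8 := by
  have h0 := h.kpos
  have h1 := h.small
  have h2 : (κ / 6) ^ 4 ≤ (κ / 6) ^ 2 :=
    pow_le_pow_of_le_one (by positivity) (by linarith [h.kle]) (by norm_num)
  nlinarith

theorem abs_integral_le {u : ℝ} (hu : |u| ≤ π) :
    |∫ s in 0..u, ‖deriv w s - e‖| ≤ b * (d + |u|) ^ 2 / d := by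
  have hd := h.dpos
  obtain ⟨hu1, hu2⟩ := abs_le.1 hu
  have hsub : uIoc 0 u ⊆ Ioc (-π) π := by
    intro s hs
    rcases le_total 0 u with h0 | h0
    · rw [uIoc_of_le h0] at hs
      exact ⟨by linarith [hs.1, pi_pos], hs.2.trans hu2⟩
    · rw [uIoc_of_ge h0] at hs
      exact ⟨by linarith [hs.1], by linarith [hs.2, pi_pos]⟩
  have hle : -π ≤ π := by linarith [pi_pos]
  have hI := (intervalIntegrable_iff_integrableOn_Ioc_of_le hle).1
    (h.intervalIntegrable_weight (-π) π)
  have hG := (intervalIntegrable_iff.1 (h.intervalIntegrable_norm 0 u))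
  rw [intervalIntegral.abs_intervalIntegral_eq,
    abs_of_nonneg (setIntegral_nonneg measurableSet_uIoc fun _ _ => norm_nonneg _)]
  calc ∫ s in uIoc 0 u, ‖deriv w s - e‖
      ≤ ∫ s in uIoc 0 u, (d + |u|) ^ 2 * (‖deriv w s - e‖ / (d + |s|) ^ 2) := by
        refine setIntegral_mono_on hG ((hI.mono_set hsub).const_mul _) measurableSet_uIoc ?_
        intro s hs
        have hsu : |s| ≤ |u| := by
          have := abs_sub_left_of_mem_uIcc (uIoc_subset_uIcc hs)
          simpa using this
        rw [← mul_div_assoc, le_div_iff₀ (pow_pos (h.add_abs_pos s) 2), mul_comm]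
        gcongr
    _ = (d + |u|) ^ 2 * ∫ s in uIoc 0 u, ‖deriv w s - e‖ / (d + |s|) ^ 2 :=
        integral_const_mul _ _
    _ ≤ (d + |u|) ^ 2 * (b / d) := by
        gcongr
        refine le_trans ?_ h.flat
        rw [intervalIntegral.integral_of_le hle]
        exact setIntegral_mono_set hI (Eventually.of_forall fun s => by positivity)
          hsub.eventuallyLE
    _ = b * (d + |u|) ^ 2 / d := by ring

theorem norm_sub_line_le (u : ℝ) :
    ‖w u - w 0 - u * e‖ ≤ |∫ s in 0..u, ‖deriv w s - e‖| := by
  have h1 : w u - w 0 - u * e = ∫ s in 0..u, (deriv w s - e) := by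
    rw [intervalIntegral.integral_sub (h.curve.intervalIntegrable_deriv 0 u)
      intervalIntegrable_const, h.curve.integral_deriv]
    simp
  rw [h1]
  exact intervalIntegral.norm_integral_le_abs_integral_norm

theorem norm_sub_ge {u : ℝ} (hu : |u| ≤ π) :
    κ / 3 * (d + |u|) ≤ ‖w u - p‖ := by
  have h1 := h.nearest u
  have h2 := h.chord_arc u hu
  have h3 : ‖w u - w 0‖ ≤ ‖w u - p‖ + ‖p - w 0‖ := norm_sub_le_norm_sub_add_norm_sub _ _ _
  rw [h.norm_sub_zero] at h3
  nlinarith [h.dpos, h.kle]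

theorem sub_ne_zero (u : ℝ) : w u - p ≠ 0 := by
  have := (h.dpos.trans_le (h.nearest u))
  exact norm_pos_iff.1 this

theorem conj_mul_self : conj e * e = 1 := by
  rw [mul_comm, Complex.mul_conj, normSq_eq_norm_sq, h.norm_e]
  simp

end LocallyFlat

/-- The reflection of `p` in the line through `m` of direction `e`. -/
noncomputable def reflectLine (m e p : ℂ) : ℂ := m + e ^ 2 * conj (p - m)

theorem intervalIntegrable_div_of_ne_zero {f : ℝ → ℂ} {g : ℝ → ℂ}
    (hf : IntervalIntegrable f volume (-π) π) (hg : Continuous g)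
    (h0 : ∀ u, |u| ≤ π → g u ≠ 0) :
    IntervalIntegrable (fun u => f u / g u) volume (-π) π := by
  simp_rw [div_eq_mul_inv]
  refine hf.mul_continuousOn (hg.continuousOn.inv₀ fun u hu => h0 u ?_)
  rw [uIcc_of_le (by linarith [pi_pos])] at hu
  exact abs_le.2 hu

namespace LocallyFlat

variable {w : ℝ → ℂ} {κ d b : ℝ} {p e : ℂ} (h : LocallyFlat w κ d b p e)

include h

theorem norm_refl_sub : ‖reflectLine (w 0) e p - w 0‖ = d := by
  simp [reflectLine, h.norm_e, ← h.norm_sub_zero, -map_sub]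

theorem norm_conj_sub_le (u : ℝ) :
    ‖conj (w u - w 0) - conj e ^ 2 * (w u - w 0)‖ ≤ 2 * |∫ s in 0..u, ‖deriv w s - e‖| := by
  have e1 : conj (w u - w 0) - conj e ^ 2 * (w u - w 0) =
      conj (w u - w 0 - u * e) - conj e ^ 2 * (w u - w 0 - u * e) := by
    simp only [map_sub, map_mul, Complex.conj_ofReal]
    linear_combination (- u * conj e) * h.conj_mul_self
  rw [e1]
  refine (norm_sub_le _ _).trans ?_
  rw [norm_mul, norm_pow, RCLike.norm_conj, RCLike.norm_conj, h.norm_e]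
  linarith [h.norm_sub_line_le u]

theorem conj_sub_eq (u : ℝ) :
    conj (w u - p) = conj e ^ 2 * (w u - reflectLine (w 0) e p) +
      (conj (w u - w 0) - conj e ^ 2 * (w u - w 0)) := by
  simp only [reflectLine, map_sub]
  linear_combination ((conj e * e + 1) * (conj p - conj (w 0))) * h.conj_mul_self

theorem norm_conj_deriv_sub_le (u : ℝ) :
    ‖conj (deriv w u) - conj e ^ 2 * deriv w u‖ ≤ 2 * ‖deriv w u - e‖ := by
  have e1 : conj (deriv w u) - conj e ^ 2 * deriv w u =
      conj (deriv w u - e) - conj e ^ 2 * (deriv w u - e) := by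
    simp only [map_sub]
    linear_combination (- conj e) * h.conj_mul_self
  rw [e1]
  refine (norm_sub_le _ _).trans ?_
  rw [norm_mul, norm_pow, RCLike.norm_conj, RCLike.norm_conj, h.norm_e]
  linarith

theorem norm_sub_refl_ge {u : ℝ} (hu : |u| ≤ π) :
    κ / 6 * (d + |u|) ≤ ‖w u - reflectLine (w 0) e p‖ := by
  have hd := h.dpos
  have hk := h.kpos
  rcases le_total (2 * d / κ) |u| with hf | hn
  · have h2 := h.chord_arc u hu
    have h3 : ‖w u - w 0‖ ≤ ‖w u - reflectLine (w 0) e p‖ + ‖reflectLine (w 0) e p - w 0‖ :=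
      norm_sub_le_norm_sub_add_norm_sub _ _ _
    rw [h.norm_refl_sub] at h3
    rw [div_le_iff₀ hk] at hf
    nlinarith [h.kle]
  · rw [le_div_iff₀ hk] at hn
    have h1 := h.norm_sub_ge hu
    have h2 := (h.norm_conj_sub_le u).trans
      (mul_le_mul_of_nonneg_left (h.abs_integral_le hu) (by norm_num))
    have h3 : ‖w u - p‖ ≤ ‖w u - reflectLine (w 0) e p‖ +
        ‖conj (w u - w 0) - conj e ^ 2 * (w u - w 0)‖ := by
      rw [← RCLike.norm_conj (w u - p), h.conj_sub_eq u]
      refine (norm_add_le _ _).trans ?_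
      rw [norm_mul, norm_pow, RCLike.norm_conj, h.norm_e]
      simp
    have h4 : 2 * (b * (d + |u|) ^ 2 / d) ≤ κ / 6 * (d + |u|) := by
      rw [← mul_div_assoc, div_le_iff₀ hd]
      have h5 : κ * (d + |u|) ≤ 3 * d := by nlinarith [h.kle]
      have h6 : b * (d + |u|) ≤ κ * d / 12 := by
        have h7 := h.b_le
        have h8 : b * (d + |u|) ≤ κ ^ 2 / 36 * (d + |u|) := by
          gcongr
          nlinarith
        nlinarith
      nlinarith [h.add_abs_pos u]
    linarith

theorem sub_refl_ne_zero {u : ℝ} (hu : |u| ≤ π) :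
    w u - reflectLine (w 0) e p ≠ 0 := by
  have h1 := h.norm_sub_refl_ge hu
  have h2 : 0 < κ / 6 * (d + |u|) := mul_pos (by linarith [h.kpos]) (h.add_abs_pos u)
  exact norm_pos_iff.1 (h2.trans_le h1)

theorem norm_conjCauchy_sub_le (i : ℕ) :
    ‖conjCauchy w (i + 1) 1 p -
      ∫ u in (-π)..π, deriv w u / ((w u - p) ^ (i + 1) * (w u - reflectLine (w 0) e p))‖
      ≤ b / (κ / 6) ^ 3 / d ^ (i + 1) := by
  set q := reflectLine (w 0) e p with hq
  set c := κ / 6 with hc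
  have hd := h.dpos
  have hc0 : 0 < c := by rw [hc]; linarith [h.kpos]
  have hc1 : c ≤ 1 := by rw [hc]; linarith [h.kle]
  have hw := h.curve.continuous
  have hle : -π ≤ π := by linarith [pi_pos]
  have hk := h.curve.intervalIntegrable_deriv (-π) π
  have hkc : IntervalIntegrable (fun u => conj (deriv w u)) volume (-π) π := by
    rw [intervalIntegrable_iff] at hk ⊢
    exact (Complex.conjLIE.toContinuousLinearEquiv : ℂ →L[ℝ] ℂ).integrable_comp hk
  have i1 : IntervalIntegrable
      (fun u => conj (deriv w u) / ((w u - p) ^ (i + 1) * conj (w u - p) ^ 1)) volume (-π) π := by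
    refine intervalIntegrable_div_of_ne_zero hkc ?_ ?_
    · exact (hw.sub continuous_const).pow _ |>.mul
        ((continuous_conj.comp (hw.sub continuous_const)).pow _)
    · intro u hu
      have := h.sub_ne_zero u
      have h' : conj (w u - p) ≠ 0 := (map_ne_zero _).2 this
      exact mul_ne_zero (pow_ne_zero _ this) (pow_ne_zero _ h')
  have i2 : IntervalIntegrable
      (fun u => deriv w u / ((w u - p) ^ (i + 1) * (w u - q))) volume (-π) π := by
    refine intervalIntegrable_div_of_ne_zero hk (by fun_prop) ?_
    intro u hu
    exact mul_ne_zero (pow_ne_zero _ (h.sub_ne_zero u)) (h.sub_refl_ne_zero hu)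
  rw [conjCauchy, ← intervalIntegral.integral_sub i1 i2]
  set H : ℝ → ℝ := fun u => |∫ s in 0..u, ‖deriv w s - e‖|
  have hHc : Continuous H := (intervalIntegral.continuous_primitive h.intervalIntegrable_norm 0).abs
  have j1 := h.intervalIntegrable_weight (-π) π
  have j2 : IntervalIntegrable (fun u => H u / (d + |u|) ^ 3) volume (-π) π := by
    simp_rw [div_eq_mul_inv]
    exact (hHc.mul (h.continuous_weight 3)).intervalIntegrable _ _
  have hpt : ∀ u, |u| ≤ π →
      ‖conj (deriv w u) / ((w u - p) ^ (i + 1) * conj (w u - p) ^ 1) -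
        deriv w u / ((w u - p) ^ (i + 1) * (w u - q))‖ ≤
      1 / (c ^ 3 * d ^ i) * (1 / 2 * (‖deriv w u - e‖ / (d + |u|) ^ 2) +
        1 / 2 * (H u / (d + |u|) ^ 3)) := by
    intro u hu
    have hW := h.add_abs_pos u
    have hA := h.norm_sub_ge hu
    have hQ := h.norm_sub_refl_ge hu
    have hA0 := h.sub_ne_zero u
    have hQ0 := h.sub_refl_ne_zero hu
    have hA0' : conj (w u - p) ≠ 0 := (map_ne_zero _).2 hA0
    have hN := h.norm_conj_sub_le u
    have hN' := h.norm_conj_deriv_sub_le u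
    have hAeq := h.conj_sub_eq u
    rw [← hq] at hQ hQ0 hAeq
    set A := w u - p
    set Q := w u - q
    set N := conj (w u - w 0) - conj e ^ 2 * (w u - w 0)
    set N' := conj (deriv w u) - conj e ^ 2 * deriv w u with hN'def
    have hid : conj (deriv w u) / (A ^ (i + 1) * conj A ^ 1) - deriv w u / (A ^ (i + 1) * Q) =
        (1 / A ^ i) * (N' / (A * conj A) - deriv w u * N / (A * conj A * Q)) :=
      div_sub_div_eq_of_eq_mul_add hA0 hA0' hQ0 hAeq (by rw [hN'def]; ring) i
    have hAd : d ≤ ‖A‖ := h.nearest u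
    have hA2 : 2 * c * (d + |u|) ≤ ‖A‖ := by rw [hc]; linarith
    have hk1 := h.curve.norm_deriv_le u
    rw [hid, norm_mul]
    have s1 : ‖1 / A ^ i‖ ≤ 1 / d ^ i := by
      rw [norm_div, norm_one, norm_pow]
      gcongr
    have s2 : ‖N' / (A * conj A)‖ ≤ 1 / c ^ 3 * (1 / 2 * (‖deriv w u - e‖ / (d + |u|) ^ 2)) := by
      rw [norm_div, norm_mul, RCLike.norm_conj]
      calc ‖N'‖ / (‖A‖ * ‖A‖) ≤ 2 * ‖deriv w u - e‖ /
            ((2 * c * (d + |u|)) * (2 * c * (d + |u|))) := by gcongr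
        _ = 1 / c ^ 2 * (1 / 2 * (‖deriv w u - e‖ / (d + |u|) ^ 2)) := by field_simp
        _ ≤ _ := by
          gcongr ?_ * _
          exact one_div_le_one_div_of_le (by positivity)
            (pow_le_pow_of_le_one hc0.le hc1 (by norm_num))
    have s3 : ‖deriv w u * N / (A * conj A * Q)‖ ≤
        1 / c ^ 3 * (1 / 2 * (H u / (d + |u|) ^ 3)) := by
      rw [norm_div, norm_mul, norm_mul, norm_mul, RCLike.norm_conj]
      calc ‖deriv w u‖ * ‖N‖ / (‖A‖ * ‖A‖ * ‖Q‖) ≤ 1 * (2 * H u) /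
            ((2 * c * (d + |u|)) * (2 * c * (d + |u|)) * (c * (d + |u|))) := by gcongr
        _ = _ := by field_simp
    calc ‖1 / A ^ i‖ * ‖N' / (A * conj A) - deriv w u * N / (A * conj A * Q)‖
        ≤ 1 / d ^ i * (1 / c ^ 3 * (1 / 2 * (‖deriv w u - e‖ / (d + |u|) ^ 2)) +
          1 / c ^ 3 * (1 / 2 * (H u / (d + |u|) ^ 3))) := by
          gcongr
          exact (norm_sub_le _ _).trans (add_le_add s2 s3)
      _ = _ := by field_simp
  have hH2 := integral_abs_primitive_div_cube_le (fun u => norm_nonneg (deriv w u - e))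
    h.intervalIntegrable_norm hd pi_pos.le
  have hflat := h.flat
  have hb := h.b_nonneg
  calc _ ≤ ∫ u in (-π)..π, 1 / (c ^ 3 * d ^ i) * (1 / 2 * (‖deriv w u - e‖ / (d + |u|) ^ 2) +
        1 / 2 * (H u / (d + |u|) ^ 3)) := by
        refine intervalIntegral.norm_integral_le_of_norm_le hle
          (Eventually.of_forall fun u hu => hpt u (abs_le.2 ⟨hu.1.le, hu.2⟩)) ?_
        exact ((j1.const_mul _).add (j2.const_mul _)).const_mul _
    _ ≤ 1 / (c ^ 3 * d ^ i) * (b / d) := by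
        rw [intervalIntegral.integral_const_mul, intervalIntegral.integral_add
          (j1.const_mul _) (j2.const_mul _), intervalIntegral.integral_const_mul,
          intervalIntegral.integral_const_mul]
        gcongr
        have : 0 ≤ b / d := by positivity
        linarith
    _ = b / c ^ 3 / d ^ (i + 1) := by field_simp; ring

end LocallyFlat

namespace UnitCurve

variable {w : ℝ → ℂ}

theorem exists_abs_le_eq (hw : UnitCurve w) (s : ℝ) : ∃ u, |u| ≤ π ∧ w u = w s := by
  refine ⟨toIocMod two_pi_pos (-π) s, ?_, ?_⟩
  · have h := toIocMod_mem_Ioc two_pi_pos (-π) s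
    exact abs_le.2 ⟨h.1.le, by linarith [h.2]⟩
  · rw [toIocMod]
    exact hw.per.sub_zsmul_eq _

theorem integral_deriv_div_sq (hw : UnitCurve w) {p : ℂ} {d : ℝ} (hd : 0 < d)
    (hp : ∀ u, d ≤ ‖w u - p‖) : ∫ u in (-π)..π, deriv w u / (w u - p) ^ 2 = 0 := by
  have h0 : ∀ u, w u - p ≠ 0 := fun u => norm_pos_iff.1 (hd.trans_le (hp u))
  have hlip : LipschitzOnWith (toNNReal (1 / d ^ 2)) (fun u => -(w u - p)⁻¹)
      (uIcc (-π) π) := by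
    refine LipschitzOnWith.of_dist_le_mul fun x _ y _ => ?_
    rw [dist_eq_norm, coe_toNNReal _ (by positivity), dist_eq]
    have e1 : -(w x - p)⁻¹ - -(w y - p)⁻¹ = (w x - w y) / ((w x - p) * (w y - p)) := by
      field_simp [h0 x, h0 y]
      ring
    rw [e1, norm_div, norm_mul]
    calc ‖w x - w y‖ / (‖w x - p‖ * ‖w y - p‖) ≤ |x - y| / (d * d) := by
          gcongr
          · exact hw.norm_sub_le x y
          · exact hp x
          · exact hp y
      _ = _ := by ring
  have := (hlip.integral_eq_sub_of_ae_hasDerivAt (g := fun u => deriv w u / (w u - p) ^ 2) ?_).2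
  · rw [this]
    have e : w π = w (-π) := by
      have := hw.per (-π)
      rw [← this]
      congr 1
      ring
    simp [e]
  · filter_upwards [hw.hasDerivAt] with u hu _
    refine ((hu.1.sub_const p).inv (h0 u)).neg.congr_deriv ?_
    ring

theorem integral_deriv_div_mul_mul (hw : UnitCurve w) {p q : ℂ} (hpq : p ≠ q)
    (hp : ∀ u, w u ≠ p) (hq : ∀ u, w u ≠ q) (i : ℕ) :
    ∫ u in (-π)..π, deriv w u / ((w u - p) ^ (i + 1) * (w u - q)) =
      ((∫ u in (-π)..π, deriv w u / (w u - p) ^ (i + 1)) -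
        ∫ u in (-π)..π, deriv w u / ((w u - p) ^ i * (w u - q))) / (p - q) := by
  have hc := hw.continuous
  have hk := hw.intervalIntegrable_deriv (-π) π
  have hp0 : ∀ u, w u - p ≠ 0 := fun u => sub_ne_zero.2 (hp u)
  have hq0 : ∀ u, w u - q ≠ 0 := fun u => sub_ne_zero.2 (hq u)
  have i1 : IntervalIntegrable (fun u => deriv w u / (w u - p) ^ (i + 1)) volume (-π) π :=
    intervalIntegrable_div_of_ne_zero hk (by fun_prop) fun u _ => pow_ne_zero _ (hp0 u)
  have i2 : IntervalIntegrable (fun u => deriv w u / ((w u - p) ^ i * (w u - q))) volume (-π) π :=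
    intervalIntegrable_div_of_ne_zero hk (by fun_prop) fun u _ =>
      mul_ne_zero (pow_ne_zero _ (hp0 u)) (hq0 u)
  rw [← intervalIntegral.integral_sub i1 i2, ← intervalIntegral.integral_div]
  refine intervalIntegral.integral_congr fun u _ => ?_
  have h1 := hp0 u
  have h2 := hq0 u
  have h3 : p - q ≠ 0 := sub_ne_zero.2 hpq
  field_simp
  ring

end UnitCurve

namespace LocallyFlat

variable {w : ℝ → ℂ} {κ d b : ℝ} {p e : ℂ} (h : LocallyFlat w κ d b p e)

include h

theorem le_norm_sub_refl (s : ℝ) :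
    κ / 6 * d ≤ ‖w s - reflectLine (w 0) e p‖ := by
  obtain ⟨u, hu, hus⟩ := h.curve.exists_abs_le_eq s
  rw [← hus]
  refine le_trans ?_ (h.norm_sub_refl_ge hu)
  have := h.kpos
  gcongr
  linarith [abs_nonneg u]

theorem norm_sub_reflectLine :
    d ≤ ‖p - reflectLine (w 0) e p‖ ∧ ‖p - reflectLine (w 0) e p‖ ≤ 2 * d := by
  have hd := h.dpos
  constructor
  swap
  · calc _ ≤ ‖p - w 0‖ + ‖w 0 - reflectLine (w 0) e p‖ := norm_sub_le_norm_sub_add_norm_sub _ _ _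
      _ = 2 * d := by rw [h.norm_sub_zero, norm_sub_rev, h.norm_refl_sub]; ring
  set ζ := conj e * (p - w 0) with hζ
  have hpm : p - w 0 = e * ζ := by
    rw [hζ]
    linear_combination (-(p - w 0)) * h.conj_mul_self
  have hζn : ‖ζ‖ = d := by rw [hζ, norm_mul, RCLike.norm_conj, h.norm_e, h.norm_sub_zero, one_mul]
  have hζ2 : ζ.re ^ 2 + ζ.im ^ 2 = d ^ 2 := by
    rw [← hζn, ← normSq_eq_norm_sq, normSq_apply]; ring
  have hdiff : p - reflectLine (w 0) e p = e * (ζ - conj ζ) := by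
    rw [reflectLine, sub_add_eq_sub_sub, hpm, map_mul]
    linear_combination (-e * conj ζ) * h.conj_mul_self
  have hn : ‖p - reflectLine (w 0) e p‖ = 2 * |ζ.im| := by
    rw [hdiff, norm_mul, h.norm_e, one_mul, Complex.sub_conj, norm_mul, norm_I,
      norm_real, norm_eq_abs, abs_mul]
    norm_num
  have hb : b ≤ 1 / 288 := by
    have := h.b_le
    nlinarith [h.kle, h.kpos]
  have hline : ∀ u : ℝ, |u| = d / 2 → 2 * u * ζ.re ≤ d ^ 2 / 4 + d ^ 2 / 4 := by
    intro u hu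
    have hu2 : u ^ 2 = d ^ 2 / 4 := by rw [← sq_abs, hu]; ring
    have h1 := (h.norm_sub_line_le u).trans (h.abs_integral_le (u := u)
      (by rw [hu]; linarith [h.dle, pi_gt_three]))
    have h2 := h.nearest u
    have h3 : ‖w u - p‖ ≤ ‖w u - w 0 - u * e‖ + ‖(u : ℂ) - ζ‖ := by
      have : w u - p = (w u - w 0 - u * e) + e * (u - ζ) := by
        rw [mul_sub, ← hpm]; ring
      rw [this]
      refine (norm_add_le _ _).trans ?_
      rw [norm_mul, h.norm_e, one_mul]
    have h4 : b * (d + |u|) ^ 2 / d = 9 / 4 * b * d := by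
      rw [hu]; field_simp; ring
    rw [h4] at h1
    have h5 : d * (1 - 1 / 100) ≤ ‖(u : ℂ) - ζ‖ := by nlinarith
    have h6 : ‖(u : ℂ) - ζ‖ ^ 2 = u ^ 2 - 2 * u * ζ.re + d ^ 2 := by
      rw [← normSq_eq_norm_sq, normSq_apply, ← hζ2]
      simp
      ring
    have h7 : (d * (1 - 1 / 100)) ^ 2 ≤ ‖(u : ℂ) - ζ‖ ^ 2 := by gcongr
    nlinarith
  have h1 := hline (d / 2) (abs_of_pos (by linarith))
  have h2 := hline (-(d / 2)) (by rw [abs_neg, abs_of_pos (by linarith)])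
  have h3 : |ζ.re| ≤ d / 2 := by
    rw [abs_le]
    constructor <;> nlinarith
  have h4 : ζ.re ^ 2 ≤ (d / 2) ^ 2 := by rw [← sq_abs]; gcongr
  have h5 : (d / 2) ^ 2 ≤ ζ.im ^ 2 := by nlinarith
  have h6 := (le_abs_self _).trans (sq_le_sq.1 h5)
  rw [hn]
  linarith

theorem one_div_le_norm_conjCauchy :
    1 / d ≤ ‖conjCauchy w 1 1 p‖ := by
  have hd := h.dpos
  have hk0 := h.kpos
  have hle : -π ≤ π := by linarith [pi_pos]
  have hc := h.curve.continuous
  have hinv : Continuous fun u => 1 / ‖w u - p‖ ^ 2 :=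
    continuous_const.div (by fun_prop) fun u =>
      pow_ne_zero _ (norm_pos_iff.2 (h.sub_ne_zero u)).ne'
  have hone : Continuous fun u : ℝ => 1 / (d + |u|) ^ 2 := by
    simpa using h.continuous_weight 2
  have hk := h.curve.intervalIntegrable_deriv (-π) π
  have hkc : IntervalIntegrable (fun u => conj (deriv w u)) volume (-π) π := by
    rw [intervalIntegrable_iff] at hk ⊢
    exact (Complex.conjLIE.toContinuousLinearEquiv : ℂ →L[ℝ] ℂ).integrable_comp hk
  have hY : e * conjCauchy w 1 1 p =
      (∫ u in (-π)..π, ((1 / ‖w u - p‖ ^ 2 : ℝ) : ℂ)) +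
        ∫ u in (-π)..π, e * conj (deriv w u - e) * ((1 / ‖w u - p‖ ^ 2 : ℝ) : ℂ) := by
    rw [conjCauchy, ← intervalIntegral.integral_const_mul, ← intervalIntegral.integral_add]
    · refine intervalIntegral.integral_congr fun u _ => ?_
      simp only [pow_one]
      rw [Complex.mul_conj, normSq_eq_norm_sq, map_sub]
      push_cast
      linear_combination (1 / (‖w u - p‖ : ℂ) ^ 2) * h.conj_mul_self
    · exact (Complex.continuous_ofReal.comp hinv).intervalIntegrable _ _
    · refine IntervalIntegrable.mul_continuousOn ?_
        (Complex.continuous_ofReal.comp hinv).continuousOn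
      simp only [map_sub]
      exact (hkc.sub intervalIntegrable_const).const_mul _
  have h1 : ‖∫ u in (-π)..π, e * conj (deriv w u - e) * ((1 / ‖w u - p‖ ^ 2 : ℝ) : ℂ)‖ ≤
      9 / κ ^ 2 * (b / d) := by
    calc _ ≤ ∫ u in (-π)..π, 9 / κ ^ 2 * (‖deriv w u - e‖ / (d + |u|) ^ 2) := by
          refine intervalIntegral.norm_integral_le_of_norm_le hle
            (Eventually.of_forall fun u hu => ?_)
            ((h.intervalIntegrable_weight _ _).const_mul _)
          have hA := h.norm_sub_ge (abs_le.2 ⟨hu.1.le, hu.2⟩)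
          rw [norm_mul, norm_mul, RCLike.norm_conj, h.norm_e, one_mul, norm_real,
            norm_of_nonneg (by positivity)]
          calc ‖deriv w u - e‖ * (1 / ‖w u - p‖ ^ 2) ≤
                ‖deriv w u - e‖ * (1 / (κ / 3 * (d + |u|)) ^ 2) := by gcongr
            _ = _ := by field_simp; norm_num
      _ ≤ _ := by
          rw [intervalIntegral.integral_const_mul]
          gcongr
          exact h.flat
  have h2 : 2 * (1 / d - 1 / (d + π)) ≤ ∫ u in (-π)..π, 1 / ‖w u - p‖ ^ 2 := by
    rw [← integral_one_div_add_abs_sq hd pi_pos.le]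
    refine intervalIntegral.integral_mono_on hle (hone.intervalIntegrable _ _)
      (hinv.intervalIntegrable _ _) fun u hu => ?_
    have hA0 := norm_pos_iff.2 (h.sub_ne_zero u)
    have : ‖w u - p‖ ≤ d + |u| := by
      have h3 : ‖w u - p‖ ≤ ‖w u - w 0‖ + ‖w 0 - p‖ := norm_sub_le_norm_sub_add_norm_sub _ _ _
      have h4 := h.curve.norm_sub_le u 0
      rw [norm_sub_rev (w 0), h.norm_sub_zero] at h3
      rw [sub_zero] at h4
      linarith
    gcongr
  have h3 : ‖e * conjCauchy w 1 1 p‖ = ‖conjCauchy w 1 1 p‖ := by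
    rw [norm_mul, h.norm_e, one_mul]
  rw [← h3, hY, intervalIntegral.integral_ofReal]
  have h4 : 2 * (1 / d - 1 / (d + π)) ≤ ‖((∫ u in (-π)..π, 1 / ‖w u - p‖ ^ 2 : ℝ) : ℂ)‖ := by
    rw [norm_real]
    exact h2.trans (le_abs_self _)
  have h5 : 9 / κ ^ 2 * (b / d) ≤ 1 / 2 * (1 / d) := by
    have hb : 9 / κ ^ 2 * b ≤ 1 / 2 := by
      rw [div_mul_eq_mul_div, div_le_iff₀ (by positivity)]
      nlinarith [h.b_le]
    calc 9 / κ ^ 2 * (b / d) = (9 / κ ^ 2 * b) * (1 / d) := by ring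
      _ ≤ _ := by gcongr
  have h6 : 1 / (d + π) ≤ 1 / 3 := by
    gcongr
    linarith [pi_gt_three]
  have h7 : 2 ≤ 1 / d := by
    rw [le_div_iff₀ hd]
    linarith [h.dle]
  have h8 := norm_sub_le_norm_add ((∫ u in (-π)..π, 1 / ‖w u - p‖ ^ 2 : ℝ) : ℂ)
    (∫ u in (-π)..π, e * conj (deriv w u - e) * ((1 / ‖w u - p‖ ^ 2 : ℝ) : ℂ))
  linarith

theorem norm_conjCauchy_le (i j : ℕ) (hij : i + j = 3) :
    ‖conjCauchy w i j p‖ ≤ 18 / κ ^ 2 / d ^ 2 := by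
  have hd := h.dpos
  have hk0 := h.kpos
  have hle : -π ≤ π := by linarith [pi_pos]
  have hone : Continuous fun u : ℝ => 1 / (d + |u|) ^ 2 := by
    simpa using h.continuous_weight 2
  calc ‖conjCauchy w i j p‖ ≤ ∫ u in (-π)..π, 9 / κ ^ 2 / d * (1 / (d + |u|) ^ 2) := by
        refine intervalIntegral.norm_integral_le_of_norm_le hle
          (Eventually.of_forall fun u hu => ?_)
          ((hone.intervalIntegrable _ _).const_mul _)
        have hA := h.norm_sub_ge (abs_le.2 ⟨hu.1.le, hu.2⟩)
        have hk1 := h.curve.norm_deriv_le u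
        have hn := h.nearest u
        rw [norm_div, RCLike.norm_conj, norm_mul, norm_pow, norm_pow, RCLike.norm_conj, ← pow_add,
          hij]
        calc ‖deriv w u‖ / ‖w u - p‖ ^ 3 ≤ 1 / (d * (κ / 3 * (d + |u|)) ^ 2) := by
              rw [pow_succ' ‖w u - p‖ 2]
              gcongr
          _ = _ := by field_simp; norm_num
    _ = 9 / κ ^ 2 / d * (2 * (1 / d - 1 / (d + π))) := by
        rw [intervalIntegral.integral_const_mul, integral_one_div_add_abs_sq hd pi_pos.le]
    _ ≤ 9 / κ ^ 2 / d * (2 * (1 / d)) := by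
        gcongr
        have : 0 ≤ 1 / (d + π) := by positivity
        linarith
    _ = _ := by field_simp; norm_num

end LocallyFlat

namespace LocallyFlat

variable {w : ℝ → ℂ} {κ d b : ℝ} {p e : ℂ}

theorem reflection_estimates (h : LocallyFlat w κ d b p e) {Ω Ωs : Set ℂ} {n : ℂ}
    (hΩ : IsOpen Ω) (hΩs : IsOpen Ωs) (hdisj : Disjoint Ω Ωs)
    (hunion : Ω ∪ Ωs = (range w)ᶜ) (hn : ∀ z ∈ Ω, cauchyIndex w z = n)
    (hs : ∀ z ∈ Ωs, cauchyIndex w z = 0) (hp : p ∈ Ω) :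
    ‖1 + n * conjCauchy w 2 1 p / conjCauchy w 1 1 p ^ 2‖ ≤ (3 + ‖n‖) * (216 / κ ^ 3) * b ∧
    ‖n * conjCauchy w 1 2 p / conjCauchy w 1 1 p ^ 2‖ ≤ ‖n‖ * (18 / κ ^ 2) ∧
    ‖n / conjCauchy w 1 1 p‖ ≤ ‖n‖ * d ∧
    ∀ ζ ∈ Ω, d + ‖p - ζ‖ ≤
      (1 + (1 + ‖n‖) * (12 / κ)) * ‖p - n / conjCauchy w 1 1 p - ζ‖ := by
  set Y := conjCauchy w 1 1 p
  set Y1 := conjCauchy w 2 1 p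
  set Y2 := conjCauchy w 1 2 p with hY2
  set q := reflectLine (w 0) e p with hq
  set c := κ / 6 with hc
  set β := b / c ^ 3 with hβ
  have hd := h.dpos
  have hc0 : 0 < c := by rw [hc]; linarith [h.kpos]
  have hc1 : c ≤ 1 / 6 := by rw [hc]; linarith [h.kle]
  have hb0 := h.b_nonneg
  have hβc : β ≤ c / 8 := by
    rw [hβ, div_le_iff₀ (by positivity)]
    have := h.small
    rw [← hc] at this
    nlinarith
  have hYd : 1 / d ≤ ‖Y‖ := h.one_div_le_norm_conjCauchy
  have hYpos : 0 < ‖Y‖ := lt_of_lt_of_le (by positivity) hYd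
  have hY0 : Y ≠ 0 := norm_pos_iff.1 hYpos
  have hpr : ∀ u, w u ≠ p := fun u => _root_.sub_ne_zero.1 (h.sub_ne_zero u)
  have hqd := h.le_norm_sub_refl
  have hqr : ∀ u, w u ≠ q := fun u => by
    have := (mul_pos hc0 hd).trans_le (hqd u)
    exact _root_.sub_ne_zero.1 (norm_pos_iff.1 this)
  have hpq := h.norm_sub_reflectLine
  rw [← hq] at hpq hqd
  have hpq0 : p - q ≠ 0 := norm_pos_iff.1 (hd.trans_le hpq.1)
  set Z := ∫ u in (-π)..π, deriv w u / ((w u - p) ^ (0 + 1) * (w u - q)) with hZ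
  set Z2 := ∫ u in (-π)..π, deriv w u / ((w u - p) ^ (1 + 1) * (w u - q)) with hZ2
  have hYZ : ‖Y - Z‖ ≤ β / d := (h.norm_conjCauchy_sub_le 0).trans_eq (by rw [zero_add, pow_one])
  have hYZ2 : ‖Y1 - Z2‖ ≤ β / d ^ 2 := h.norm_conjCauchy_sub_le 1
  have hZe : Z = (cauchyIndex w p - cauchyIndex w q) / (p - q) := by
    rw [hZ, h.curve.integral_deriv_div_mul_mul (_root_.sub_ne_zero.1 hpq0) hpr hqr 0]
    simp [cauchyIndex]
  have hZ2e : Z2 = -Z / (p - q) := by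
    rw [hZ2, h.curve.integral_deriv_div_mul_mul (_root_.sub_ne_zero.1 hpq0) hpr hqr 1,
      h.curve.integral_deriv_div_sq hd h.nearest, hZ]
    simp
  have hYZ' : ‖Y - Z‖ ≤ β * ‖Y‖ :=
    hYZ.trans (by rw [div_eq_mul_one_div]; gcongr)
  have hZ0 : Z ≠ 0 := by
    intro h0
    rw [h0, sub_zero] at hYZ'
    nlinarith
  have hqU : q ∈ Ω ∪ Ωs := by
    rw [hunion]
    rintro ⟨u, hu⟩
    exact hqr u hu
  have hqs : q ∈ Ωs := by
    rcases hqU with hq1 | hq1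
    · exact absurd (by rw [hZe, hn p hp, hn q hq1]; simp) hZ0
    · exact hq1
  have hnZ : n = Z * (p - q) := by
    rw [hZe, hn p hp, hs q hqs]
    field_simp
    ring
  have hnZ2 : n * Z2 = -Z ^ 2 := by
    rw [hnZ, hZ2e]
    field_simp
  have hball : ball q (c * d) ⊆ Ωs := by
    refine (convex_ball q (c * d)).isPreconnected.subset_right_of_subset_union hΩ hΩs hdisj ?_
      ⟨q, mem_ball_self (by positivity), hqs⟩
    rw [hunion]
    rintro z hz ⟨u, rfl⟩
    rw [mem_ball, dist_eq_norm] at hz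
    exact absurd (hqd u) (not_le.2 hz)
  have hnY : ‖n / Y‖ ≤ ‖n‖ * d := by
    rw [norm_div, div_le_iff₀ hYpos]
    rw [div_le_iff₀ hd] at hYd
    nlinarith [norm_nonneg n]
  have hYsq : 1 / d ^ 2 ≤ ‖Y‖ ^ 2 := by
    rw [← one_div_pow]
    gcongr
  refine ⟨?_, ?_, hnY, ?_⟩
  · have e1 : 1 + n * Y1 / Y ^ 2 = ((Y - Z) * (2 * Y - (Y - Z)) + n * (Y1 - Z2)) / Y ^ 2 := by
      field_simp
      linear_combination hnZ2
    rw [e1, norm_div, norm_pow, div_le_iff₀ (by positivity)]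
    have e2 : (3 + ‖n‖) * (216 / κ ^ 3) * b = (3 + ‖n‖) * β := by
      have := h.kpos
      rw [hβ, hc]
      field_simp
      norm_num
      ring
    rw [e2]
    calc _ ≤ ‖Y - Z‖ * (2 * ‖Y‖ + ‖Y - Z‖) + ‖n‖ * ‖Y1 - Z2‖ := by
          refine (norm_add_le _ _).trans ?_
          rw [norm_mul, norm_mul]
          gcongr
          refine (norm_sub_le _ _).trans ?_
          rw [norm_mul]
          simp
      _ ≤ (β * ‖Y‖) * (2 * ‖Y‖ + 1 * ‖Y‖) + ‖n‖ * (β * ‖Y‖ ^ 2) := by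
          gcongr
          · exact hYZ'.trans (by gcongr; linarith)
          · exact hYZ2.trans (by rw [div_eq_mul_one_div]; gcongr)
      _ = _ := by ring
  · have := h.norm_conjCauchy_le 1 2 (by norm_num)
    rw [← hY2] at this
    rw [norm_div, norm_mul, norm_pow, div_le_iff₀ (by positivity), mul_assoc]
    gcongr
    refine this.trans ?_
    rw [div_eq_mul_one_div]
    gcongr
  · intro ζ hζ
    have h1 : c * d ≤ ‖q - ζ‖ := by
      by_contra! hlt
      have : ζ ∈ ball q (c * d) := by rwa [mem_ball, dist_eq_norm, norm_sub_rev]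
      exact Set.disjoint_left.1 hdisj hζ (hball this)
    have h2 : ‖p - n / Y - q‖ ≤ c * d / 4 := by
      have e1 : p - n / Y - q = (p - q) * (Y - Z) / Y := by
        rw [hnZ]
        field_simp
        ring
      rw [e1, norm_div, norm_mul, div_le_iff₀ hYpos]
      calc ‖p - q‖ * ‖Y - Z‖ ≤ (2 * d) * (c / 8 * ‖Y‖) := by
            gcongr
            · exact hpq.2
            · exact hYZ'.trans (by gcongr)
        _ = _ := by ring
    have h3 : ‖q - ζ‖ ≤ ‖p - n / Y - q‖ + ‖p - n / Y - ζ‖ := by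
      rw [norm_sub_rev _ q]
      exact norm_sub_le_norm_sub_add_norm_sub _ _ _
    have h4 : c * d ≤ 2 * ‖p - n / Y - ζ‖ := by nlinarith
    have h5 : ‖p - ζ‖ ≤ ‖n / Y‖ + ‖p - n / Y - ζ‖ := by
      have : p - ζ = n / Y + (p - n / Y - ζ) := by ring
      rw [this]
      exact norm_add_le _ _
    have h6 : d ≤ 12 / κ * ‖p - n / Y - ζ‖ := by
      rw [div_mul_eq_mul_div, le_div_iff₀ h.kpos]
      have : κ = 6 * c := by rw [hc]; ring
      rw [this]
      linarith
    have h7 : ‖n‖ * d ≤ ‖n‖ * (12 / κ * ‖p - n / Y - ζ‖) := by gcongr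
    nlinarith

end LocallyFlat

/-- The real linear map `v ↦ A v + B conj v`. -/
noncomputable def wirtingerMap (A B : ℂ) : ℂ →L[ℝ] ℂ :=
  A • ContinuousLinearMap.id ℝ ℂ + B • (conjCLE : ℂ →L[ℝ] ℂ)

@[simp]
theorem wirtingerMap_apply (A B v : ℂ) :
    wirtingerMap A B v = A * v + B * conj v := by
  simp [wirtingerMap]

theorem norm_wirtingerMap_le (A B : ℂ) : ‖wirtingerMap A B‖ ≤ ‖A‖ + ‖B‖ := by
  refine ContinuousLinearMap.opNorm_le_bound _ (by positivity) fun v => ?_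
  rw [wirtingerMap_apply, add_mul]
  refine (norm_add_le _ _).trans ?_
  simp

theorem hasFDerivAt_div_normSq (c a x : ℂ) (hx : a - x ≠ 0) :
    HasFDerivAt (fun x => c / ((a - x) ^ 1 * conj (a - x) ^ 1))
      (wirtingerMap (c / ((a - x) ^ 2 * conj (a - x) ^ 1)) (c / ((a - x) ^ 1 * conj (a - x) ^ 2)))
      x := by
  have hx' : conj (a - x) ≠ 0 := (map_ne_zero _).2 hx
  have h1 : HasFDerivAt (fun x : ℂ => a - x) (-ContinuousLinearMap.id ℝ ℂ) x :=
    (hasFDerivAt_id x).const_sub a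
  have h2 : HasFDerivAt (fun x : ℂ => conj (a - x))
      ((conjCLE : ℂ →L[ℝ] ℂ).comp (-ContinuousLinearMap.id ℝ ℂ)) x :=
    (conjCLE : ℂ →L[ℝ] ℂ).hasFDerivAt.comp x h1
  have h3 := ((hasFDerivAt_inv' (𝕜 := ℝ) (mul_ne_zero hx hx')).comp x (h1.mul h2)).const_mul c
  simp only [pow_one, div_eq_mul_inv]
  refine h3.congr_fderiv (ContinuousLinearMap.ext fun v => ?_)
  simp
  rw [map_sub] at hx'
  field_simp
  ring

namespace UnitCurve

variable {w : ℝ → ℂ}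

theorem hasFDerivAt_conjCauchy (hw : UnitCurve w) {p : ℂ} {d : ℝ} (hd : 0 < d)
    (hp : ∀ u, d ≤ ‖w u - p‖) :
    HasFDerivAt (conjCauchy w 1 1) (wirtingerMap (conjCauchy w 2 1 p) (conjCauchy w 1 2 p)) p := by
  have hm := measurable_deriv (w := w)
  have hc := hw.continuous
  have hlow : ∀ u, ∀ x ∈ ball p (d / 2), d / 2 ≤ ‖w u - x‖ := by
    intro u x hx
    have h1 : ‖w u - p‖ ≤ ‖w u - x‖ + ‖x - p‖ := norm_sub_le_norm_sub_add_norm_sub _ _ _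
    rw [mem_ball, dist_eq_norm] at hx
    linarith [hp u]
  have hmeas : ∀ (i j : ℕ) (x : ℂ),
      Measurable fun u => conj (deriv w u) / ((w u - x) ^ i * conj (w u - x) ^ j) := by
    intro i j x
    have h1 : Measurable fun u => conj (deriv w u) := continuous_conj.measurable.comp hm
    have h2 : Measurable fun u => (w u - x) ^ i * conj (w u - x) ^ j := by
      refine Continuous.measurable ?_
      exact ((hc.sub continuous_const).pow i).mul
        ((continuous_conj.comp (hc.sub continuous_const)).pow j)
    exact h1.div h2
  have hbd : ∀ (i j : ℕ) (x : ℂ), x ∈ ball p (d / 2) → ∀ u,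
      ‖conj (deriv w u) / ((w u - x) ^ i * conj (w u - x) ^ j)‖ ≤ 1 / (d / 2) ^ (i + j) := by
    intro i j x hx u
    rw [norm_div, norm_mul, norm_pow, norm_pow, RCLike.norm_conj, RCLike.norm_conj, ← pow_add]
    have := hlow u x hx
    have := hw.norm_deriv_le u
    gcongr
  have hintv : ∀ (i j : ℕ), IntervalIntegrable
      (fun u => conj (deriv w u) / ((w u - p) ^ i * conj (w u - p) ^ j)) volume (-π) π := by
    intro i j
    rw [intervalIntegrable_iff, uIoc_of_le (by linarith [pi_pos])]
    exact Integrable.of_bound (hmeas i j p).aestronglyMeasurable _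
      (Eventually.of_forall (hbd i j p (mem_ball_self (by positivity))))
  have hmW : Measurable fun u => wirtingerMap
      (conj (deriv w u) / ((w u - p) ^ 2 * conj (w u - p) ^ 1))
      (conj (deriv w u) / ((w u - p) ^ 1 * conj (w u - p) ^ 2)) := by
    unfold wirtingerMap
    exact ((hmeas 2 1 p).smul_const _).add ((hmeas 1 2 p).smul_const _)
  have hWb : ∀ u, ∀ x ∈ ball p (d / 2), ‖wirtingerMap
      (conj (deriv w u) / ((w u - x) ^ 2 * conj (w u - x) ^ 1))
      (conj (deriv w u) / ((w u - x) ^ 1 * conj (w u - x) ^ 2))‖ ≤ 2 * (1 / (d / 2) ^ 3) := by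
    intro u x hx
    refine (norm_wirtingerMap_le _ _).trans ?_
    have h1 := hbd 2 1 x hx u
    have h2 := hbd 1 2 x hx u
    norm_num at h1 h2 ⊢
    linarith
  have key := intervalIntegral.hasFDerivAt_integral_of_dominated_of_fderiv_le
    (μ := volume) (a := -π) (b := π) (𝕜 := ℝ) (s := ball p (d / 2)) (x₀ := p)
    (F := fun x u => conj (deriv w u) / ((w u - x) ^ 1 * conj (w u - x) ^ 1))
    (F' := fun x u => wirtingerMap
      (conj (deriv w u) / ((w u - x) ^ 2 * conj (w u - x) ^ 1))
      (conj (deriv w u) / ((w u - x) ^ 1 * conj (w u - x) ^ 2)))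
    (bound := fun _ => 2 * (1 / (d / 2) ^ 3))
    (ball_mem_nhds p (by positivity))
    (Eventually.of_forall fun x => (hmeas 1 1 x).aestronglyMeasurable)
    (hintv 1 1) hmW.aestronglyMeasurable
    (Eventually.of_forall fun u _ x hx => hWb u x hx) intervalIntegrable_const
    (Eventually.of_forall fun u _ x hx => hasFDerivAt_div_normSq _ _ _
      (norm_pos_iff.1 (lt_of_lt_of_le (by positivity) (hlow u x hx))))
  refine key.congr_fderiv (ContinuousLinearMap.ext fun v => ?_)
  have hWi : IntervalIntegrable (fun u => wirtingerMap
      (conj (deriv w u) / ((w u - p) ^ 2 * conj (w u - p) ^ 1))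
      (conj (deriv w u) / ((w u - p) ^ 1 * conj (w u - p) ^ 2))) volume (-π) π := by
    rw [intervalIntegrable_iff, uIoc_of_le (by linarith [pi_pos])]
    exact Integrable.of_bound hmW.aestronglyMeasurable _
      (Eventually.of_forall fun u => hWb u p (mem_ball_self (by positivity)))
  rw [ContinuousLinearMap.intervalIntegral_apply hWi]
  simp only [wirtingerMap_apply]
  rw [intervalIntegral.integral_add ((hintv 2 1).mul_const _) ((hintv 1 2).mul_const _),
    intervalIntegral.integral_mul_const, intervalIntegral.integral_mul_const]
  rfl

theorem hasDerivAt_cauchyIndex (hw : UnitCurve w) {p : ℂ} {d : ℝ} (hd : 0 < d)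
    (hp : ∀ u, d ≤ ‖w u - p‖) : HasDerivAt (cauchyIndex w) 0 p := by
  have hm := measurable_deriv (w := w)
  have hc := hw.continuous
  have hlow : ∀ u, ∀ x ∈ ball p (d / 2), d / 2 ≤ ‖w u - x‖ := by
    intro u x hx
    have h1 : ‖w u - p‖ ≤ ‖w u - x‖ + ‖x - p‖ := norm_sub_le_norm_sub_add_norm_sub _ _ _
    rw [mem_ball, dist_eq_norm] at hx
    linarith [hp u]
  have hp0 : ∀ u, ∀ x ∈ ball p (d / 2), w u - x ≠ 0 := fun u x hx =>
    norm_pos_iff.1 (lt_of_lt_of_le (by positivity) (hlow u x hx))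
  have key := (intervalIntegral.hasDerivAt_integral_of_dominated_loc_of_deriv_le
    (μ := volume) (a := -π) (b := π) (s := ball p (d / 2)) (x₀ := p)
    (F := fun x u => deriv w u / (w u - x))
    (F' := fun x u => deriv w u / (w u - x) ^ 2)
    (bound := fun _ => 1 / (d / 2) ^ 2)
    (ball_mem_nhds p (by positivity))
    (Eventually.of_forall fun x => (hm.div
      (hc.sub continuous_const).measurable).aestronglyMeasurable)
    (intervalIntegrable_div_of_ne_zero (hw.intervalIntegrable_deriv _ _) (by fun_prop) fun u _ =>
      hp0 u p (mem_ball_self (by positivity)))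
    (hm.div ((hc.sub continuous_const).pow 2).measurable).aestronglyMeasurable
    (Eventually.of_forall fun u _ x hx => by
      rw [norm_div, norm_pow]
      have := hlow u x hx
      have := hw.norm_deriv_le u
      gcongr) intervalIntegrable_const
    (Eventually.of_forall fun u _ x hx => by
      have h0 := hp0 u x hx
      refine ((hasDerivAt_const x (deriv w u)).div
        ((hasDerivAt_id x).const_sub (w u)) h0).congr_deriv ?_
      simp)).2
  rw [hw.integral_deriv_div_sq hd hp] at key
  exact key

theorem exists_pos_le_norm_sub (hw : UnitCurve w) {p : ℂ} (hp : p ∉ range w) :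
    ∃ d > 0, ∀ u, d ≤ ‖w u - p‖ := by
  obtain ⟨u0, hu0, hmin⟩ := (isCompact_Icc (a := -π) (b := π)).exists_isMinOn
    ⟨0, by constructor <;> linarith [pi_pos]⟩
    (f := fun u => ‖w u - p‖) (by have := hw.continuous; fun_prop)
  refine ⟨‖w u0 - p‖, norm_pos_iff.2 (sub_ne_zero.2 fun h => hp ⟨u0, h⟩), fun s => ?_⟩
  obtain ⟨u, hu, hus⟩ := hw.exists_abs_le_eq s
  rw [← hus]
  exact hmin (abs_le.1 hu)

theorem exists_cauchyIndex_eq (hw : UnitCurve w) {U : Set ℂ} (hU : IsOpen U)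
    (hUc : IsPreconnected U) (hUw : Disjoint U (range w)) :
    ∃ n, ∀ z ∈ U, cauchyIndex w z = n := by
  have h : ∀ z ∈ U, HasDerivAt (cauchyIndex w) 0 z := fun z hz => by
    obtain ⟨d, hd, hdz⟩ := hw.exists_pos_le_norm_sub (Set.disjoint_left.1 hUw hz)
    exact hw.hasDerivAt_cauchyIndex hd hdz
  exact hU.exists_is_const_of_deriv_eq_zero hUc
    (fun z hz => (h z hz).differentiableAt.differentiableWithinAt) (fun z hz => (h z hz).deriv)

theorem cauchyIndex_eq_zero (hw : UnitCurve w) {U : Set ℂ} (hU : IsOpen U)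
    (hUc : IsPreconnected U) (hUw : Disjoint U (range w)) (hUb : ¬ IsBounded U) :
    ∀ z ∈ U, cauchyIndex w z = 0 := by
  obtain ⟨n, hn⟩ := hw.exists_cauchyIndex_eq hU hUc hUw
  suffices n = 0 by rw [← this]; exact hn
  have hR : ∀ u, ‖w u‖ ≤ ‖w 0‖ + π := by
    intro s
    obtain ⟨u, hu, hus⟩ := hw.exists_abs_le_eq s
    rw [← hus]
    have h1 := hw.norm_sub_le u 0
    have h2 := norm_le_norm_add_norm_sub' (w u) (w 0)
    rw [sub_zero] at h1
    linarith
  by_contra hne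
  have hpos := norm_pos_iff.2 hne
  refine hUb ((isBounded_iff_forall_norm_le).2 ⟨‖w 0‖ + π + 2 * π / ‖n‖, fun z hz => ?_⟩)
  by_contra! hlt
  have hz1 : 2 * π / ‖n‖ < ‖z‖ - (‖w 0‖ + π) := by linarith
  have hgap : 0 < ‖z‖ - (‖w 0‖ + π) := lt_trans (by positivity) hz1
  have hb : ‖cauchyIndex w z‖ ≤ 1 / (‖z‖ - (‖w 0‖ + π)) * |π - -π| := by
    refine intervalIntegral.norm_integral_le_of_norm_le_const fun u _ => ?_
    rw [norm_div]
    have h1 := hw.norm_deriv_le u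
    have h2 : ‖z‖ - (‖w 0‖ + π) ≤ ‖w u - z‖ := by
      have := norm_sub_norm_le z (w u)
      rw [norm_sub_rev] at this
      linarith [hR u]
    gcongr
  rw [hn z hz, abs_of_pos (by linarith [pi_pos]), one_div_mul_eq_div, le_div_iff₀ hgap] at hb
  rw [div_lt_iff₀ hpos] at hz1
  linarith

end UnitCurve

theorem lintegral_norm_comp_complex (g : ℝ → ENNReal) (hg : Measurable g) :
    ∫⁻ z : ℂ, g ‖z‖ = ofReal (2 * π) * ∫⁻ r in Ioi (0 : ℝ), ofReal r * g r := by
  have hpt : ∀ p ∈ polarCoord.target, ofReal p.1 • g ‖Complex.polarCoord.symm p‖ =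
      ofReal p.1 * g p.1 * 1 := by
    intro p hp
    rw [polarCoord_target] at hp
    rw [Complex.norm_polarCoord_symm, abs_of_pos (mem_Ioi.1 hp.1), smul_eq_mul, mul_one]
  have hg' : Measurable fun r => ofReal r * g r :=
    (measurable_ofReal.comp measurable_id).mul hg
  rw [← Complex.lintegral_comp_polarCoord_symm,
    setLIntegral_congr_fun polarCoord.open_target.measurableSet hpt, polarCoord_target,
    Measure.volume_eq_prod, ← Measure.prod_restrict,
    lintegral_prod_mul (f := fun r => ofReal r * g r) (g := fun _ => 1)
      hg'.aemeasurable aemeasurable_const, mul_comm]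
  congr 1
  simp only [lintegral_const, Measure.restrict_apply MeasurableSet.univ, univ_inter,
    Real.volume_Ioo, one_mul]
  congr 1
  ring

/-- Antiderivative computation behind `lintegral_kernel_le`. -/
theorem lintegral_Ioi_kernel_le {D : ℝ} (hD : 0 < D) :
    ∫⁻ r in Ioi (0 : ℝ), ofReal r *
      ofReal (1 / (r * √r * ((r + D) ^ 2 * √(r + D)))) ≤ ofReal (2 / D ^ 2) := by
  set s : ℝ → ℝ := fun r => r / (r + D) with hs
  set A : ℝ → ℝ := fun r => (2 * √(s r) - 2 / 3 * (s r * √(s r))) / D ^ 2 with hA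
  have hcont : ContinuousWithinAt A (Ici 0) 0 := by
    have : ContinuousAt A 0 := by
      have hs0 : ContinuousAt s 0 := by
        refine continuousAt_id.div (by fun_prop) ?_
        simpa using hD.ne'
      have := hs0.sqrt
      exact ((continuousAt_const.mul this).sub (continuousAt_const.mul (hs0.mul this))).div_const _
    exact this.continuousWithinAt
  have hder : ∀ r ∈ Ioi (0 : ℝ),
      HasDerivAt A (r * (1 / (r * √r * ((r + D) ^ 2 * √(r + D))))) r := by
    intro r hr
    have hr0 : 0 < r := hr
    have hrD : 0 < r + D := by linarith
    have h1 : HasDerivAt s (D / (r + D) ^ 2) r := by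
      refine ((hasDerivAt_id r).div ((hasDerivAt_id r).add_const D) hrD.ne').congr_deriv ?_
      simp
    have hs0 : 0 < s r := div_pos hr0 hrD
    have h2 := h1.sqrt hs0.ne'
    refine (((h2.const_mul 2).sub ((h1.mul h2).const_mul (2 / 3))).div_const (D ^ 2)).congr_deriv ?_
    have e1 : √(s r) = √r / √(r + D) := sqrt_div hr0.le _
    have e2 : s r = r / (r + D) := rfl
    rw [e1, e2]
    have g1 := sq_sqrt hr0.le
    have g2 := sq_sqrt hrD.le
    set x := √r
    set y := √(r + D)
    have hD' : D = y ^ 2 - x ^ 2 := by linarith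
    have hr' : r = x ^ 2 := g1.symm
    rw [← g2, hr']
    have hne : y ^ 2 - x ^ 2 ≠ 0 := by rw [← hD']; exact hD.ne'
    rw [hD']
    field_simp
    ring
  have hlim : Tendsto A atTop (nhds ((2 * √1 - 2 / 3 * (1 * √1)) / D ^ 2)) := by
    have hs1 : Tendsto s atTop (nhds 1) := by
      have h0 : Tendsto (fun r : ℝ => 1 - D / (r + D)) atTop (nhds (1 - 0)) :=
        tendsto_const_nhds.sub (tendsto_const_nhds.div_atTop
          (Filter.tendsto_atTop_add_const_right _ _ Filter.tendsto_id))
      rw [sub_zero] at h0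
      refine h0.congr' ?_
      filter_upwards [Filter.eventually_gt_atTop 0] with r hr
      have : r + D ≠ 0 := by linarith
      rw [hs]
      field_simp
      ring
    have h2 := hs1.sqrt
    exact ((tendsto_const_nhds.mul h2).sub (tendsto_const_nhds.mul (hs1.mul h2))).div_const _
  have hpos : ∀ r ∈ Ioi (0 : ℝ), 0 ≤ r * (1 / (r * √r * ((r + D) ^ 2 * √(r + D)))) := by
    intro r hr
    have : 0 < r := hr
    positivity
  have hintv := integral_Ioi_of_hasDerivAt_of_nonneg hcont hder hpos hlim
  have hio := integrableOn_Ioi_deriv_of_nonneg hcont hder hpos hlim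
  have e : ∀ r ∈ Ioi (0 : ℝ), ofReal r *
      ofReal (1 / (r * √r * ((r + D) ^ 2 * √(r + D)))) =
      ofReal (r * (1 / (r * √r * ((r + D) ^ 2 * √(r + D))))) := fun r hr =>
    (ofReal_mul (le_of_lt hr)).symm
  rw [setLIntegral_congr_fun measurableSet_Ioi e, ← ofReal_integral_eq_lintegral_ofReal hio
    ((ae_restrict_iff' measurableSet_Ioi).2 (Eventually.of_forall hpos)), hintv]
  refine ofReal_le_ofReal ?_
  have : A 0 = 0 := by simp [hA, hs]
  rw [this, sub_zero, Real.sqrt_one]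
  gcongr
  norm_num

theorem lintegral_kernel_le (q : ℂ) {D : ℝ} (hD : 0 < D) :
    ∫⁻ z : ℂ, ofReal (1 / (‖z - q‖ * √‖z - q‖ * ((‖z - q‖ + D) ^ 2 * √(‖z - q‖ + D)))) ≤
      ofReal (4 * π / D ^ 2) := by
  rw [lintegral_sub_right_eq_self (fun z : ℂ => ofReal
    (1 / (‖z‖ * √‖z‖ * ((‖z‖ + D) ^ 2 * √(‖z‖ + D))))) q,
    lintegral_norm_comp_complex (fun r => ofReal
    (1 / (r * √r * ((r + D) ^ 2 * √(r + D))))) (by fun_prop)]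
  refine (mul_le_mul_right (lintegral_Ioi_kernel_le hD) _).trans_eq ?_
  rw [← ofReal_mul (by positivity)]
  congr 1
  ring

theorem lintegral_Ioi_div_add_pow_four_le {d : ℝ} (hd : 0 < d) :
    ∫⁻ r in Ioi (0 : ℝ), ofReal r * ofReal (1 / (d + r) ^ 4) ≤
      ofReal (1 / d ^ 2) := by
  set A : ℝ → ℝ := fun r => -(1 / (d + r) ^ 2) with hA
  have hder : ∀ r ∈ Ici (0 : ℝ), HasDerivAt A (2 / (d + r) ^ 3) r := by
    intro r hr
    have hr0 : 0 < d + r := by linarith [mem_Ici.1 hr]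
    have h1 : HasDerivAt (fun r => d + r) 1 r := (hasDerivAt_id r).const_add d
    have := ((h1.pow 2).inv (pow_ne_zero 2 hr0.ne')).neg
    simp only [hA, one_div]
    refine this.congr_deriv ?_
    simp
    field_simp
  have hlim : Tendsto A atTop (nhds (-0)) := by
    have : Tendsto (fun r : ℝ => (d + r) ^ 2) atTop atTop :=
      (Filter.tendsto_pow_atTop two_ne_zero).comp
        (Filter.tendsto_atTop_add_const_left _ _ Filter.tendsto_id)
    exact (tendsto_const_nhds.div_atTop this).neg
  have hpos : ∀ r ∈ Ioi (0 : ℝ), 0 ≤ 2 / (d + r) ^ 3 := by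
    intro r hr
    have : 0 < r := hr
    positivity
  have hintv := integral_Ioi_of_hasDerivAt_of_nonneg' hder hpos hlim
  have hio := integrableOn_Ioi_deriv_of_nonneg' hder hpos hlim
  calc _ ≤ ∫⁻ r in Ioi (0 : ℝ), ofReal (2 / (d + r) ^ 3) := by
        refine setLIntegral_mono' measurableSet_Ioi fun r hr => ?_
        have hr0 : 0 < r := hr
        rw [← ofReal_mul hr0.le]
        refine ofReal_le_ofReal ?_
        rw [mul_one_div, div_le_div_iff₀ (by positivity) (by positivity), pow_succ (d + r) 3]
        nlinarith [pow_pos (by linarith : 0 < d + r) 3]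
    _ = ofReal (1 / d ^ 2) := by
        rw [← ofReal_integral_eq_lintegral_ofReal hio
          ((ae_restrict_iff' measurableSet_Ioi).2 (Eventually.of_forall hpos)), hintv]
        simp [hA]

theorem lintegral_div_add_pow_four_le (q : ℂ) {d : ℝ} (hd : 0 < d) :
    ∫⁻ z : ℂ, ofReal (1 / (d + ‖z - q‖) ^ 4) ≤ ofReal (2 * π / d ^ 2) := by
  rw [lintegral_sub_right_eq_self (fun z : ℂ => ofReal (1 / (d + ‖z‖) ^ 4)) q,
    lintegral_norm_comp_complex (fun r => ofReal (1 / (d + r) ^ 4)) (by fun_prop)]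
  refine (mul_le_mul_right (lintegral_Ioi_div_add_pow_four_le hd) _).trans_eq ?_
  rw [← ofReal_mul (by positivity)]
  congr 1
  ring

namespace UnitCurve

variable {w : ℝ → ℂ}

theorem comp_const_add (hw : UnitCurve w) (s : ℝ) : UnitCurve fun u => w (s + u) where
  lip := by
    have := hw.lip.comp (LipschitzWith.of_dist_le_mul (K := 1) (f := fun u : ℝ => s + u)
      fun x y => by simp)
    rwa [mul_one] at this
  per := fun u => by simp only [← add_assoc]; exact hw.per (s + u)
  inj := by
    intro x hx y hy h
    have hx' : s + x ∈ Ico s (s + 2 * π) := ⟨by linarith [hx.1], by linarith [hx.2]⟩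
    have hy' : s + y ∈ Ico s (s + 2 * π) := ⟨by linarith [hy.1], by linarith [hy.2]⟩
    exact add_left_cancel (hw.injective_Ico s hx' hy' h)
  der := by
    have h := (measurePreserving_add_left volume s).quasiMeasurePreserving.ae hw.der
    filter_upwards [h] with u hu
    obtain ⟨v, hv, hv1⟩ := hu
    exact ⟨v, hv.comp_const_add s u, hv1⟩

theorem deriv_comp_const_add' (s : ℝ) :
    deriv (fun u => w (s + u)) = fun u => deriv w (s + u) :=
  funext fun u => deriv_comp_const_add w s u

theorem intervalIntegral_comp_const_add {f : ℝ → ℂ} (hf : Periodic f (2 * π)) (s : ℝ) :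
    ∫ u in (-π)..π, f (s + u) = ∫ u in (-π)..π, f u := by
  rw [intervalIntegral.integral_comp_add_left]
  have := hf.intervalIntegral_add_eq (s + -π) (-π)
  rwa [show s + -π + 2 * π = s + π by ring, show -π + 2 * π = π by ring] at this

theorem conjCauchy_comp_const_add (hw : UnitCurve w) (s : ℝ) (i j : ℕ) (p : ℂ) :
    conjCauchy (fun u => w (s + u)) i j p = conjCauchy w i j p := by
  rw [conjCauchy, conjCauchy, deriv_comp_const_add']
  refine intervalIntegral_comp_const_add
    (f := fun u => conj (deriv w u) / ((w u - p) ^ i * conj (w u - p) ^ j)) (fun u => ?_) s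
  simp only [hw.deriv_periodic u, hw.per u]

theorem cauchyIndex_comp_const_add (hw : UnitCurve w) (s : ℝ) (p : ℂ) :
    cauchyIndex (fun u => w (s + u)) p = cauchyIndex w p := by
  rw [cauchyIndex, cauchyIndex, deriv_comp_const_add']
  refine intervalIntegral_comp_const_add (f := fun u => deriv w u / (w u - p)) (fun u => ?_) s
  simp only [hw.deriv_periodic u, hw.per u]

theorem range_comp_const_add (s : ℝ) : range (fun u => w (s + u)) = range w :=
  (Equiv.addLeft s).surjective.range_comp w

/-- The integrand of `tanDefect`. -/
noncomputable def tanKernel (w : ℝ → ℂ) (x : ℂ × ℝ × ℝ) : ENNReal :=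
  if ‖x.1 - w x.2.1‖ ≤ 2 * infDist x.1 (range w) then
    ofReal (√(infDist x.1 (range w)) /
      (‖w (x.2.1 + x.2.2) - x.1‖ ^ 2 * √‖w (x.2.1 + x.2.2) - x.1‖) *
      ‖deriv w (x.2.1 + x.2.2) - deriv w x.2.1‖ ^ 2)
  else 0

/-- Local mean oscillation of the tangent seen from `p`. -/
noncomputable def tanDefect (w : ℝ → ℂ) (p : ℂ) : ENNReal :=
  ∫⁻ v in Ioc 0 (2 * π), ∫⁻ u in Ioc (-π) π, tanKernel w (p, v, u)

theorem measurable_tanKernel (hw : UnitCurve w) : Measurable (tanKernel w) := by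
  have hc := hw.continuous
  have hi : Continuous fun x : ℂ × ℝ × ℝ => infDist x.1 (range w) :=
    (continuous_infDist_pt _).comp continuous_fst
  refine Measurable.ite (measurableSet_le (by fun_prop) (by fun_prop)) ?_ measurable_const
  fun_prop

theorem measurable_lintegral_tanKernel (hw : UnitCurve w) :
    Measurable fun x : ℂ × ℝ => ∫⁻ u in Ioc (-π) π, tanKernel w (x.1, x.2, u) :=
  Measurable.lintegral_prod_right' (f := fun x : (ℂ × ℝ) × ℝ => tanKernel w (x.1.1, x.1.2, x.2))
    (hw.measurable_tanKernel.comp MeasurableEquiv.prodAssoc.measurable)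

theorem measurable_tanDefect (hw : UnitCurve w) : Measurable (tanDefect w) :=
  Measurable.lintegral_prod_right' hw.measurable_lintegral_tanKernel

theorem kernel_pointwise_le {d r ρ D : ℝ} (hd : 0 ≤ d) (hr : d ≤ r) (hr2 : r ≤ 2 * d)
    (hρ : d ≤ ρ) (hD : D ≤ r + ρ) (hD0 : 0 ≤ D) :
    √d / (ρ ^ 2 * √ρ) * (1 / d ^ 2) ≤ 300 * (1 / (r * √r * ((r + D) ^ 2 * √(r + D)))) := by
  rcases hd.eq_or_lt with rfl | hd
  · simp
    positivity
  have hr0 : 0 < r := by linarith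
  have hρ0 : 0 < ρ := by linarith
  have h1 : (r + D) ^ 2 ≤ 25 * ρ ^ 2 := by nlinarith
  have h2 : √(r + D) ≤ 3 * √ρ := by
    rw [show (3 : ℝ) * √ρ = √(9 * ρ) by
      rw [Real.sqrt_mul (by norm_num), show (9 : ℝ) = 3 ^ 2 by norm_num,
        Real.sqrt_sq (by norm_num)]]
    exact sqrt_le_sqrt (by linarith)
  have h3 : √d * (r * √r) ≤ 4 * d ^ 2 := by
    have : √d * √r ≤ r := by
      calc √d * √r ≤ √r * √r := by gcongr
        _ = r := mul_self_sqrt hr0.le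
    nlinarith
  have h4 : (r + D) ^ 2 * √(r + D) ≤ 75 * (ρ ^ 2 * √ρ) := by
    calc (r + D) ^ 2 * √(r + D) ≤ (25 * ρ ^ 2) * (3 * √ρ) := by gcongr
      _ = _ := by ring
  have e : √d / (ρ ^ 2 * √ρ) * (1 / d ^ 2) = √d / (ρ ^ 2 * √ρ * d ^ 2) := by
    field_simp
  rw [e, mul_one_div, div_le_div_iff₀ (by positivity) (by positivity)]
  calc √d * (r * √r * ((r + D) ^ 2 * √(r + D)))
      = (√d * (r * √r)) * ((r + D) ^ 2 * √(r + D)) := by ring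
    _ ≤ (4 * d ^ 2) * (75 * (ρ ^ 2 * √ρ)) := by gcongr
    _ = _ := by ring

theorem lintegral_tanDefect_lt_top (hw : UnitCurve w) (hE : moebiusEnergy w < ⊤) :
    ∫⁻ p, tanDefect w p * ofReal (1 / infDist p (range w) ^ 2) < ⊤ := by
  obtain ⟨κ, hκ, hκ1, hca⟩ := hw.exists_chord_arc hE
  set Φ : ℂ × ℝ × ℝ → ENNReal := fun x =>
    tanKernel w x * ofReal (1 / infDist x.1 (range w) ^ 2) with hΦ
  have hΦm : Measurable Φ := hw.measurable_tanKernel.mul (by fun_prop)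
  have e1 : ∀ p, tanDefect w p * ofReal (1 / infDist p (range w) ^ 2) =
      ∫⁻ v in Ioc 0 (2 * π), ∫⁻ u in Ioc (-π) π, Φ (p, v, u) := by
    intro p
    rw [tanDefect, ← lintegral_mul_const' _ _ ofReal_ne_top]
    refine lintegral_congr fun v => ?_
    rw [← lintegral_mul_const' _ _ ofReal_ne_top]
  have hpt : ∀ v u : ℝ, u ∈ Ioc (-π) π → ∫⁻ p, Φ (p, v, u) ≤
      ofReal (1200 * π / κ ^ 2) *
        ofReal (‖deriv w (v + u) - deriv w v‖ ^ 2 / u ^ 2) := by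
    intro v u hu
    rcases eq_or_ne u 0 with rfl | hu0
    · simp [hΦ, tanKernel]
    have hD : κ * |u| ≤ ‖w (v + u) - w v‖ := hca v u (abs_le.2 ⟨hu.1.le, hu.2⟩)
    have hD0 : 0 < κ * |u| := mul_pos hκ (abs_pos.2 hu0)
    set D := κ * |u|
    calc ∫⁻ p, Φ (p, v, u) ≤ ∫⁻ p, ofReal (300 * ‖deriv w (v + u) - deriv w v‖ ^ 2) *
          ofReal (1 / (‖p - w v‖ * √‖p - w v‖ *
            ((‖p - w v‖ + D) ^ 2 * √(‖p - w v‖ + D)))) := by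
          refine lintegral_mono fun p => ?_
          simp only [hΦ, tanKernel]
          split_ifs with hp
          · rw [← ofReal_mul (by positivity), ← ofReal_mul (by positivity)]
            refine ofReal_le_ofReal ?_
            have k1 : infDist p (range w) ≤ ‖p - w v‖ := by
              rw [← dist_eq_norm]
              exact infDist_le_dist_of_mem ⟨v, rfl⟩
            have k2 : infDist p (range w) ≤ ‖w (v + u) - p‖ := by
              rw [← dist_eq_norm, dist_comm]
              exact infDist_le_dist_of_mem ⟨v + u, rfl⟩
            have k3 : ‖w (v + u) - w v‖ ≤ ‖p - w v‖ + ‖w (v + u) - p‖ := by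
              exact (norm_sub_le_norm_sub_add_norm_sub (w (v + u)) p (w v)).trans_eq (add_comm _ _)
            have := kernel_pointwise_le infDist_nonneg k1 hp k2 (hD.trans k3) hD0.le
            have := mul_le_mul_of_nonneg_right this (sq_nonneg ‖deriv w (v + u) - deriv w v‖)
            refine (le_of_eq ?_).trans (this.trans_eq ?_) <;> ring
          · simp
      _ ≤ ofReal (300 * ‖deriv w (v + u) - deriv w v‖ ^ 2) *
          ofReal (4 * π / D ^ 2) := by
          rw [lintegral_ofReal_mul]
          exact mul_le_mul_right (lintegral_kernel_le _ hD0) _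
      _ = _ := by
          rw [← ofReal_mul (by positivity), ← ofReal_mul (by positivity)]
          congr 1
          have : D ^ 2 = κ ^ 2 * u ^ 2 := by rw [mul_pow, sq_abs]
          rw [this]
          field_simp
          ring
  simp only [e1]
  rw [lintegral_lintegral_swap (f := fun p v => ∫⁻ u in Ioc (-π) π, Φ (p, v, u))]
  · calc _ ≤ ∫⁻ v in Ioc 0 (2 * π), ofReal (1200 * π / κ ^ 2) * tanEnergy w v := by
          refine lintegral_mono fun v => ?_
          rw [lintegral_lintegral_swap (f := fun p u => Φ (p, v, u)), tanEnergy,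
            ← lintegral_ofReal_mul]
          · exact setLIntegral_mono' measurableSet_Ioc fun u hu => hpt v u hu
          · exact Measurable.aemeasurable (hΦm.comp (by fun_prop))
      _ < ⊤ := by
          rw [lintegral_ofReal_mul]
          exact mul_lt_top ofReal_lt_top (hw.lintegral_tanEnergy_lt_top hE)
  · refine Measurable.aemeasurable ?_
    exact Measurable.lintegral_prod_right' (f := fun x : (ℂ × ℝ) × ℝ => Φ (x.1.1, x.1.2, x.2))
      (hΦm.comp MeasurableEquiv.prodAssoc.measurable)

end UnitCurve

theorem integral_sqrt_div_add_abs_le {d : ℝ} (hd : 0 < d) {T : ℝ} (hT : 0 ≤ T) :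
    ∫ u in -T..T, √d / ((d + |u|) * √(d + |u|)) ≤ 4 := by
  have hpos : ∀ u : ℝ, 0 < d + |u| := fun u => by positivity
  have hc : Continuous fun u : ℝ => √d / ((d + |u|) * √(d + |u|)) :=
    continuous_const.div (by fun_prop) fun u => by have := hpos u; positivity
  rw [intervalIntegral_neg_self_eq_add (hc.intervalIntegrable _ _) hT]
  have h : ∫ u in 0..T, √d / ((d + |u|) * √(d + |u|)) = 2 - 2 * √d / √(d + T) := by
    have hder : ∀ u ∈ uIcc 0 T, HasDerivAt (fun u => -(2 * √d / √(d + u)))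
        (√d / ((d + |u|) * √(d + |u|))) u := by
      intro u hu
      rw [uIcc_of_le hT] at hu
      have h0 : 0 < d + u := by linarith [hu.1]
      rw [abs_of_nonneg hu.1]
      have h1 := (((hasDerivAt_id u).const_add d).sqrt h0.ne')
      refine (((hasDerivAt_const u (2 * √d)).div h1 (sqrt_pos.2 h0).ne').neg).congr_deriv ?_
      have h2 := sq_sqrt h0.le
      simp only [id]
      rw [h2]
      field_simp
      ring
    rw [intervalIntegral.integral_eq_sub_of_hasDerivAt hder (hc.intervalIntegrable _ _)]
    have : √d ≠ 0 := (sqrt_pos.2 hd).ne'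
    rw [add_zero, mul_div_assoc, mul_div_assoc, div_self this]
    ring
  simp only [abs_neg]
  rw [h]
  have : 0 ≤ 2 * √d / √(d + T) := by positivity
  linarith

theorem ofReal_sq_integral_weight_le {f : ℝ → ℝ} (hf : Measurable f) (hf0 : ∀ u, 0 ≤ f u)
    {M : ℝ} (hfM : ∀ u, f u ≤ M) {d : ℝ} (hd : 0 < d) :
    ofReal ((d * ∫ u in (-π)..π, f u / (d + |u|) ^ 2) ^ 2) ≤
      4 * ∫⁻ u in Ioc (-π) π,
        ofReal (d * √d / ((d + |u|) ^ 2 * √(d + |u|)) * f u ^ 2) := by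
  have hπ := pi_pos
  have hpos : ∀ u : ℝ, 0 < d + |u| := fun u => by positivity
  have hi : ∀ (g k : ℝ → ℝ), Continuous g → (∃ C, ∀ u, |k u| ≤ C) → Measurable k →
      IntervalIntegrable (fun u => g u * k u) volume (-π) π := by
    rintro g k hg ⟨C, hC⟩ hk
    refine IntervalIntegrable.continuousOn_mul ?_ hg.continuousOn
    rw [intervalIntegrable_iff, uIoc_of_le (by linarith)]
    exact Integrable.of_bound hk.aestronglyMeasurable C (Eventually.of_forall hC)
  have hfb : ∃ C, ∀ u, |f u| ≤ C := ⟨M, fun u => by rw [abs_of_nonneg (hf0 u)]; exact hfM u⟩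
  have hfb2 : ∃ C, ∀ u, |f u ^ 2| ≤ C := ⟨M ^ 2, fun u => by
    rw [abs_of_nonneg (sq_nonneg _)]
    exact pow_le_pow_left₀ (hf0 u) (hfM u) 2⟩
  have hcW : Continuous fun u : ℝ => d * √d / ((d + |u|) ^ 2 * √(d + |u|)) :=
    continuous_const.div (by fun_prop) fun u => by have := hpos u; positivity
  have hcV : Continuous fun u : ℝ => √d / ((d + |u|) * √(d + |u|)) :=
    continuous_const.div (by fun_prop) fun u => by have := hpos u; positivity
  have hc2 : Continuous fun u : ℝ => d / (d + |u|) ^ 2 :=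
    continuous_const.div (by fun_prop) fun u => by have := hpos u; positivity
  have iW := hi _ (fun u => f u ^ 2) hcW hfb2 (hf.pow_const 2)
  have iF := hi _ f hc2 hfb hf
  have hW0 : ∀ u, 0 ≤ d * √d / ((d + |u|) ^ 2 * √(d + |u|)) * f u ^ 2 := fun u => by
    have := hpos u
    positivity
  rw [← ofReal_integral_eq_lintegral_ofReal
    ((intervalIntegrable_iff_integrableOn_Ioc_of_le (by linarith)).1 iW)
    (Eventually.of_forall hW0), ← intervalIntegral.integral_of_le (by linarith),
    show (4 : ENNReal) = ofReal 4 by norm_num, ← ofReal_mul (by norm_num)]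
  refine ofReal_le_ofReal ?_
  set t := ∫ u in (-π)..π, d * √d / ((d + |u|) ^ 2 * √(d + |u|)) * f u ^ 2
  have ht : 0 ≤ t := intervalIntegral.integral_nonneg (by linarith) fun u _ => hW0 u
  have eb : d * ∫ u in (-π)..π, f u / (d + |u|) ^ 2 =
      ∫ u in (-π)..π, d / (d + |u|) ^ 2 * f u := by
    rw [← intervalIntegral.integral_const_mul]
    congr 1
    ext u
    ring
  rw [eb]
  set b := ∫ u in (-π)..π, d / (d + |u|) ^ 2 * f u
  have hb0 : 0 ≤ b := intervalIntegral.integral_nonneg (by linarith) fun u _ =>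
    mul_nonneg (by have := hpos u; positivity) (hf0 u)
  rcases hb0.eq_or_lt with h | hb
  · rw [← h]
    nlinarith
  have hpt : ∀ u ∈ Icc (-π) π, d / (d + |u|) ^ 2 * f u ≤
      2 / b * (d * √d / ((d + |u|) ^ 2 * √(d + |u|)) * f u ^ 2) +
        b / 8 * (√d / ((d + |u|) * √(d + |u|))) := by
    intro u _
    have h0 := hpos u
    have g1 := sq_sqrt hd.le
    have g2 := sq_sqrt h0.le
    set x := √d
    set y := √(d + |u|)
    rw [← g2, ← g1]
    have key : 2 / b * (x ^ 2 * x / ((y ^ 2) ^ 2 * y) * f u ^ 2) + b / 8 * (x / (y ^ 2 * y)) -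
        x ^ 2 / (y ^ 2) ^ 2 * f u = x / (8 * b * y ^ 5) * (4 * x * f u - b * y) ^ 2 := by
      field_simp
      ring
    have : 0 ≤ x / (8 * b * y ^ 5) * (4 * x * f u - b * y) ^ 2 := by positivity
    linarith
  have hintv := intervalIntegral.integral_mono_on (by linarith) iF
    ((iW.const_mul (2 / b)).add ((hcV.intervalIntegrable _ _).const_mul (b / 8))) hpt
  rw [intervalIntegral.integral_add (iW.const_mul _) ((hcV.intervalIntegrable _ _).const_mul _),
    intervalIntegral.integral_const_mul, intervalIntegral.integral_const_mul] at hintv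
  have hV := integral_sqrt_div_add_abs_le hd hπ.le
  have h2 : b ≤ 2 / b * t + b / 8 * 4 := hintv.trans (by gcongr)
  have h3 : b / 2 ≤ 2 * t / b := by
    rw [div_mul_eq_mul_div] at h2
    linarith
  rw [le_div_iff₀ hb] at h3
  nlinarith

namespace UnitCurve

variable {w : ℝ → ℂ}

/-- Choice of an approximate tangent direction `e` at the scale `d`. -/
theorem exists_unit_direction (hw : UnitCurve w) {κ : ℝ} (hκ : 0 < κ)
    (hca : ∀ s L, |L| ≤ π → κ * |L| ≤ ‖w (s + L) - w s‖) {p : ℂ} {s d : ℝ} (hd : 0 < d)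
    (hd1 : d ≤ 1 / 2) (hdp : infDist p (range w) = d) (hs : ‖p - w s‖ = d) :
    ∃ e : ℂ, ‖e‖ = 1 ∧
      ofReal ((d * ∫ u in (-π)..π, ‖deriv w (s + u) - e‖ / (d + |u|) ^ 2) ^ 2) ≤
        2 * tanDefect w p ∧
      ofReal ((d * ∫ u in (-π)..π, ‖deriv w (s + u) - e‖ / (d + |u|) ^ 2) ^ 2) ≤
        ofReal (8 / κ ^ 2) * ∫⁻ v in Ioc (s - d) (s + d), tanEnergy w v := by
  set S := Ioc (s - d) (s + d)
  have hvol : volume S = ofReal (2 * d) := by rw [volume_Ioc]; ring_nf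
  set TE : ℝ → ENNReal := fun v => ∫⁻ u in Ioc (-π) π,
    ofReal (d * √d / ((d + |u|) ^ 2 * √(d + |u|)) * ‖deriv w (s + u) - deriv w v‖ ^ 2)
    with hTE
  have hTEm : Measurable TE := by
    refine Measurable.lintegral_prod_right' (f := fun x : ℝ × ℝ => ofReal
      (d * √d / ((d + |x.2|) ^ 2 * √(d + |x.2|)) * ‖deriv w (s + x.2) - deriv w x.1‖ ^ 2)) ?_
    fun_prop
  have hnull : (volume.restrict S) (Sᶜ ∪ {v | ¬ ‖deriv w v‖ = 1}) = 0 := by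
    refine measure_union_null ?_ ?_
    · rw [Measure.restrict_apply measurableSet_Ioc.compl, compl_inter_self, measure_empty]
    · exact ae_restrict_of_ae (hw.hasDerivAt.mono fun v hv => hv.2)
  have hI0 : volume.restrict S ≠ 0 := by
    rw [Ne, Measure.restrict_eq_zero, hvol]
    simp [hd]
  obtain ⟨v, hvn, hv⟩ := exists_notMem_null_le_laverage hI0 hTEm.aemeasurable hnull
  rw [mem_union, not_or, notMem_compl_iff] at hvn
  have hv1 : ‖deriv w v‖ = 1 := by simpa using hvn.2
  have havg : TE v ≤ ofReal (1 / (2 * d)) * ∫⁻ v in S, TE v := by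
    refine hv.trans_eq ?_
    rw [laverage_eq, Measure.restrict_apply_univ, hvol, ENNReal.div_eq_inv_mul,
      ← ofReal_inv_of_pos (by positivity), one_div]
  have hcs : ofReal ((d * ∫ u in (-π)..π,
      ‖deriv w (s + u) - deriv w v‖ / (d + |u|) ^ 2) ^ 2) ≤ 4 * TE v :=
    ofReal_sq_integral_weight_le (M := 2) (by fun_prop) (fun u => norm_nonneg _) (fun u => by
      have h1 := hw.norm_deriv_le (s + u)
      have h2 := hw.norm_deriv_le v
      exact (_root_.norm_sub_le _ _).trans (by linarith)) hd
  have hρ : ∀ u, ‖w (s + u) - p‖ ≤ d + |u| := by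
    intro u
    have h1 := norm_sub_le_norm_sub_add_norm_sub (w (s + u)) (w s) p
    have h2 := hw.norm_sub_le (s + u) s
    rw [add_sub_cancel_left] at h2
    rw [norm_sub_rev] at hs
    linarith
  have hρd : ∀ u, d ≤ ‖w u - p‖ := by
    intro u
    rw [← hdp, ← dist_eq_norm, dist_comm]
    exact infDist_le_dist_of_mem ⟨u, rfl⟩
  have hshift : ∀ (c : ℂ → ℝ) (v : ℝ),
      ∫⁻ u in Ioc (-π) π, ofReal (c (w (s + u)) * ‖deriv w (s + u) - deriv w v‖ ^ 2) =
      ∫⁻ u in Ioc (-π) π,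
        ofReal (c (w (v + u)) * ‖deriv w (v + u) - deriv w v‖ ^ 2) := by
    intro c v
    have hg : Periodic
        (fun x => ofReal (c (w x) * ‖deriv w x - deriv w v‖ ^ 2)) (2 * π) := fun x => by
      simp only [hw.deriv_periodic x, hw.per x]
    have h1 := hg.setLIntegral_Ioc_add two_pi_pos (-π) s
    have h2 := hg.setLIntegral_Ioc_add two_pi_pos (-π) v
    rw [show -π + 2 * π = π by ring] at h1 h2
    simp only [add_comm s, add_comm v]
    rw [h1, h2]
  have hsv : ∀ v ∈ S, |s - v| ≤ d := fun v hv => abs_le.2 ⟨by linarith [hv.2], by linarith [hv.1]⟩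
  have hfin : ∀ c X, ∫⁻ v in S, TE v ≤ ofReal c * X →
      4 * TE v ≤ ofReal (2 / d * c) * X := fun c X h => by
    calc 4 * TE v ≤ 4 * (ofReal (1 / (2 * d)) * (ofReal c * X)) := by
          gcongr
          exact havg.trans (mul_le_mul_right h _)
      _ = _ := by
          rw [← mul_assoc, ← mul_assoc, show (4 : ENNReal) = ofReal 4 by norm_num,
            ← ofReal_mul (by norm_num), ← ofReal_mul (by positivity)]
          congr 2
          ring
  refine ⟨deriv w v, hv1, hcs.trans ?_, hcs.trans ?_⟩
  · -- comparison with the defect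
    have h1 : ∀ v ∈ S, TE v ≤ ofReal d * ∫⁻ u in Ioc (-π) π, tanKernel w (p, v, u) := by
      intro v hvI
      have hpv : ‖p - w v‖ ≤ 2 * d := by
        have h1 := norm_sub_le_norm_sub_add_norm_sub p (w s) (w v)
        have h2 := hw.norm_sub_le s v
        linarith [hsv v hvI]
      rw [← lintegral_ofReal_mul]
      calc TE v ≤ ∫⁻ u in Ioc (-π) π, ofReal (d * (√d / (‖w (s + u) - p‖ ^ 2 *
            √‖w (s + u) - p‖)) * ‖deriv w (s + u) - deriv w v‖ ^ 2) := by
            refine lintegral_mono fun u => ofReal_le_ofReal ?_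
            have h1 := hρ u
            have h2 : 0 < ‖w (s + u) - p‖ := hd.trans_le (hρd _)
            rw [mul_div_assoc]
            gcongr
        _ = _ := hshift (fun z => d * (√d / (‖z - p‖ ^ 2 * √‖z - p‖))) v
        _ = _ := by
            refine lintegral_congr fun u => ?_
            simp only [tanKernel, hdp]
            rw [if_pos hpv, ← ofReal_mul hd.le, mul_assoc]
    have h2 : ∫⁻ v in S, TE v ≤ ofReal d * tanDefect w p := by
      have hG : Periodic (fun v => ∫⁻ u in Ioc (-π) π, tanKernel w (p, v, u))
          (2 * π) := by
        intro v
        refine lintegral_congr fun u => ?_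
        simp only [tanKernel]
        rw [add_right_comm, hw.deriv_periodic, hw.deriv_periodic, hw.per, hw.per]
      calc ∫⁻ v in S, TE v ≤ ∫⁻ v in S, ofReal d *
            ∫⁻ u in Ioc (-π) π, tanKernel w (p, v, u) :=
            setLIntegral_mono' measurableSet_Ioc h1
        _ = ofReal d * ∫⁻ v in S, ∫⁻ u in Ioc (-π) π, tanKernel w (p, v, u) :=
            lintegral_ofReal_mul
        _ ≤ ofReal d * ∫⁻ v in Ioc (s - d) (s - d + 2 * π),
              ∫⁻ u in Ioc (-π) π, tanKernel w (p, v, u) := by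
            refine mul_le_mul_right (lintegral_mono_set (Ioc_subset_Ioc_right ?_)) _
            linarith [pi_gt_three]
        _ = _ := by
            rw [hG.setLIntegral_Ioc_eq two_pi_pos _ 0, zero_add, tanDefect]
    refine (hfin d _ h2).trans_eq ?_
    rw [div_mul_cancel₀ _ hd.ne', ENNReal.ofReal_ofNat]
  · -- smallness
    have h1 : ∀ v ∈ S, TE v ≤ ofReal (4 * d / κ ^ 2) * tanEnergy w v := by
      intro v hvI
      rw [tanEnergy, ← lintegral_ofReal_mul]
      calc TE v ≤ ∫⁻ u in Ioc (-π) π, ofReal (4 * d / (d + ‖w (s + u) - w v‖) ^ 2 *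
            ‖deriv w (s + u) - deriv w v‖ ^ 2) := by
            refine lintegral_mono fun u => ofReal_le_ofReal ?_
            refine mul_le_mul_of_nonneg_right ?_ (sq_nonneg _)
            have h2 := hw.norm_sub_le (s + u) v
            have h3 : |s + u - v| ≤ d + |u| := by
              rw [show s + u - v = (s - v) + u by ring]
              exact (abs_add_le _ _).trans (by linarith [hsv v hvI])
            have h4 : d + ‖w (s + u) - w v‖ ≤ 2 * (d + |u|) := by linarith [abs_nonneg u]
            have h5 : √d ≤ √(d + |u|) := sqrt_le_sqrt (by linarith [abs_nonneg u])
            have h6 : 0 < d + |u| := by positivity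
            have h7 : 0 < d + ‖w (s + u) - w v‖ := by positivity
            have h8 : (d + ‖w (s + u) - w v‖) ^ 2 ≤ 4 * (d + |u|) ^ 2 := by nlinarith
            rw [div_le_div_iff₀ (by positivity) (by positivity)]
            calc d * √d * (d + ‖w (s + u) - w v‖) ^ 2 ≤ d * √(d + |u|) * (4 * (d + |u|) ^ 2) := by
                  gcongr
              _ = _ := by ring
        _ = _ := hshift (fun z => 4 * d / (d + ‖z - w v‖) ^ 2) v
        _ ≤ _ := by
            refine setLIntegral_mono' measurableSet_Ioc fun u hu => ?_
            rw [← ofReal_mul (by positivity)]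
            refine ofReal_le_ofReal ?_
            rcases eq_or_ne u 0 with rfl | hu0
            · simp
            have h2 := hca v u (abs_le.2 ⟨hu.1.le, hu.2⟩)
            have h4 : κ ^ 2 * u ^ 2 ≤ (d + ‖w (v + u) - w v‖) ^ 2 := by
              rw [← sq_abs u, ← mul_pow]
              gcongr
              linarith
            calc 4 * d / (d + ‖w (v + u) - w v‖) ^ 2 * ‖deriv w (v + u) - deriv w v‖ ^ 2
                ≤ 4 * d / (κ ^ 2 * u ^ 2) * ‖deriv w (v + u) - deriv w v‖ ^ 2 := by
                  gcongr
              _ = _ := by field_simp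
    refine (hfin (4 * d / κ ^ 2) (∫⁻ v in S, tanEnergy w v) ?_).trans_eq ?_
    · rw [← lintegral_ofReal_mul]
      exact setLIntegral_mono' measurableSet_Ioc h1
    · rw [show 2 / d * (4 * d / κ ^ 2) = 8 / κ ^ 2 by field_simp; norm_num]

end UnitCurve

/-- A reflection `R` across the curve `w` defined near `range w` on `Ω`: its Wirtinger derivatives
are `A` and `B`, and `A` is controlled by the square-integrable defect `D`. -/
structure ReflectionData (w : ℝ → ℂ) (Ω : Set ℂ) (δ C : ℝ) (R A B : ℂ → ℂ) (D : ℂ → ENNReal) :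
    Prop where
  pos : 0 < δ
  const_pos : 0 < C
  measurable_defect : Measurable D
  lintegral_defect : ∫⁻ p, D p * ofReal (1 / infDist p (range w) ^ 2) < ⊤
  hasFDerivAt : ∀ p ∈ Ω, infDist p (range w) < δ → HasFDerivAt R (wirtingerMap (A p) (B p)) p
  norm_fst_sq_le : ∀ p ∈ Ω, infDist p (range w) < δ →
    ofReal (‖A p‖ ^ 2) ≤ ofReal C * D p
  norm_fst_le : ∀ p ∈ Ω, infDist p (range w) < δ → ‖A p‖ ≤ C
  norm_snd_le : ∀ p ∈ Ω, infDist p (range w) < δ → ‖B p‖ ≤ C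
  norm_sub_le : ∀ p ∈ Ω, infDist p (range w) < δ → ‖R p - p‖ ≤ C * infDist p (range w)
  le_norm_sub : ∀ p ∈ Ω, infDist p (range w) < δ → ∀ ζ ∈ Ω,
    infDist p (range w) + ‖p - ζ‖ ≤ C * ‖R p - ζ‖

namespace UnitCurve

variable {w : ℝ → ℂ}

theorem infDist_pos (hw : UnitCurve w) {p : ℂ} (hp : p ∉ range w) :
    0 < infDist p (range w) := by
  obtain ⟨d, hd, h⟩ := hw.exists_pos_le_norm_sub hp
  refine hd.trans_le ((le_infDist (range_nonempty w)).2 ?_)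
  rintro _ ⟨u, rfl⟩
  rw [dist_comm, dist_eq_norm]
  exact h u

theorem isCompact_range (hw : UnitCurve w) : IsCompact (range w) := by
  rw [← hw.per.image_Icc two_pi_pos 0]
  exact isCompact_Icc.image hw.continuous

theorem exists_locallyFlat (hw : UnitCurve w) (hE : moebiusEnergy w < ⊤) :
    ∃ κ > 0, ∃ δ > 0, ∀ p ∉ range w, infDist p (range w) < δ →
      ∃ s b e, LocallyFlat (fun u => w (s + u)) κ (infDist p (range w)) b p e ∧ b ≤ 1 ∧
        ofReal (b ^ 2) ≤ 2 * tanDefect w p := by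
  obtain ⟨κ, hκ, hκ1, hca⟩ := hw.exists_chord_arc hE
  set b0 := (κ / 6) ^ 4 / 8 with hb0
  have hb0pos : 0 < b0 := by positivity
  obtain ⟨δ, hδ, -, hsm⟩ := hw.exists_forall_lintegral_tanEnergy_lt hE
    (ε := ofReal (κ ^ 2 / 8 * b0 ^ 2)) (ENNReal.ofReal_pos.2 (by positivity))
  refine ⟨κ, hκ, min δ (1 / 2), lt_min hδ (by norm_num), fun p hp hpd => ?_⟩
  have hd := hw.infDist_pos hp
  obtain ⟨_, ⟨s, rfl⟩, hs⟩ := hw.isCompact_range.exists_infDist_eq_dist (range_nonempty w) p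
  have hd1 : infDist p (range w) ≤ 1 / 2 := hpd.le.trans (min_le_right _ _)
  have hdδ : infDist p (range w) ≤ δ := hpd.le.trans (min_le_left _ _)
  rw [dist_eq_norm] at hs
  obtain ⟨e, he, h1, h2⟩ := hw.exists_unit_direction hκ hca hd hd1 rfl hs.symm
  set d := infDist p (range w) with hdef
  set b := d * ∫ u in (-π)..π, ‖deriv w (s + u) - e‖ / (d + |u|) ^ 2 with hb
  have hbb : b ≤ b0 := by
    have h3 : ofReal (b ^ 2) ≤ ofReal (b0 ^ 2) := by
      calc ofReal (b ^ 2) ≤ ofReal (8 / κ ^ 2) *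
            ofReal (κ ^ 2 / 8 * b0 ^ 2) := h2.trans (mul_le_mul_right
              ((lintegral_mono_set (Ioc_subset_Ioc (by linarith) (by linarith))).trans
                (hsm s).le) _)
        _ = _ := by
            rw [← ofReal_mul (by positivity)]
            congr 1
            field_simp
    rw [ofReal_le_ofReal_iff (by positivity)] at h3
    exact (le_abs_self b).trans (abs_le_of_sq_le_sq h3 hb0pos.le)
  refine ⟨s, b, e, ⟨hw.comp_const_add s, hκ, hκ1, hd, hd1, ?_, ?_, ?_, he, ?_, ?_⟩, ?_, h1⟩
  · simpa using hs.symm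
  · intro u
    rw [hdef, ← dist_eq_norm, dist_comm]
    exact infDist_le_dist_of_mem ⟨s + u, rfl⟩
  · intro u hu
    simpa using hca s u hu
  · rw [deriv_comp_const_add', hb, mul_div_cancel_left₀ _ hd.ne']
  · rw [hb0] at hbb
    linarith
  · refine hbb.trans ?_
    have : (κ / 6) ^ 4 ≤ 1 := pow_le_one₀ (by positivity) (by linarith)
    rw [hb0]
    linarith

theorem exists_reflectionData (hw : UnitCurve w) (hE : moebiusEnergy w < ⊤) {Ω Ωs : Set ℂ}
    (hΩ : IsOpen Ω) (hΩc : IsPreconnected Ω) (hΩs : IsOpen Ωs) (hΩsc : IsPreconnected Ωs)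
    (hdisj : Disjoint Ω Ωs) (hunion : Ω ∪ Ωs = (range w)ᶜ) (hub : ¬ IsBounded Ωs) :
    ∃ δ C R A B D, ReflectionData w Ω δ C R A B D := by
  have hΩw : Disjoint Ω (range w) := Set.disjoint_left.2 fun z hz hz' =>
    (hunion ▸ mem_union_left Ωs hz : z ∈ (range w)ᶜ) hz'
  have hΩsw : Disjoint Ωs (range w) := Set.disjoint_left.2 fun z hz hz' =>
    (hunion ▸ mem_union_right Ω hz : z ∈ (range w)ᶜ) hz'
  obtain ⟨n, hn⟩ := hw.exists_cauchyIndex_eq hΩ hΩc hΩw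
  have hs := hw.cauchyIndex_eq_zero hΩs hΩsc hΩsw hub
  obtain ⟨κ, hκ, δ, hδ, hflat⟩ := hw.exists_locallyFlat hE
  set C1 := (3 + ‖n‖) * (216 / κ ^ 3)
  set C2 := ‖n‖ * (18 / κ ^ 2)
  set C3 := 1 + (1 + ‖n‖) * (12 / κ)
  have hC1 : 0 < C1 := by positivity
  have hC2 : 0 ≤ C2 := by positivity
  have hC3 : 0 < C3 := by positivity
  set C := 2 * C1 ^ 2 + C1 + C2 + C3 + ‖n‖
  have hn0 := norm_nonneg n
  have hsq := sq_nonneg C1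
  have main : ∀ p ∈ Ω, infDist p (range w) < δ → ∃ b, 0 ≤ b ∧ b ≤ 1 ∧
      ofReal (b ^ 2) ≤ 2 * tanDefect w p ∧
      ‖1 + n * conjCauchy w 2 1 p / conjCauchy w 1 1 p ^ 2‖ ≤ C1 * b ∧
      ‖n * conjCauchy w 1 2 p / conjCauchy w 1 1 p ^ 2‖ ≤ C2 ∧
      ‖n / conjCauchy w 1 1 p‖ ≤ ‖n‖ * infDist p (range w) ∧
      conjCauchy w 1 1 p ≠ 0 ∧
      ∀ ζ ∈ Ω, infDist p (range w) + ‖p - ζ‖ ≤ C3 * ‖p - n / conjCauchy w 1 1 p - ζ‖ := by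
    intro p hp hpd
    obtain ⟨s, b, e, h, hb1, hb⟩ := hflat p (Set.disjoint_left.1 hΩw hp) hpd
    have h0 := h.one_div_le_norm_conjCauchy
    obtain ⟨h1, h2, h3, h4⟩ := h.reflection_estimates (Ω := Ω) (Ωs := Ωs) (n := n) hΩ hΩs hdisj
      (by rw [range_comp_const_add, hunion])
      (fun z hz => by rw [hw.cauchyIndex_comp_const_add, hn z hz])
      (fun z hz => by rw [hw.cauchyIndex_comp_const_add, hs z hz]) hp
    simp only [hw.conjCauchy_comp_const_add] at h0 h1 h2 h3 h4
    exact ⟨b, h.b_nonneg, hb1, hb, h1, h2, h3,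
      norm_pos_iff.1 (lt_of_lt_of_le (one_div_pos.2 h.dpos) h0), h4⟩
  refine ⟨δ, C, fun p => p - n / conjCauchy w 1 1 p,
    fun p => 1 + n * conjCauchy w 2 1 p / conjCauchy w 1 1 p ^ 2,
    fun p => n * conjCauchy w 1 2 p / conjCauchy w 1 1 p ^ 2, tanDefect w,
    hδ, by positivity, hw.measurable_tanDefect, hw.lintegral_tanDefect_lt_top hE, ?_, ?_, ?_, ?_,
    ?_, ?_⟩
  · intro p hp hpd
    obtain ⟨b, -, -, -, -, -, -, hY, -⟩ := main p hp hpd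
    obtain ⟨d, hd, hdp⟩ := hw.exists_pos_le_norm_sub (Set.disjoint_left.1 hΩw hp)
    have h1 := hw.hasFDerivAt_conjCauchy hd hdp
    have h2 := ((hasFDerivAt_inv' (𝕜 := ℝ) hY).comp p h1).const_mul n
    simp only [div_eq_mul_inv n]
    refine ((hasFDerivAt_id p).sub h2).congr_fderiv (ContinuousLinearMap.ext fun v => ?_)
    simp
    field_simp
    ring
  · intro p hp hpd
    obtain ⟨b, hb0, -, hb, hA, -⟩ := main p hp hpd
    calc _ ≤ ofReal (C1 ^ 2 * b ^ 2) := by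
          refine ofReal_le_ofReal ?_
          rw [← mul_pow]
          gcongr
      _ = ofReal (C1 ^ 2) * ofReal (b ^ 2) := ofReal_mul (by positivity)
      _ ≤ ofReal (C1 ^ 2) * (2 * tanDefect w p) := mul_le_mul_right hb _
      _ = ofReal (2 * C1 ^ 2) * tanDefect w p := by
          rw [← mul_assoc, mul_comm (2 : ℝ), ofReal_mul (by positivity),
            show ofReal 2 = 2 by norm_num]
      _ ≤ _ := by
          gcongr
          linarith
  · intro p hp hpd
    obtain ⟨b, hb0, hb1, hb, hA, -⟩ := main p hp hpd
    have : C1 * b ≤ C1 * 1 := by gcongr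
    linarith
  · intro p hp hpd
    obtain ⟨b, -, -, -, -, hB, -⟩ := main p hp hpd
    linarith
  · intro p hp hpd
    obtain ⟨b, -, -, -, -, -, hR, -⟩ := main p hp hpd
    rw [sub_sub_cancel_left, norm_neg]
    refine hR.trans ?_
    have := infDist_nonneg (x := p) (s := range w)
    gcongr
    linarith
  · intro p hp hpd ζ hζ
    obtain ⟨b, -, -, -, -, -, -, -, hR⟩ := main p hp hpd
    refine (hR ζ hζ).trans ?_
    gcongr
    linarith

end UnitCurve

theorem eq_wirtingerMap (L : ℂ →L[ℝ] ℂ) :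
    L = wirtingerMap ((L 1 - I * L I) / 2)
      ((L 1 + I * L I) / 2) := by
  refine ContinuousLinearMap.ext fun v => ?_
  conv_lhs => rw [← re_add_im v, show (v.re : ℂ) + v.im * I =
    v.re • (1 : ℂ) + v.im • I by simp, map_add, map_smul, map_smul]
  rw [wirtingerMap_apply]
  have h1 := re_add_im v
  have h2 : conj v = v.re - v.im * I := by
    apply Complex.ext <;> simp
  rw [h2, real_smul, real_smul]
  nth_rw 3 [← h1]
  linear_combination (L I * v.im) * Complex.I_sq

theorem exists_contDiff_cutoff (Γ : Set ℂ) {a b : ℝ} (hab : a < b) :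
    ∃ χ : ℂ → ℝ, ContDiff ℝ 1 χ ∧ (∀ p, infDist p Γ ≤ a → χ p = 1) ∧
      (∀ p, b ≤ infDist p Γ → χ p = 0) ∧ ∀ p, χ p ∈ Icc (0 : ℝ) 1 := by
  have hc : Continuous fun p => infDist p Γ := continuous_infDist_pt Γ
  obtain ⟨f, h0, h1, h2⟩ := exists_contMDiffMap_zero_one_of_isClosed (n := 1) (modelWithCornersSelf ℝ ℂ)
    (s := {p | b ≤ infDist p Γ}) (t := {p | infDist p Γ ≤ a})
    (isClosed_le continuous_const hc) (isClosed_le hc continuous_const)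
    (Set.disjoint_left.2 fun p hp hp' => by
      have h1 : b ≤ infDist p Γ := hp
      have h2 : infDist p Γ ≤ a := hp'
      linarith)
  exact ⟨f, f.contMDiff.contDiff, fun p hp => h1 hp, fun p hp => h0 hp, fun p => h2 p⟩

theorem exists_wirtinger_cutoff {Γ Ω : Set ℂ} (hΩ : IsBounded Ω) {a b : ℝ} (hab : a < b) :
    ∃ χ α β : ℂ → ℂ, ∃ M > 0, (∀ p, HasFDerivAt χ (wirtingerMap (α p) (β p)) p) ∧
      (∀ p, infDist p Γ ≤ a → χ p = 1) ∧ (∀ p, b ≤ infDist p Γ → χ p = 0) ∧ (∀ p, ‖χ p‖ ≤ 1) ∧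
      (∀ p ∈ Ω, ‖α p‖ ≤ M) ∧ (∀ p ∈ Ω, ‖β p‖ ≤ M) ∧
      (∀ p, infDist p Γ < a → α p = 0) := by
  obtain ⟨χ, hχ, h1, h0, hI⟩ := exists_contDiff_cutoff Γ hab
  set X : ℂ → ℂ := fun p => (χ p : ℂ) with hX
  have hXc : ContDiff ℝ 1 X := Complex.ofRealCLM.contDiff.comp hχ
  obtain ⟨M, hM⟩ := (hΩ.isCompact_closure.image (hXc.continuous_fderiv one_ne_zero)).isBounded.exists_norm_le
  have hb : ∀ p ∈ Ω, ‖fderiv ℝ X p‖ ≤ max M 1 := fun p hp =>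
    (hM _ ⟨p, subset_closure hp, rfl⟩).trans (le_max_left _ _)
  have hbv : ∀ p ∈ Ω, ∀ v : ℂ, ‖v‖ = 1 → ‖fderiv ℝ X p v‖ ≤ max M 1 := fun p hp v hv => by
    have := (fderiv ℝ X p).le_opNorm v
    rw [hv, mul_one] at this
    exact this.trans (hb p hp)
  refine ⟨X, fun p => (fderiv ℝ X p 1 - I * fderiv ℝ X p I) / 2,
    fun p => (fderiv ℝ X p 1 + I * fderiv ℝ X p I) / 2, max M 1, by positivity,
    fun p => ?_, fun p hp => by simp [hX, h1 p hp], fun p hp => by simp [hX, h0 p hp], fun p => ?_,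
    fun p hp => ?_, fun p hp => ?_, fun p hp => ?_⟩
  · rw [← eq_wirtingerMap]
    exact (hXc.differentiable one_ne_zero p).hasFDerivAt
  · simp only [hX, norm_real, norm_eq_abs, abs_le]
    exact ⟨by linarith [(hI p).1], (hI p).2⟩
  · have h1 := hbv p hp 1 (by simp)
    have h2 := hbv p hp I (by simp)
    have h3 := norm_sub_le (fderiv ℝ X p 1) (I * fderiv ℝ X p I)
    rw [norm_mul, norm_I, one_mul] at h3
    rw [norm_div, Complex.norm_ofNat]
    linarith
  · have h1 := hbv p hp 1 (by simp)
    have h2 := hbv p hp I (by simp)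
    have h3 := norm_add_le (fderiv ℝ X p 1) (I * fderiv ℝ X p I)
    rw [norm_mul, norm_I, one_mul] at h3
    rw [norm_div, Complex.norm_ofNat]
    linarith
  · have : X =ᶠ[nhds p] fun _ => 1 := by
      filter_upwards [(isOpen_lt (continuous_infDist_pt Γ) continuous_const).mem_nhds
        (show infDist p Γ < a from hp)] with q hq
      have hq : infDist q Γ < a := hq
      simp [hX, h1 q hq.le]
    simp [this.fderiv_eq]

theorem norm_coeff_le {C s S E : ℝ} {c r U V : ℂ} (hC : 0 < C) (hs : 0 < s) (hsr : s ≤ C * ‖r‖)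
    (hsS : s ≤ S) (hc : ‖c‖ ≤ 1) (hU : ‖U‖ ≤ E) :
    ‖-c / r ^ 2 * U + r⁻¹ * V‖ ≤ (C ^ 2 * E + ‖V‖ * C * S) / s ^ 2 := by
  have hr : 0 < ‖r‖ := by
    by_contra! h
    linarith [mul_nonpos_of_nonneg_of_nonpos hC.le h]
  have h1 : ‖r‖⁻¹ ≤ C / s := by
    rw [inv_eq_one_div, div_le_div_iff₀ hr hs]
    linarith
  have h2 : C / s ≤ C * S / s ^ 2 := by
    rw [div_le_div_iff₀ hs (by positivity)]
    nlinarith [mul_le_mul_of_nonneg_left hsS (mul_pos hC hs).le]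
  calc ‖-c / r ^ 2 * U + r⁻¹ * V‖ ≤ ‖c‖ * ‖r‖⁻¹ ^ 2 * ‖U‖ + ‖r‖⁻¹ * ‖V‖ := by
        refine (norm_add_le _ _).trans_eq ?_
        rw [norm_mul, norm_mul, norm_div, norm_neg, norm_pow, norm_inv, inv_pow, div_eq_mul_inv]
    _ ≤ 1 * (C / s) ^ 2 * E + C * S / s ^ 2 * ‖V‖ := by gcongr; exact h1.trans h2
    _ = _ := by ring

theorem ReflectionData.exists_kernel {w : ℝ → ℂ} {Ω : Set ℂ} {δ C : ℝ} {R A B : ℂ → ℂ}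
    {D : ℂ → ENNReal} (h : ReflectionData w Ω δ C R A B D)
    (hΩ : IsBounded Ω) (hd : ∀ p ∈ Ω, 0 < infDist p (range w)) :
    ∃ K : ℂ → ENNReal, ∃ M > 0, ∃ δ₁ > 0, Measurable K ∧
      ∫⁻ p in Ω, K p * ofReal (1 / infDist p (range w) ^ 2) < ⊤ ∧
      ∀ ζ ∈ Ω, ∃ T a b : ℂ → ℂ, ∀ p ∈ Ω, HasFDerivAt T (wirtingerMap (a p) (b p)) p ∧
        ofReal (‖a p‖ ^ 2) ≤
          K p * ofReal (1 / (infDist p (range w) + ‖p - ζ‖) ^ 4) ∧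
        ‖a p‖ ≤ M / infDist p (range w) ^ 2 ∧ ‖b p‖ ≤ M / infDist p (range w) ^ 2 ∧
        (infDist p (range w) < δ₁ → p ≠ ζ →
          ‖T p - 1 / (p - ζ)‖ ≤ M * infDist p (range w) / ‖p - ζ‖ ^ 2) := by
  have hδ := h.pos
  have hC := h.const_pos
  obtain ⟨χ, α, β, N, hN, hχ, hχ1, hχ0, hχn, hα, hβ, hα0⟩ :=
    exists_wirtinger_cutoff (Γ := range w) hΩ (show δ / 3 < δ / 2 by linarith)
  obtain ⟨S, hS, hSb⟩ : ∃ S > 0, ∀ p ∈ Ω, ∀ ζ ∈ Ω, infDist p (range w) + ‖p - ζ‖ ≤ S := by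
    obtain ⟨N₁, h₁⟩ := hΩ.exists_norm_le
    refine ⟨max (infDist 0 (range w) + N₁ + (N₁ + N₁)) 1, by positivity, fun p hp ζ hζ =>
      le_max_of_le_left ?_⟩
    have h2 := infDist_le_infDist_add_dist (s := range w) (x := p) (y := 0)
    rw [dist_zero_right] at h2
    have h3 := _root_.norm_sub_le p ζ
    linarith [h₁ p hp, h₁ ζ hζ]
  set d : ℂ → ℝ := fun p => infDist p (range w) with hd_def
  have hdm : Measurable d := (continuous_infDist_pt _).measurable
  set V := {p | δ / 3 ≤ d p} with hV
  have hVm : MeasurableSet V := measurableSet_le measurable_const hdm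
  refine ⟨fun p => ofReal (2 * C ^ 5) * D p +
      V.indicator (fun _ => ofReal (2 * (N * C * S) ^ 2)) p,
    max (C ^ 3 + N * C * S) (C ^ 2), by positivity, δ / 3, by linarith,
    (h.measurable_defect.const_mul _).add (measurable_const.indicator hVm), ?_, fun ζ hζ => ?_⟩
  · simp only [add_mul]
    have hm : Measurable fun p => ofReal (2 * C ^ 5) * D p *
        ofReal (1 / infDist p (range w) ^ 2) :=
      (h.measurable_defect.const_mul _).mul (measurable_const.div (hdm.pow_const 2)).ennreal_ofReal
    rw [lintegral_add_left hm, ENNReal.add_lt_top]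
    constructor
    · simp only [mul_assoc]
      rw [lintegral_ofReal_mul]
      exact mul_lt_top ofReal_lt_top
        ((setLIntegral_le_lintegral _ _).trans_lt h.lintegral_defect)
    · have hle : ∀ p, V.indicator (fun _ => ofReal (2 * (N * C * S) ^ 2)) p *
          ofReal (1 / d p ^ 2) ≤
          ofReal (2 * (N * C * S) ^ 2) * ofReal (1 / (δ / 3) ^ 2) := fun p => by
        by_cases hp : p ∈ V
        · rw [indicator_of_mem hp]
          have : δ / 3 ≤ d p := hp
          gcongr
        · simp [indicator_of_notMem hp]
      refine (lintegral_mono hle).trans_lt ?_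
      rw [setLIntegral_const]
      exact mul_lt_top (mul_lt_top ofReal_lt_top ofReal_lt_top)
        hΩ.measure_lt_top
  · refine ⟨fun p => χ p * (R p - ζ)⁻¹,
      fun p => if d p < δ then -χ p / (R p - ζ) ^ 2 * A p + (R p - ζ)⁻¹ * α p else 0,
      fun p => if d p < δ then -χ p / (R p - ζ) ^ 2 * B p + (R p - ζ)⁻¹ * β p else 0,
      fun p hp => ?_⟩
    have hdp : 0 < d p := hd p hp
    by_cases hpd : d p < δ
    · simp only [hpd, if_true]
      have hs := h.le_norm_sub p hp hpd ζ hζ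
      have hSp := hSb p hp ζ hζ
      have hn : 0 ≤ ‖p - ζ‖ := norm_nonneg _
      have hR : 0 < ‖R p - ζ‖ := by
        by_contra! hc
        have := mul_nonpos_of_nonneg_of_nonpos hC.le hc
        have : 0 < d p := hdp
        simp only [hd_def] at this
        linarith
      have hne : R p - ζ ≠ 0 := norm_pos_iff.1 hR
      have key : ∀ (U V : ℂ) (E : ℝ), ‖U‖ ≤ E → ‖-χ p / (R p - ζ) ^ 2 * U + (R p - ζ)⁻¹ * V‖ ≤
          (C ^ 2 * E + ‖V‖ * C * S) / (d p + ‖p - ζ‖) ^ 2 := fun U V E hU =>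
        norm_coeff_le hC (by positivity) hs hSp (hχn p) hU
      have hsq : d p ^ 2 ≤ (d p + ‖p - ζ‖) ^ 2 := by gcongr; linarith
      refine ⟨?_, ?_, ?_, ?_, fun hp3 hpζ => ?_⟩
      · have h1 := (h.hasFDerivAt p hp hpd).sub_const ζ
        have h2 := (hasFDerivAt_inv' (𝕜 := ℝ) hne).comp p h1
        refine ((hχ p).mul h2).congr_fderiv ?_
        refine ContinuousLinearMap.ext fun v => ?_
        simp
        field_simp
        ring
      · refine (ofReal_le_ofReal (pow_le_pow_left₀ (norm_nonneg _) (key _ (α p) _ le_rfl) 2)).trans ?_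
        have hpow : ∀ x : ℝ, (x / (d p + ‖p - ζ‖) ^ 2) ^ 2 = x ^ 2 * (1 / (d p + ‖p - ζ‖) ^ 4) :=
          fun x => by rw [div_pow, ← pow_mul, div_eq_mul_one_div]
        rw [hpow, ofReal_mul (by positivity)]
        gcongr
        refine (ofReal_le_ofReal (show (C ^ 2 * ‖A p‖ + ‖α p‖ * C * S) ^ 2 ≤
          2 * C ^ 4 * ‖A p‖ ^ 2 + 2 * (‖α p‖ * C * S) ^ 2 by
            nlinarith [sq_nonneg (C ^ 2 * ‖A p‖ - ‖α p‖ * C * S)])).trans ?_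
        rw [ofReal_add (by positivity) (by positivity)]
        refine add_le_add ?_ ?_
        · rw [ofReal_mul (by positivity), show 2 * C ^ 5 = 2 * C ^ 4 * C by ring,
            ofReal_mul (p := 2 * C ^ 4) (q := C) (by positivity), mul_assoc]
          refine mul_le_mul_right ?_ _
          exact h.norm_fst_sq_le p hp hpd
        · by_cases hpV : p ∈ V
          · rw [indicator_of_mem hpV]
            gcongr
            exact hα p hp
          · rw [hα0 p (by simpa [hV] using hpV)]
            simp
      · refine (key _ _ C (h.norm_fst_le p hp hpd)).trans ?_
        gcongr
        refine le_trans ?_ (le_max_left _ _)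
        rw [show C ^ 3 = C ^ 2 * C by ring]
        gcongr
        exact hα p hp
      · refine (key _ _ C (h.norm_snd_le p hp hpd)).trans ?_
        gcongr
        refine le_trans ?_ (le_max_left _ _)
        rw [show C ^ 3 = C ^ 2 * C by ring]
        gcongr
        exact hβ p hp
      · have hpζ' : p - ζ ≠ 0 := sub_ne_zero.2 hpζ
        have hpz : 0 < ‖p - ζ‖ := norm_pos_iff.2 hpζ'
        rw [hχ1 p hp3.le, one_mul, inv_eq_one_div, div_sub_div _ _ hne hpζ', norm_div, norm_mul,
          one_mul, mul_one, sub_sub_sub_cancel_right, norm_sub_rev, div_le_div_iff₀ (by positivity) (by positivity)]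
        have h1 := h.norm_sub_le p hp hpd
        have h2 : ‖p - ζ‖ ≤ C * ‖R p - ζ‖ := by
          have : 0 < d p := hdp
          simp only [hd_def] at this
          linarith
        calc ‖R p - p‖ * ‖p - ζ‖ ^ 2 = ‖R p - p‖ * ‖p - ζ‖ * ‖p - ζ‖ := by ring
          _ ≤ C * d p * (C * ‖R p - ζ‖) * ‖p - ζ‖ := by gcongr
          _ = C ^ 2 * d p * (‖R p - ζ‖ * ‖p - ζ‖) := by ring
          _ ≤ _ := by gcongr; exact le_max_right _ _
    · simp only [hpd, if_false]
      refine ⟨?_, by simp, by simp; positivity, by simp; positivity, fun h1 => by linarith⟩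
      have : (fun p => χ p * (R p - ζ)⁻¹) =ᶠ[nhds p] fun _ => 0 := by
        filter_upwards [(isOpen_lt continuous_const (continuous_infDist_pt (range w))).mem_nhds
          (show δ / 2 < infDist p (range w) by simp only [hd_def] at hpd; linarith)] with q hq
        have hq : δ / 2 < infDist q (range w) := hq
        simp [hχ0 q hq.le]
      refine ((hasFDerivAt_const (0 : ℂ) p).congr_of_eventuallyEq this).congr_fderiv ?_
      refine ContinuousLinearMap.ext fun v => ?_
      simp

theorem integral_radial_mul {k : ℝ → ℝ} {q : ℂ → ℂ} (hk : ∀ r, 1 ≤ r → k r = 0)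
    (hq : DifferentiableOn ℂ q (ball 0 1)) : ∫ z : ℂ, (k ‖z‖ : ℂ) * (q z - q 0) = 0 := by
  rw [← Complex.integral_comp_polarCoord_symm, polarCoord_target]
  by_cases hi : IntegrableOn (fun p : ℝ × ℝ => p.1 • ((k ‖Complex.polarCoord.symm p‖ : ℂ) *
      (q (Complex.polarCoord.symm p) - q 0))) (Ioi 0 ×ˢ Ioo (-π) π)
  swap
  · exact integral_undef hi
  rw [Measure.volume_eq_prod, setIntegral_prod _ hi]
  refine setIntegral_eq_zero_of_forall_eq_zero fun r hr => ?_
  have hr : 0 < r := hr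
  simp only [Complex.norm_polarCoord_symm, abs_of_pos hr]
  rw [integral_smul, integral_const_mul]
  rcases le_or_gt 1 r with h1 | h1
  · simp [hk r h1]
  have hd : DifferentiableOn ℂ (fun z => q z - q 0) (closedBall 0 r) :=
    (hq.mono (closedBall_subset_ball h1)).sub_const _
  have h2 : circleAverage (fun z => q z - q 0) 0 r = q 0 - q 0 := by
    refine DiffContOnCl.circleAverage ?_
    rw [abs_of_pos hr]
    exact DifferentiableOn.diffContOnCl_ball (U := closedBall 0 r) hd subset_rfl
  have per : Periodic (fun θ => q (circleMap 0 r θ) - q 0) (2 * π) := fun θ => by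
    simp [periodic_circleMap 0 r θ]
  have h3 := per.intervalIntegral_add_eq (-π) 0
  rw [show -π + 2 * π = π by ring, zero_add] at h3
  rw [circleAverage_def, ← h3, sub_self, smul_eq_zero,
    intervalIntegral.integral_of_le (by linarith [pi_pos]), integral_Ioc_eq_integral_Ioo] at h2
  have h4 := h2.resolve_left (by positivity)
  have h5 : ∀ θ, Complex.polarCoord.symm (r, θ) = circleMap 0 r θ := fun θ => by
    rw [Complex.polarCoord_symm_apply, circleMap, exp_mul_I]
    push_cast
    ring
  simp only [h5, h4, mul_zero, smul_zero]

/-- The `∂`-derivative of a real function. -/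
noncomputable def delReal (k : ℂ → ℝ) (z : ℂ) : ℂ :=
  (fderiv ℝ k z 1 - I * fderiv ℝ k z I) / 2

theorem integral_cutoff_mul {ρ N : ℝ} {k : ℂ → ℝ} (hk : ContDiff ℝ 1 k)
    (hs : ∀ z, ρ < ‖z‖ → k z = 0) {X a b : ℂ → ℂ}
    (hX : ∀ z ∈ closedBall (0 : ℂ) ρ, HasFDerivAt X (wirtingerMap (a z) (b z)) z)
    (ha : ∀ z ∈ closedBall (0 : ℂ) ρ, ‖a z‖ ≤ N) (hb : ∀ z ∈ closedBall (0 : ℂ) ρ, ‖b z‖ ≤ N) :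
    Integrable (fun z => (k z : ℂ) * a z) ∧
      ∫ z, (k z : ℂ) * a z = - ∫ z, delReal k z * X z := by
  set K := closedBall (0 : ℂ) ρ with hK
  have hKc : IsCompact K := isCompact_closedBall 0 ρ
  have hout : ∀ z ∉ K, ρ < ‖z‖ := fun z hz => by simpa [hK, mem_closedBall] using hz
  have hk0 : ∀ z ∉ K, k z = 0 := fun z hz => hs z (hout z hz)
  have hfk0 : ∀ z ∉ K, fderiv ℝ k z = 0 := fun z hz => by
    have : k =ᶠ[nhds z] fun _ => 0 := by
      filter_upwards [hKc.isClosed.isOpen_compl.mem_nhds hz] with y hy using hk0 y hy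
    simp [this.fderiv_eq]
  have hXc : ContinuousOn X K := fun z hz => (hX z hz).continuousAt.continuousWithinAt
  have hXd : ∀ z ∈ tsupport k, DifferentiableAt ℝ X z := fun z hz => by
    refine (hX z ?_).differentiableAt
    refine closure_minimal (fun y hy => ?_) hKc.isClosed hz
    by_contra h
    exact hy (hk0 y h)
  have hkd : Differentiable ℝ k := hk.differentiable one_ne_zero
  have hfX : ∀ z ∈ K, fderiv ℝ X z = wirtingerMap (a z) (b z) := fun z hz => (hX z hz).fderiv
  have i1 : ∀ v, Integrable (fun z => fderiv ℝ k z v • X z) := fun v => by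
    have hc : ContinuousOn (fun z => fderiv ℝ k z v • X z) K :=
      ((hk.continuous_fderiv one_ne_zero).clm_apply continuous_const).continuousOn.smul hXc
    refine (integrableOn_iff_integrable_of_support_subset fun z hz => ?_).1
      (hc.integrableOn_compact hKc)
    by_contra h
    exact hz (by simp [hfk0 z h])
  have i3 : Integrable (fun z => k z • X z) := by
    refine (integrableOn_iff_integrable_of_support_subset fun z hz => ?_).1
      ((hk.continuous.continuousOn.smul hXc).integrableOn_compact hKc)
    by_contra h
    exact hz (by simp [hk0 z h])
  obtain ⟨M, hM⟩ := hKc.exists_bound_of_continuousOn hk.continuous.continuousOn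
  have i2 : ∀ v, Integrable (fun z => k z • fderiv ℝ X z v) := fun v => by
    refine (integrableOn_iff_integrable_of_support_subset (s := K) fun z hz => ?_).1 ?_
    · by_contra h
      exact hz (by simp [hk0 z h])
    · refine Measure.integrableOn_of_bounded (M := M * ((N + N) * ‖v‖)) hKc.measure_lt_top.ne
        (hk.continuous.measurable.smul (measurable_fderiv_apply_const ℝ X v)).aestronglyMeasurable ?_
      filter_upwards [ae_restrict_mem hKc.measurableSet] with z hz
      rw [norm_smul, hfX z hz]
      have h1 := hM z hz
      have h2 : ‖wirtingerMap (a z) (b z) v‖ ≤ (N + N) * ‖v‖ := by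
        rw [wirtingerMap_apply]
        refine (norm_add_le _ _).trans ?_
        rw [norm_mul, norm_mul, RCLike.norm_conj, add_mul]
        gcongr
        exacts [ha z hz, hb z hz]
      exact mul_le_mul h1 h2 (norm_nonneg _) ((norm_nonneg _).trans h1)
  have ibp : ∀ v, ∫ z, k z • fderiv ℝ X z v = - ∫ z, fderiv ℝ k z v • X z := fun v =>
    integral_smul_fderiv_eq_neg_fderiv_smul_of_integrable (i1 v) (i2 v) i3
      (fun z _ => hkd z) hXd
  have hA : (fun z => (k z : ℂ) * a z) = fun z =>
      (1 / 2 : ℂ) * (k z • fderiv ℝ X z 1) - (I / 2) * (k z • fderiv ℝ X z I) := by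
    funext z
    by_cases hz : z ∈ K
    · rw [hfX z hz]
      simp only [wirtingerMap_apply, map_one, Complex.conj_I, real_smul]
      linear_combination ((k z : ℂ) / 2 * (a z - b z)) * Complex.I_sq
    · simp [hk0 z hz]
  have hB : (fun z => delReal k z * X z) = fun z =>
      (1 / 2 : ℂ) * (fderiv ℝ k z 1 • X z) - (I / 2) * (fderiv ℝ k z I • X z) := by
    funext z
    simp only [delReal, real_smul]
    ring
  rw [hA, hB]
  refine ⟨((i2 1).const_mul _).sub ((i2 _).const_mul _), ?_⟩
  rw [integral_sub ((i2 1).const_mul _) ((i2 _).const_mul _),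
    integral_sub ((i1 1).const_mul _) ((i1 _).const_mul _), integral_const_mul, integral_const_mul,
    integral_const_mul, integral_const_mul, ibp, ibp]
  ring

theorem exists_radial_cutoff : ∃ M > 0, ∀ η ∈ Ioo (0 : ℝ) (1 / 2), ∃ k : ℝ → ℝ,
    ContDiff ℝ 1 (fun z : ℂ => k ‖z‖) ∧ (∀ r, 0 ≤ r → 1 - η ≤ r ^ 2 → k r = 0) ∧
    (∀ r, 0 ≤ k r ∧ k r ≤ 1) ∧
    (ofReal (π * (1 - 2 * η)) ≤ ∫⁻ z : ℂ, ofReal (k ‖z‖)) ∧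
    (∀ z, ‖z‖ ^ 2 < 1 - 2 * η → delReal (fun z => k ‖z‖) z = 0) ∧
    ∫⁻ z : ℂ, ‖delReal (fun z => k ‖z‖) z‖ₑ ≤ ofReal M := by
  have hsd : Continuous (deriv smoothTransition) :=
    (smoothTransition.contDiff (n := 1)).continuous_deriv le_rfl
  obtain ⟨M, hM⟩ := (isCompact_Icc (a := (0 : ℝ)) (b := 1)).exists_bound_of_continuousOn hsd.continuousOn
  have hM0 : 0 ≤ M := (norm_nonneg _).trans (hM 0 (by simp))
  have hs0 : ∀ x, x ∉ Icc (0 : ℝ) 1 → deriv smoothTransition x = 0 := fun x hx => by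
    rw [mem_Icc, not_and_or, not_le, not_le] at hx
    rcases hx with hx | hx
    · have : smoothTransition =ᶠ[nhds x] fun _ => 0 := by
        filter_upwards [isOpen_Iio.mem_nhds hx] with y hy
        exact smoothTransition.zero_of_nonpos (le_of_lt hy)
      simp [this.deriv_eq]
    · have : smoothTransition =ᶠ[nhds x] fun _ => 1 := by
        filter_upwards [isOpen_Ioi.mem_nhds hx] with y hy
        exact smoothTransition.one_of_one_le (le_of_lt hy)
      simp [this.deriv_eq]
  refine ⟨2 * M * π + 1, by positivity, fun η hη => ?_⟩
  have hη0 := hη.1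
  have hη1 := hη.2
  have hu : ∀ z : ℂ, HasFDerivAt (fun z : ℂ => (1 - η - ‖z‖ ^ 2) / η)
      ((-(2 / η)) • (innerSL ℝ z)) z := fun z => by
    have h1 := ((hasStrictFDerivAt_norm_sq z).hasFDerivAt.const_sub (1 - η)).mul_const η⁻¹
    simp only [← div_eq_mul_inv] at h1
    refine h1.congr_fderiv ?_
    ext v <;> simp <;> ring
  have hk : ∀ z : ℂ, HasFDerivAt (fun z : ℂ => smoothTransition ((1 - η - ‖z‖ ^ 2) / η))
      (deriv smoothTransition ((1 - η - ‖z‖ ^ 2) / η) • ((-(2 / η)) • (innerSL ℝ z))) z := fun z =>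
    HasDerivAt.comp_hasFDerivAt z
      ((smoothTransition.contDiff (n := 1)).differentiable one_ne_zero _).hasDerivAt (hu z)
  have hdel : ∀ z, delReal (fun z : ℂ => smoothTransition ((1 - η - ‖z‖ ^ 2) / η)) z =
      -((deriv smoothTransition ((1 - η - ‖z‖ ^ 2) / η) : ℝ) : ℂ) / η * conj z := fun z => by
    have hz : conj z = z.re - z.im * I := by apply Complex.ext <;> simp
    rw [delReal, (hk z).fderiv, hz]
    simp [Complex.inner]
    ring
  refine ⟨fun r => smoothTransition ((1 - η - r ^ 2) / η), ?_, fun r _ hr => ?_, fun r =>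
    ⟨smoothTransition.nonneg _, smoothTransition.le_one _⟩, ?_, fun z hz => ?_, ?_⟩
  · exact smoothTransition.contDiff.comp ((contDiff_const.sub (contDiff_norm_sq ℝ)).div_const η)
  · exact smoothTransition.zero_of_nonpos (div_nonpos_of_nonpos_of_nonneg (by linarith) hη0.le)
  · have h1 : ∀ z ∈ ball (0 : ℂ) √(1 - 2 * η),
        1 ≤ ofReal (smoothTransition ((1 - η - ‖z‖ ^ 2) / η)) := fun z hz => by
      rw [smoothTransition.one_of_one_le, ENNReal.ofReal_one]
      rw [mem_ball_zero_iff, lt_sqrt (norm_nonneg _)] at hz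
      rw [le_div_iff₀ hη0]
      linarith
    refine le_trans (le_of_eq ?_) ((setLIntegral_mono' measurableSet_ball h1).trans
      (setLIntegral_le_lintegral _ _))
    rw [setLIntegral_one, Complex.volume_ball, ← ofReal_pow (by positivity),
      sq_sqrt (by linarith), ofReal_mul (by positivity), mul_comm]
    congr 1
    exact (ofReal_coe_nnreal (p := NNReal.pi))
  · rw [hdel, hs0]
    · simp
    · rw [mem_Icc, not_and_or, not_le, not_le, lt_div_iff₀ hη0]
      right; linarith
  · set V := closedBall (0 : ℂ) √(1 - η) \ ball (0 : ℂ) √(1 - 2 * η) with hV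
    have hle : ∀ z, ‖delReal (fun z : ℂ => smoothTransition ((1 - η - ‖z‖ ^ 2) / η)) z‖ₑ ≤
        V.indicator (fun _ => ofReal (M / η)) z := fun z => by
      by_cases hz : z ∈ V
      · rw [indicator_of_mem hz, hdel, ← ofReal_norm]
        have h1 : ‖z‖ ≤ 1 := by
          refine (mem_closedBall_zero_iff.1 hz.1).trans ?_
          exact sqrt_le_one.2 (by linarith)
        have h2 : ‖deriv smoothTransition ((1 - η - ‖z‖ ^ 2) / η)‖ ≤ M := by
          by_cases h : (1 - η - ‖z‖ ^ 2) / η ∈ Icc (0 : ℝ) 1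
          · exact hM _ h
          · rw [hs0 _ h]; simpa using hM0
        refine ofReal_le_ofReal ?_
        rw [norm_mul, norm_div, norm_neg, RCLike.norm_conj, norm_real, norm_real,
          norm_of_nonneg hη0.le]
        calc _ ≤ M / η * 1 := by gcongr
          _ = _ := mul_one _
      · rw [indicator_of_notMem hz, hdel, hs0]
        · simp
        · intro h
          refine hz ⟨?_, ?_⟩
          · rw [mem_closedBall_zero_iff]
            refine Real.le_sqrt_of_sq_le ?_
            have := h.1
            rw [le_div_iff₀ hη0] at this
            linarith
          · rw [mem_ball_zero_iff, lt_sqrt (norm_nonneg _), not_lt]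
            have := h.2
            rw [div_le_iff₀ hη0] at this
            linarith
    refine (lintegral_mono hle).trans ?_
    rw [lintegral_indicator (measurableSet_closedBall.diff measurableSet_ball), setLIntegral_const]
    have hvol : volume V = ofReal (π * η) := by
      have hsub : ball (0 : ℂ) √(1 - 2 * η) ⊆ closedBall (0 : ℂ) √(1 - η) :=
        ball_subset_closedBall.trans (closedBall_subset_closedBall (sqrt_le_sqrt (by linarith)))
      have hpi : ((NNReal.pi : NNReal) : ENNReal) = ofReal π := ofReal_coe_nnreal.symm
      rw [hV, measure_sdiff hsub measurableSet_ball.nullMeasurableSet measure_ball_lt_top.ne,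
        Complex.volume_ball, Complex.volume_closedBall, ← ofReal_pow (by positivity),
        ← ofReal_pow (by positivity), sq_sqrt (by linarith), sq_sqrt (by linarith),
        hpi, ← ofReal_mul (by linarith), ← ofReal_mul (by linarith),
        ← ENNReal.ofReal_sub _ (mul_nonneg (by linarith) pi_pos.le)]
      congr 1; ring
    rw [hvol, ← ofReal_mul (by positivity)]
    refine ofReal_le_ofReal ?_
    have : M / η * (π * η) = M * π := by field_simp
    rw [this]
    nlinarith [mul_nonneg hM0 pi_pos.le]

theorem ofReal_pi_mul_norm_le_lintegral {X P b q : ℂ → ℂ} (hq : DifferentiableOn ℂ q (ball 0 1))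
    (hX : ∀ z ∈ 𝔻, HasFDerivAt X (wirtingerMap (P z - q z) (b z)) z)
    (hb : ∀ ρ < 1, ∃ N, ∀ z ∈ closedBall (0 : ℂ) ρ, ‖P z‖ ≤ N ∧ ‖b z‖ ≤ N)
    (hX0 : ∀ ε > 0, ∃ r < 1, ∀ z ∈ 𝔻, r < ‖z‖ → ‖X z‖ ≤ ε) :
    ofReal (π * ‖q 0‖) ≤ ∫⁻ z in 𝔻, ‖P z‖ₑ := by
  obtain ⟨M, hM, hcut⟩ := exists_radial_cutoff
  have key : ∀ ε > 0, ∀ r < 1, (∀ z ∈ 𝔻, r < ‖z‖ → ‖X z‖ ≤ ε) →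
      ∀ η ∈ Ioo (0 : ℝ) (1 / 2), r ^ 2 < 1 - 2 * η → 0 ≤ r →
      ofReal (‖q 0‖ * (π * (1 - 2 * η))) ≤
        (∫⁻ z in 𝔻, ‖P z‖ₑ) + ofReal (ε * M) := by
    intro ε hε r hr1 hXr η hη hrη hr0
    obtain ⟨k, hk, hk0, hkI, hkint, hdel0, hdel⟩ := hcut η hη
    have hη0 := hη.1
    have hρ1 : √(1 - η) < 1 := by
      rw [sqrt_lt' one_pos]; linarith
    have hρ0 : ∀ z : ℂ, √(1 - η) < ‖z‖ → k ‖z‖ = 0 := fun z hz => by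
      refine hk0 _ (norm_nonneg _) ?_
      rw [sqrt_lt' ((sqrt_nonneg _).trans_lt hz)] at hz
      exact hz.le
    have hsub : closedBall (0 : ℂ) √(1 - η) ⊆ ball 0 1 := closedBall_subset_ball hρ1
    have hout : ∀ z ∉ 𝔻, k ‖z‖ = 0 := fun z hz => hρ0 z (by
      rw [mem_ball_zero_iff, not_lt] at hz
      linarith)
    obtain ⟨N, hN⟩ := hb _ hρ1
    have hKc : IsCompact (closedBall (0 : ℂ) √(1 - η)) := isCompact_closedBall _ _
    obtain ⟨N', hN'⟩ := hKc.exists_bound_of_continuousOn (hq.continuousOn.mono hsub)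
    obtain ⟨i1, h1⟩ := integral_cutoff_mul (N := N + N') hk hρ0 (X := X) (a := fun z => P z - q z) (b := b)
      (fun z hz => hX z (hsub hz))
      (fun z hz => (norm_sub_le _ _).trans (add_le_add (hN z hz).1 (hN' z hz)))
      (fun z hz => (hN z hz).2.trans (by linarith [(norm_nonneg _).trans (hN' z hz)]))
    have icont : ∀ g : ℂ → ℂ, ContinuousOn g (closedBall (0 : ℂ) √(1 - η)) →
        Integrable fun z : ℂ => (k ‖z‖ : ℂ) * g z := fun g hg => by
      have hkc : Continuous fun z : ℂ => (k ‖z‖ : ℂ) := Complex.continuous_ofReal.comp hk.continuous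
      refine (integrableOn_iff_integrable_of_support_subset fun z hz => ?_).1
        ((hkc.continuousOn.mul hg).integrableOn_compact hKc)
      by_contra h
      rw [mem_closedBall_zero_iff, not_le] at h
      exact hz (by simp [hρ0 z h])
    have i2 := icont q (hq.continuousOn.mono hsub)
    have i3 := icont (fun _ => q 0) continuousOn_const
    have i4 : Integrable fun z : ℂ => k ‖z‖ := by
      have := (icont (fun _ => 1) continuousOn_const).re
      simpa using this
    have h2 := integral_radial_mul (k := k) (q := q)
      (fun r hr => hk0 r (by linarith) (by nlinarith)) hq
    have h3 : ∫ z : ℂ, (k ‖z‖ : ℂ) * P z = (∫ z : ℂ, (k ‖z‖ : ℂ) * (P z - q z)) +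
        ∫ z : ℂ, (k ‖z‖ : ℂ) * q z := by
      rw [← integral_add i1 i2]
      congr 1; funext z; ring
    have h4 : ∫ z : ℂ, (k ‖z‖ : ℂ) * q z = (∫ z : ℂ, (k ‖z‖ : ℂ)) * q 0 := by
      rw [← integral_mul_const, ← sub_eq_zero, ← integral_sub i2 i3]
      refine Eq.trans ?_ h2
      congr 1; funext z; ring
    have h5 : (∫ z : ℂ, (k ‖z‖ : ℂ)) * q 0 = (∫ z : ℂ, (k ‖z‖ : ℂ) * P z) +
        ∫ z, delReal (fun z => k ‖z‖) z * X z := by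
      rw [h3, h1, ← h4]; ring
    have h6 : ofReal (π * (1 - 2 * η)) ≤ ‖∫ z : ℂ, (k ‖z‖ : ℂ)‖ₑ := by
      rw [integral_complex_ofReal, ← ofReal_norm, norm_real,
        norm_of_nonneg (integral_nonneg fun z => (hkI _).1),
        ofReal_integral_eq_lintegral_ofReal i4 (Eventually.of_forall fun z => (hkI _).1)]
      exact hkint
    have h7 : ‖∫ z : ℂ, (k ‖z‖ : ℂ) * P z‖ₑ ≤ ∫⁻ z in 𝔻, ‖P z‖ₑ := by
      refine (enorm_integral_le_lintegral_enorm _).trans ?_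
      rw [← lintegral_indicator measurableSet_ball]
      refine lintegral_mono fun z => ?_
      by_cases hz : z ∈ 𝔻
      · rw [indicator_of_mem hz, enorm_mul]
        refine mul_le_of_le_one_left' ?_
        rw [← ofReal_norm, norm_real, norm_of_nonneg (hkI _).1, ENNReal.ofReal_le_one]
        exact (hkI _).2
      · simp [hout z hz]
    have h8 : ‖∫ z, delReal (fun z => k ‖z‖) z * X z‖ₑ ≤ ofReal (ε * M) := by
      refine (enorm_integral_le_lintegral_enorm _).trans ?_
      rw [ofReal_mul hε.le]
      refine le_trans ?_ (mul_le_mul_right hdel _)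
      rw [← lintegral_ofReal_mul]
      refine lintegral_mono fun z => ?_
      rw [enorm_mul, mul_comm]
      by_cases hz : z ∈ 𝔻
      · rcases lt_or_ge (‖z‖ ^ 2) (1 - 2 * η) with hz2 | hz2
        · simp [hdel0 z hz2]
        · refine mul_le_mul_left ?_ _
          rw [← ofReal_norm]
          refine ofReal_le_ofReal (hXr z hz ?_)
          exact lt_of_pow_lt_pow_left₀ 2 (norm_nonneg _) (hrη.trans_le hz2)
      · have : delReal (fun z => k ‖z‖) z = 0 := by
          have h9 : (fun z : ℂ => k ‖z‖) =ᶠ[nhds z] fun _ => 0 := by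
            filter_upwards [hKc.isClosed.isOpen_compl.mem_nhds fun h => hz (hsub h)] with y hy
            refine hρ0 y ?_
            simpa [mem_closedBall] using hy
          simp [delReal, h9.fderiv_eq]
        simp [this]
    rw [ofReal_mul (norm_nonneg _), mul_comm, ofReal_norm]
    refine (mul_le_mul_left h6 _).trans ?_
    rw [← enorm_mul, h5]
    exact (enorm_add_le _ _).trans (add_le_add h7 h8)
  refine ENNReal.le_of_forall_pos_le_add fun e he _ => ?_
  have he : (0 : ℝ) < e := he
  obtain ⟨r, hr1, hr⟩ := hX0 (e / (2 * M)) (by positivity)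
  set r' := max r 0
  have hr'1 : r' < 1 := max_lt hr1 one_pos
  have hr'0 : 0 ≤ r' := le_max_right _ _
  set Q := π * ‖q 0‖ + 1 with hQ
  have hQ1 : 1 ≤ Q := by rw [hQ]; have : 0 ≤ π * ‖q 0‖ := by positivity
                         linarith
  set η := min (min (1 / 4) ((1 - r' ^ 2) / 4)) (e / (4 * Q)) with hη
  have hr'2 : r' ^ 2 < 1 := by nlinarith
  have hη0 : 0 < η := lt_min (lt_min (by norm_num) (by linarith)) (by positivity)
  have hη1 : η ≤ 1 / 4 := (min_le_left _ _).trans (min_le_left _ _)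
  have hη2 : η ≤ (1 - r' ^ 2) / 4 := (min_le_left _ _).trans (min_le_right _ _)
  have hη3 : η * (4 * Q) ≤ e := by
    rw [← le_div_iff₀ (by positivity)]
    exact min_le_right _ _
  have h := key (e / (2 * M)) (by positivity) r' hr'1
    (fun z hz hzr => hr z hz ((le_max_left _ _).trans_lt hzr)) η ⟨hη0, by linarith⟩ (by linarith) hr'0
  have h2 : e / (2 * M) * M = (e : ℝ) / 2 := by field_simp
  rw [h2] at h
  have h3 : π * ‖q 0‖ ≤ ‖q 0‖ * (π * (1 - 2 * η)) + e / 2 := by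
    nlinarith [mul_pos hη0 (show 0 < Q by linarith)]
  refine (ofReal_le_ofReal h3).trans (ENNReal.ofReal_add_le.trans
    ((add_le_add_left h _).trans ?_))
  rw [add_assoc, ← ofReal_add (by positivity) (by positivity), add_halves,
    ofReal_coe_nnreal]

/-- The Schwarzian derivative. -/
noncomputable def schwarzian (f : ℂ → ℂ) (z : ℂ) : ℂ :=
  deriv (fun z => deriv (deriv f) z / deriv f z) z - (deriv (deriv f) z / deriv f z) ^ 2 / 2

theorem deriv_eventuallyEq_of_eq_add_mul {f g : ℂ → ℂ} {c : ℂ} (hg : AnalyticAt ℂ g 0)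
    (h : f =ᶠ[nhds 0] fun z => c + z * g z) :
    deriv f =ᶠ[nhds 0] fun z => g z + z * deriv g z := by
  filter_upwards [h.eventuallyEq_nhds, hg.eventually_analyticAt] with z hz hgz
  rw [hz.deriv_eq]
  have := ((hasDerivAt_id z).mul hgz.differentiableAt.hasDerivAt).const_add c
  rw [show (fun z => c + z * g z) = fun z => c + ((id : ℂ → ℂ) * g) z from rfl, this.deriv]
  simp

theorem derivs_of_eq_add_mul {f g : ℂ → ℂ} {c : ℂ} (hg : AnalyticAt ℂ g 0)
    (h : f =ᶠ[nhds 0] fun z => c + z * g z) :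
    deriv f 0 = g 0 ∧ deriv (deriv f) 0 = 2 * deriv g 0 ∧
      deriv (deriv (deriv f)) 0 = 3 * deriv (deriv g) 0 := by
  have h1 := deriv_eventuallyEq_of_eq_add_mul hg h
  have h2 : deriv (deriv f) =ᶠ[nhds 0] fun z => 2 * deriv g z + z * deriv (deriv g) z := by
    filter_upwards [h1.eventuallyEq_nhds, hg.eventually_analyticAt] with z hz hgz
    rw [hz.deriv_eq]
    have h3 := (hasDerivAt_id z).mul hgz.deriv.differentiableAt.hasDerivAt
    have h4 := hgz.differentiableAt.hasDerivAt.add h3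
    rw [show (fun z => g z + z * deriv g z) = g + id * deriv g from rfl, h4.deriv]
    simp
    ring
  refine ⟨by simpa using h1.self_of_nhds, by simpa using h2.self_of_nhds, ?_⟩
  rw [h2.deriv_eq]
  have h3 := (hasDerivAt_id (0 : ℂ)).mul hg.deriv.deriv.differentiableAt.hasDerivAt
  have h4 := (hg.deriv.differentiableAt.hasDerivAt.const_mul 2).add h3
  rw [show (fun z => 2 * deriv g z + z * deriv (deriv g) z) =
    (fun z => 2 * deriv g z) + id * deriv (deriv g) from rfl, h4.deriv]
  simp
  ring

theorem exists_deriv_eq_schwarzian {f : ℂ → ℂ} (hf : DifferentiableOn ℂ f (ball 0 1))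
    (hi : InjOn f (ball 0 1)) :
    ∃ ψ : ℂ → ℂ, DifferentiableOn ℂ ψ (ball 0 1) ∧
      (∀ z ∈ 𝔻, z ≠ 0 → ψ z = deriv f 0 / (f z - f 0) - 1 / z) ∧
      deriv ψ 0 = - schwarzian f 0 / 6 := by
  have h0 : (0 : ℂ) ∈ 𝔻 := mem_ball_self one_pos
  have hn : 𝔻 ∈ nhds (0 : ℂ) := isOpen_ball.mem_nhds h0
  have hα := deriv_ne_zero_of_differentiableOn_of_injOn isOpen_ball hf hi h0
  set g := dslope f 0 with hg
  have hgd : DifferentiableOn ℂ g (ball 0 1) := (Complex.differentiableOn_dslope hn).2 hf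
  have hg0 : g 0 = deriv f 0 := dslope_same f 0
  have hgz : ∀ z, z ≠ 0 → g z = (f z - f 0) / z := fun z hz => by
    rw [hg, dslope_of_ne _ hz, slope_def_field, sub_zero]
  have hgne : ∀ z ∈ 𝔻, g z ≠ 0 := fun z hz => by
    by_cases h : z = 0
    · rw [h, hg0]; exact hα
    · rw [hgz z h]
      exact div_ne_zero (sub_ne_zero.2 fun h' => h (hi hz h0 h')) h
  have hfg : f =ᶠ[nhds 0] fun z => f 0 + z * g z := by
    refine Eventually.of_forall fun z => ?_
    by_cases h : z = 0
    · simp [h]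
    · simp only [hgz z h]; field_simp; ring
  set p : ℂ → ℂ := fun z => deriv f 0 / g z with hp
  have hpd : DifferentiableOn ℂ p (ball 0 1) := (differentiableOn_const _).div hgd hgne
  set ψ := dslope p 0 with hψ
  have hψd : DifferentiableOn ℂ ψ (ball 0 1) := (Complex.differentiableOn_dslope hn).2 hpd
  have hp0 : p 0 = 1 := by simp [hp, hg0, hα]
  have hpψ : p =ᶠ[nhds 0] fun z => 1 + z * ψ z := by
    refine Eventually.of_forall fun z => ?_
    by_cases h : z = 0
    · simp [h, hp0]
    · simp only [hψ, dslope_of_ne _ h, slope_def_field, sub_zero, hp0]; field_simp; ring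
  have hga : AnalyticAt ℂ g 0 := hgd.analyticAt hn
  have hψa : AnalyticAt ℂ ψ 0 := hψd.analyticAt hn
  have hfa : AnalyticAt ℂ f 0 := hf.analyticAt hn
  obtain ⟨a1, a2, a3⟩ := derivs_of_eq_add_mul hga hfg
  obtain ⟨b1, b2, -⟩ := derivs_of_eq_add_mul hψa hpψ
  refine ⟨ψ, hψd, fun z hz hz0 => ?_, ?_⟩
  · rw [hψ, dslope_of_ne _ hz0, slope_def_field, sub_zero, hp0, hp]
    simp only [hgz z hz0]
    have : f z - f 0 ≠ 0 := sub_ne_zero.2 fun h' => hz0 (hi hz h0 h')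
    field_simp
  · have c1 : deriv p =ᶠ[nhds 0] fun z => -deriv f 0 * deriv g z / g z ^ 2 := by
      filter_upwards [hn, hga.eventually_analyticAt] with z hz hz'
      have := (hasDerivAt_const z (deriv f 0)).div hz'.differentiableAt.hasDerivAt (hgne z hz)
      rw [hp, show (fun z => deriv f 0 / g z) = (fun _ => deriv f 0) / g from rfl, this.deriv]
      ring
    have c2 : HasDerivAt (fun z => -deriv f 0 * deriv g z / g z ^ 2)
        ((-deriv f 0 * deriv (deriv g) 0 * g 0 ^ 2 - -deriv f 0 * deriv g 0 * (2 * g 0 * deriv g 0)) /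
          (g 0 ^ 2) ^ 2) 0 := by
      have h1 := hga.deriv.differentiableAt.hasDerivAt.const_mul (-deriv f 0)
      have h2 := hga.differentiableAt.hasDerivAt.pow 2
      refine (h1.div h2 (pow_ne_zero 2 (hgne 0 h0))).congr_deriv ?_
      simp
    have c3 : HasDerivAt (fun z => deriv (deriv f) z / deriv f z)
        ((deriv (deriv (deriv f)) 0 * deriv f 0 - deriv (deriv f) 0 * deriv (deriv f) 0) /
          deriv f 0 ^ 2) 0 :=
      hfa.deriv.deriv.differentiableAt.hasDerivAt.div hfa.deriv.differentiableAt.hasDerivAt hα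
    rw [c1.deriv_eq, c2.deriv] at b2
    rw [schwarzian, c3.deriv, a3, a2]
    rw [hg0] at b2
    generalize deriv f 0 = α at *
    field_simp at b2 ⊢
    linear_combination (-3) * b2

theorem ofReal_pi_mul_sq_le_lintegral {P : ℂ → ℂ} {c : ℝ} (hc : 0 ≤ c)
    (h : ofReal (π * c) ≤ ∫⁻ z in 𝔻, ‖P z‖ₑ) :
    ofReal (π * c ^ 2) ≤ ∫⁻ z in 𝔻, ofReal (‖P z‖ ^ 2) := by
  rcases hc.eq_or_lt with rfl | hc
  · simp
  have h1 : ∫⁻ z in 𝔻, ‖P z‖ₑ ≤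
      ∫⁻ z in 𝔻, (ofReal (1 / (2 * c)) * ofReal (‖P z‖ ^ 2) +
        ofReal (c / 2)) := by
    refine lintegral_mono fun z => ?_
    rw [← ofReal_norm, ← ofReal_mul (by positivity),
      ← ofReal_add (by positivity) (by positivity)]
    refine ofReal_le_ofReal ?_
    have : 1 / (2 * c) * ‖P z‖ ^ 2 + c / 2 - ‖P z‖ = (‖P z‖ - c) ^ 2 / (2 * c) := by
      field_simp
      ring
    have : 0 ≤ (‖P z‖ - c) ^ 2 / (2 * c) := by positivity
    linarith
  rw [lintegral_add_right _ measurable_const, lintegral_ofReal_mul,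
    setLIntegral_const, Complex.volume_ball] at h1
  have hpi : ((NNReal.pi : NNReal) : ENNReal) = ofReal π := ofReal_coe_nnreal.symm
  have h2 : ofReal (c / 2) * (ofReal 1 ^ 2 * (NNReal.pi : ENNReal)) =
      ofReal (π * c / 2) := by
    rw [hpi, ENNReal.ofReal_one, one_pow, one_mul, ← ofReal_mul (by positivity)]
    congr 1; ring
  rw [h2] at h1
  have h3 := h.trans h1
  have h3' : ofReal (π * c) = ofReal (π * c / 2) + ofReal (π * c / 2) := by
    rw [← ofReal_add (by positivity) (by positivity), add_halves]
  rw [h3', ENNReal.add_le_add_iff_right ofReal_ne_top] at h3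
  have h4 := mul_le_mul_right h3 (ofReal (2 * c))
  rw [← mul_assoc, ← ofReal_mul (by positivity), ← ofReal_mul (by positivity),
    show 2 * c * (1 / (2 * c)) = 1 by field_simp, ENNReal.ofReal_one, one_mul] at h4
  refine le_trans (le_of_eq ?_) h4
  congr 1; ring

theorem schwarzian_zero_bound {f T a b : ℂ → ℂ} (hf : DifferentiableOn ℂ f (ball 0 1))
    (hi : InjOn f (ball 0 1))
    (hT : ∀ z ∈ 𝔻, HasFDerivAt T (wirtingerMap (a (f z)) (b (f z))) (f z))
    (hab : ∀ ρ < 1, ∃ N, ∀ z ∈ closedBall (0 : ℂ) ρ, ‖a (f z)‖ ≤ N ∧ ‖b (f z)‖ ≤ N)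
    (hT0 : ∀ ε > 0, ∃ r < 1, ∀ z ∈ 𝔻, r < ‖z‖ →
      ‖T (f z) - 1 / (f z - f 0)‖ ≤ ε) :
    ofReal (π / 36 * ‖schwarzian f 0‖ ^ 2) ≤ ofReal (‖deriv f 0‖ ^ 2) *
      ∫⁻ p in f '' ball 0 1, ofReal (‖a p‖ ^ 2) := by
  obtain ⟨ψ, hψ, hψz, hψ0⟩ := exists_deriv_eq_schwarzian hf hi
  set α := deriv f 0
  have hfd : ∀ z ∈ 𝔻, DifferentiableAt ℂ f z := fun z hz =>
    hf.differentiableAt (isOpen_ball.mem_nhds hz)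
  have hdf : DifferentiableOn ℂ (deriv f) (ball 0 1) := hf.deriv isOpen_ball
  have hX : ∀ z ∈ 𝔻, HasFDerivAt (fun z => α * T (f z) - ψ z - conj z)
      (wirtingerMap (α * a (f z) * deriv f z - deriv ψ z)
        (α * b (f z) * conj (deriv f z) - 1)) z := fun z hz => by
    have h1 := (hfd z hz).hasDerivAt.complexToReal_fderiv
    have h2 := ((hT z hz).comp z h1).const_mul α
    have h3 := (hψ.differentiableAt (isOpen_ball.mem_nhds hz)).hasDerivAt.complexToReal_fderiv
    have h4 := conjCLE.hasFDerivAt (x := z)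
    refine ((h2.sub h3).sub h4).congr_fderiv ?_
    refine ContinuousLinearMap.ext fun v => ?_
    simp
    ring
  have key := ofReal_pi_mul_norm_le_lintegral (q := deriv ψ)
    (P := fun z => α * a (f z) * deriv f z) (hψ.deriv isOpen_ball) hX ?_ ?_
  · have h2 := ofReal_pi_mul_sq_le_lintegral (norm_nonneg _) key
    rw [lintegral_image_eq_lintegral_norm_deriv_sq measurableSet_ball hfd hi,
      ← lintegral_ofReal_mul]
    refine le_trans (le_of_eq ?_) (h2.trans (le_of_eq ?_))
    · rw [hψ0, norm_div, norm_neg, Complex.norm_ofNat]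
      congr 1; ring
    · refine lintegral_congr fun z => ?_
      rw [← ofReal_mul (by positivity), ← ofReal_mul (by positivity), norm_mul, norm_mul]
      congr 1; ring
  · intro ρ hρ
    obtain ⟨N, hN⟩ := hab ρ hρ
    obtain ⟨N', hN'⟩ := (isCompact_closedBall (0 : ℂ) ρ).exists_bound_of_continuousOn
      (hdf.continuousOn.mono (closedBall_subset_ball hρ))
    refine ⟨‖α‖ * N * N' + 1, fun z hz => ?_⟩
    have hN0 := (norm_nonneg _).trans (hN z hz).1
    constructor
    · rw [norm_mul, norm_mul]
      have : ‖α‖ * ‖a (f z)‖ * ‖deriv f z‖ ≤ ‖α‖ * N * N' := by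
        gcongr
        exacts [(hN z hz).1, hN' z hz]
      linarith
    · refine (norm_sub_le _ _).trans ?_
      rw [norm_mul, norm_mul, norm_one, RCLike.norm_conj]
      gcongr
      exacts [(hN z hz).2, hN' z hz]
  · intro ε hε
    obtain ⟨r, hr1, hr⟩ := hT0 (ε / (2 * (‖α‖ + 1))) (by positivity)
    refine ⟨max r (max (1 / 2) (1 - ε / 8)), max_lt hr1 (max_lt (by norm_num) (by linarith)),
      fun z hz hrz => ?_⟩
    rw [max_lt_iff, max_lt_iff] at hrz
    obtain ⟨h1, h2, h3⟩ := hrz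
    have hz0 : z ≠ 0 := norm_pos_iff.1 (by linarith)
    have hz1 : ‖z‖ < 1 := mem_ball_zero_iff.1 hz
    have e1 : α * T (f z) - ψ z - conj z =
        α * (T (f z) - 1 / (f z - f 0)) + (1 / z - conj z) := by
      rw [hψz z hz hz0]; ring
    have e2 : 1 / z - conj z = ((1 - ‖z‖ ^ 2 : ℝ) : ℂ) / z := by
      have := Complex.mul_conj' z
      field_simp
      push_cast
      rw [← this]
    have e3 : ‖1 / z - conj z‖ ≤ ε / 2 := by
      rw [e2, norm_div, norm_real, norm_of_nonneg (by nlinarith), div_le_iff₀ (by linarith)]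
      nlinarith
    have e4 : ‖α‖ * (ε / (2 * (‖α‖ + 1))) ≤ ε / 2 := by
      have : ‖α‖ * (ε / (2 * (‖α‖ + 1))) = ε / 2 * (‖α‖ / (‖α‖ + 1)) := by
        field_simp
      rw [this]
      exact mul_le_of_le_one_right (by positivity) ((div_le_one (by positivity)).2 (by linarith))
    rw [e1]
    refine (norm_add_le _ _).trans ?_
    rw [norm_mul]
    have := mul_le_mul_of_nonneg_left (hr z hz h1) (norm_nonneg α)
    linarith

/-- The disk automorphism `z ↦ (z + a) / (1 + ā z)`. -/
noncomputable def diskMap (a z : ℂ) : ℂ := (z + a) / (1 + conj a * z)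

theorem one_add_conj_mul_ne_zero {a z : ℂ} (ha : ‖a‖ < 1) (hz : ‖z‖ < 1) :
    1 + conj a * z ≠ 0 := fun h => by
  have h1 : conj a * z = -1 := by linear_combination h
  have h2 : ‖a‖ * ‖z‖ = 1 := by
    rw [← Complex.norm_conj a, ← norm_mul, h1, norm_neg, norm_one]
  nlinarith [norm_nonneg a, norm_nonneg z]

theorem norm_diskMap_lt_one {a z : ℂ} (ha : ‖a‖ < 1) (hz : ‖z‖ < 1) : ‖diskMap a z‖ < 1 := by
  have h0 := one_add_conj_mul_ne_zero ha hz
  rw [diskMap, norm_div, div_lt_one (norm_pos_iff.2 h0)]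
  refine lt_of_pow_lt_pow_left₀ 2 (norm_nonneg _) ?_
  have h1 : ‖a‖ ^ 2 < 1 := by nlinarith [norm_nonneg a]
  have h2 : ‖z‖ ^ 2 < 1 := by nlinarith [norm_nonneg z]
  rw [← normSq_eq_norm_sq, normSq_apply] at h1 h2 ⊢
  rw [← normSq_eq_norm_sq, normSq_apply]
  simp only [Complex.add_re, Complex.add_im, Complex.mul_re, Complex.mul_im, Complex.conj_re,
    Complex.conj_im, Complex.one_re, Complex.one_im]
  nlinarith [mul_pos (sub_pos.2 h1) (sub_pos.2 h2)]

theorem diskMap_neg_diskMap {a z : ℂ} (ha : ‖a‖ < 1) (hz : ‖z‖ < 1) :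
    diskMap (-a) (diskMap a z) = z := by
  have h0 := one_add_conj_mul_ne_zero ha hz
  have h1 : 1 + conj (-a) * diskMap a z ≠ 0 :=
    one_add_conj_mul_ne_zero (by simpa using ha) (norm_diskMap_lt_one ha hz)
  rw [diskMap, div_eq_iff h1]
  rw [diskMap, map_neg]
  generalize conj a = c at h0
  refine mul_right_cancel₀ h0 ?_
  rw [add_mul, div_mul_cancel₀ _ h0, mul_assoc z, add_mul, mul_assoc (-c), div_mul_cancel₀ _ h0]
  ring

theorem bijOn_diskMap {a : ℂ} (ha : ‖a‖ < 1) :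
    BijOn (diskMap a) (𝔻) (ball 0 1) := by
  have hm : ∀ b : ℂ, ‖b‖ < 1 → MapsTo (diskMap b) (𝔻) (ball 0 1) :=
    fun b hb z hz => by
      simp only [mem_ball_zero_iff] at hz ⊢
      exact norm_diskMap_lt_one hb hz
  have hna : ‖-a‖ < 1 := by simpa using ha
  refine InvOn.bijOn (f' := diskMap (-a)) ⟨fun z hz => ?_, fun z hz => ?_⟩ (hm a ha)
    (hm _ hna)
  · exact diskMap_neg_diskMap ha (mem_ball_zero_iff.1 hz)
  · simpa using diskMap_neg_diskMap hna (mem_ball_zero_iff.1 hz)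

theorem diskMap_zero (a : ℂ) : diskMap a 0 = a := by simp [diskMap]

theorem hasDerivAt_diskMap {a z : ℂ} (ha : ‖a‖ < 1) (hz : ‖z‖ < 1) :
    HasDerivAt (diskMap a) ((1 - conj a * a) / (1 + conj a * z) ^ 2) z := by
  have h0 := one_add_conj_mul_ne_zero ha hz
  have h1 := (((hasDerivAt_id z).add_const a).div
    (((hasDerivAt_id z).const_mul (conj a)).const_add 1) h0)
  refine h1.congr_deriv ?_
  simp only [id_eq]
  field_simp
  ring

theorem one_sub_conj_mul_self (a : ℂ) :
    1 - conj a * a = ((1 - ‖a‖ ^ 2 : ℝ) : ℂ) := by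
  rw [mul_comm, Complex.mul_conj, normSq_eq_norm_sq]; push_cast; ring

theorem deriv_comp_diskMap {f : ℂ → ℂ} (hf : DifferentiableOn ℂ f (ball 0 1)) {a z : ℂ}
    (ha : ‖a‖ < 1) (hz : ‖z‖ < 1) :
    deriv (fun z => f (diskMap a z)) z =
      deriv f (diskMap a z) * ((1 - conj a * a) / (1 + conj a * z) ^ 2) :=
  ((hf.differentiableAt (isOpen_ball.mem_nhds
    (mem_ball_zero_iff.2 (norm_diskMap_lt_one ha hz)))).hasDerivAt.comp z
      (hasDerivAt_diskMap ha hz)).deriv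

theorem one_sub_conj_mul_self_ne_zero {a : ℂ} (ha : ‖a‖ < 1) :
    1 - conj a * a ≠ 0 := by
  rw [one_sub_conj_mul_self]
  have : 0 < 1 - ‖a‖ ^ 2 := by nlinarith [norm_nonneg a]
  exact_mod_cast this.ne'

theorem preSchwarzian_comp_diskMap {f : ℂ → ℂ} (hf : DifferentiableOn ℂ f (ball 0 1))
    (hi : InjOn f (ball 0 1)) {a z : ℂ} (ha : ‖a‖ < 1) (hz : ‖z‖ < 1) :
    deriv (deriv fun z => f (diskMap a z)) z / deriv (fun z => f (diskMap a z)) z =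
      deriv (deriv f) (diskMap a z) / deriv f (diskMap a z) *
        ((1 - conj a * a) / (1 + conj a * z) ^ 2) -
        2 * conj a / (1 + conj a * z) := by
  have h0 := one_add_conj_mul_ne_zero ha hz
  have hb : diskMap a z ∈ 𝔻 := mem_ball_zero_iff.2 (norm_diskMap_lt_one ha hz)
  have h1 : deriv f (diskMap a z) ≠ 0 :=
    deriv_ne_zero_of_differentiableOn_of_injOn isOpen_ball hf hi hb
  have h2 : (deriv fun z => f (diskMap a z)) =ᶠ[nhds z] fun z => deriv f (diskMap a z) *
      ((1 - conj a * a) / (1 + conj a * z) ^ 2) := by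
    filter_upwards [isOpen_ball.mem_nhds (mem_ball_zero_iff.2 hz)] with y hy
    exact deriv_comp_diskMap hf ha (mem_ball_zero_iff.1 hy)
  have h3 := ((hf.deriv isOpen_ball).differentiableAt (isOpen_ball.mem_nhds hb)).hasDerivAt.comp z
    (hasDerivAt_diskMap ha hz)
  have h4 := ((((hasDerivAt_id z).const_mul (conj a)).const_add 1).pow 2)
  have h5 := (hasDerivAt_const z (1 - conj a * a)).div h4 (pow_ne_zero 2 h0)
  have h6 := (h3.mul h5).deriv
  have hcc := one_sub_conj_mul_self_ne_zero ha
  rw [h2.deriv_eq, h2.self_of_nhds]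
  refine (congrArg (· / _) h6).trans ?_
  simp only [Function.comp, id_eq]
  generalize deriv (deriv f) (diskMap a z) = u
  generalize deriv f (diskMap a z) = v at h1
  generalize conj a = c at *
  simp only [Pi.pow_apply, Pi.div_apply]
  field_simp
  ring

theorem schwarzian_comp_diskMap {f : ℂ → ℂ} (hf : DifferentiableOn ℂ f (ball 0 1))
    (hi : InjOn f (ball 0 1)) {a : ℂ} (ha : ‖a‖ < 1) :
    schwarzian (fun z => f (diskMap a z)) 0 = ((1 - ‖a‖ ^ 2 : ℝ) : ℂ) ^ 2 * schwarzian f a := by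
  have hab : a ∈ 𝔻 := mem_ball_zero_iff.2 ha
  have hz : ‖(0 : ℂ)‖ < 1 := by simp
  have h0 := one_add_conj_mul_ne_zero ha hz
  have h2 : (fun z => deriv (deriv fun z => f (diskMap a z)) z /
      deriv (fun z => f (diskMap a z)) z) =ᶠ[nhds 0] fun z =>
      deriv (deriv f) (diskMap a z) / deriv f (diskMap a z) *
        ((1 - conj a * a) / (1 + conj a * z) ^ 2) -
        2 * conj a / (1 + conj a * z) := by
    filter_upwards [isOpen_ball.mem_nhds (mem_ball_zero_iff.2 hz)] with y hy
    exact preSchwarzian_comp_diskMap hf hi ha (mem_ball_zero_iff.1 hy)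
  have hG : DifferentiableAt ℂ (fun z => deriv (deriv f) z / deriv f z) (diskMap a 0) := by
    rw [diskMap_zero]
    exact (((hf.deriv isOpen_ball).deriv isOpen_ball).differentiableAt
      (isOpen_ball.mem_nhds hab)).div ((hf.deriv isOpen_ball).differentiableAt
      (isOpen_ball.mem_nhds hab)) (deriv_ne_zero_of_differentiableOn_of_injOn isOpen_ball hf hi hab)
  have h3 := hG.hasDerivAt.comp 0 (hasDerivAt_diskMap ha hz)
  have h4 := ((hasDerivAt_id (0 : ℂ)).const_mul (conj a)).const_add 1
  have h5 := (hasDerivAt_const (0 : ℂ) (1 - conj a * a)).div (h4.pow 2)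
    (pow_ne_zero 2 h0)
  have h6 := ((h3.mul h5).sub ((hasDerivAt_const (0 : ℂ) (2 * conj a)).div h4 h0)).deriv
  have h7 := h2.deriv_eq.trans h6
  have h8 := h2.self_of_nhds
  beta_reduce at h8
  unfold schwarzian
  rw [h7, h8, ← one_sub_conj_mul_self]
  simp only [Function.comp, diskMap_zero, id_eq, Pi.pow_apply, Pi.div_apply]
  ring

theorem isOpen_image_of_differentiableOn_of_injOn {f : ℂ → ℂ} {U V : Set ℂ} (hU : IsOpen U)
    (hf : DifferentiableOn ℂ f U) (hi : InjOn f U) (hV : IsOpen V) (hVU : V ⊆ U) :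
    IsOpen (f '' V) := by
  rw [isOpen_iff_mem_nhds]
  rintro _ ⟨z, hz, rfl⟩
  have h1 := (hf.analyticAt (hU.mem_nhds (hVU hz))).hasStrictDerivAt
  rw [← h1.map_nhds_eq (deriv_ne_zero_of_differentiableOn_of_injOn hU hf hi (hVU hz))]
  exact image_mem_map (hV.mem_nhds hz)

/-- A conformal map of the disk onto `Ω` is proper. -/
theorem exists_radius_of_isCompact {f : ℂ → ℂ} {Ω C : Set ℂ}
    (hf : DifferentiableOn ℂ f (ball 0 1)) (hb : BijOn f (ball 0 1) Ω) (hC : IsCompact C)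
    (hCΩ : C ⊆ Ω) : ∃ r < 1, ∀ z ∈ 𝔻, f z ∈ C → ‖z‖ ≤ r := by
  have hsub : ∀ n : ℕ, ball (0 : ℂ) (1 - 1 / (n + 1)) ⊆ ball 0 1 := fun n =>
    ball_subset_ball (by linarith [show (0 : ℝ) ≤ 1 / (n + 1) by positivity])
  have hmono : Monotone fun n : ℕ => f '' ball (0 : ℂ) (1 - 1 / (n + 1)) := fun m n hmn => by
    refine image_mono (ball_subset_ball ?_)
    have : (m : ℝ) ≤ n := by exact_mod_cast hmn
    have := one_div_le_one_div_of_le (by positivity : (0 : ℝ) < m + 1) (by linarith : (m : ℝ) + 1 ≤ n + 1)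
    linarith
  obtain ⟨n, hn⟩ := hC.elim_directed_cover (fun n : ℕ => f '' ball (0 : ℂ) (1 - 1 / (n + 1)))
    (fun n => isOpen_image_of_differentiableOn_of_injOn isOpen_ball hf hb.injOn isOpen_ball
      (hsub n)) (fun p hp => by
        obtain ⟨z, hz, rfl⟩ := hb.surjOn (hCΩ hp)
        obtain ⟨n, hn⟩ := exists_nat_one_div_lt (sub_pos.2 (mem_ball_zero_iff.1 hz))
        refine mem_iUnion.2 ⟨n, z, ?_, rfl⟩
        rw [mem_ball_zero_iff]
        linarith) hmono.directed_le
  refine ⟨1 - 1 / (n + 1), by linarith [show (0 : ℝ) < 1 / (n + 1) by positivity],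
    fun z hz hfz => ?_⟩
  obtain ⟨y, hy, hyz⟩ := hn hfz
  rw [← hb.injOn (hsub n hy) hz hyz]
  exact (mem_ball_zero_iff.1 hy).le

theorem closure_subset_of_union_eq_compl {Ω Ωs Γ : Set ℂ} (hΩs : IsOpen Ωs)
    (hdisj : Disjoint Ω Ωs) (hunion : Ω ∪ Ωs = Γᶜ) : closure Ω ⊆ Ω ∪ Γ := fun p hp => by
  by_contra h
  rw [mem_union, not_or] at h
  have h1 : p ∈ Ω ∪ Ωs := by rw [hunion]; exact h.2
  have h2 : p ∈ Ωs := h1.resolve_left h.1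
  obtain ⟨q, hq, hq'⟩ := mem_closure_iff.1 hp Ωs hΩs h2
  exact hdisj.le_bot ⟨hq', hq⟩

theorem exists_radius_infDist_lt {f : ℂ → ℂ} {Ω Γ : Set ℂ}
    (hf : DifferentiableOn ℂ f (ball 0 1)) (hb : BijOn f (ball 0 1) Ω)
    (hΩ : IsBounded Ω) (hcl : closure Ω ⊆ Ω ∪ Γ) {η : ℝ} (hη : 0 < η) :
    ∃ r < 1, ∀ z ∈ 𝔻, r < ‖z‖ → infDist (f z) Γ < η := by
  have hsub : closure Ω ∩ {p | η ≤ infDist p Γ} ⊆ Ω := fun p hp => by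
    refine (hcl hp.1).resolve_right fun h => ?_
    have := hp.2
    rw [mem_ofPred_eq, infDist_zero_of_mem h] at this
    linarith
  have hcomp : IsCompact (closure Ω ∩ {p | η ≤ infDist p Γ}) :=
    hΩ.isCompact_closure.inter_right (isClosed_le continuous_const (continuous_infDist_pt Γ))
  obtain ⟨r, hr, h⟩ := exists_radius_of_isCompact hf hb hcomp hsub
  refine ⟨r, hr, fun z hz hrz => ?_⟩
  by_contra hc
  exact absurd (h z hz ⟨subset_closure (hb.mapsTo hz), not_lt.1 hc⟩) (not_le.2 hrz)

theorem schwarzian_zero_le {f T a b : ℂ → ℂ} {Ω Γ : Set ℂ} {M δ : ℝ} {K : ℂ → ENNReal}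
    (hf : DifferentiableOn ℂ f (ball 0 1)) (hb : BijOn f (ball 0 1) Ω)
    (hΩ : IsBounded Ω) (hcl : closure Ω ⊆ Ω ∪ Γ) (hd : ∀ p ∈ Ω, 0 < infDist p Γ)
    (hM : 0 < M) (hδ : 0 < δ)
    (h : ∀ p ∈ Ω, HasFDerivAt T (wirtingerMap (a p) (b p)) p ∧
      ofReal (‖a p‖ ^ 2) ≤ K p * ofReal (1 / (infDist p Γ + ‖p - f 0‖) ^ 4) ∧
      ‖a p‖ ≤ M / infDist p Γ ^ 2 ∧ ‖b p‖ ≤ M / infDist p Γ ^ 2 ∧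
      (infDist p Γ < δ → p ≠ f 0 → ‖T p - 1 / (p - f 0)‖ ≤ M * infDist p Γ / ‖p - f 0‖ ^ 2)) :
    ofReal (π / 36 * ‖schwarzian f 0‖ ^ 2) ≤ ofReal (‖deriv f 0‖ ^ 2) *
      ∫⁻ p in Ω, K p * ofReal (1 / (infDist p Γ + ‖p - f 0‖) ^ 4) := by
  have h0 : f 0 ∈ Ω := hb.mapsTo (mem_ball_self one_pos)
  have hΩm : MeasurableSet Ω := by
    rw [← hb.image_eq]
    exact (isOpen_image_of_differentiableOn_of_injOn isOpen_ball hf hb.injOn isOpen_ball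
      subset_rfl).measurableSet
  refine (schwarzian_zero_bound (T := T) (a := a) (b := b) hf hb.injOn
    (fun z hz => (h _ (hb.mapsTo hz)).1) (fun ρ hρ => ?_) fun ε hε => ?_).trans ?_
  · have hsub : closedBall (0 : ℂ) ρ ⊆ ball 0 1 := closedBall_subset_ball hρ
    have hc : ContinuousOn (fun z => M / infDist (f z) Γ ^ 2) (closedBall 0 ρ) :=
      continuousOn_const.div (((continuous_infDist_pt Γ).comp_continuousOn
        (hf.continuousOn.mono hsub)).pow 2) fun z hz =>
          pow_ne_zero 2 (hd _ (hb.mapsTo (hsub hz))).ne'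
    obtain ⟨N, hN⟩ := (isCompact_closedBall (0 : ℂ) ρ).exists_bound_of_continuousOn hc
    refine ⟨N, fun z hz => ?_⟩
    have h1 := (le_norm_self _).trans (hN z hz)
    have h2 := h _ (hb.mapsTo (hsub hz))
    exact ⟨h2.2.2.1.trans h1, h2.2.2.2.1.trans h1⟩
  · have hd0 := hd _ h0
    set e := infDist (f 0) Γ
    obtain ⟨r, hr, hrz⟩ := exists_radius_infDist_lt hf hb hΩ hcl
      (lt_min hδ (lt_min (half_pos hd0) (show 0 < ε * (e / 2) ^ 2 / M by positivity)))
    refine ⟨r, hr, fun z hz hz' => ?_⟩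
    have h1 := hrz z hz hz'
    rw [lt_min_iff, lt_min_iff] at h1
    have h2 : e ≤ infDist (f z) Γ + ‖f z - f 0‖ := by
      rw [← dist_eq_norm, dist_comm]
      exact infDist_le_infDist_add_dist
    have h3 : e / 2 ≤ ‖f z - f 0‖ := by linarith
    have h4 : 0 < ‖f z - f 0‖ := by linarith
    refine ((h _ (hb.mapsTo hz)).2.2.2.2 h1.1 (sub_ne_zero.1 (norm_pos_iff.1 h4))).trans ?_
    rw [div_le_iff₀ (by positivity)]
    have h5 := h1.2.2
    rw [lt_div_iff₀ hM] at h5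
    have h6 : (e / 2) ^ 2 ≤ ‖f z - f 0‖ ^ 2 := by gcongr
    nlinarith
  · rw [hb.image_eq]
    refine mul_le_mul_right ?_ _
    exact setLIntegral_mono' hΩm fun p hp => (h p hp).2.1

theorem lintegral_schwarzian_lt_top_of_kernel {F : ℂ → ℂ} {Ω Γ : Set ℂ} {M δ : ℝ}
    {K : ℂ → ENNReal} (hF : DifferentiableOn ℂ F (ball 0 1)) (hb : BijOn F (ball 0 1) Ω)
    (hΩ : IsBounded Ω) (hcl : closure Ω ⊆ Ω ∪ Γ) (hd : ∀ p ∈ Ω, 0 < infDist p Γ)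
    (hM : 0 < M) (hδ : 0 < δ) (hKm : Measurable K)
    (hK : ∫⁻ p in Ω, K p * ofReal (1 / infDist p Γ ^ 2) < ⊤)
    (h : ∀ ζ ∈ Ω, ∃ T a b : ℂ → ℂ, ∀ p ∈ Ω, HasFDerivAt T (wirtingerMap (a p) (b p)) p ∧
      ofReal (‖a p‖ ^ 2) ≤ K p * ofReal (1 / (infDist p Γ + ‖p - ζ‖) ^ 4) ∧
      ‖a p‖ ≤ M / infDist p Γ ^ 2 ∧ ‖b p‖ ≤ M / infDist p Γ ^ 2 ∧
      (infDist p Γ < δ → p ≠ ζ → ‖T p - 1 / (p - ζ)‖ ≤ M * infDist p Γ / ‖p - ζ‖ ^ 2)) :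
    ∫⁻ z in 𝔻, ofReal ((1 - ‖z‖ ^ 2) ^ 2 * ‖schwarzian F z‖ ^ 2) < ⊤ := by
  set S : ℂ → ENNReal := fun ζ =>
    ∫⁻ p in Ω, K p * ofReal (1 / (infDist p Γ + ‖p - ζ‖) ^ 4) with hI
  have key : ∀ z ∈ 𝔻,
      ofReal ((1 - ‖z‖ ^ 2) ^ 2 * ‖schwarzian F z‖ ^ 2) ≤
        ofReal (36 / π) * (ofReal (‖deriv F z‖ ^ 2) * S (F z)) := fun z hz => by
    have hz1 : ‖z‖ < 1 := mem_ball_zero_iff.1 hz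
    have ht : 0 < 1 - ‖z‖ ^ 2 := by nlinarith [norm_nonneg z]
    obtain ⟨T, a, b, hT⟩ := h _ (hb.mapsTo hz)
    have hg : DifferentiableOn ℂ (fun y => F (diskMap z y)) (ball 0 1) := fun y hy =>
      ((hF.differentiableAt (isOpen_ball.mem_nhds ((bijOn_diskMap hz1).mapsTo hy))).comp y
        (hasDerivAt_diskMap hz1 (mem_ball_zero_iff.1 hy)).differentiableAt).differentiableWithinAt
    have h1 := schwarzian_zero_le (f := fun y => F (diskMap z y)) (T := T) (a := a) (b := b)
      (K := K) hg (hb.comp (bijOn_diskMap hz1)) hΩ hcl hd hM hδ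
      (by simp only [diskMap_zero]; exact hT)
    rw [schwarzian_comp_diskMap hF hb.injOn hz1, deriv_comp_diskMap hF hz1 (by simp)] at h1
    simp only [diskMap_zero, mul_zero, add_zero, one_pow, div_one, one_sub_conj_mul_self, norm_mul,
      norm_pow, norm_real, norm_of_nonneg ht.le] at h1
    have h2 := mul_le_mul_right h1 (ofReal (36 / π / (1 - ‖z‖ ^ 2) ^ 2))
    rw [← mul_assoc, ← ofReal_mul (by positivity), ← ofReal_mul (by positivity)]
      at h2
    rw [← mul_assoc, ← ofReal_mul (by positivity)]
    convert h2 using 2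
    · field_simp
    · congr 1; field_simp
  have hΩo : IsOpen Ω := by
    rw [← hb.image_eq]
    exact isOpen_image_of_differentiableOn_of_injOn isOpen_ball hF hb.injOn isOpen_ball subset_rfl
  refine (setLIntegral_mono' measurableSet_ball key).trans_lt ?_
  rw [lintegral_ofReal_mul, ← lintegral_image_eq_lintegral_norm_deriv_sq
    measurableSet_ball (fun z hz => hF.differentiableAt (isOpen_ball.mem_nhds hz)) hb.injOn S,
    hb.image_eq]
  refine mul_lt_top ofReal_lt_top ?_
  have hmeas : Measurable fun q : ℂ × ℂ =>
      K q.2 * ofReal (1 / (infDist q.2 Γ + ‖q.2 - q.1‖) ^ 4) := by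
    have : Measurable fun p : ℂ => infDist p Γ := (continuous_infDist_pt Γ).measurable
    fun_prop
  simp only [hI]
  rw [lintegral_lintegral_swap hmeas.aemeasurable]
  calc ∫⁻ p in Ω, ∫⁻ ζ in Ω, K p * ofReal (1 / (infDist p Γ + ‖p - ζ‖) ^ 4)
      ≤ ∫⁻ p in Ω, ofReal (2 * π) * (K p * ofReal (1 / infDist p Γ ^ 2)) := by
        refine setLIntegral_mono' hΩo.measurableSet fun p hp => ?_
        have h3 := lintegral_div_add_pow_four_le p (hd p hp)
        rw [lintegral_const_mul _ (by fun_prop), mul_left_comm, ← ofReal_mul (by positivity),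
          mul_one_div]
        gcongr
        refine (setLIntegral_le_lintegral _ _).trans ?_
        simpa only [norm_sub_rev p] using h3
    _ < ⊤ := by
        rw [lintegral_ofReal_mul]
        exact mul_lt_top ofReal_lt_top hK

theorem UnitCurve.lintegral_schwarzian_lt_top {w : ℝ → ℂ} (hw : UnitCurve w)
    (hE : moebiusEnergy w < ⊤) {Ω Ωs : Set ℂ} (hΩ : IsOpen Ω) (hΩc : IsPreconnected Ω)
    (hΩs : IsOpen Ωs) (hΩsc : IsPreconnected Ωs) (hdisj : Disjoint Ω Ωs)
    (hunion : Ω ∪ Ωs = (range w)ᶜ) (hΩb : IsBounded Ω)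
    (hub : ¬ IsBounded Ωs) {F : ℂ → ℂ} (hF : DifferentiableOn ℂ F (ball 0 1))
    (hb : BijOn F (ball 0 1) Ω) :
    ∫⁻ z in 𝔻, ofReal ((1 - ‖z‖ ^ 2) ^ 2 * ‖schwarzian F z‖ ^ 2) < ⊤ := by
  obtain ⟨δ, C, R, A, B, D, h⟩ :=
    hw.exists_reflectionData hE hΩ hΩc hΩs hΩsc hdisj hunion hub
  have hd : ∀ p ∈ Ω, 0 < infDist p (range w) := fun p hp => hw.infDist_pos fun hp' => by
    have : p ∈ (range w)ᶜ := hunion ▸ Or.inl hp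
    exact this hp'
  obtain ⟨K, M, hM, δ₁, hδ₁, hKm, hK, hker⟩ := h.exists_kernel hΩb hd
  exact lintegral_schwarzian_lt_top_of_kernel hF hb hΩb
    (closure_subset_of_union_eq_compl hΩs hdisj hunion) hd hM hδ₁ hKm hK hker

theorem tendsto_setLIntegral_annulus {g : ℂ → ENNReal}
    (h : ∫⁻ z in 𝔻, g z < ⊤) {ε : ENNReal} (hε : 0 < ε) :
    ∃ r, 0 < r ∧ r < 1 ∧ ∫⁻ z in 𝔻 \ closedBall 0 r, g z ≤ ε := by
  have hmono : Monotone fun n : ℕ => closedBall (0 : ℂ) (1 - 1 / (n + 2)) := fun m n hmn => by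
    refine closedBall_subset_closedBall ?_
    have : (m : ℝ) ≤ n := by exact_mod_cast hmn
    have := one_div_le_one_div_of_le (by positivity : (0 : ℝ) < m + 2)
      (by linarith : (m : ℝ) + 2 ≤ n + 2)
    linarith
  have hI : ⋂ n : ℕ, (𝔻 \ closedBall 0 (1 - 1 / (n + 2))) = ∅ := by
    refine eq_empty_of_forall_notMem fun z hz => ?_
    rw [mem_iInter] at hz
    have h0 := mem_ball_zero_iff.1 (hz 0).1
    obtain ⟨n, hn⟩ := exists_nat_one_div_lt (sub_pos.2 h0)
    refine (hz n).2 (mem_closedBall_zero_iff.2 ?_)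
    have := one_div_le_one_div_of_le (by positivity : (0 : ℝ) < n + 1)
      (by linarith : (n : ℝ) + 1 ≤ n + 2)
    linarith
  have ht := tendsto_measure_iInter_atTop (μ := (volume.restrict (𝔻)).withDensity g)
    (s := fun n : ℕ => 𝔻 \ closedBall 0 (1 - 1 / (n + 2)))
    (fun n => (measurableSet_ball.diff measurableSet_closedBall).nullMeasurableSet)
    (fun m n hmn => sdiff_subset_sdiff_right (hmono hmn)) ⟨0, ?_⟩
  · rw [hI, measure_empty] at ht
    obtain ⟨n, hn⟩ := (ht.eventually_lt_const hε).exists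
    have h2 : (1 : ℝ) / (n + 2) ≤ 1 / 2 := one_div_le_one_div_of_le two_pos (by
      have : (0 : ℝ) ≤ n := n.cast_nonneg
      linarith)
    refine ⟨1 - 1 / (n + 2), by linarith, by
      linarith [show (0 : ℝ) < 1 / (n + 2) by positivity], ?_⟩
    rw [Function.comp_apply, withDensity_apply _ (measurableSet_ball.diff measurableSet_closedBall),
      Measure.restrict_restrict (measurableSet_ball.diff measurableSet_closedBall),
      inter_eq_left.2 sdiff_subset] at hn
    exact hn.le
  · rw [withDensity_apply _ (measurableSet_ball.diff measurableSet_closedBall)]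
    exact ((setLIntegral_le_lintegral _ _).trans_lt h).ne

/-- The mean value property turns weighted `L²` bounds into decay at the boundary. -/
theorem exists_radius_pow_mul_norm_le {h : ℂ → ℂ} (n : ℕ)
    (hd : DifferentiableOn ℂ h (ball 0 1))
    (hI : ∫⁻ z in 𝔻, ofReal ((1 - ‖z‖) ^ (2 * n) * ‖h z‖ ^ 2) < ⊤) {ε : ℝ}
    (hε : 0 < ε) :
    ∃ r < 1, ∀ z ∈ 𝔻, r < ‖z‖ → (1 - ‖z‖) ^ (n + 1) * ‖h z‖ ≤ ε := by
  obtain ⟨ρ, hρ0, hρ1, hρ⟩ := tendsto_setLIntegral_annulus hI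
    (ENNReal.ofReal_pos.2 (show 0 < ε ^ 2 * (π / 2 ^ 2) / 2 ^ (2 * n) by positivity))
  refine ⟨(1 + 2 * ρ) / 3, by linarith, fun z hz hrz => ?_⟩
  have hz1 : ‖z‖ < 1 := mem_ball_zero_iff.1 hz
  set d := 1 - ‖z‖
  have hd0 : 0 < d := by linarith
  have hsub : ball z (d / 2) ⊆ ball 0 1 \ closedBall 0 ρ := fun y hy => by
    rw [mem_ball_iff_norm] at hy
    have h1 := norm_le_norm_add_norm_sub' y z
    have h2 := norm_le_norm_add_norm_sub' z y
    rw [norm_sub_rev] at h2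
    refine ⟨mem_ball_zero_iff.2 (by linarith), fun h => ?_⟩
    rw [mem_closedBall_zero_iff] at h
    linarith
  have h1 := ofReal_norm_sq_mul_le_lintegral_ball (half_pos hd0)
    (hd.mono (hsub.trans sdiff_subset))
  have h2 : ofReal ((d / 2) ^ (2 * n)) * ∫⁻ y in ball z (d / 2), ofReal (‖h y‖ ^ 2)
      ≤ ofReal (ε ^ 2 * (π / 2 ^ 2) / 2 ^ (2 * n)) := by
    rw [← lintegral_ofReal_mul]
    refine le_trans ?_ ((lintegral_mono_set hsub).trans hρ)
    refine setLIntegral_mono' measurableSet_ball fun y hy => ?_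
    rw [← ofReal_mul (by positivity)]
    refine ofReal_le_ofReal ?_
    gcongr
    rw [mem_ball_iff_norm] at hy
    linarith [norm_le_norm_add_norm_sub' y z]
  have h3 := (mul_le_mul_right h1 (ofReal ((d / 2) ^ (2 * n)))).trans h2
  rw [← ofReal_mul (by positivity), ofReal_le_ofReal_iff (by positivity)] at h3
  refine le_of_sq_le_sq ?_ hε.le
  have h4 : (d / 2) ^ (2 * n) * (‖h z‖ ^ 2 * (π * (d / 2) ^ 2)) =
      (d ^ (n + 1) * ‖h z‖) ^ 2 * (π / 2 ^ 2) / 2 ^ (2 * n) := by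
    rw [div_pow, div_pow]; ring
  rw [h4] at h3
  have h5 : (0 : ℝ) < π / 2 ^ 2 / 2 ^ (2 * n) := by positivity
  rw [mul_div_assoc, mul_div_assoc] at h3
  exact le_of_mul_le_mul_right h3 h5

/-- Trapping for the perturbed Riccati equation `κ' = -κ - κ² + e`. -/
theorem riccati_decay {κ e : ℝ → ℂ} {L : ℝ → ℝ} {t₁ t₂ ε A B N : ℝ} (hε : ε ≤ 1 / 8)
    (hκ : ∀ t ≥ t₁, HasDerivAt κ (-κ t - κ t ^ 2 + e t) t) (he : ∀ t ≥ t₁, ‖e t‖ ≤ ε)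
    (hL : ∀ t ≥ t₁, HasDerivAt L (-2 * (κ t).re) t) (hLA : ∀ t ≥ t₁, L t ≤ A + t)
    (hLB : -B ≤ L t₁) (ht₂ : t₁ + 2 * (A + B + t₁) < t₂) (hN : ‖κ t₂‖ ≤ N) {t : ℝ}
    (ht : t₂ ≤ t) : ‖κ t‖ ^ 2 ≤ N ^ 2 * exp (-(t - t₂) / 4) + 16 * ε ^ 2 := by
  have h12 : t₁ < t₂ := by linarith [hLA t₁ le_rfl]
  have hre : ∀ t ≥ t₁, HasDerivAt (fun t => -(κ t).re) (-(-κ t - κ t ^ 2 + e t).re) t :=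
    fun t ht => (reCLM.hasFDerivAt.comp_hasDerivAt t (hκ t ht)).neg
  have hcont : ∀ {a b : ℝ}, t₁ ≤ a → ContinuousOn (fun t => -(κ t).re) (Icc a b) :=
    fun ha t ht => (hre t (ha.trans ht.1)).continuousAt.continuousWithinAt
  obtain ⟨s, hs1, hs2, hs⟩ : ∃ s, t₁ ≤ s ∧ s ≤ t₂ ∧ -(κ s).re ≤ 3 / 4 := by
    by_contra! hcon
    have hmono : MonotoneOn (fun t => L t - 3 / 2 * t) (Icc t₁ t₂) := by
      refine monotoneOn_of_hasDerivWithinAt_nonneg (f' := fun t => -2 * (κ t).re - 3 / 2)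
        (convex_Icc _ _) (fun t ht => ?_) (fun t ht => ?_) fun t ht => ?_
      · exact ((hL t ht.1).continuousAt.sub (by fun_prop)).continuousWithinAt
      · rw [interior_Icc] at ht ⊢
        exact (((hL t ht.1.le).sub ((hasDerivAt_id t).const_mul (3 / 2))).congr_deriv
          (by ring)).hasDerivWithinAt
      · rw [interior_Icc] at ht
        linarith [hcon t ht.1.le ht.2.le]
    have := hmono (left_mem_Icc.2 h12.le) (right_mem_Icc.2 h12.le) h12.le
    simp only at this
    linarith [hLA t₂ h12.le]
  have hbar : ∀ t, t₂ ≤ t → -(κ t).re ≤ 3 / 4 := fun t ht =>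
    image_le_of_deriv_right_lt_deriv_boundary (a := s) (b := t) (f := fun t => -(κ t).re)
      (f' := fun t => -(-κ t - κ t ^ 2 + e t).re) (B := fun _ => 3 / 4) (B' := fun _ => 0)
      (hcont hs1) (fun x hx => (hre x (hs1.trans hx.1)).hasDerivWithinAt) hs
      (fun x => hasDerivAt_const x _) (fun x hx hx' => by
        have h1 := (abs_re_le_norm (e x)).trans (he x (hs1.trans hx.1))
        have h2 := neg_abs_le (e x).re
        have h3 : (κ x ^ 2).re = (κ x).re ^ 2 - (κ x).im ^ 2 := by simp [pow_two]
        have h4 : (κ x).re = -(3 / 4) := by linarith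
        simp only [Complex.add_re, Complex.sub_re, Complex.neg_re, h3, h4]
        nlinarith [sq_nonneg (κ x).im]) (right_mem_Icc.2 (hs2.trans ht))
  have hsq : ∀ t ≥ t₁, HasDerivAt (fun t => ‖κ t‖ ^ 2)
      (2 * ((κ t).re * (-κ t - κ t ^ 2 + e t).re + (κ t).im * (-κ t - κ t ^ 2 + e t).im)) t :=
    fun t ht => by
      have h1 := (reCLM.hasFDerivAt.comp_hasDerivAt t (hκ t ht)).pow 2
      have h2 := (imCLM.hasFDerivAt.comp_hasDerivAt t (hκ t ht)).pow 2
      have h3 : (fun t => ‖κ t‖ ^ 2) = (reCLM ∘ κ) ^ 2 + (imCLM ∘ κ) ^ 2 := by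
        funext t
        rw [← normSq_eq_norm_sq, normSq_apply]
        simp [pow_two]
      rw [h3]
      refine (h1.add h2).congr_deriv ?_
      simp
      ring
  have hanti : AntitoneOn (fun t => exp (t / 4) * (‖κ t‖ ^ 2 - 16 * ε ^ 2)) (Icc t₂ t) := by
    have hder : ∀ t ≥ t₁, HasDerivAt (fun t => exp (t / 4) * (‖κ t‖ ^ 2 - 16 * ε ^ 2))
        (exp (t / 4) * ((‖κ t‖ ^ 2 - 16 * ε ^ 2) / 4 +
          2 * ((κ t).re * (-κ t - κ t ^ 2 + e t).re + (κ t).im * (-κ t - κ t ^ 2 + e t).im))) t :=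
      fun t ht => by
        have h1 := ((hasDerivAt_id t).div_const 4).exp
        refine (h1.mul ((hsq t ht).sub_const (16 * ε ^ 2))).congr_deriv ?_
        simp only [id_eq]
        ring
    refine antitoneOn_of_hasDerivWithinAt_nonpos (f' := fun t => exp (t / 4) *
        ((‖κ t‖ ^ 2 - 16 * ε ^ 2) / 4 + 2 * ((κ t).re * (-κ t - κ t ^ 2 + e t).re +
          (κ t).im * (-κ t - κ t ^ 2 + e t).im))) (convex_Icc _ _)
      (fun t ht => (hder t (h12.le.trans ht.1)).continuousAt.continuousWithinAt)
      (fun t ht => ?_) fun t ht => ?_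
    · rw [interior_Icc] at ht ⊢
      exact (hder t (h12.le.trans ht.1.le)).hasDerivWithinAt
    · rw [interior_Icc] at ht
      refine mul_nonpos_of_nonneg_of_nonpos (exp_pos _).le ?_
      have h1 := hbar t ht.1.le
      have h2 : (κ t).re * (e t).re + (κ t).im * (e t).im ≤ ‖κ t‖ * ε := by
        have h3 : (κ t).re * (e t).re + (κ t).im * (e t).im = (conj (κ t) * e t).re := by
          simp
        rw [h3]
        refine (re_le_norm _).trans ?_
        rw [norm_mul, Complex.norm_conj]
        exact mul_le_mul_of_nonneg_left (he t (h12.le.trans ht.1.le)) (norm_nonneg _)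
      have h4 : (κ t).re * (-κ t - κ t ^ 2 + e t).re + (κ t).im * (-κ t - κ t ^ 2 + e t).im =
          -‖κ t‖ ^ 2 - ‖κ t‖ ^ 2 * (κ t).re + ((κ t).re * (e t).re + (κ t).im * (e t).im) := by
        rw [← normSq_eq_norm_sq, normSq_apply]
        simp [pow_two]
        ring
      rw [h4]
      nlinarith [sq_nonneg (‖κ t‖ - 4 * ε), mul_nonneg (sq_nonneg ‖κ t‖) (by linarith : 0 ≤ 3 / 4 + (κ t).re)]
  have h1 := hanti (left_mem_Icc.2 ht) (right_mem_Icc.2 ht) ht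
  simp only at h1
  have h2 : exp (t / 4) * (N ^ 2 * exp (-(t - t₂) / 4)) = exp (t₂ / 4) * N ^ 2 := by
    rw [mul_left_comm, ← exp_add, mul_comm]; congr 2; ring
  have h3 : ‖κ t₂‖ ^ 2 ≤ N ^ 2 := by gcongr
  have h4 : exp (t / 4) * (‖κ t‖ ^ 2 - 16 * ε ^ 2) ≤
      exp (t / 4) * (N ^ 2 * exp (-(t - t₂) / 4)) := by
    rw [h2]
    refine h1.trans (mul_le_mul_of_nonneg_left ?_ (exp_pos _).le)
    nlinarith [sq_nonneg ε]
  linarith [le_of_mul_le_mul_left h4 (exp_pos _)]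

theorem HasDerivAt.log_norm {g : ℝ → ℂ} {g' : ℂ} {t : ℝ} (hg : HasDerivAt g g' t) (h0 : g t ≠ 0) :
    HasDerivAt (fun t => Real.log ‖g t‖) (g' / g t).re t := by
  have h1 := (hg.norm_sq.log (pow_ne_zero 2 (norm_ne_zero_iff.2 h0))).div_const 2
  have h2 : (fun t => Real.log ‖g t‖) = fun t => Real.log (‖g t‖ ^ 2) / 2 := by
    funext t
    rw [Real.log_pow]
    push_cast
    ring
  rw [h2]
  refine h1.congr_deriv ?_
  rw [Complex.div_re, ← normSq_eq_norm_sq, Complex.inner]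
  have := Complex.normSq_pos.2 h0
  simp
  field_simp

theorem norm_deriv_le_of_ball {F : ℂ → ℂ} {M : ℝ} (hF : DifferentiableOn ℂ F (ball 0 1))
    (hM : ∀ z ∈ 𝔻, ‖F z‖ ≤ M) {z : ℂ} (hz : z ∈ 𝔻) :
    ‖deriv F z‖ ≤ 2 * M / (1 - ‖z‖) := by
  have hz1 : ‖z‖ < 1 := mem_ball_zero_iff.1 hz
  have hsub : closedBall z ((1 - ‖z‖) / 2) ⊆ ball 0 1 := fun y hy => by
    rw [mem_closedBall_iff_norm] at hy
    have := norm_le_norm_add_norm_sub' y z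
    exact mem_ball_zero_iff.2 (by linarith)
  have h1 := Complex.norm_deriv_le_of_forall_mem_sphere_norm_le (c := z) (f := F)
    (show 0 < (1 - ‖z‖) / 2 by linarith) (hF.diffContOnCl_ball hsub) fun y hy =>
      hM y (hsub (sphere_subset_closedBall hy))
  refine h1.trans (le_of_eq ?_)
  have : 1 - ‖z‖ ≠ 0 := by linarith
  field_simp

theorem exists_radius_preSchwarzian_le {F : ℂ → ℂ} {M : ℝ}
    (hF : DifferentiableOn ℂ F (ball 0 1)) (hi : InjOn F (ball 0 1))
    (hM : ∀ z ∈ 𝔻, ‖F z‖ ≤ M)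
    (hS : ∀ ε > 0, ∃ r < 1, ∀ z ∈ 𝔻, r < ‖z‖ →
      (1 - ‖z‖) ^ 2 * ‖schwarzian F z‖ ≤ ε) {η : ℝ} (hη : 0 < η) :
    ∃ r < 1, ∀ z ∈ 𝔻, r < ‖z‖ →
      (1 - ‖z‖) * ‖deriv (deriv F) z / deriv F z‖ ≤ η := by
  set G : ℂ → ℂ := fun z => deriv (deriv F) z / deriv F z with hG
  have h0 : ∀ z ∈ 𝔻, deriv F z ≠ 0 := fun z hz =>
    deriv_ne_zero_of_differentiableOn_of_injOn isOpen_ball hF hi hz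
  have hF' : DifferentiableOn ℂ (deriv F) (ball 0 1) := hF.deriv isOpen_ball
  have hGd : DifferentiableOn ℂ G (ball 0 1) := (hF'.deriv isOpen_ball).div hF' h0
  set ε := min (1 / 8) (η / 16)
  have hε0 : 0 < ε := by positivity
  obtain ⟨r₀, hr₀, hr⟩ := hS ε hε0
  set ρ := max r₀ 0
  have hρ1 : ρ < 1 := max_lt hr₀ one_pos
  set t₁ := -Real.log ((1 - ρ) / 2) with ht₁
  have hρt : ρ < 1 - exp (-t₁) := by
    rw [ht₁, neg_neg, exp_log (by linarith)]
    linarith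
  obtain ⟨c, hc, hcz⟩ : ∃ c > 0, ∀ z ∈ closedBall (0 : ℂ) (1 - exp (-t₁)), c ≤ ‖deriv F z‖ := by
    have hsub : closedBall (0 : ℂ) (1 - exp (-t₁)) ⊆ ball 0 1 :=
      closedBall_subset_ball (by linarith [exp_pos (-t₁)])
    obtain ⟨x, hx, hmin⟩ := (isCompact_closedBall (0 : ℂ) (1 - exp (-t₁))).exists_isMinOn
      (nonempty_closedBall.2 ((le_max_right _ _).trans hρt.le))
      (hF'.continuousOn.mono hsub).norm
    exact ⟨_, norm_pos_iff.2 (h0 x (hsub hx)), fun z hz => hmin hz⟩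
  have hMpos : 0 ≤ M := (norm_nonneg _).trans (hM 0 (mem_ball_self one_pos))
  set A := Real.log (2 * (M + 1)) with hA
  set B := -Real.log c with hB
  set t₂ := max t₁ (t₁ + 2 * (A + B + t₁)) + 1
  have h12 : t₁ ≤ t₂ := by linarith [le_max_left t₁ (t₁ + 2 * (A + B + t₁))]
  have hsub₂ : closedBall (0 : ℂ) (1 - exp (-t₂)) ⊆ ball 0 1 :=
    closedBall_subset_ball (by linarith [exp_pos (-t₂)])
  obtain ⟨N, hN⟩ := (isCompact_closedBall (0 : ℂ) (1 - exp (-t₂))).exists_bound_of_continuousOn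
    (hGd.continuousOn.mono hsub₂)
  have ht : Tendsto (fun t : ℝ => N ^ 2 * exp (-(t - t₂) / 4)) atTop (nhds 0) := by
    rw [← mul_zero (N ^ 2)]
    refine Tendsto.const_mul _ (tendsto_exp_atBot.comp ?_)
    have : (fun t : ℝ => -(t - t₂) / 4) = fun t => -((1 / 4) * t + -(t₂ / 4)) := by
      funext t; ring
    rw [this]
    exact Filter.tendsto_neg_atTop_atBot.comp (Filter.tendsto_atTop_add_const_right _ _
      (Filter.tendsto_id.const_mul_atTop (by norm_num)))
  obtain ⟨t₃, ht₃⟩ := Filter.eventually_atTop.1 (ht.eventually_lt_const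
    (show 0 < η ^ 2 / 8 by positivity))
  refine ⟨1 - exp (-max t₂ t₃), by linarith [exp_pos (-max t₂ t₃)], fun z hz hrz => ?_⟩
  have hz1 : ‖z‖ < 1 := mem_ball_zero_iff.1 hz
  obtain ⟨θ, hθ⟩ : ∃ θ : ℝ, z = ‖z‖ * Complex.exp (θ * I) :=
    ⟨z.arg, (Complex.norm_mul_exp_arg_mul_I z).symm⟩
  set E := Complex.exp (θ * I)
  have hE1 : ‖E‖ = 1 := norm_exp_ofReal_mul_I θ
  set p : ℝ → ℂ := fun t => ((1 - exp (-t) : ℝ) : ℂ) * E with hp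
  have hpn : ∀ t ≥ t₁, ‖p t‖ = 1 - exp (-t) := fun t ht => by
    have : exp (-t) ≤ exp (-t₁) := exp_le_exp.2 (by linarith)
    have h2 : 0 ≤ 1 - exp (-t) := by linarith [(le_max_right r₀ 0).trans hρt.le]
    simp only [hp]
    rw [norm_mul, hE1, mul_one, norm_real, norm_of_nonneg h2]
  have hpb : ∀ t ≥ t₁, p t ∈ 𝔻 := fun t ht => by
    rw [mem_ball_zero_iff, hpn t ht]
    linarith [exp_pos (-t)]
  have hpd : ∀ t, HasDerivAt p ((exp (-t) : ℝ) * E) t := fun t => by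
    have h1 := (((hasDerivAt_id t).neg.exp).const_sub 1).ofReal_comp.mul_const E
    refine h1.congr_deriv ?_
    simp
  set κ : ℝ → ℂ := fun t => -(1 / 2) * ((exp (-t) : ℝ) : ℂ) * E * G (p t) with hκ
  set e : ℝ → ℂ := fun t => -(1 / 2) * ((exp (-t) : ℝ) : ℂ) ^ 2 * E ^ 2 * schwarzian F (p t)
    with he
  have hκd : ∀ t ≥ t₁, HasDerivAt κ (-κ t - κ t ^ 2 + e t) t := fun t ht => by
    have h1 := ((hGd.differentiableAt (isOpen_ball.mem_nhds (hpb t ht))).hasDerivAt).comp t (hpd t)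
    have h2 := (((hasDerivAt_id t).neg.exp).ofReal_comp.const_mul (-(1 / 2) : ℂ)).mul_const E
    refine (h2.mul h1).congr_deriv ?_
    simp only [hκ, he, schwarzian, Function.comp, id_eq, Pi.neg_apply]
    push_cast
    ring
  have hen : ∀ t ≥ t₁, ‖e t‖ ≤ ε := fun t ht => by
    have h1 := hr (p t) (hpb t ht) (by
      rw [hpn t ht]
      have : exp (-t) ≤ exp (-t₁) := exp_le_exp.2 (by linarith)
      linarith [le_max_left r₀ 0])
    rw [hpn t ht, sub_sub_cancel] at h1
    simp only [he, norm_mul, norm_pow, hE1, norm_real, norm_neg, norm_div, norm_one,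
      Complex.norm_ofNat, norm_of_nonneg (exp_pos (-t)).le]
    nlinarith
  have hL : ∀ t ≥ t₁, HasDerivAt (fun t => Real.log ‖deriv F (p t)‖) (-2 * (κ t).re) t :=
    fun t ht => by
      have h1 := ((hF'.differentiableAt (isOpen_ball.mem_nhds (hpb t ht))).hasDerivAt).comp t
        (hpd t)
      refine (h1.log_norm (h0 _ (hpb t ht))).congr_deriv ?_
      rw [← Complex.re_ofReal_mul]
      congr 1
      simp only [hκ, hG, Function.comp]
      push_cast
      ring
  have hLA : ∀ t ≥ t₁, Real.log ‖deriv F (p t)‖ ≤ A + t := fun t ht => by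
    have h1 := norm_deriv_le_of_ball hF hM (hpb t ht)
    rw [hpn t ht, sub_sub_cancel, exp_neg, div_inv_eq_mul] at h1
    rw [hA, ← log_exp t, ← Real.log_mul (by positivity) (exp_pos t).ne', log_exp]
    refine Real.log_le_log (norm_pos_iff.2 (h0 _ (hpb t ht))) (h1.trans ?_)
    gcongr
    linarith
  have hLB : -B ≤ Real.log ‖deriv F (p t₁)‖ := by
    rw [hB, neg_neg]
    exact Real.log_le_log hc (hcz _ (mem_closedBall_zero_iff.2 (hpn t₁ le_rfl).le))
  have hκn : ∀ t, ‖κ t‖ = 1 / 2 * (exp (-t) * ‖G (p t)‖) := fun t => by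
    simp only [hκ, norm_mul, norm_neg, hE1, norm_real, norm_div, norm_one,
      Complex.norm_ofNat, norm_of_nonneg (exp_pos (-t)).le]
    ring
  have hκN : ‖κ t₂‖ ≤ N := by
    have h1 := hN _ (mem_closedBall_zero_iff.2 (hpn t₂ h12).le)
    have h2 : exp (-t₂) ≤ 1 := by
      have := norm_nonneg (p t₂)
      rw [hpn t₂ h12] at this
      linarith
    rw [hκn]
    nlinarith [norm_nonneg (G (p t₂)), exp_pos (-t₂)]
  set t := -Real.log (1 - ‖z‖) with htz
  have hexp : exp (-t) = 1 - ‖z‖ := by rw [htz, neg_neg, exp_log (by linarith)]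
  have htt : max t₂ t₃ ≤ t := by
    have h1 : 1 - ‖z‖ < exp (-max t₂ t₃) := by linarith
    rw [← hexp, exp_lt_exp] at h1
    linarith
  have hpt : p t = z := by
    simp only [hp]
    rw [hexp, sub_sub_cancel]
    exact hθ.symm
  have hfin := riccati_decay (min_le_left _ _) hκd hen hL hLA hLB (t₂ := t₂) (N := N)
    (by linarith [le_max_right t₁ (t₁ + 2 * (A + B + t₁))]) hκN ((le_max_left _ _).trans htt)
  have h5 := ht₃ t ((le_max_right _ _).trans htt)
  rw [hκn, hexp, hpt] at hfin
  have h6 : ε ^ 2 ≤ (η / 16) ^ 2 := by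
    gcongr
    exact min_le_right _ _
  refine le_of_sq_le_sq ?_ hη.le
  nlinarith

theorem lintegral_annulus_eq_polar {g : ℂ → ENNReal} (hg : Measurable g) {a : ℝ} (ha : 0 ≤ a) :
    ∫⁻ z in 𝔻 \ closedBall 0 a, g z =
      ∫⁻ θ in Ioo (-π) π, ∫⁻ r in Ioo a 1,
        ofReal r * g (r * Complex.exp (θ * I)) := by
  have hm : MeasurableSet (𝔻 \ closedBall 0 a) :=
    measurableSet_ball.diff measurableSet_closedBall
  rw [← lintegral_indicator hm, ← Complex.lintegral_comp_polarCoord_symm]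
  have hpt : ∀ p ∈ polarCoord.target, ofReal p.1 •
      (𝔻 \ closedBall 0 a).indicator g (Complex.polarCoord.symm p) =
      (Ioo a 1).indicator (fun r => ofReal r * g (r * Complex.exp (p.2 * I)))
        p.1 := fun p hp => by
    rw [polarCoord_target] at hp
    have h0 : (0 : ℝ) < p.1 := hp.1
    have h1 : Complex.polarCoord.symm p = p.1 * Complex.exp (p.2 * I) := by
      rw [Complex.polarCoord_symm_apply, exp_mul_I]
      push_cast
      rfl
    have h2 : Complex.polarCoord.symm p ∈ 𝔻 \ closedBall 0 a ↔ p.1 ∈ Ioo a 1 := by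
      rw [mem_sdiff, mem_ball_zero_iff, mem_closedBall_zero_iff, Complex.norm_polarCoord_symm,
        abs_of_pos h0, not_le, and_comm]
      rfl
    by_cases h : p.1 ∈ Ioo a 1
    · rw [indicator_of_mem h, indicator_of_mem (h2.2 h), h1, smul_eq_mul]
    · rw [indicator_of_notMem h, indicator_of_notMem (h2.not.2 h), smul_zero]
  rw [setLIntegral_congr_fun polarCoord.open_target.measurableSet hpt, polarCoord_target,
    Measure.volume_eq_prod, ← Measure.prod_restrict, lintegral_prod_symm]
  · refine lintegral_congr fun θ => ?_
    dsimp only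
    rw [lintegral_indicator measurableSet_Ioo, Measure.restrict_restrict measurableSet_Ioo,
      inter_eq_left.2 (show Ioo a 1 ⊆ Ioi 0 from fun r hr => ha.trans_lt hr.1)]
  · have : (fun p : ℝ × ℝ => (Ioo a 1).indicator
        (fun r => ofReal r * g (r * Complex.exp (p.2 * I))) p.1) =
        (Prod.fst ⁻¹' Ioo a 1).indicator
          fun p : ℝ × ℝ => ofReal p.1 * g (p.1 * Complex.exp (p.2 * I)) := by
      funext p
      by_cases h : p.1 ∈ Ioo a 1
      · rw [indicator_of_mem h, indicator_of_mem (s := Prod.fst ⁻¹' Ioo a 1) h]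
      · rw [indicator_of_notMem h, indicator_of_notMem (s := Prod.fst ⁻¹' Ioo a 1) h]
    rw [this]
    refine (Measurable.indicator ?_ (measurable_fst measurableSet_Ioo)).aemeasurable
    have : Measurable fun p : ℝ × ℝ => (p.1 : ℂ) * Complex.exp (p.2 * I) := by fun_prop
    exact measurable_fst.ennreal_ofReal.mul (hg.comp this)

/-- A Hardy-type inequality for solutions of `u' = s + u² / 2`. -/
theorem lintegral_riccati_le {u s : ℝ → ℂ} {a : ℝ} (ha0 : 0 ≤ a)
    (hu : ∀ r ∈ Ico a 1, HasDerivAt u (s r + u r ^ 2 / 2) r)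
    (hs : ContinuousOn s (Ico a 1)) (hsm : ∀ r ∈ Ico a 1, (1 - r) * ‖u r‖ ≤ 1 / 4) :
    ∫⁻ r in Ioo a 1, ofReal (‖u r‖ ^ 2) ≤ ofReal (2 * ‖u a‖ ^ 2) +
      ∫⁻ r in Ioo a 1, ofReal (8 * ((1 - r) ^ 2 * ‖s r‖ ^ 2)) := by
  have key : ∀ R ∈ Ico a 1, ∫⁻ r in Ioc a R, ofReal (‖u r‖ ^ 2) ≤
      ofReal (2 * ‖u a‖ ^ 2) +
      ∫⁻ r in Ioo a 1, ofReal (8 * ((1 - r) ^ 2 * ‖s r‖ ^ 2)) := fun R hR => by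
    have hsub : Icc a R ⊆ Ico a 1 := fun r hr => ⟨hr.1, hr.2.trans_lt hR.2⟩
    have huc : ContinuousOn u (Icc a R) := fun r hr =>
      (hu r (hsub hr)).continuousAt.continuousWithinAt
    have hsc := hs.mono hsub
    have hI1 : ContinuousOn (fun r => ‖u r‖ ^ 2) (Icc a R) := by fun_prop
    have hI2 : ContinuousOn (fun r => 8 * ((1 - r) ^ 2 * ‖s r‖ ^ 2)) (Icc a R) := by fun_prop
    have hV : ∀ r ∈ Icc a R, HasDerivAt (fun r => 2 * ((1 - r) * ‖u r‖ ^ 2))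
        (2 * (-‖u r‖ ^ 2 + (1 - r) * (2 * inner ℝ (u r) (s r + u r ^ 2 / 2)))) r := fun r hr => by
      refine ((((hasDerivAt_id r).const_sub 1).mul (hu r (hsub hr)).norm_sq).const_mul
        2).congr_deriv ?_
      simp only [id_eq]
      ring
    have hI3 : ContinuousOn (fun r => 2 * (-‖u r‖ ^ 2 +
        (1 - r) * (2 * inner ℝ (u r) (s r + u r ^ 2 / 2)))) (Icc a R) := by fun_prop
    have h1 := intervalIntegral.integral_eq_sub_of_hasDerivAt
      (fun r hr => hV r (uIcc_of_le hR.1 ▸ hr)) (hI3.intervalIntegrable_of_Icc hR.1)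
    have h2 : ∫ r in a..R, (2 * (-‖u r‖ ^ 2 +
        (1 - r) * (2 * inner ℝ (u r) (s r + u r ^ 2 / 2)))) ≤
        ∫ r in a..R, (8 * ((1 - r) ^ 2 * ‖s r‖ ^ 2) - ‖u r‖ ^ 2) := by
      refine intervalIntegral.integral_mono_on hR.1 (hI3.intervalIntegrable_of_Icc hR.1)
        ((hI2.sub hI1).intervalIntegrable_of_Icc hR.1) fun r hr => ?_
      have h3 := real_inner_le_norm (u r) (s r + u r ^ 2 / 2)
      have h4 : ‖s r + u r ^ 2 / 2‖ ≤ ‖s r‖ + ‖u r‖ ^ 2 / 2 := by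
        refine (_root_.norm_add_le _ _).trans ?_
        simp
      have h5 := hsm r (hsub hr)
      have hr1 : 0 < 1 - r := by linarith [(hsub hr).2]
      have h6 : (1 - r) * inner ℝ (u r) (s r + u r ^ 2 / 2) ≤
          (1 - r) * (‖u r‖ * (‖s r‖ + ‖u r‖ ^ 2 / 2)) :=
        mul_le_mul_of_nonneg_left (h3.trans (mul_le_mul_of_nonneg_left h4 (norm_nonneg _))) hr1.le
      have h7 : (1 - r) * (‖u r‖ * (‖s r‖ + ‖u r‖ ^ 2 / 2)) =
          ‖u r‖ * ((1 - r) * ‖s r‖) + ((1 - r) * ‖u r‖) * (‖u r‖ ^ 2 / 2) := by ring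
      have h8 : ((1 - r) * ‖u r‖) * (‖u r‖ ^ 2 / 2) ≤ 1 / 4 * (‖u r‖ ^ 2 / 2) :=
        mul_le_mul_of_nonneg_right h5 (by positivity)
      nlinarith [sq_nonneg (‖u r‖ - 4 * ((1 - r) * ‖s r‖)), sq_nonneg (‖u r‖ - 2 * ((1 - r) * ‖s r‖))]
    rw [intervalIntegral.integral_sub (hI2.intervalIntegrable_of_Icc hR.1)
      (hI1.intervalIntegrable_of_Icc hR.1)] at h2
    have h3 : ∫ r in a..R, ‖u r‖ ^ 2 ≤ 2 * ‖u a‖ ^ 2 +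
        (∫ r in a..R, 8 * ((1 - r) ^ 2 * ‖s r‖ ^ 2)) := by
      have h4 : 0 ≤ 2 * ((1 - R) * ‖u R‖ ^ 2) := by
        have : 0 ≤ 1 - R := by linarith [hR.2]
        positivity
      have h5 : 2 * ((1 - a) * ‖u a‖ ^ 2) ≤ 2 * ‖u a‖ ^ 2 := by nlinarith [sq_nonneg ‖u a‖]
      linarith
    rw [intervalIntegral.integral_of_le hR.1, intervalIntegral.integral_of_le hR.1] at h3
    have hintv : ∀ {f : ℝ → ℝ}, ContinuousOn f (Icc a R) → IntegrableOn f (Ioc a R) :=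
      fun hf => hf.integrableOn_Icc.mono_set Ioc_subset_Icc_self
    rw [← ofReal_integral_eq_lintegral_ofReal (hintv hI1) (ae_of_all _ fun r => by positivity)]
    refine (ofReal_le_ofReal h3).trans ?_
    rw [ofReal_add (by positivity) (integral_nonneg fun r => by positivity),
      ofReal_integral_eq_lintegral_ofReal (hintv hI2) (ae_of_all _ fun r => by positivity)]
    gcongr
    exact hR.2
  by_cases ha : a < 1
  swap
  · rw [Ioo_eq_empty ha]; simp
  have hun : Ioo a 1 = ⋃ n : ℕ, Ioc a (1 - (1 - a) / (n + 1)) := by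
    ext r
    simp only [mem_Ioo, mem_iUnion, mem_Ioc]
    refine ⟨fun hr => ?_, fun ⟨n, hn⟩ => ⟨hn.1, hn.2.trans_lt ?_⟩⟩
    · obtain ⟨n, hn⟩ := exists_nat_one_div_lt (show 0 < (1 - r) / (1 - a) from
        div_pos (by linarith) (by linarith))
      rw [lt_div_iff₀ (by linarith), one_div_mul_eq_div] at hn
      exact ⟨n, hr.1, by linarith⟩
    · have : 0 < (1 - a) / (n + 1) := div_pos (by linarith) (by positivity)
      linarith
  conv_lhs => rw [hun]
  rw [setLIntegral_iUnion_of_directed]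
  · refine iSup_le fun n => key _ ⟨?_, ?_⟩
    · have : (1 - a) / (n + 1) ≤ 1 - a := div_le_self (by linarith) (by
        have : (0 : ℝ) ≤ n := n.cast_nonneg
        linarith)
      linarith
    · have : 0 < (1 - a) / (n + 1) := div_pos (by linarith) (by positivity)
      linarith
  · refine Monotone.directed_le fun m n hmn => Ioc_subset_Ioc_right ?_
    have : (m : ℝ) ≤ n := by exact_mod_cast hmn
    have := div_le_div_of_nonneg_left (by linarith : 0 ≤ 1 - a) (by positivity : (0 : ℝ) < m + 1)
      (by linarith : (m : ℝ) + 1 ≤ n + 1)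
    linarith

theorem lintegral_preSchwarzian_lt_top {G : ℂ → ℂ} (hG : DifferentiableOn ℂ G (ball 0 1))
    (hsm : ∃ r < 1, ∀ z ∈ 𝔻, r < ‖z‖ → (1 - ‖z‖) * ‖G z‖ ≤ 1 / 4)
    (hS : ∫⁻ z in 𝔻,
      ofReal ((1 - ‖z‖) ^ 2 * ‖deriv G z - G z ^ 2 / 2‖ ^ 2) < ⊤) :
    ∫⁻ z in 𝔻, ofReal (‖G z‖ ^ 2) < ⊤ := by
  obtain ⟨r₀, hr₀, hsm⟩ := hsm
  set a := (max r₀ 0 + 1) / 2 with ha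
  have hm1 : max r₀ 0 < 1 := max_lt hr₀ one_pos
  have ha1 : a < 1 := by linarith
  have ha0 : 0 < a := by linarith [le_max_right r₀ 0]
  have har : r₀ < a := by linarith [le_max_left r₀ 0]
  have hsub : closedBall (0 : ℂ) a ⊆ ball 0 1 := closedBall_subset_ball ha1
  obtain ⟨N, hN⟩ := (isCompact_closedBall (0 : ℂ) a).exists_bound_of_continuousOn
    (hG.continuousOn.mono hsub)
  have hmA : MeasurableSet (𝔻 \ closedBall 0 a) :=
    measurableSet_ball.diff measurableSet_closedBall
  have hin : ∫⁻ z in closedBall (0 : ℂ) a, ofReal (‖G z‖ ^ 2) < ⊤ := by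
    refine (setLIntegral_mono' (g := fun _ => ofReal (N ^ 2)) measurableSet_closedBall
      fun z hz => ofReal_le_ofReal (pow_le_pow_left₀ (norm_nonneg _) (hN z hz) 2)).trans_lt ?_
    rw [setLIntegral_const]
    exact mul_lt_top ofReal_lt_top (isCompact_closedBall _ _).measure_lt_top
  have hdG : ContinuousOn (fun z => deriv G z - G z ^ 2 / 2) (ball 0 1) :=
    (hG.deriv isOpen_ball).continuousOn.sub ((hG.continuousOn.pow 2).div_const 2)
  have hmeas : ∀ {f : ℂ → ENNReal}, ContinuousOn f (𝔻) →
      Measurable ((𝔻).indicator f) := fun {f} hf => by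
    classical
    rw [← piecewise_eq_indicator]
    exact hf.measurable_piecewise continuousOn_const measurableSet_ball
  have hpol : ∀ {f : ℂ → ENNReal}, ContinuousOn f (𝔻) →
      ∫⁻ z in 𝔻 \ closedBall 0 a, f z = ∫⁻ θ in Ioo (-π) π,
        ∫⁻ r in Ioo a 1, ofReal r * f (r * Complex.exp (θ * I)) :=
    fun {f} hf => by
      have h1 := lintegral_annulus_eq_polar (hmeas hf) ha0.le
      rw [setLIntegral_congr_fun (g := f) hmA fun z hz => indicator_of_mem hz.1 f] at h1
      rw [h1]
      refine lintegral_congr fun θ => setLIntegral_congr_fun measurableSet_Ioo fun r hr => ?_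
      have : (r : ℂ) * Complex.exp (θ * I) ∈ 𝔻 := by
        rw [mem_ball_zero_iff, norm_mul, norm_exp_ofReal_mul_I, mul_one, norm_real,
          norm_of_nonneg (ha0.trans hr.1).le]
        exact hr.2
      rw [indicator_of_mem this]
  have hc1 : ContinuousOn (fun z => ofReal (‖G z‖ ^ 2)) (𝔻) :=
    continuous_ofReal.comp_continuousOn (hG.continuousOn.norm.pow 2)
  have hc2 : ContinuousOn (fun z => ofReal
      ((1 - ‖z‖) ^ 2 * ‖deriv G z - G z ^ 2 / 2‖ ^ 2)) (𝔻) :=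
    continuous_ofReal.comp_continuousOn
      (((continuousOn_const.sub continuousOn_id.norm).pow 2).mul (hdG.norm.pow 2))
  have key : ∀ θ : ℝ, ∫⁻ r in Ioo a 1, ofReal r *
      ofReal (‖G (r * Complex.exp (θ * I))‖ ^ 2) ≤ ofReal (2 * N ^ 2) +
      ofReal (8 / a) * ∫⁻ r in Ioo a 1, ofReal r * ofReal
        ((1 - ‖(r : ℂ) * Complex.exp (θ * I)‖) ^ 2 *
          ‖deriv G (r * Complex.exp (θ * I)) -
            G (r * Complex.exp (θ * I)) ^ 2 / 2‖ ^ 2) := fun θ => by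
    set E := Complex.exp (θ * I)
    have hE1 : ‖E‖ = 1 := norm_exp_ofReal_mul_I θ
    have hnorm : ∀ r : ℝ, 0 ≤ r → ‖(r : ℂ) * E‖ = r := fun r hr => by
      rw [norm_mul, hE1, mul_one, norm_real, norm_of_nonneg hr]
    have hb : ∀ r ∈ Ico a 1, (r : ℂ) * E ∈ 𝔻 := fun r hr => by
      rw [mem_ball_zero_iff, hnorm r (ha0.le.trans hr.1)]
      exact hr.2
    have hu := lintegral_riccati_le (u := fun r : ℝ => E * G (r * E))
      (s := fun r : ℝ => E ^ 2 * (deriv G (r * E) - G (r * E) ^ 2 / 2)) ha0.le (fun r hr => by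
        have h1 : HasDerivAt (fun r : ℝ => (r : ℂ) * E) E r := by
          simpa using (hasDerivAt_id r).ofReal_comp.mul_const E
        refine (((hG.differentiableAt (isOpen_ball.mem_nhds (hb r hr))).hasDerivAt.comp r
          h1).const_mul E).congr_deriv ?_
        ring) (by
        refine continuousOn_const.mul (hdG.comp (f := fun r : ℝ => (r : ℂ) * E) ?_ hb)
        fun_prop) (fun r hr => by
        rw [norm_mul, hE1, one_mul]
        have h2 := hnorm r (ha0.le.trans hr.1)
        have h4 := hsm _ (hb r hr) (by rw [h2]; exact har.trans_le hr.1)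
        rwa [h2] at h4)
    simp only [norm_mul, norm_pow, hE1, one_mul, one_pow] at hu
    have hl : ∫⁻ r in Ioo a 1, ofReal r * ofReal (‖G (r * E)‖ ^ 2) ≤
        ∫⁻ r in Ioo a 1, ofReal (‖G (r * E)‖ ^ 2) :=
      setLIntegral_mono' measurableSet_Ioo fun r hr => by
        rw [← ofReal_mul (ha0.trans hr.1).le]
        exact ofReal_le_ofReal (mul_le_of_le_one_left (by positivity) hr.2.le)
    refine hl.trans (hu.trans (add_le_add (ofReal_le_ofReal ?_) ?_))
    · have := hN (a * E) (mem_closedBall_zero_iff.2 (hnorm a ha0.le).le)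
      gcongr
    · rw [← lintegral_ofReal_mul]
      refine setLIntegral_mono' measurableSet_Ioo fun r hr => ?_
      have hr0 : 0 < r := ha0.trans hr.1
      rw [← ofReal_mul hr0.le, ← ofReal_mul (by positivity), hnorm r hr0.le,
        ← mul_assoc (8 / a)]
      refine ofReal_le_ofReal (mul_le_mul_of_nonneg_right ?_ (by positivity))
      rw [div_mul_eq_mul_div, le_div_iff₀ ha0]
      linarith [hr.1]
  have hout : ∫⁻ z in 𝔻 \ closedBall 0 a, ofReal (‖G z‖ ^ 2) < ⊤ := by
    rw [hpol hc1]
    refine (lintegral_mono key).trans_lt ?_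
    rw [lintegral_add_left measurable_const, lintegral_ofReal_mul,
      ← hpol hc2, setLIntegral_const]
    refine ENNReal.add_lt_top.2 ⟨mul_lt_top ofReal_lt_top (by simp),
      mul_lt_top ofReal_lt_top ((lintegral_mono_set sdiff_subset).trans_lt hS)⟩
  rw [← sdiff_union_of_subset hsub]
  exact (lintegral_union_le _ _ _).trans_lt (ENNReal.add_lt_top.2 ⟨hout, hin⟩)

theorem UnitCurve.lintegral_preSchwarzian_lt_top {w : ℝ → ℂ} (hw : UnitCurve w)
    (hE : moebiusEnergy w < ⊤) {Ω Ωs : Set ℂ} (hΩ : IsOpen Ω) (hΩc : IsPreconnected Ω)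
    (hΩs : IsOpen Ωs) (hΩsc : IsPreconnected Ωs) (hdisj : Disjoint Ω Ωs)
    (hunion : Ω ∪ Ωs = (range w)ᶜ) (hΩb : IsBounded Ω)
    (hub : ¬ IsBounded Ωs) {F : ℂ → ℂ} (hF : DifferentiableOn ℂ F (ball 0 1))
    (hb : BijOn F (ball 0 1) Ω) :
    ∫⁻ z in 𝔻, ofReal (‖deriv (deriv F) z / deriv F z‖ ^ 2) < ⊤ := by
  have hS := hw.lintegral_schwarzian_lt_top hE hΩ hΩc hΩs hΩsc hdisj hunion hΩb hub hF hb
  have hF' : DifferentiableOn ℂ (deriv F) (ball 0 1) := hF.deriv isOpen_ball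
  have hGd : DifferentiableOn ℂ (fun z => deriv (deriv F) z / deriv F z) (ball 0 1) :=
    (hF'.deriv isOpen_ball).div hF' fun z hz =>
      deriv_ne_zero_of_differentiableOn_of_injOn isOpen_ball hF hb.injOn hz
  have hSd : DifferentiableOn ℂ (schwarzian F) (ball 0 1) :=
    (hGd.deriv isOpen_ball).sub ((hGd.pow 2).div_const 2)
  have hS' : ∫⁻ z in 𝔻, ofReal ((1 - ‖z‖) ^ 2 * ‖schwarzian F z‖ ^ 2) < ⊤ :=
    (setLIntegral_mono' measurableSet_ball fun z hz => by
      have := mem_ball_zero_iff.1 hz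
      refine ofReal_le_ofReal (mul_le_mul_of_nonneg_right ?_ (by positivity))
      refine pow_le_pow_left₀ (by linarith) ?_ 2
      nlinarith [norm_nonneg z]).trans_lt hS
  obtain ⟨M, hM⟩ := hΩb.exists_norm_le
  exact _root_.lintegral_preSchwarzian_lt_top hGd
    (exists_radius_preSchwarzian_le hF hb.injOn (fun z hz => hM _ (hb.mapsTo hz))
      (fun ε hε => exists_radius_pow_mul_norm_le 1 hSd (by simpa using hS') hε) (by norm_num)) hS'

theorem lintegral_preSchwarzian_lt_top_of_moebius {Γ Ω Ωs : Set ℂ} (hΩ : IsOpen Ω)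
    (hΩc : IsPreconnected Ω) (hΩs : IsOpen Ωs) (hΩsc : IsPreconnected Ωs) (hdisj : Disjoint Ω Ωs)
    (hunion : Ω ∪ Ωs = Γᶜ) (hΩb : IsBounded Ω) (hub : ¬ IsBounded Ωs)
    {F : ℂ → ℂ} (hF : DifferentiableOn ℂ F (ball 0 1)) (hb : BijOn F (ball 0 1) Ω)
    {c : ℝ} (hc : 0 < c) {w : ℝ → ℂ} (hwl : LipschitzWith (toNNReal c) w)
    (hwp : ∀ θ, w (θ + 2 * π) = w θ) (hwi : InjOn w (Ico 0 (2 * π)))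
    (hwr : range w = Γ) (hwd : ∀ᵐ θ : ℝ, ∃ v : ℂ, HasDerivAt w v θ ∧ ‖v‖ = c)
    (hE : ∫⁻ θ in Ioc 0 (2 * π), ∫⁻ σ in Ioc 0 (2 * π), ofReal
      ((1 / ‖w θ - w σ‖ ^ 2 - 1 / (c * min |θ - σ| (2 * π - |θ - σ|)) ^ 2) * c ^ 2) < ⊤) :
    ∫⁻ z in 𝔻, ofReal (‖deriv (deriv F) z / deriv F z‖ ^ 2) < ⊤ := by
  have hc' : (c : ℂ) ≠ 0 := by exact_mod_cast hc.ne'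
  have hcn : ‖(c : ℂ)‖ = c := by rw [norm_real, norm_of_nonneg hc.le]
  have hu : UnitCurve fun θ => w θ / c := by
    refine ⟨?_, fun θ => by simp only [hwp], fun x hx y hy h => hwi hx hy ?_, ?_⟩
    · refine LipschitzWith.of_dist_le_mul fun x y => ?_
      rw [dist_eq_norm, ← sub_div, norm_div, hcn, div_le_iff₀ hc, ← dist_eq_norm]
      refine (hwl.dist_le_mul x y).trans (le_of_eq ?_)
      rw [coe_toNNReal _ hc.le, NNReal.coe_one]
      ring
    · exact (div_left_inj' hc').1 h
    · filter_upwards [hwd] with θ ⟨v, hv, hvn⟩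
      refine ⟨v / c, hv.div_const _, ?_⟩
      rw [norm_div, hcn, hvn, div_self hc.ne']
  set e : ℂ ≃ₜ ℂ := Homeomorph.mulRight₀ (c : ℂ)⁻¹ (inv_ne_zero hc') with he
  have hea : ∀ z, e z = z / c := fun z => by simp [he, div_eq_mul_inv]
  have hcomp : e '' Ω ∪ e '' Ωs = (range fun θ => w θ / c)ᶜ := by
    rw [← Set.image_union, hunion, image_compl_eq e.bijective, ← hwr, ← range_comp]
    congr 2
  have hbd : ∀ S : Set ℂ, IsBounded S → IsBounded (e '' S) := fun S hS => by
    obtain ⟨M, hM⟩ := hS.exists_norm_le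
    refine isBounded_iff_forall_norm_le.2 ⟨M / c, ?_⟩
    rintro _ ⟨z, hz, rfl⟩
    rw [hea, norm_div, hcn]
    gcongr
    exact hM z hz
  have hbd' : ¬ IsBounded (e '' Ωs) := fun h => hub <| by
    obtain ⟨M, hM⟩ := h.exists_norm_le
    refine isBounded_iff_forall_norm_le.2 ⟨M * c, fun z hz => ?_⟩
    have := hM _ (mem_image_of_mem e hz)
    rwa [hea, norm_div, hcn, div_le_iff₀ hc] at this
  have hbij : BijOn (fun z => F z / c) (ball 0 1) (e '' Ω) := by
    have : (fun z => F z / c) = e ∘ F := funext fun z => (hea _).symm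
    rw [this]
    exact (e.injective.injOn.bijOn_image).comp hb
  have key := hu.lintegral_preSchwarzian_lt_top
    (by rw [← lintegral_moebius_eq_moebiusEnergy hc hwp]; exact hE)
    (e.isOpenMap _ hΩ) (hΩc.image _ e.continuous.continuousOn) (e.isOpenMap _ hΩs)
    (hΩsc.image _ e.continuous.continuousOn) ((disjoint_image_iff e.injective).2 hdisj) hcomp
    (hbd Ω hΩb) hbd' (hF.div_const _) hbij
  refine lt_of_eq_of_lt (setLIntegral_congr_fun measurableSet_ball fun z hz => ?_) key
  have hd1 : deriv (fun z => F z / c) = fun z => deriv F z / c := by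
    funext z
    exact deriv_div_const _
  rw [hd1, deriv_div_const, div_div_div_cancel_right₀ hc']

lemma setLIntegral_reProdIm {g : ℂ → ENNReal} (hg : Measurable g) {S J : Set ℝ}
    (hI : MeasurableSet S) (hJ : MeasurableSet J) :
    ∫⁻ z in S ×ℂ J, g z = ∫⁻ y in J, ∫⁻ x in S, g (x + y * I) := by
  have hset : S ×ℂ J = measurableEquivRealProd ⁻¹' (S ×ˢ J) := by
    ext z; simp [Complex.mem_reProdIm, measurableEquivRealProd]
  have hgm : Measurable fun p : ℝ × ℝ => g (p.1 + p.2 * I) := hg.comp (by fun_prop)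
  have h := Complex.volume_preserving_equiv_real_prod.setLIntegral_comp_preimage
    (hI.prod hJ) hgm
  rw [← hset] at h
  have h2 : ∀ z : ℂ, g (((measurableEquivRealProd z).1 : ℂ) +
      (measurableEquivRealProd z).2 * I) = g z := fun z => by
    simp [measurableEquivRealProd, re_add_im]
  simp only [h2] at h
  rw [h, Measure.volume_eq_prod, ← Measure.prod_restrict, lintegral_prod_symm _ hgm.aemeasurable]

lemma setLIntegral_ball_le_reProdIm {g : ℂ → ENNReal} (hg : Measurable g) (x t r : ℝ) :
    ∫⁻ z in ball (x + t * I) r, g z ≤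
      ∫⁻ y in Ioo (t - r) (t + r), ∫⁻ u in Ioc (x - r) (x + r), g (u + y * I) := by
  rw [← setLIntegral_reProdIm hg measurableSet_Ioc measurableSet_Ioo]
  refine lintegral_mono_set fun z hz => ?_
  rw [mem_ball, dist_eq_norm] at hz
  have h1 := (abs_re_le_norm _).trans_lt hz
  have h2 := (abs_im_le_norm _).trans_lt hz
  simp only [Complex.sub_re, Complex.sub_im, Complex.add_re, Complex.add_im, Complex.ofReal_re,
    Complex.ofReal_im, Complex.mul_re, Complex.mul_im, Complex.I_re, Complex.I_im, mul_zero,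
    mul_one, sub_zero, add_zero, zero_add] at h1 h2
  rw [abs_lt] at h1 h2
  rw [Complex.mem_reProdIm]
  exact ⟨⟨by linarith, by linarith⟩, by linarith, by linarith⟩

/-- The chart `φ` has derivative `ψ` and pre-Schwarzian `P = ψ' / ψ` on the upper half plane, with
the Bloch-type bound `y ‖P‖ ≤ 1 / 4` up to height `y₀`. -/
structure HalfPlaneChart (φ ψ P : ℂ → ℂ) (y₀ : ℝ) : Prop where
  hasDerivAt : ∀ ζ : ℂ, 0 < ζ.im → HasDerivAt φ (ψ ζ) ζ
  hasDerivAt_deriv : ∀ ζ : ℂ, 0 < ζ.im → HasDerivAt ψ (P ζ * ψ ζ) ζ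
  differentiableAt : ∀ ζ : ℂ, 0 < ζ.im → DifferentiableAt ℂ P ζ
  ne_zero : ∀ ζ : ℂ, 0 < ζ.im → ψ ζ ≠ 0
  bound : ∀ ζ : ℂ, 0 < ζ.im → ζ.im ≤ y₀ → ζ.im * ‖P ζ‖ ≤ 1 / 4
  measurable : Measurable P

/-- The average of `Q · y` over the box of size `L` above the interval `[a, a + L]`. -/
noncomputable def boxMean (Q : ℝ → ℝ → ENNReal) (a L : ℝ) : ENNReal :=
  ∫⁻ y in Ioo 0 (3 * L), ∫⁻ x in Ioc (a - 2 * L) (a + 2 * L), Q x y * ofReal (y / L)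

/-- The energy density of the pre-Schwarzian. -/
noncomputable def energyDensity (P : ℂ → ℂ) (x y : ℝ) : ENNReal :=
  ofReal (‖P (x + y * I)‖ ^ 2)

namespace HalfPlaneChart
variable {φ ψ P : ℂ → ℂ} {y₀ : ℝ}

lemma measurable_energyDensity (h : Measurable P) :
    Measurable (uncurry (energyDensity P)) := by
  unfold energyDensity uncurry
  exact measurable_ofReal.comp ((h.comp (by fun_prop)).norm.pow_const 2)

lemma im_add (x t : ℝ) : ((x : ℂ) + t * I).im = t := by simp

lemma hasDerivAt_vert {g g' : ℂ → ℂ} {x t : ℝ} (hg : HasDerivAt g (g' (x + t * I)) (x + t * I)) :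
    HasDerivAt (fun s : ℝ => g (x + s * I)) (g' (x + t * I) * I) t := by
  have h1 : HasDerivAt (fun s : ℝ => (x : ℂ) + s * I) I t := by
    simpa using ((hasDerivAt_id t).ofReal_comp.mul_const I).const_add (x : ℂ)
  exact hg.comp t h1

lemma hasDerivAt_horiz {g g' : ℂ → ℂ} {x t : ℝ} (hg : HasDerivAt g (g' (x + t * I)) (x + t * I)) :
    HasDerivAt (fun s : ℝ => g (s + t * I)) (g' (x + t * I)) x := by
  have h1 : HasDerivAt (fun s : ℝ => (s : ℂ) + t * I) 1 x := by
    simpa using (hasDerivAt_id x).ofReal_comp.add_const (t * I)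
  exact (hg.comp x h1).congr_deriv (mul_one _)

variable (h : HalfPlaneChart φ ψ P y₀)
include h

lemma mean_value {x t r : ℝ} (hr : 0 < r) (hrt : r ≤ t) :
    ofReal (‖P (x + t * I)‖ ^ 2 * (π * r ^ 2)) ≤
      ∫⁻ y in Ioo (t - r) (t + r), ∫⁻ u in Ioc (x - r) (x + r), energyDensity P u y := by
  refine (ofReal_norm_sq_mul_le_lintegral_ball hr fun z hz => ?_).trans
    (setLIntegral_ball_le_reProdIm
      (g := fun z => ofReal (‖P z‖ ^ 2))
      (measurable_ofReal.comp (h.measurable.norm.pow_const 2)) x t r)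
  refine (h.differentiableAt z ?_).differentiableWithinAt
  rw [mem_ball, dist_eq_norm] at hz
  have h2 := (abs_im_le_norm _).trans_lt hz
  simp at h2
  rw [abs_lt] at h2
  linarith

/-- `√t ‖ψ(x + it)‖²` is increasing in `t`. -/
lemma sqrt_mul_norm_sq_le {x s t : ℝ} (hs : 0 < s) (hst : s ≤ t) (ht : t ≤ y₀) :
    √s * ‖ψ (x + s * I)‖ ^ 2 ≤ √t * ‖ψ (x + t * I)‖ ^ 2 := by
  have hd : ∀ τ, 0 < τ → HasDerivAt (fun s : ℝ => √s * ‖ψ (x + s * I)‖ ^ 2)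
      (1 / (2 * √τ) * ‖ψ (x + τ * I)‖ ^ 2 + √τ * (2 * inner ℝ (ψ (x + τ * I))
        (P (x + τ * I) * ψ (x + τ * I) * I))) τ := fun τ hτ =>
    (Real.hasDerivAt_sqrt hτ.ne').mul
      (hasDerivAt_vert (g' := fun z => P z * ψ z) (h.hasDerivAt_deriv _ (by simpa using hτ))).norm_sq
  have hm : MonotoneOn (fun s : ℝ => √s * ‖ψ (x + s * I)‖ ^ 2) (Icc s t) := by
    refine monotoneOn_of_hasDerivWithinAt_nonneg (convex_Icc _ _)
      (fun τ hτ => (hd τ (hs.trans_le hτ.1)).continuousAt.continuousWithinAt)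
      (fun τ hτ => (hd τ (hs.trans_le (interior_subset hτ).1)).hasDerivWithinAt) fun τ hτ => ?_
    have hτ' := interior_subset hτ
    have hτ0 : 0 < τ := hs.trans_le hτ'.1
    have hb := h.bound (x + τ * I) (by simpa using hτ0) (by simpa using hτ'.2.trans ht)
    rw [im_add] at hb
    have hc := abs_le.1 (abs_real_inner_le_norm (ψ (x + τ * I))
        (P (x + τ * I) * ψ (x + τ * I) * I))
    have hc1 := hc.1
    simp only [norm_mul, norm_I, mul_one] at hc1
    set A := ‖ψ (x + τ * I)‖
    set B := ‖P (x + τ * I)‖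
    set N := inner ℝ (ψ (x + τ * I)) (P (x + τ * I) * ψ (x + τ * I) * I)
    have hsq := sq_sqrt hτ0.le
    have e1 : 1 / (2 * √τ) * A ^ 2 + √τ * (2 * N) = (1 / (2 * √τ)) * (A ^ 2 + 4 * (√τ) ^ 2 * N) := by
      field_simp
      ring
    rw [e1, hsq]
    refine mul_nonneg (by positivity) ?_
    have : τ * (A * (B * A)) ≤ 1 / 4 * A ^ 2 := by
      have := mul_le_mul_of_nonneg_right hb (sq_nonneg A)
      nlinarith
    nlinarith
  exact hm ⟨le_rfl, hst⟩ ⟨hst, le_rfl⟩ hst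

end HalfPlaneChart

lemma boxMean_eq {Q : ℝ → ℝ → ENNReal} (hQ : Measurable (uncurry Q)) (a L : ℝ) :
    boxMean Q a L = ∫⁻ y in Ioo 0 (3 * L),
      (∫⁻ x in Ioc (a - 2 * L) (a + 2 * L), Q x y) * ofReal (y / L) :=
  lintegral_congr fun y => lintegral_mul_const _ (hQ.comp (by fun_prop : Measurable fun x => (x, y)))

namespace HalfPlaneChart
variable {φ ψ P : ℂ → ℂ} {y₀ : ℝ} (h : HalfPlaneChart φ ψ P y₀)
include h

lemma norm_mul_le {a L δ u : ℝ} (hL : 0 < L) (hδ : 0 < δ)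
    (hb : boxMean (energyDensity P) a L ≤ ofReal (δ ^ 2)) (hu : u ∈ Icc a (a + L)) :
    L * ‖P (u + L * I)‖ ≤ 2 * δ := by
  have hm := measurable_energyDensity h.measurable
  have h1 := h.mean_value (x := u) (t := L) (r := L / 2) (by positivity) (by linarith)
  have h2 : ∫⁻ y in Ioo (L - L / 2) (L + L / 2), ∫⁻ v in Ioc (u - L / 2) (u + L / 2),
      energyDensity P v y ≤ 2 * boxMean (energyDensity P) a L := by
    rw [boxMean_eq hm, ← lintegral_const_mul' _ _ ENNReal.ofNat_ne_top]
    refine (setLIntegral_mono' measurableSet_Ioo fun y hy => ?_).trans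
      (lintegral_mono_set (Ioo_subset_Ioo (by linarith) (by linarith)))
    have e : (1 : ENNReal) ≤ 2 * ofReal (y / L) := by
      rw [show (2 : ENNReal) = ofReal 2 by simp, ← ofReal_mul (by norm_num),
        ENNReal.one_le_ofReal, ← mul_div_assoc, le_div_iff₀ hL]
      linarith [hy.1]
    calc _ ≤ ∫⁻ v in Ioc (a - 2 * L) (a + 2 * L), energyDensity P v y :=
          lintegral_mono_set (Ioc_subset_Ioc (by linarith [hu.1]) (by linarith [hu.2]))
      _ = (∫⁻ v in Ioc (a - 2 * L) (a + 2 * L), energyDensity P v y) * 1 := (mul_one _).symm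
      _ ≤ (∫⁻ v in Ioc (a - 2 * L) (a + 2 * L), energyDensity P v y) *
          (2 * ofReal (y / L)) := mul_le_mul_right e _
      _ = _ := by ring
  have h3 : ‖P (u + L * I)‖ ^ 2 * (π * (L / 2) ^ 2) ≤ 2 * δ ^ 2 := by
    rw [← ofReal_le_ofReal_iff (by positivity)]
    refine (h1.trans h2).trans ((mul_le_mul_right hb 2).trans_eq ?_)
    rw [show (2 : ENNReal) = ofReal 2 by simp, ← ofReal_mul (by norm_num)]
  refine abs_le_of_sq_le_sq' ?_ (by positivity) |>.2
  have := pi_gt_three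
  nlinarith

lemma lintegral_sq_mul_le {a L x : ℝ} (hL : 0 < L) (hx : x ∈ Icc a (a + L)) :
    ∫⁻ t in Ioc 0 L, ofReal (t ^ 2 * ‖P (x + t * I)‖ ^ 2) ≤
      ofReal (2 * L) * boxMean (energyDensity P) a L := by
  have hm := measurable_energyDensity h.measurable
  set q : ℝ → ENNReal := fun y => ∫⁻ v in Ioc (a - 2 * L) (a + 2 * L), energyDensity P v y
  have hq : Measurable q := Measurable.lintegral_prod_left' hm
  have h1 : ∀ t ∈ Ioc 0 L, ofReal (t ^ 2 * ‖P (x + t * I)‖ ^ 2) ≤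
      ofReal (4 / π) * ∫⁻ y in Ioo 0 (3 * L),
        (Ioo (2 * y / 3) (2 * y)).indicator 1 t * q y := fun t ht => by
    have e : t ^ 2 * ‖P (x + t * I)‖ ^ 2 =
        4 / π * (‖P (x + t * I)‖ ^ 2 * (π * (t / 2) ^ 2)) := by field_simp; ring
    rw [e, ofReal_mul (by positivity)]
    refine mul_le_mul_right ((h.mean_value (half_pos ht.1) (by linarith [ht.1])).trans ?_) _
    rw [← lintegral_indicator measurableSet_Ioo, ← lintegral_indicator measurableSet_Ioo]
    refine lintegral_mono fun y => indicator_le (fun y hy => ?_) y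
    rw [indicator_of_mem (by constructor <;> linarith [hy.1, hy.2, ht.1, ht.2] :
      y ∈ Ioo 0 (3 * L)), indicator_of_mem (by constructor <;> linarith [hy.1, hy.2] :
      t ∈ Ioo (2 * y / 3) (2 * y)), Pi.one_apply, one_mul]
    exact lintegral_mono_set (Ioc_subset_Ioc (by linarith [hx.1, ht.2])
      (by linarith [hx.2, ht.2]))
  have hmI : Measurable fun p : ℝ × ℝ =>
      (Ioo (2 * p.2 / 3) (2 * p.2)).indicator (1 : ℝ → ENNReal) p.1 * q p.2 := by
    refine Measurable.mul ?_ (hq.comp measurable_snd)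
    have : (fun p : ℝ × ℝ => (Ioo (2 * p.2 / 3) (2 * p.2)).indicator (1 : ℝ → ENNReal) p.1) =
        ({p : ℝ × ℝ | 2 * p.2 / 3 < p.1} ∩ {p | p.1 < 2 * p.2}).indicator 1 := by
      ext p; simp [Set.indicator_apply]
    rw [this]
    exact measurable_one.indicator ((measurableSet_lt (by fun_prop) (by fun_prop)).inter
      (measurableSet_lt (by fun_prop) (by fun_prop)))
  refine (setLIntegral_mono' measurableSet_Ioc h1).trans ?_
  rw [lintegral_ofReal_mul, lintegral_lintegral_swap hmI.aemeasurable,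
    boxMean_eq hm, ← lintegral_ofReal_mul,
    ← lintegral_ofReal_mul]
  refine setLIntegral_mono' measurableSet_Ioo fun y hy => ?_
  rw [lintegral_mul_const _ (measurable_one.indicator measurableSet_Ioo)]
  have e2 : ∫⁻ t in Ioc 0 L, (Ioo (2 * y / 3) (2 * y)).indicator (1 : ℝ → ENNReal) t ≤
      ofReal (4 * y / 3) := by
    refine (setLIntegral_le_lintegral _ _).trans ?_
    rw [lintegral_indicator_one measurableSet_Ioo, Real.volume_Ioo]
    exact ofReal_le_ofReal (by linarith)
  calc _ ≤ ofReal (4 / π) * (ofReal (4 * y / 3) * q y) :=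
        mul_le_mul_right (mul_le_mul_left e2 _) _
    _ = ofReal (4 / π * (4 * y / 3)) * q y := by
        rw [ofReal_mul (by positivity), mul_assoc]
    _ ≤ ofReal (2 * L * (y / L)) * q y := by
        refine mul_le_mul_left (ofReal_le_ofReal ?_) _
        have hy0 := hy.1
        rw [show 2 * L * (y / L) = 2 * y by field_simp, div_mul_eq_mul_div, div_le_iff₀ pi_pos]
        nlinarith [pi_gt_three]
    _ = _ := by rw [ofReal_mul (by positivity)]; ring

end HalfPlaneChart

lemma integral_sqrt_div_le {s L : ℝ} (hs : 0 < s) (hsL : s ≤ L) :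
    ∫⁻ t in Ioc s L, ofReal (√(L / t)) ≤ ofReal (2 * L) := by
  have hL := hs.trans_le hsL
  have hd : ∀ t ∈ uIcc s L, HasDerivAt (fun t => 2 * √L * √t) (√(L / t)) t := fun t ht => by
    rw [uIcc_of_le hsL] at ht
    have ht0 := hs.trans_le ht.1
    refine ((Real.hasDerivAt_sqrt ht0.ne').const_mul (2 * √L)).congr_deriv ?_
    rw [sqrt_div hL.le]
    have := (sqrt_pos.2 ht0).ne'
    field_simp
  have hc : ContinuousOn (fun t => √(L / t)) (uIcc s L) := by
    rw [uIcc_of_le hsL]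
    exact (continuousOn_const.div continuousOn_id fun t ht => (hs.trans_le ht.1).ne').sqrt
  have hi := hc.intervalIntegrable (μ := volume)
  rw [← ofReal_integral_eq_lintegral_ofReal hi.1 (Eventually.of_forall fun t =>
    sqrt_nonneg _), ← intervalIntegral.integral_of_le hsL,
    intervalIntegral.integral_eq_sub_of_hasDerivAt hd hi]
  refine ofReal_le_ofReal ?_
  have : √L * √L = L := mul_self_sqrt hL.le
  have : 0 ≤ √L * √s := by positivity
  linarith

namespace HalfPlaneChart
variable {φ ψ P : ℂ → ℂ} {y₀ : ℝ}

lemma continuousOn_vert {g : ℂ → ℂ} (hg : ∀ ζ : ℂ, 0 < ζ.im → ContinuousAt g ζ) (x : ℝ) :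
    ContinuousOn (fun t : ℝ => g (x + t * I)) (Ioi 0) := fun t ht =>
  ((hg _ (by simpa using ht)).comp (f := fun t : ℝ => (x : ℂ) + t * I)
    (by fun_prop)).continuousWithinAt

variable (h : HalfPlaneChart φ ψ P y₀)
include h

/-- `φ(x + it) - it φ'(x + it)`, the first order extrapolation of `φ` to the boundary. -/
lemma norm_extrapolation_sub_le {a L δ x s : ℝ} (hL : L ≤ y₀) (hδ : 0 < δ)
    (hb : boxMean (energyDensity P) a L ≤ ofReal (δ ^ 2)) (hx : x ∈ Icc a (a + L))
    (hs : 0 < s) (hsL : s ≤ L) :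
    ‖(φ (x + L * I) - L * I * ψ (x + L * I)) -
      (φ (x + s * I) - s * I * ψ (x + s * I))‖ ≤
      2 * δ * L * ‖ψ (x + L * I)‖ := by
  have hL0 := hs.trans_le hsL
  set N := ‖ψ (x + L * I)‖
  have hN : 0 < N := norm_pos_iff.2 (h.ne_zero _ (by simpa using hL0))
  set D : ℝ → ℂ := fun t => t * (P (x + t * I) * ψ (x + t * I))
  have hd : ∀ t ∈ uIcc s L, HasDerivAt (fun t : ℝ => φ (x + t * I) -
      t * I * ψ (x + t * I)) (D t) t := fun t ht => by
    rw [uIcc_of_le hsL] at ht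
    have ht0 := hs.trans_le ht.1
    have e1 := hasDerivAt_vert (g' := ψ) (h.hasDerivAt (x + t * I) (by simpa using ht0))
    have e2 := hasDerivAt_vert (g' := fun z => P z * ψ z)
      (h.hasDerivAt_deriv (x + t * I) (by simpa using ht0))
    refine (e1.sub (((hasDerivAt_id t).ofReal_comp.mul_const I).mul e2)).congr_deriv ?_
    simp only [D, id, Complex.ofReal_one]
    linear_combination (-(t : ℂ) * (P (x + t * I) * ψ (x + t * I))) * Complex.I_mul_I
  have hc : ContinuousOn D (uIcc s L) := by
    rw [uIcc_of_le hsL]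
    refine ContinuousOn.mono ?_ (fun t ht => hs.trans_le ht.1 : Icc s L ⊆ Ioi 0)
    exact Complex.continuous_ofReal.continuousOn.mul
      ((continuousOn_vert (fun ζ hζ => (h.differentiableAt ζ hζ).continuousAt) x).mul
      (continuousOn_vert (fun ζ hζ => (h.hasDerivAt_deriv ζ hζ).continuousAt) x))
  rw [← intervalIntegral.integral_eq_sub_of_hasDerivAt hd hc.intervalIntegrable,
    intervalIntegral.integral_of_le hsL, ← ofReal_le_ofReal_iff (by positivity),
    ofReal_norm]
  refine (enorm_integral_le_lintegral_enorm _).trans ?_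
  have hp : ∀ t ∈ Ioc s L, ‖D t‖ₑ ≤ ofReal (N / (2 * δ)) *
      ofReal (t ^ 2 * ‖P (x + t * I)‖ ^ 2) +
      ofReal (N * δ / 2) * ofReal (√(L / t)) := fun t ht => by
    have ht0 := hs.trans ht.1
    have hg := h.sqrt_mul_norm_sq_le (x := x) ht0 ht.2 hL
    rw [← ofReal_mul (by positivity), ← ofReal_mul (by positivity),
      ← ofReal_add (by positivity) (by positivity), ← ofReal_norm]
    refine ofReal_le_ofReal ?_
    have hn : ‖D t‖ = t * ‖P (x + t * I)‖ * ‖ψ (x + t * I)‖ := by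
      simp [D, abs_of_pos ht0, mul_assoc]
    rw [hn]
    set A := ‖ψ (x + t * I)‖
    set B := t * ‖P (x + t * I)‖
    have hA : A ^ 2 ≤ √(L / t) * N ^ 2 := by
      rw [sqrt_div hL0.le, div_mul_eq_mul_div, le_div_iff₀ (sqrt_pos.2 ht0)]
      linarith
    have e : N / (2 * δ) * (t ^ 2 * ‖P (x + t * I)‖ ^ 2) + N * δ / 2 * √(L / t) - B * A =
        1 / (2 * δ * N) * ((N * B - δ * A) ^ 2 + δ ^ 2 * (√(L / t) * N ^ 2 - A ^ 2)) := by
      simp only [B]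
      field_simp
      ring
    have : 0 ≤ 1 / (2 * δ * N) * ((N * B - δ * A) ^ 2 + δ ^ 2 * (√(L / t) * N ^ 2 - A ^ 2)) :=
      mul_nonneg (by positivity) (add_nonneg (sq_nonneg _)
        (mul_nonneg (sq_nonneg _) (sub_nonneg.2 hA)))
    linarith
  refine (setLIntegral_mono' measurableSet_Ioc hp).trans ?_
  rw [lintegral_add_right _ (by fun_prop), lintegral_ofReal_mul,
    lintegral_ofReal_mul]
  have e1 := (lintegral_mono_set (Ioc_subset_Ioc_left hs.le)).trans
    ((h.lintegral_sq_mul_le hL0 hx).trans (mul_le_mul_right hb _))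
  rw [← ofReal_mul (by positivity)] at e1
  refine (add_le_add (mul_le_mul_right e1 _)
    (mul_le_mul_right (integral_sqrt_div_le hs hsL) _)).trans_eq ?_
  rw [← ofReal_mul (by positivity), ← ofReal_mul (by positivity),
      ← ofReal_add (by positivity) (by positivity)]
  congr 1
  field_simp
  ring

end HalfPlaneChart

namespace HalfPlaneChart
variable {φ ψ P : ℂ → ℂ} {y₀ : ℝ} (h : HalfPlaneChart φ ψ P y₀)
include h

lemma norm_mul_sqrt_le {M : ℝ} (hy1 : y₀ ≤ 1)
    (hM : ∀ x : ℝ, ‖ψ (x + y₀ * I)‖ ≤ M) {x t : ℝ} (ht : 0 < t) (hty : t ≤ y₀) :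
    ‖ψ (x + t * I)‖ * √t ≤ M := by
  have h1 := h.sqrt_mul_norm_sq_le (x := x) ht hty le_rfl
  have hM0 : 0 ≤ M := (norm_nonneg _).trans (hM 0)
  refine abs_le_of_sq_le_sq' ?_ hM0 |>.2
  have h2 : √y₀ ≤ 1 := sqrt_le_one.2 hy1
  have h3 : √t ≤ 1 := sqrt_le_one.2 (hty.trans hy1)
  have h4 : ‖ψ (x + y₀ * I)‖ ^ 2 ≤ M ^ 2 := pow_le_pow_left₀ (norm_nonneg _) (hM x) 2
  have h5 : √y₀ * ‖ψ (x + y₀ * I)‖ ^ 2 ≤ M ^ 2 :=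
    (mul_le_of_le_one_left (sq_nonneg _) h2).trans h4
  calc (‖ψ (x + t * I)‖ * √t) ^ 2 = √t * (√t * ‖ψ (x + t * I)‖ ^ 2) := by ring
    _ ≤ √t * ‖ψ (x + t * I)‖ ^ 2 := mul_le_of_le_one_left (by positivity) h3
    _ ≤ M ^ 2 := h1.trans h5

lemma norm_sub_le_sqrt {M : ℝ} (hy1 : y₀ ≤ 1)
    (hM : ∀ x : ℝ, ‖ψ (x + y₀ * I)‖ ≤ M) {x s t : ℝ} (hs : 0 < s) (hst : s ≤ t)
    (hty : t ≤ y₀) :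
    ‖φ (x + t * I) - φ (x + s * I)‖ ≤ 2 * M * (√t - √s) := by
  have hd : ∀ τ ∈ Icc s t, HasDerivAt (fun τ : ℝ => φ (x + τ * I))
      (ψ (x + τ * I) * I) τ := fun τ hτ =>
    hasDerivAt_vert (g' := ψ) (h.hasDerivAt _ (by simpa using hs.trans_le hτ.1))
  have hB : ∀ τ ∈ Icc s t, HasDerivAt (fun τ : ℝ => 2 * M * (√τ - √s))
      (2 * M * (1 / (2 * √τ))) τ := fun τ hτ =>
    (((Real.hasDerivAt_sqrt (hs.trans_le hτ.1).ne').sub_const _).const_mul _)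
  have := image_norm_le_of_norm_deriv_right_le_deriv_boundary'
    (f := fun τ : ℝ => φ (x + τ * I) - φ (x + s * I))
    (f' := fun τ => ψ (x + τ * I) * I)
    (B := fun τ : ℝ => 2 * M * (√τ - √s)) (B' := fun τ => 2 * M * (1 / (2 * √τ)))
    (a := s) (b := t)
    (fun τ hτ => ((hd τ hτ).sub_const _).continuousAt.continuousWithinAt)
    (fun τ hτ => ((hd τ ⟨hτ.1, hτ.2.le⟩).sub_const _).hasDerivWithinAt) (by simp)
    (fun τ hτ => (hB τ hτ).continuousAt.continuousWithinAt)
    (fun τ hτ => (hB τ ⟨hτ.1, hτ.2.le⟩).hasDerivWithinAt)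
    (fun τ hτ => by
      have hp := sqrt_pos.2 (hs.trans_le hτ.1)
      rw [norm_mul, norm_I, mul_one,
        show 2 * M * (1 / (2 * √τ)) = M / √τ by field_simp, le_div_iff₀ hp]
      exact h.norm_mul_sqrt_le hy1 hM (hs.trans_le hτ.1) (hτ.2.le.trans hty))
  exact this ⟨hst, le_rfl⟩

lemma exists_boundary {M : ℝ} (hy0 : 0 < y₀) (hy1 : y₀ ≤ 1)
    (hM : ∀ x : ℝ, ‖ψ (x + y₀ * I)‖ ≤ M) :
    ∃ φ₀ : ℝ → ℂ, Continuous φ₀ ∧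
      ∀ x t : ℝ, 0 < t → t ≤ y₀ → ‖φ (x + t * I) - φ₀ x‖ ≤ 2 * M * √t := by
  have hM0 : 0 ≤ M := (norm_nonneg _).trans (hM 0)
  have hlim : ∀ x : ℝ, ∃ l, Tendsto (fun t : ℝ => φ (x + t * I))
      (𝓝[>] 0) (nhds l) := fun x => by
    refine cauchy_map_iff_exists_tendsto.1 (Metric.cauchy_iff.2 ⟨inferInstance, fun ε hε => ?_⟩)
    have ht : Tendsto (fun t : ℝ => 2 * M * √t) (𝓝[>] 0) (nhds 0) := by
      have : Continuous fun t : ℝ => 2 * M * √t := by fun_prop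
      simpa using (this.tendsto 0).mono_left nhdsWithin_le_nhds
    obtain ⟨τ, ⟨hτ, hτ0⟩, hτy⟩ := ((ht.eventually_lt_const hε).and self_mem_nhdsWithin |>.and
      (nhdsWithin_le_nhds (Iio_mem_nhds hy0))).exists
    refine ⟨_, image_mem_map (Ioo_mem_nhdsGT (show (0 : ℝ) < τ from hτ0)), ?_⟩
    have key : ∀ s t, 0 < s → s ≤ t → t < τ →
        ‖φ (x + t * I) - φ (x + s * I)‖ < ε := fun s t hs hst htτ => by
      refine (h.norm_sub_le_sqrt hy1 hM hs hst (htτ.le.trans (le_of_lt hτy))).trans_lt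
        (lt_of_le_of_lt ?_ hτ)
      have := sqrt_nonneg s
      have := sqrt_le_sqrt htτ.le
      exact mul_le_mul_of_nonneg_left (by linarith) (by positivity)
    rintro _ ⟨s, hs, rfl⟩ _ ⟨t, ht, rfl⟩
    rcases le_total s t with hst | hst
    · rw [dist_comm, dist_eq_norm]; exact key s t hs.1 hst ht.2
    · rw [dist_eq_norm]; exact key t s ht.1 hst hs.2
  choose φ₀ hφ₀ using hlim
  have hbd : ∀ x t : ℝ, 0 < t → t ≤ y₀ → ‖φ (x + t * I) - φ₀ x‖ ≤ 2 * M * √t :=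
    fun x t ht hty => by
    refine le_of_tendsto ((tendsto_const_nhds.sub (hφ₀ x)).norm)
      (mem_of_superset (Ioo_mem_nhdsGT ht) fun s hs => ?_)
    refine (h.norm_sub_le_sqrt hy1 hM hs.1 hs.2.le hty).trans ?_
    have := sqrt_nonneg s
    exact mul_le_mul_of_nonneg_left (by linarith) (by positivity)
  refine ⟨φ₀, ?_, hbd⟩
  have hu : TendstoUniformly (fun (t : ℝ) (x : ℝ) => φ (x + t * I)) φ₀
      (𝓝[>] 0) := by
    rw [Metric.tendstoUniformly_iff]
    intro ε hε
    have ht : Tendsto (fun t : ℝ => 2 * M * √t) (𝓝[>] 0) (nhds 0) := by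
      have : Continuous fun t : ℝ => 2 * M * √t := by fun_prop
      simpa using (this.tendsto 0).mono_left nhdsWithin_le_nhds
    filter_upwards [ht.eventually_lt_const hε, Ioo_mem_nhdsGT hy0] with t h1 h2 x
    rw [dist_comm, dist_eq_norm]
    exact (hbd x t h2.1 h2.2.le).trans_lt h1
  refine hu.continuous (Eventually.frequently ?_)
  filter_upwards [self_mem_nhdsWithin] with t ht
  exact continuous_iff_continuousAt.2 fun x =>
    (hasDerivAt_horiz (g' := ψ) (h.hasDerivAt _ (by simpa using ht))).continuousAt

/-- The boundary values of `φ` on `[a, a + L]` are affine up to the box average of the energy. -/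
lemma norm_boundary_sub_le {φ₀ : ℝ → ℂ} {M : ℝ} (hy1 : y₀ ≤ 1)
    (hM : ∀ x : ℝ, ‖ψ (x + y₀ * I)‖ ≤ M)
    (hφ₀ : ∀ x t : ℝ, 0 < t → t ≤ y₀ → ‖φ (x + t * I) - φ₀ x‖ ≤ 2 * M * √t)
    {a L δ : ℝ} (hL0 : 0 < L) (hL : L ≤ y₀) (hδ : 0 < δ) (hδ1 : δ ≤ 1 / 4)
    (hb : boxMean (energyDensity P) a L ≤ ofReal (δ ^ 2)) {x : ℝ}
    (hx : x ∈ Icc a (a + L)) :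
    ‖φ₀ x - φ₀ a - ψ (a + L * I) * (x - a)‖ ≤ 16 * δ * (‖ψ (a + L * I)‖ * L) := by
  have ha : a ∈ Icc a (a + L) := ⟨le_rfl, by linarith⟩
  set p := ψ (a + L * I)
  have hcψ : Continuous fun u : ℝ => ψ (u + L * I) := continuous_iff_continuousAt.2 fun u =>
    (hasDerivAt_horiz (g' := fun z => P z * ψ z)
      (h.hasDerivAt_deriv _ (by simpa using hL0))).continuousAt
  obtain ⟨u₁, hu₁, hmax⟩ := isCompact_Icc.exists_isMaxOn ⟨a, ha⟩ hcψ.norm.continuousOn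
  have hψ1 : ∀ u ∈ Icc a (a + L), ‖ψ (u + L * I) - p‖ ≤
      2 * δ * ‖ψ (u₁ + L * I)‖ := fun u hu => by
    have := (convex_Icc a (a + L)).norm_image_sub_le_of_norm_hasDerivWithin_le
      (f := fun u : ℝ => ψ (u + L * I))
      (f' := fun u => P (u + L * I) * ψ (u + L * I))
      (C := 2 * δ / L * ‖ψ (u₁ + L * I)‖)
      (fun v hv => (hasDerivAt_horiz (g' := fun z => P z * ψ z)
        (h.hasDerivAt_deriv _ (by simpa using hL0))).hasDerivWithinAt)
      (fun v hv => by
        rw [norm_mul]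
        refine mul_le_mul ?_ (hmax hv) (norm_nonneg _) (by positivity)
        rw [le_div_iff₀ hL0, mul_comm]
        exact h.norm_mul_le hL0 hδ hb hv) ha hu
    refine this.trans ?_
    rw [norm_of_nonneg (by linarith [hu.1])]
    calc _ ≤ 2 * δ / L * ‖ψ (u₁ + L * I)‖ * L :=
          mul_le_mul_of_nonneg_left (by linarith [hu.2]) (by positivity)
      _ = _ := by field_simp
  have hmax2 : ‖ψ (u₁ + L * I)‖ ≤ 2 * ‖p‖ := by
    have h1 := norm_le_norm_add_norm_sub' (ψ (u₁ + L * I)) p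
    have h2 := hψ1 u₁ hu₁
    have h3 := mul_le_mul_of_nonneg_right hδ1 (norm_nonneg (ψ (u₁ + L * I)))
    linarith
  have hψ2 : ∀ u ∈ Icc a (a + L), ‖ψ (u + L * I) - p‖ ≤ 4 * δ * ‖p‖ := fun u hu => by
    refine (hψ1 u hu).trans ?_
    have := mul_le_mul_of_nonneg_left hmax2 (by positivity : 0 ≤ 2 * δ)
    linarith
  have hhor : ‖φ (x + L * I) - φ (a + L * I) - p * (x - a)‖ ≤ 4 * δ * ‖p‖ * L := by
    have := (convex_Icc a (a + L)).norm_image_sub_le_of_norm_hasDerivWithin_le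
      (f := fun u : ℝ => φ (u + L * I) - p * u)
      (f' := fun u => ψ (u + L * I) - p) (C := 4 * δ * ‖p‖)
      (fun v hv => ((hasDerivAt_horiz (g' := ψ)
        (h.hasDerivAt _ (by simpa using hL0))).sub (((hasDerivAt_id v).ofReal_comp.const_mul
          p).congr_deriv (by simp))).hasDerivWithinAt) hψ2 ha hx
    rw [norm_of_nonneg (by linarith [hx.1])] at this
    calc _ = ‖φ (x + L * I) - p * x - (φ (a + L * I) - p * a)‖ := by
          congr 1; ring
      _ ≤ _ := this
      _ ≤ _ := mul_le_mul_of_nonneg_left (by linarith [hx.2]) (by positivity)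
  have hver : ∀ u ∈ Icc a (a + L),
      ‖(φ (u + L * I) - L * I * ψ (u + L * I)) - φ₀ u‖ ≤
        2 * δ * L * (2 * ‖p‖) := fun u hu => by
    have hl : Tendsto (fun s : ℝ => φ (u + s * I) - s * I *
        ψ (u + s * I)) (𝓝[>] 0) (nhds (φ₀ u)) := by
      rw [tendsto_iff_norm_sub_tendsto_zero]
      have ht : Tendsto (fun t : ℝ => 3 * M * √t) (𝓝[>] 0) (nhds 0) := by
        have : Continuous fun t : ℝ => 3 * M * √t := by fun_prop
        simpa using (this.tendsto 0).mono_left nhdsWithin_le_nhds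
      refine squeeze_zero' (Eventually.of_forall fun _ => norm_nonneg _) ?_ ht
      filter_upwards [Ioo_mem_nhdsGT (hL0.trans_le hL)] with s hs
      have h1 := hφ₀ u s hs.1 hs.2.le
      have h2 := mul_le_mul_of_nonneg_right
        (h.norm_mul_sqrt_le hy1 hM (x := u) hs.1 hs.2.le) (sqrt_nonneg s)
      rw [mul_assoc, mul_self_sqrt hs.1.le] at h2
      have h3 := _root_.norm_sub_le (φ (u + s * I) - φ₀ u) (s * I *
        ψ (u + s * I))
      rw [norm_mul, norm_mul, norm_I, norm_real, norm_of_nonneg hs.1.le,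
        mul_one, sub_right_comm] at h3
      linarith
    refine le_of_tendsto ((tendsto_const_nhds.sub hl).norm)
      (mem_of_superset (Ioo_mem_nhdsGT hL0) fun s hs => ?_)
    refine (h.norm_extrapolation_sub_le hL hδ hb hu hs.1 hs.2.le).trans ?_
    exact mul_le_mul_of_nonneg_left ((hmax hu).trans hmax2) (by positivity)
  have e : φ₀ x - φ₀ a - p * (x - a) =
      (φ (x + L * I) - φ (a + L * I) - p * (x - a)) -
      ((φ (x + L * I) - L * I * ψ (x + L * I)) - φ₀ x) +
      ((φ (a + L * I) - L * I * ψ (a + L * I)) - φ₀ a) -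
      L * I * (ψ (x + L * I) - p) := by
    simp only [p]; ring
  rw [e]
  refine (_root_.norm_sub_le _ _).trans ?_
  have n1 := _root_.norm_add_le (φ (x + L * I) - φ (a + L * I) - p * (x - a) -
      ((φ (x + L * I) - L * I * ψ (x + L * I)) - φ₀ x))
      ((φ (a + L * I) - L * I * ψ (a + L * I)) - φ₀ a)
  have n2 := _root_.norm_sub_le (φ (x + L * I) - φ (a + L * I) - p * (x - a))
      ((φ (x + L * I) - L * I * ψ (x + L * I)) - φ₀ x)
  have n3 := hver x hx
  have n4 := hver a ha
  have n5 : ‖L * I * (ψ (x + L * I) - p)‖ ≤ L * (4 * δ * ‖p‖) := by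
    rw [norm_mul, norm_mul, norm_I, norm_real, norm_of_nonneg hL0.le, mul_one]
    exact mul_le_mul_of_nonneg_left (hψ2 x hx) hL0.le
  linarith

end HalfPlaneChart

/-- A `2π`-periodic curve which is affine on every short interval, up to an error controlled by a
finite energy density `Q`; `p a L` is the slope on `[a, a + L]`. -/
structure AffineApprox (φ₀ : ℝ → ℂ) (p : ℝ → ℝ → ℂ) (Q : ℝ → ℝ → ENNReal) (L₀ : ℝ) : Prop where
  continuous : Continuous φ₀
  periodic : ∀ x, φ₀ (x + 2 * π) = φ₀ x
  ne_zero : ∀ a L, 0 < L → p a L ≠ 0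
  measurable : Measurable (uncurry Q)
  density_periodic : ∀ x y, Q (x + 2 * π) y = Q x y
  lt_top : ∫⁻ y in Ioo 0 1, ∫⁻ x in Ioc 0 (2 * π), Q x y < ⊤
  pos : 0 < L₀
  le_one : L₀ ≤ 1 / 3
  approx : ∀ a L δ x, 0 < L → L ≤ L₀ → 0 < δ → δ ≤ 1 / 4 → boxMean Q a L ≤ ofReal (δ ^ 2) →
    x ∈ Icc a (a + L) → ‖φ₀ x - φ₀ a - p a L * (x - a)‖ ≤ 16 * δ * (‖p a L‖ * L)

lemma norm_exp_I_mul (z : ℂ) : ‖Complex.exp (I * z)‖ = exp (-z.im) := by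
  rw [Complex.norm_exp]; simp

lemma exp_I_mul_mem_ball {z : ℂ} (hz : 0 < z.im) : Complex.exp (I * z) ∈ 𝔻 := by
  rw [mem_ball_zero_iff, norm_exp_I_mul, Real.exp_lt_one_iff]; linarith

lemma exp_I_mul_periodic (x y : ℝ) :
    Complex.exp (I * ((x + 2 * π : ℝ) + y * I)) =
      Complex.exp (I * (x + y * I)) := by
  have : I * ((x + 2 * π : ℝ) + y * I) =
      I * (x + y * I) + 2 * π * I := by push_cast; ring
  rw [this, Complex.exp_add, Complex.exp_two_pi_mul_I, mul_one]

lemma lintegral_strip_comp_exp_le {g : ℂ → ENNReal} :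
    ∫⁻ z in Ioc 0 (2 * π) ×ℂ Ioo 0 1, g (Complex.exp (I * z)) ≤
      ofReal (exp 2) * ∫⁻ z in 𝔻, g z := by
  set S := Ioc 0 (2 * π) ×ℂ Ioo (0 : ℝ) 1
  have hS : MeasurableSet S := (measurableSet_Ioc.preimage Complex.measurable_re).inter
    (measurableSet_Ioo.preimage Complex.measurable_im)
  have hd : ∀ z, HasDerivAt (fun z : ℂ => Complex.exp (I * z))
      (Complex.exp (I * z) * I) z := fun z =>
    (((hasDerivAt_id z).const_mul I).congr_deriv (mul_one _)).cexp
  have hinj : InjOn (fun z : ℂ => Complex.exp (I * z)) S := by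
    intro z hz z' hz' he
    obtain ⟨n, hn⟩ := Complex.exp_eq_exp_iff_exists_int.1 he
    have e : z = z' + n * (2 * π) := by
      apply mul_left_cancel₀ Complex.I_ne_zero
      rw [hn]; ring
    have e1 := congrArg Complex.re e
    simp at e1
    have h1 := hz.1; have h2 := hz'.1
    have n0 : n = 0 := by
      have hp := two_pi_pos
      have a1 : (n : ℝ) < 1 := by
        by_contra! hc
        nlinarith [h1.2, h2.1]
      have a2 : (-1 : ℝ) < n := by
        by_contra! hc
        nlinarith [h1.1, h2.2]
      have b1 : n < 1 := by exact_mod_cast a1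
      have b2 : -1 < n := by exact_mod_cast a2
      omega
    simpa [n0] using e
  have hi := lintegral_image_eq_lintegral_norm_deriv_sq hS
    (fun z _ => (hd z).differentiableAt) hinj g
  calc _ ≤ ∫⁻ z in S, ofReal (exp 2) * (ofReal
          (‖deriv (fun z : ℂ => Complex.exp (I * z)) z‖ ^ 2) *
            g (Complex.exp (I * z))) := by
        refine setLIntegral_mono' hS fun z hz => ?_
        rw [← mul_assoc, ← ofReal_mul (by positivity), (hd z).deriv, norm_mul,
          norm_I, mul_one, norm_exp_I_mul, ← Real.exp_nat_mul, ← Real.exp_add]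
        refine le_mul_of_one_le_left zero_le (ENNReal.one_le_ofReal.2 (Real.one_le_exp ?_))
        have := hz.2.2
        push_cast
        linarith
    _ = ofReal (exp 2) * ∫⁻ z in (fun z : ℂ => Complex.exp (I * z)) '' S,
          g z := by rw [lintegral_ofReal_mul, hi]
    _ ≤ _ := by
        refine mul_le_mul_right (lintegral_mono_set ?_) _
        rintro _ ⟨z, hz, rfl⟩
        exact exp_I_mul_mem_ball hz.2.1

theorem exists_affineApprox {F : ℂ → ℂ} (hF : DifferentiableOn ℂ F (ball 0 1))
    (hFi : InjOn F (ball 0 1))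
    (hE : ∫⁻ z in 𝔻, ofReal (‖deriv (deriv F) z / deriv F z‖ ^ 2) < ⊤) :
    ∃ φ₀ p Q L₀, AffineApprox φ₀ p Q L₀ ∧ ∀ ε > 0, ∀ᶠ t : ℝ in 𝓝[>] 0, ∀ x : ℝ,
      ‖F (Complex.exp (I * (x + t * I))) - φ₀ x‖ < ε := by
  set G : ℂ → ℂ := fun z => deriv (deriv F) z / deriv F z with hG
  have hne : ∀ z ∈ 𝔻, deriv F z ≠ 0 := fun z hz =>
    deriv_ne_zero_of_differentiableOn_of_injOn isOpen_ball hF hFi hz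
  have hF1 : DifferentiableOn ℂ (deriv F) (ball 0 1) := hF.deriv isOpen_ball
  have hGd : DifferentiableOn ℂ G (ball 0 1) := (hF1.deriv isOpen_ball).div hF1 hne
  obtain ⟨r, hr1, hr⟩ := exists_radius_pow_mul_norm_le 0 hGd (by simpa only [mul_zero, pow_zero, one_mul] using hE)
    (ε := 1 / 16) (by norm_num)
  set r' := max r (1 / 2)
  have hr' : 0 < r' := lt_of_lt_of_le (by norm_num) (le_max_right _ _)
  have hr'1 : r' < 1 := max_lt hr1 (by norm_num)
  set y₀ := min (1 / 8) (-Real.log r' / 2)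
  have hlog : Real.log r' < 0 := Real.log_neg hr' hr'1
  have hy0 : 0 < y₀ := lt_min (by norm_num) (by linarith)
  set e : ℂ → ℂ := fun z => Complex.exp (I * z)
  have hed : ∀ z, HasDerivAt e (I * e z) z := fun z =>
    (((hasDerivAt_id z).const_mul I).congr_deriv (mul_one _)).cexp.congr_deriv (mul_comm _ _)
  have he : ∀ x y : ℝ, e ((x + 2 * π : ℝ) + y * I) = e (x + y * I) :=
    exp_I_mul_periodic
  have hat : ∀ {g : ℂ → ℂ}, DifferentiableOn ℂ g (ball 0 1) → ∀ z : ℂ, 0 < z.im →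
      HasDerivAt (fun z => g (e z)) (deriv g (e z) * (I * e z)) z := fun hg z hz =>
    ((hg.differentiableAt (isOpen_ball.mem_nhds (exp_I_mul_mem_ball hz))).hasDerivAt).comp z (hed z)
  set P : ℂ → ℂ := fun z => I * e z * deriv F (e z)
  set N : ℂ → ℂ := fun z => I + I * e z * G (e z)
  have hN : ∀ z : ℂ, 0 < z.im → ‖N z‖ ≤ 1 + ‖G (e z)‖ := fun z hz => by
    refine (_root_.norm_add_le _ _).trans ?_
    rw [norm_mul, norm_mul, norm_I, one_mul]
    exact add_le_add_right (mul_le_of_le_one_left (norm_nonneg _)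
      (mem_ball_zero_iff.1 (exp_I_mul_mem_ball hz)).le) _
  have hchart : HalfPlaneChart (fun z => F (e z)) P N y₀ :=
    { hasDerivAt := fun z hz => (hat hF z hz).congr_deriv (by ring)
      hasDerivAt_deriv := fun z hz => by
        refine (((hed z).const_mul I).mul (hat hF1 z hz)).congr_deriv ?_
        have := hne _ (exp_I_mul_mem_ball hz)
        simp only [N, P, hG]
        change deriv F (e z) ≠ 0 at this
        field_simp
      differentiableAt := fun z hz => (((hed z).differentiableAt.const_mul I).mul
        (hat hGd z hz).differentiableAt).const_add _
      ne_zero := fun z hz => mul_ne_zero (mul_ne_zero Complex.I_ne_zero (Complex.exp_ne_zero _))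
        (hne _ (exp_I_mul_mem_ball hz))
      bound := fun z hz hzy => by
        have hb := exp_I_mul_mem_ball hz
        have hlt : r < ‖e z‖ := by
          rw [norm_exp_I_mul]
          refine (le_max_left r (1 / 2)).trans_lt ?_
          rw [← Real.log_lt_iff_lt_exp hr']
          have := hzy.trans (min_le_right _ _)
          linarith
        have h1 := hr _ hb hlt
        rw [zero_add, pow_one] at h1
        have hy8 := hzy.trans (min_le_left _ _)
        have h2 : z.im / 2 ≤ 1 - ‖e z‖ := by
          rw [norm_exp_I_mul]
          have h3 := Real.abs_exp_sub_one_sub_id_le (x := -z.im) (by rw [abs_neg, abs_of_pos hz]; linarith)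
          have := (abs_le.1 h3).2
          nlinarith
        have h6 := mul_le_mul_of_nonneg_left (hN z hz) hz.le
        have h7 := mul_le_mul_of_nonneg_right h2 (norm_nonneg (G (e z)))
        linarith
      measurable := by
        have hem : Measurable e := by fun_prop
        have hGm : Measurable G := (measurable_deriv _).div (measurable_deriv _)
        exact measurable_const.add ((measurable_const.mul hem).mul (hGm.comp hem)) }
  obtain ⟨M, hM⟩ : ∃ M, ∀ x : ℝ, ‖P (x + y₀ * I)‖ ≤ M := by
    have hc : Continuous fun x : ℝ => P (x + y₀ * I) := continuous_iff_continuousAt.2 fun x =>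
      (HalfPlaneChart.hasDerivAt_horiz (g := P) (g' := fun z => N z * P z)
        (hchart.hasDerivAt_deriv _ (by simpa using hy0))).continuousAt
    have hp : Periodic (fun x : ℝ => P (x + y₀ * I)) (2 * π) := fun x => by
      simp only [P, he x y₀]
    obtain ⟨M, hM⟩ := (hp.isBounded_of_continuous two_pi_pos.ne' hc).exists_norm_le
    exact ⟨M, fun x => hM _ ⟨x, rfl⟩⟩
  have hy1 : y₀ ≤ 1 := (min_le_left _ _).trans (by norm_num)
  obtain ⟨φ₀, hφc, hφ⟩ := hchart.exists_boundary hy0 hy1 hM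
  have hconv : ∀ ε > 0, ∀ᶠ t : ℝ in 𝓝[>] 0, ∀ x : ℝ,
      ‖F (Complex.exp (I * (x + t * I))) - φ₀ x‖ < ε := fun ε hε => by
    have ht : Tendsto (fun t : ℝ => 2 * M * √t) (𝓝[>] 0) (nhds 0) := by
      have : Continuous fun t : ℝ => 2 * M * √t := by fun_prop
      simpa using (this.tendsto 0).mono_left nhdsWithin_le_nhds
    filter_upwards [ht.eventually_lt_const hε, Ioo_mem_nhdsGT hy0] with t h1 h2 x
    exact (hφ x t h2.1 h2.2.le).trans_lt h1
  refine ⟨φ₀, fun a L => P (a + L * I), energyDensity N, y₀,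
    { continuous := hφc
      periodic := fun x => by
        refine eq_of_forall_dist_le fun ε hε => ?_
        obtain ⟨t, ht⟩ := (hconv (ε / 2) (by positivity)).exists
        have h1 := ht x
        have h2 := ht (x + 2 * π)
        rw [exp_I_mul_periodic, ← dist_eq_norm] at h2
        rw [← dist_eq_norm] at h1
        linarith [dist_triangle_left (φ₀ (x + 2 * π)) (φ₀ x)
          (F (Complex.exp (I * (x + t * I))))]
      ne_zero := fun a L hL => hchart.ne_zero _ (by simpa using hL)
      measurable := HalfPlaneChart.measurable_energyDensity hchart.measurable
      density_periodic := fun x y => by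
        simp only [energyDensity, N, he x y]
      lt_top := ?_
      pos := hy0
      le_one := (min_le_left _ _).trans (by norm_num)
      approx := fun a L δ x hL hL0 hδ hδ1 hb hx =>
        hchart.norm_boundary_sub_le hy1 hM hφ hL hL0 hδ hδ1 hb hx }, hconv⟩
  unfold energyDensity
  rw [← setLIntegral_reProdIm (g := fun z => ofReal (‖N z‖ ^ 2))
    (measurable_ofReal.comp (hchart.measurable.norm.pow_const 2))
    measurableSet_Ioc measurableSet_Ioo]
  have hS : MeasurableSet (Ioc 0 (2 * π) ×ℂ Ioo (0 : ℝ) 1) :=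
    (measurableSet_Ioc.preimage Complex.measurable_re).inter
    (measurableSet_Ioo.preimage Complex.measurable_im)
  calc _ ≤ ∫⁻ z in Ioc 0 (2 * π) ×ℂ Ioo 0 1,
        (ofReal 2 + ofReal 2 * ofReal (‖G (e z)‖ ^ 2)) := by
        refine setLIntegral_mono' hS fun z hz => ?_
        rw [← ofReal_mul (by norm_num), ← ofReal_add (by norm_num) (by positivity)]
        refine ofReal_le_ofReal ?_
        have h6 := pow_le_pow_left₀ (norm_nonneg _) (hN z hz.2.1) 2
        nlinarith [sq_nonneg (1 - ‖G (e z)‖)]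
    _ < ⊤ := by
        rw [lintegral_add_left measurable_const, lintegral_ofReal_mul,
          setLIntegral_const]
        refine ENNReal.add_lt_top.2 ⟨mul_lt_top ofReal_lt_top ?_,
          mul_lt_top ofReal_lt_top ?_⟩
        · exact ((isBounded_Ioc 0 (2 * π)).reProdIm (isBounded_Ioo 0 1)).measure_lt_top
        · exact (lintegral_strip_comp_exp_le (g := fun z => ofReal (‖G z‖ ^ 2))).trans_lt
            (mul_lt_top ofReal_lt_top hE)

lemma norm_le_re_add {u : ℂ} {c : ℝ} (hc : 0 < c) (hu : c ≤ ‖u‖) : ‖u‖ ≤ |u.re| + u.im ^ 2 / c := by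
  have h1 : ‖u‖ ^ 2 = |u.re| ^ 2 + u.im ^ 2 := by
    rw [← normSq_eq_norm_sq, normSq_apply, sq_abs]; ring
  have h2 := abs_re_le_norm u
  have h3 : (‖u‖ - |u.re|) * c ≤ u.im ^ 2 := by
    nlinarith [abs_nonneg u.re, mul_le_mul_of_nonneg_left hu (sub_nonneg.2 h2),
      mul_nonneg (sub_nonneg.2 h2) (abs_nonneg u.re)]
  have h4 := (le_div_iff₀ hc).2 h3
  linarith

/-- The triangle inequality is sharp to second order for nearly aligned vectors. -/
lemma norm_add_norm_sub_le_of_aligned {u v p : ℂ} {α L d : ℝ} (hp : p ≠ 0) (hα : 0 ≤ α) (hαL : α ≤ L)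
    (hL : 0 < L) (hd : d ≤ 1 / 64) (h1 : ‖u - p * α‖ ≤ d * (‖p‖ * L))
    (h2 : ‖u + v - p * L‖ ≤ d * (‖p‖ * L)) (hu : ‖p‖ * L / 8 ≤ ‖u‖) (hv : ‖p‖ * L / 8 ≤ ‖v‖) :
    ‖u‖ + ‖v‖ - ‖u + v‖ ≤ 40 * d ^ 2 * (‖p‖ * L) := by
  wlog hp1 : p = 1 generalizing u v p
  · have hn := norm_pos_iff.2 hp
    have key := this (u := u / p) (v := v / p) one_ne_zero
      (by
        rw [show u / p - 1 * α = (u - p * α) / p by field_simp, norm_div, div_le_iff₀ hn, norm_one]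
        linarith)
      (by
        rw [show u / p + v / p - 1 * L = (u + v - p * L) / p by field_simp, norm_div,
          div_le_iff₀ hn, norm_one]
        linarith)
      (by rw [norm_div, le_div_iff₀ hn, norm_one]; linarith)
      (by rw [norm_div, le_div_iff₀ hn, norm_one]; linarith) rfl
    rw [← add_div, norm_div, norm_div, norm_div, norm_one, ← add_div, ← sub_div,
      div_le_iff₀ hn] at key
    linarith
  subst hp1
  rw [norm_one, one_mul] at *
  have hdL : d * L ≤ L / 64 := by nlinarith
  have r1 := abs_le.1 ((abs_re_le_norm _).trans h1)
  have i1 := abs_le.1 ((abs_im_le_norm _).trans h1)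
  have r2 := abs_le.1 ((abs_re_le_norm _).trans h2)
  have i2 := abs_le.1 ((abs_im_le_norm _).trans h2)
  simp only [one_mul, Complex.sub_re, Complex.sub_im, Complex.add_re, Complex.add_im,
    Complex.ofReal_re, Complex.ofReal_im, sub_zero] at r1 i1 r2 i2
  have nu := Complex.norm_le_abs_re_add_abs_im u
  have nv := Complex.norm_le_abs_re_add_abs_im v
  have iu : |u.im| ≤ d * L := abs_le.2 i1
  have iv : |v.im| ≤ 2 * (d * L) := abs_le.2 ⟨by linarith, by linarith⟩
  have pu : 0 < u.re := by
    by_contra! hc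
    rw [abs_of_nonpos hc] at nu
    linarith
  have pv : 0 < v.re := by
    by_contra! hc
    rw [abs_of_nonpos hc] at nv
    linarith
  have e1 := norm_le_re_add (by positivity) hu
  have e2 := norm_le_re_add (by positivity) hv
  rw [abs_of_pos pu] at e1
  rw [abs_of_pos pv] at e2
  have e3 := re_le_norm (u + v)
  rw [Complex.add_re] at e3
  have s1 : u.im ^ 2 ≤ (d * L) ^ 2 := sq_le_sq' i1.1 i1.2
  have s2 : v.im ^ 2 ≤ (2 * (d * L)) ^ 2 := sq_le_sq' (abs_le.1 iv).1 (abs_le.1 iv).2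
  have f1 : u.im ^ 2 / (L / 8) ≤ 8 * d ^ 2 * L := by
    rw [div_le_iff₀ (by positivity)]; nlinarith
  have f2 : v.im ^ 2 / (L / 8) ≤ 32 * d ^ 2 * L := by
    rw [div_le_iff₀ (by positivity)]; nlinarith
  linarith

/-- The total energy `∑ⱼ η(2⁻ʲ L)` of all dyadic boxes, up to constants. -/
noncomputable def dyadicEnergy (Q : ℝ → ℝ → ENNReal) (L : ℝ) : ENNReal :=
  ∫⁻ y in Ioo 0 (3 * L), (∫⁻ x in Ioc 0 (2 * π), Q x y) * ofReal (6 - y / L)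

namespace AffineApprox
variable {φ₀ : ℝ → ℂ} {p : ℝ → ℝ → ℂ} {Q : ℝ → ℝ → ENNReal} {L₀ : ℝ} (h : AffineApprox φ₀ p Q L₀)
include h

lemma measurable_lintegral : Measurable fun y => ∫⁻ x in Ioc 0 (2 * π), Q x y :=
  Measurable.lintegral_prod_left' h.measurable

lemma boxMean_add_dyadicEnergy_le (a : ℝ) {L : ℝ} (hL : 0 < L) (hL1 : L ≤ 1 / 3) :
    boxMean Q a L + dyadicEnergy Q (L / 2) ≤ dyadicEnergy Q L := by
  set q : ℝ → ENNReal := fun y => ∫⁻ x in Ioc 0 (2 * π), Q x y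
  have h1 : boxMean Q a L ≤ ∫⁻ y in Ioo 0 (3 * L), q y * ofReal (y / L) := by
    rw [boxMean_eq h.measurable]
    refine lintegral_mono fun y => mul_le_mul_left ?_ _
    have hp : Periodic (fun x => Q x y) (2 * π) := fun x => h.density_periodic x y
    have e := hp.setLIntegral_Ioc_eq two_pi_pos (a - 2 * L) 0
    rw [zero_add] at e
    exact (lintegral_mono_set (Ioc_subset_Ioc_right
      (show a + 2 * L ≤ a - 2 * L + 2 * π by linarith [pi_gt_three]))).trans_eq e
  have h2 : dyadicEnergy Q (L / 2) = ∫⁻ y in Ioo 0 (3 * L),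
      (Ioo 0 (3 * (L / 2))).indicator (fun y => q y * ofReal (6 - y / (L / 2))) y := by
    rw [lintegral_indicator measurableSet_Ioo, Measure.restrict_restrict measurableSet_Ioo,
      inter_eq_left.2 (Ioo_subset_Ioo_right (by linarith))]
    rfl
  refine (add_le_add_left h1 _).trans ?_
  have hm : Measurable fun y => q y * ofReal (y / L) :=
    h.measurable_lintegral.mul (by fun_prop)
  rw [h2, ← lintegral_add_left hm]
  refine setLIntegral_mono' measurableSet_Ioo fun y hy => ?_
  change _ ≤ q y * _
  have hyL : y / L < 3 := by rw [div_lt_iff₀ hL]; exact hy.2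
  have hyL0 : 0 < y / L := div_pos hy.1 hL
  by_cases hm : y ∈ Ioo 0 (3 * (L / 2))
  · rw [indicator_of_mem hm, ← mul_add]
    refine mul_le_mul_right ?_ _
    have e : y / (L / 2) = 2 * (y / L) := by field_simp
    rw [e, ← ofReal_add hyL0.le (by linarith)]
    exact ofReal_le_ofReal (by linarith)
  · rw [indicator_of_notMem hm, add_zero]
    exact mul_le_mul_right (ofReal_le_ofReal (by linarith)) _

lemma exists_dyadicEnergy_le {ε : ℝ} (hε : 0 < ε) :
    ∃ L₁, 0 < L₁ ∧ L₁ ≤ L₀ ∧ ∀ L, 0 < L → L ≤ L₁ → dyadicEnergy Q L ≤ ofReal ε := by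
  set q : ℝ → ENNReal := fun y => ∫⁻ x in Ioc 0 (2 * π), Q x y
  have hv : Tendsto (fun L : ℝ => (volume.restrict (Ioo (0 : ℝ) 1)) (Ioo 0 (3 * L)))
      (𝓝[>] 0) (nhds 0) := by
    have h0 : Tendsto (fun L : ℝ => ofReal (3 * L)) (𝓝[>] 0)
        (nhds 0) := by
      have : Continuous fun L : ℝ => ofReal (3 * L) :=
        continuous_ofReal.comp (by fun_prop)
      simpa using (this.tendsto 0).mono_left nhdsWithin_le_nhds
    refine tendsto_of_tendsto_of_tendsto_of_le_of_le tendsto_const_nhds h0 (fun _ => zero_le)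
      fun L => (Measure.restrict_apply_le _ _).trans ?_
    rw [Real.volume_Ioo, sub_zero]
  have ht := tendsto_setLIntegral_zero (f := q) h.lt_top.ne hv
  have ht2 := (ht.eventually_lt_const (v := 0) (u := ofReal (ε / 6))
    (ENNReal.ofReal_pos.2 (by positivity)))
  obtain ⟨u, hu, hu2⟩ := (mem_nhdsGT_iff_exists_Ioo_subset).1 ht2
  have hu0 : (0 : ℝ) < u := hu
  refine ⟨min L₀ (u / 2), lt_min h.pos (half_pos hu0), min_le_left _ _, fun L hL hL1 => ?_⟩
  have hLu : L ∈ Ioo 0 u := ⟨hL, by linarith [hL1.trans (min_le_right _ _)]⟩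
  have hlt : ∫⁻ y in Ioo 0 (3 * L), q y ∂(volume.restrict (Ioo (0 : ℝ) 1)) <
    ofReal (ε / 6) := hu2 hLu
  have hL3 : L ≤ 1 / 3 := (hL1.trans (min_le_left _ _)).trans h.le_one
  rw [Measure.restrict_restrict measurableSet_Ioo,
    inter_eq_left.2 (Ioo_subset_Ioo_right (by linarith))] at hlt
  calc dyadicEnergy Q L ≤ ∫⁻ y in Ioo 0 (3 * L), ofReal 6 * q y := by
        refine setLIntegral_mono' measurableSet_Ioo fun y hy => ?_
        rw [mul_comm]
        refine mul_le_mul_left (ofReal_le_ofReal ?_) _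
        have := div_pos hy.1 hL
        linarith
    _ ≤ ofReal 6 * ofReal (ε / 6) := by
        rw [lintegral_ofReal_mul]
        exact mul_le_mul_right hlt.le _
    _ = _ := by rw [← ofReal_mul (by norm_num)]; congr 1; ring

end AffineApprox

/-- An `AffineApprox` restricted to scales at which the total dyadic energy is small. -/
structure SmallAffineApprox (φ₀ : ℝ → ℂ) (p : ℝ → ℝ → ℂ) (Q : ℝ → ℝ → ENNReal) (L₁ : ℝ) : Prop
    extends AffineApprox φ₀ p Q L₁ where
  small : ∀ L, 0 < L → L ≤ L₁ → dyadicEnergy Q L ≤ ofReal (1 / 2 ^ 21)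

lemma AffineApprox.exists_small {φ₀ : ℝ → ℂ} {p : ℝ → ℝ → ℂ} {Q : ℝ → ℝ → ENNReal} {L₀ : ℝ}
    (h : AffineApprox φ₀ p Q L₀) : ∃ L₁, SmallAffineApprox φ₀ p Q L₁ := by
  obtain ⟨L₁, h0, h1, h2⟩ := h.exists_dyadicEnergy_le (ε := 1 / 2 ^ 21) (by positivity)
  exact ⟨L₁, { h with
    pos := h0
    le_one := h1.trans h.le_one
    approx := fun a L δ x hL hL1 => h.approx a L δ x hL (hL1.trans h1)
    small := h2 }⟩

namespace SmallAffineApprox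
variable {φ₀ : ℝ → ℂ} {p : ℝ → ℝ → ℂ} {Q : ℝ → ℝ → ENNReal} {L₁ : ℝ}
  (h : SmallAffineApprox φ₀ p Q L₁)
include h

lemma boxMean_le (a : ℝ) {L : ℝ} (hL : 0 < L) (hL1 : L ≤ L₁) :
    boxMean Q a L ≤ ofReal (1 / 2 ^ 21) :=
  (le_self_add.trans (h.boxMean_add_dyadicEnergy_le a hL (hL1.trans h.le_one))).trans
    (h.small L hL hL1)

lemma norm_sub_sub_le {a L x : ℝ} (hL : 0 < L) (hL1 : L ≤ L₁) (hx : x ∈ Icc a (a + L)) :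
    ‖φ₀ x - φ₀ a - p a L * (x - a)‖ ≤ 1 / 64 * (‖p a L‖ * L) := by
  have := h.approx a L (1 / 2 ^ 10) x hL hL1 (by norm_num) (by norm_num)
    ((h.boxMean_le a hL hL1).trans (ofReal_le_ofReal (by norm_num))) hx
  linarith

lemma norm_sub_sub_le' {a L x y : ℝ} (hL : 0 < L) (hL1 : L ≤ L₁) (hx : x ∈ Icc a (a + L))
    (hy : y ∈ Icc a (a + L)) :
    ‖φ₀ y - φ₀ x - p a L * (y - x)‖ ≤ 1 / 32 * (‖p a L‖ * L) := by
  have h1 := h.norm_sub_sub_le hL hL1 hx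
  have h2 := h.norm_sub_sub_le hL hL1 hy
  have := _root_.norm_sub_le (φ₀ y - φ₀ a - p a L * (y - a)) (φ₀ x - φ₀ a - p a L * (x - a))
  rw [show φ₀ y - φ₀ a - p a L * (y - a) - (φ₀ x - φ₀ a - p a L * (x - a)) =
    φ₀ y - φ₀ x - p a L * (y - x) by ring] at this
  linarith

lemma le_norm_sub {a L x y : ℝ} (hL : 0 < L) (hL1 : L ≤ L₁) (hx : x ∈ Icc a (a + L))
    (hy : y ∈ Icc a (a + L)) (hxy : x ≤ y) :
    ‖p a L‖ * ((y - x) - L / 32) ≤ ‖φ₀ y - φ₀ x‖ ∧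
      ‖φ₀ y - φ₀ x‖ ≤ ‖p a L‖ * ((y - x) + L / 32) := by
  have h1 := h.norm_sub_sub_le' hL hL1 hx hy
  have e : ‖p a L * ((y : ℂ) - x)‖ = ‖p a L‖ * (y - x) := by
    rw [norm_mul, ← Complex.ofReal_sub, norm_real, norm_of_nonneg (by linarith)]
  have h2 := norm_sub_norm_le (φ₀ y - φ₀ x) (p a L * ((y : ℂ) - x))
  have h3 := norm_sub_norm_le (p a L * ((y : ℂ) - x)) (φ₀ y - φ₀ x)
  rw [norm_sub_rev (p a L * _) (φ₀ y - φ₀ x)] at h3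
  constructor <;> linarith

lemma excess_le {a L m k : ℝ} (hL : 0 < L) (hL1 : L ≤ L₁) (hm : m ∈ Icc a (a + L))
    (hk : 0 ≤ k) (hk1 : k ≤ 1 / 2 ^ 21) (hb : boxMean Q a L ≤ ofReal k)
    (hu : ‖p a L‖ * L / 8 ≤ ‖φ₀ m - φ₀ a‖) (hv : ‖p a L‖ * L / 8 ≤ ‖φ₀ (a + L) - φ₀ m‖) :
    ‖φ₀ m - φ₀ a‖ + ‖φ₀ (a + L) - φ₀ m‖ - ‖φ₀ (a + L) - φ₀ a‖ ≤
      20480 * k * ‖φ₀ (a + L) - φ₀ a‖ := by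
  have hA := (h.le_norm_sub hL hL1 ⟨le_rfl, by linarith⟩ ⟨by linarith, le_rfl⟩
    (by linarith : a ≤ a + L)).1
  have key : ∀ ε ∈ Ioo (0 : ℝ) (1 / 2 ^ 21), ‖φ₀ m - φ₀ a‖ + ‖φ₀ (a + L) - φ₀ m‖ -
      ‖φ₀ (a + L) - φ₀ a‖ ≤ 20480 * (k + ε) * ‖φ₀ (a + L) - φ₀ a‖ := fun ε hε => by
    have hs : √(k + ε) ^ 2 = k + ε := sq_sqrt (by linarith [hε.1])
    have hs1 : √(k + ε) ≤ 1 / 2 ^ 10 := Real.sqrt_le_iff.2 ⟨by norm_num, by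
      have := hε.2; norm_num at this hk1 ⊢; linarith⟩
    have hs0 : 0 < √(k + ε) := sqrt_pos.2 (by linarith [hε.1])
    have hap := fun x hx => h.approx a L (√(k + ε)) x hL hL1 hs0 (hs1.trans (by norm_num))
      (hb.trans (ofReal_le_ofReal (by rw [hs]; linarith [hε.1]))) hx
    have h1 := hap m hm
    have h2 := hap (a + L) ⟨by linarith, le_rfl⟩
    have := norm_add_norm_sub_le_of_aligned (u := φ₀ m - φ₀ a) (v := φ₀ (a + L) - φ₀ m)
      (α := m - a) (d := 16 * √(k + ε)) (h.ne_zero a L hL) (by linarith [hm.1])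
      (by linarith [hm.2]) hL (by linarith) (by push_cast; exact h1)
      (by
        convert h2 using 2
        push_cast
        ring) hu hv
    rw [show φ₀ m - φ₀ a + (φ₀ (a + L) - φ₀ m) = φ₀ (a + L) - φ₀ a by ring, mul_pow, hs] at this
    refine this.trans ?_
    have : ‖p a L‖ * L ≤ 2 * ‖φ₀ (a + L) - φ₀ a‖ := by
      have := mul_nonneg (norm_nonneg (p a L)) hL.le
      linarith
    have := mul_le_mul_of_nonneg_left this (by have := hε.1; positivity : 0 ≤ 40 * (16 ^ 2 * (k + ε)))
    linarith
  have hc : Continuous fun ε => 20480 * (k + ε) * ‖φ₀ (a + L) - φ₀ a‖ := by fun_prop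
  have ht := (hc.tendsto 0).mono_left (nhdsWithin_le_nhds (s := Ioi 0))
  rw [add_zero] at ht
  exact ge_of_tendsto ht (mem_of_superset (Ioo_mem_nhdsGT (by positivity)) key)

end SmallAffineApprox

/-- The largest point of the grid `a + 2⁻ⁿ L ℤ` below `x`. -/
noncomputable def dyadicFloor (n : ℕ) (a L x : ℝ) : ℝ := a + L * (⌊2 ^ n * ((x - a) / L)⌋ / 2 ^ n)

lemma dyadicFloor_succ_left (n : ℕ) (a x : ℝ) {L : ℝ} (hL : 0 < L) :
    dyadicFloor (n + 1) a L x = dyadicFloor n a (L / 2) x := by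
  have h : 2 ^ (n + 1) * ((x - a) / L) = 2 ^ n * ((x - a) / (L / 2)) := by
    rw [pow_succ]; field_simp
  rw [dyadicFloor, dyadicFloor, h, pow_succ]
  ring

lemma dyadicFloor_succ_right (n : ℕ) (a x : ℝ) {L : ℝ} (hL : 0 < L) :
    dyadicFloor (n + 1) a L x = dyadicFloor n (a + L / 2) (L / 2) x := by
  have h : (2 : ℝ) ^ (n + 1) * ((x - a) / L) =
      2 ^ n * ((x - (a + L / 2)) / (L / 2)) + ((2 ^ n : ℤ) : ℝ) := by
    push_cast
    rw [pow_succ]; field_simp; ring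
  rw [dyadicFloor, dyadicFloor, h, Int.floor_add_intCast, pow_succ]
  push_cast
  field_simp
  ring

lemma abs_dyadicFloor_sub_le (n : ℕ) (a x : ℝ) {L : ℝ} (hL : 0 < L) :
    |dyadicFloor n a L x - x| ≤ L / 2 ^ n := by
  have h1 := Int.floor_le (2 ^ n * ((x - a) / L))
  have h2 := Int.lt_floor_add_one (2 ^ n * ((x - a) / L))
  set k : ℝ := (⌊2 ^ n * ((x - a) / L)⌋ : ℝ) with hk
  have h2n : (0 : ℝ) < 2 ^ n := by positivity
  have e : dyadicFloor n a L x - x = (k - 2 ^ n * ((x - a) / L)) * (L / 2 ^ n) := by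
    rw [dyadicFloor, ← hk]; field_simp; ring
  rw [e, abs_mul, abs_of_pos (by positivity : 0 < L / 2 ^ n)]
  exact mul_le_of_le_one_left (by positivity) (abs_le.2 ⟨by linarith, by linarith⟩)

namespace SmallAffineApprox
variable {φ₀ : ℝ → ℂ} {p : ℝ → ℝ → ℂ} {Q : ℝ → ℝ → ENNReal} {L₁ : ℝ}
  (h : SmallAffineApprox φ₀ p Q L₁)
include h

lemma eVariationOn_dyadicFloor_le (n : ℕ) : ∀ a L : ℝ, 0 < L → L ≤ L₁ →
    eVariationOn (fun x => φ₀ (dyadicFloor n a L x)) (Icc a (a + L)) ≤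
      ofReal (‖φ₀ (a + L) - φ₀ a‖ * (1 + 40960 * (dyadicEnergy Q L).toReal)) := by
  induction n with
  | zero =>
    intro a L hL hL1
    have hm : Monotone (dyadicFloor 0 a L) := fun x y hxy => by
      simp only [dyadicFloor, pow_zero, one_mul, div_one]
      gcongr
    refine (eVariationOn.comp_le_of_monotoneOn φ₀ (s := {a, a + L}) _ (hm.monotoneOn _)
      fun x hx => ?_).trans ?_
    · simp only [dyadicFloor, pow_zero, one_mul, div_one]
      rcases eq_or_lt_of_le hx.2 with e | hlt
      · right
        rw [e]
        simp [hL.ne']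
      · left
        rw [Int.floor_eq_zero_iff.2 ⟨div_nonneg (by linarith [hx.1]) hL.le,
          (div_lt_one hL).2 (by linarith)⟩]
        simp
    · rw [eVariationOn.pair, edist_comm, edist_dist, dist_eq_norm]
      refine ofReal_le_ofReal (le_mul_of_one_le_right (norm_nonneg _) ?_)
      linarith [(toReal_nonneg : 0 ≤ (dyadicEnergy Q L).toReal)]
  | succ n ih =>
    intro a L hL hL1
    set m := a + L / 2 with hm
    have hmL : m + L / 2 = a + L := by rw [hm]; ring
    have hsplit := eVariationOn.Icc_add_Icc (fun x => φ₀ (dyadicFloor (n + 1) a L x))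
      (s := univ) (by linarith : a ≤ m) (by linarith : m ≤ a + L) (mem_univ _)
    simp only [univ_inter] at hsplit
    rw [← hsplit]
    have i1 := ih a (L / 2) (half_pos hL) (by linarith)
    have i2 := ih m (L / 2) (half_pos hL) (by linarith)
    rw [hmL] at i2
    simp only [← hm] at i1
    simp only [dyadicFloor_succ_left n a _ hL] at i1 ⊢
    simp only [← dyadicFloor_succ_right n a _ hL, hm, ← dyadicFloor_succ_left n a _ hL] at i1 i2 ⊢
    refine (add_le_add i1 i2).trans ?_
    rw [← hm]
    set τ := (dyadicEnergy Q L).toReal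
    set τ' := (dyadicEnergy Q (L / 2)).toReal
    set η := (boxMean Q a L).toReal
    have hL3 := hL1.trans h.le_one
    have hτ1 : dyadicEnergy Q L ≤ ofReal (1 / 2 ^ 21) := h.small L hL hL1
    have hτt := (hτ1.trans_lt ofReal_lt_top).ne
    have hadd := h.boxMean_add_dyadicEnergy_le a hL hL3
    have hηt : boxMean Q a L ≠ ⊤ := ne_top_of_le_ne_top hτt (le_self_add.trans hadd)
    have hτ't : dyadicEnergy Q (L / 2) ≠ ⊤ := ne_top_of_le_ne_top hτt (le_add_self.trans hadd)
    have hsum : η + τ' ≤ τ := by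
      have := ENNReal.toReal_mono hτt hadd
      rwa [ENNReal.toReal_add hηt hτ't] at this
    have hτb : τ ≤ 1 / 2 ^ 21 := by
      have := ENNReal.toReal_mono ofReal_ne_top hτ1
      rwa [ENNReal.toReal_ofReal (by norm_num)] at this
    have hη0 : 0 ≤ η := toReal_nonneg
    have hτ'0 : 0 ≤ τ' := toReal_nonneg
    have mm : m ∈ Icc a (a + L) := ⟨by linarith, by linarith⟩
    have hpL := mul_nonneg (norm_nonneg (p a L)) hL.le
    have hu := (h.le_norm_sub hL hL1 ⟨le_rfl, by linarith⟩ mm mm.1).1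
    have hv := (h.le_norm_sub hL hL1 mm ⟨by linarith, le_rfl⟩ mm.2).1
    rw [hm] at hu hv
    have hex := h.excess_le hL hL1 mm hη0 (by linarith) (ofReal_toReal hηt).ge
      (by rw [hm]; linarith) (by rw [hm]; linarith)
    set A := ‖φ₀ (a + L) - φ₀ a‖
    have hA : 0 ≤ A := norm_nonneg _
    rw [← ofReal_add (by positivity) (by positivity)]
    refine ofReal_le_ofReal ?_
    rw [← add_mul]
    have b1 : ‖φ₀ m - φ₀ a‖ + ‖φ₀ (a + L) - φ₀ m‖ ≤ A * (1 + 20480 * η) := by linarith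
    refine (mul_le_mul_of_nonneg_right b1 (by positivity)).trans ?_
    rw [mul_assoc]
    refine mul_le_mul_of_nonneg_left ?_ hA
    norm_num at hτb
    nlinarith [mul_le_mul_of_nonneg_left (by linarith : τ' ≤ 1 / 40960) hη0]

lemma eVariationOn_le {a L : ℝ} (hL : 0 < L) (hL1 : L ≤ L₁) :
    eVariationOn φ₀ (Icc a (a + L)) ≤ ofReal (2 * ‖φ₀ (a + L) - φ₀ a‖) := by
  by_contra! hc
  have ht : ∀ x ∈ Icc a (a + L), Tendsto (fun n => φ₀ (dyadicFloor n a L x))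
      atTop (nhds (φ₀ x)) := fun x _ => by
    refine (h.continuous.tendsto x).comp (tendsto_iff_dist_tendsto_zero.2 ?_)
    refine squeeze_zero (fun _ => dist_nonneg) (fun n => abs_dyadicFloor_sub_le n a x hL) ?_
    simpa [div_eq_mul_inv] using (tendsto_pow_atTop_nhds_zero_of_lt_one
      (by norm_num : (0 : ℝ) ≤ 2⁻¹) (by norm_num)).const_mul L
  obtain ⟨n, hn⟩ := (eVariationOn.lowerSemicontinuous_aux ht hc).exists
  refine (hn.trans_le (h.eVariationOn_dyadicFloor_le n a L hL hL1)).not_ge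
    (ofReal_le_ofReal ?_)
  have hτb := ENNReal.toReal_mono ofReal_ne_top (h.small L hL hL1)
  rw [ENNReal.toReal_ofReal (by norm_num)] at hτb
  rw [mul_comm]
  refine mul_le_mul_of_nonneg_right ?_ (norm_nonneg _)
  norm_num at hτb
  linarith

end SmallAffineApprox

lemma Continuous.eq_of_exp_eq_one {c : ℝ → ℂ} (hc : Continuous c) (h : ∀ x, Complex.exp (c x) = 1)
    (x y : ℝ) : c x = c y :=
  congrFun (Complex.isCoveringMap_exp.eq_of_comp_eq hc continuous_const
    (funext fun t => Subtype.ext (by simp [h])) y rfl) x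

lemma exists_continuousOn_log {X : Type*} [NormedAddCommGroup X] [NormedSpace ℝ X] {U : Set X}
    (hU : Convex ℝ U) (hne : U.Nonempty) (hUo : IsOpen U) {g : X → ℂ} (hg : ContinuousOn g U)
    (h0 : ∀ x ∈ U, g x ≠ 0) : ∃ f : X → ℂ, ContinuousOn f U ∧ ∀ x ∈ U, Complex.exp (f x) = g x := by
  have := hU.contractibleSpace hne
  have hs : SimplyConnectedSpace U := inferInstance
  exact Complex.exists_continuousOn_eqOn_exp_comp hs hUo hg fun ⟨x, hx, e⟩ => h0 x hx e

lemma exists_int_of_periodic_injOn {γ : ℝ → ℂ} (hp : ∀ θ, γ (θ + 2 * π) = γ θ)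
    (hi : InjOn γ (Ico 0 (2 * π))) {s t : ℝ} (h : γ s = γ t) :
    ∃ k : ℤ, s = t + k * (2 * π) := by
  have hm : ∀ x, γ (toIcoMod two_pi_pos 0 x) = γ x := fun x =>
    Periodic.sub_zsmul_eq hp _
  have hmem : ∀ x, toIcoMod two_pi_pos 0 x ∈ Ico 0 (2 * π) := fun x => by
    simpa using toIcoMod_mem_Ico two_pi_pos 0 x
  have e := hi (hmem s) (hmem t) (by rw [hm, hm, h])
  refine ⟨toIcoDiv two_pi_pos 0 s - toIcoDiv two_pi_pos 0 t, ?_⟩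
  have h1 := toIcoMod_add_toIcoDiv_zsmul two_pi_pos 0 s
  have h2 := toIcoMod_add_toIcoDiv_zsmul two_pi_pos 0 t
  rw [zsmul_eq_mul] at h1 h2
  push_cast
  linarith

lemma exists_continuous_lift {γ φ : ℝ → ℂ} (hγ : Continuous γ) (hp : ∀ θ, γ (θ + 2 * π) = γ θ)
    (hi : InjOn γ (Ico 0 (2 * π))) (hφ : Continuous φ) (hr : ∀ x, φ x ∈ range γ) :
    ∃ ψ : ℝ → ℝ, Continuous ψ ∧ ∀ x, γ (ψ x) = φ x := by
  have : Fact (0 < 2 * π) := ⟨two_pi_pos⟩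
  have hper : Periodic γ (2 * π) := hp
  let e : AddCircle (2 * π) → ℂ := hper.lift
  have hec : Continuous e := (QuotientAddGroup.isQuotientMap_mk _).continuous_iff.2 hγ
  have hei : Function.Injective e := fun x y => by
    refine Quotient.inductionOn₂' x y fun s t (h : γ s = γ t) => ?_
    obtain ⟨k, hk⟩ := exists_int_of_periodic_injOn hp hi h
    change (s : AddCircle (2 * π)) = (t : AddCircle (2 * π))
    rw [← sub_eq_zero, ← AddCircle.coe_sub, AddCircle.coe_eq_zero_iff]
    exact ⟨k, by rw [zsmul_eq_mul]; linarith⟩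
  let E := (hec.isClosedEmbedding hei).isEmbedding.toHomeomorph
  have hr' : ∀ x, φ x ∈ range e := fun x => by
    obtain ⟨t, ht⟩ := hr x
    exact ⟨t, ht⟩
  let f : C(ℝ, AddCircle (2 * π)) :=
    ⟨fun x => E.symm ⟨φ x, hr' x⟩, E.symm.continuous.comp (hφ.subtype_mk _)⟩
  obtain ⟨t₀, ht₀⟩ := QuotientAddGroup.mk_surjective (f 0)
  obtain ⟨ψ, ⟨-, hψ⟩, -⟩ :=
    (AddCircle.isCoveringMap_coe (2 * π)).existsUnique_continuousMap_lifts f 0 t₀ ht₀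
  refine ⟨ψ, ψ.continuous, fun x => ?_⟩
  have h1 : ((ψ x : ℝ) : AddCircle (2 * π)) = E.symm ⟨φ x, hr' x⟩ := congrFun hψ x
  exact (congrArg (fun z => (E z : ℂ)) h1).trans (by simp)

lemma Continuous.injective_of_injOn_Icc {ψ : ℝ → ℝ} (hψ : Continuous ψ) {L : ℝ} (hL : 0 < L)
    (h : ∀ a, InjOn ψ (Icc a (a + L))) : Function.Injective ψ := by
  intro x y hxy
  by_contra hne
  wlog hlt : x < y generalizing x y
  · exact this hxy.symm (Ne.symm hne) (lt_of_le_of_ne (not_lt.1 hlt) (Ne.symm hne))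
  obtain ⟨c, -, hc⟩ := exists_isLocalExtr_Ioo hlt hψ.continuousOn hxy
  have hi := h (c - L / 2)
  have hcm : c ∈ Icc (c - L / 2) (c - L / 2 + L) := ⟨by linarith, by linarith⟩
  have hnear : ∀ p : ℝ → Prop, (∀ᶠ y in nhds c, p y) →
      (∃ y ∈ Icc (c - L / 2) (c - L / 2 + L), y < c ∧ p y) ∧
      (∃ y ∈ Icc (c - L / 2) (c - L / 2 + L), c < y ∧ p y) := fun p hp => by
    obtain ⟨ε, hε, hb⟩ := Metric.eventually_nhds_iff.1 hp
    have hm : 0 < min (ε / 2) (L / 2) := by positivity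
    have h1 := min_le_left (ε / 2) (L / 2)
    have h2 := min_le_right (ε / 2) (L / 2)
    refine ⟨⟨c - min (ε / 2) (L / 2), ⟨by linarith, by linarith⟩, by linarith, hb ?_⟩,
      ⟨c + min (ε / 2) (L / 2), ⟨by linarith, by linarith⟩, by linarith, hb ?_⟩⟩ <;>
    · rw [dist_eq]
      simp only [sub_sub_cancel_left, add_sub_cancel_left, abs_neg, abs_of_pos hm]
      linarith
  rcases hψ.continuousOn.strictMonoOn_of_injOn_Icc' (by linarith) hi with hs | hs <;>
  rcases hc with hc | hc
  · obtain ⟨y, hy, hyc, h1⟩ := (hnear _ hc).1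
    exact (hs hy hcm hyc).not_ge h1
  · obtain ⟨y, hy, hyc, h1⟩ := (hnear _ hc).2
    exact (hs hcm hy hyc).not_ge h1
  · obtain ⟨y, hy, hyc, h1⟩ := (hnear _ hc).2
    exact (hs hcm hy hyc).not_ge h1
  · obtain ⟨y, hy, hyc, h1⟩ := (hnear _ hc).1
    exact (hs hy hcm hyc).not_ge h1

/-- The boundary values of a Riemann map traverse the boundary curve exactly once. -/
theorem boundary_injOn_and_range_eq {γ φ : ℝ → ℂ} {F : ℂ → ℂ} {Ω : Set ℂ} (hγ : Continuous γ)
    (hp : ∀ θ, γ (θ + 2 * π) = γ θ) (hi : InjOn γ (Ico 0 (2 * π)))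
    (hΩb : IsBounded Ω) (hcl : closure Ω ⊆ Ω ∪ range γ)
    (hdisj : Disjoint Ω (range γ)) (hF : DifferentiableOn ℂ F (ball 0 1))
    (hb : BijOn F (ball 0 1) Ω) (hφ : Continuous φ) (hφp : ∀ x, φ (x + 2 * π) = φ x)
    {L : ℝ} (hL : 0 < L) (hloc : ∀ a, InjOn φ (Icc a (a + L)))
    (hlim : ∀ ε > 0, ∀ᶠ t : ℝ in 𝓝[>] 0, ∀ x : ℝ,
      ‖F (Complex.exp (I * (x + t * I))) - φ x‖ < ε) :
    InjOn φ (Ico 0 (2 * π)) ∧ range φ = range γ := by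
  have hball : ∀ (t : ℝ), 0 < t → ∀ x : ℝ,
      Complex.exp (I * (x + t * I)) ∈ 𝔻 := fun t ht x =>
    exp_I_mul_mem_ball (by simpa using ht)
  have hcpt : IsCompact (range γ) := by
    have : Fact (0 < 2 * π) := ⟨two_pi_pos⟩
    have hper : Periodic γ (2 * π) := hp
    exact hper.compact_of_continuous two_pi_pos.ne' hγ
  have hmem : ∀ x, φ x ∈ range γ := fun x => by
    rw [hcpt.isClosed.mem_iff_infDist_zero ⟨γ 0, 0, rfl⟩]
    refine le_antisymm (le_of_forall_pos_le_add fun η hη => ?_) infDist_nonneg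
    obtain ⟨r, hr, h⟩ := exists_radius_infDist_lt hF hb hΩb hcl (half_pos hη)
    have hn : Tendsto (fun t : ℝ => exp (-t)) (𝓝[>] 0) (nhds 1) := by
      have : Continuous fun t : ℝ => exp (-t) := by fun_prop
      simpa using (this.tendsto 0).mono_left nhdsWithin_le_nhds
    obtain ⟨t, ⟨h1, h2⟩, ht⟩ := ((hlim _ (half_pos hη)).and (hn.eventually_const_lt hr)).and
      self_mem_nhdsWithin |>.exists
    have h3 := h _ (hball t ht x) (by rw [norm_exp_I_mul]; simpa using h2)
    have h4 := infDist_le_infDist_add_dist (s := range γ) (x := φ x)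
      (y := F (Complex.exp (I * (x + t * I))))
    rw [dist_comm, dist_eq_norm] at h4
    linarith [h1 x]
  obtain ⟨ψ, hψ, hγψ⟩ := exists_continuous_lift hγ hp hi hφ hmem
  have hψi : Function.Injective ψ := hψ.injective_of_injOn_Icc hL fun a x hx y hy hxy =>
    hloc a hx hy (by rw [← hγψ, ← hγψ, hxy])
  have h0 : F 0 ∉ range γ := hdisj.notMem_of_mem_left (hb.mapsTo (mem_ball_self one_pos))
  obtain ⟨d, hd⟩ := exists_int_of_periodic_injOn hp hi (s := ψ (2 * π)) (t := ψ 0) (by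
    rw [hγψ, hγψ, ← hφp 0, zero_add])
  obtain ⟨g, hg, hge⟩ := exists_continuousOn_log (X := ℝ) (g := fun θ => γ θ - F 0) convex_univ
    univ_nonempty isOpen_univ (by fun_prop) fun x _ e => h0 ⟨x, sub_eq_zero.1 e⟩
  rw [continuousOn_univ] at hg
  have hgp : ∀ x y, g (x + 2 * π) - g x = g (y + 2 * π) - g y := by
    refine Continuous.eq_of_exp_eq_one (by fun_prop) fun x => ?_
    rw [Complex.exp_sub, hge _ trivial, hge _ trivial, hp,
      div_self (fun e => h0 ⟨x, sub_eq_zero.1 e⟩)]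
  have hgz : ∀ k : ℤ, ∀ x, g (x + k * (2 * π)) - g x = k * (g (2 * π) - g 0) := by
    have hgn : ∀ k : ℕ, ∀ x, g (x + k * (2 * π)) - g x = k * (g (2 * π) - g 0) := fun k => by
      induction k with
      | zero => simp
      | succ k ih =>
        intro x
        have h1 := ih x
        have h2 := hgp (x + k * (2 * π)) 0
        rw [zero_add] at h2
        push_cast
        rw [show x + (k + 1) * (2 * π) = x + k * (2 * π) + 2 * π by ring]
        linear_combination h1 + h2
    intro k x
    obtain ⟨n, rfl | rfl⟩ := k.eq_nat_or_neg
    · exact_mod_cast hgn n x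
    · have := hgn n (x - n * (2 * π))
      rw [sub_add_cancel] at this
      push_cast
      rw [neg_mul, ← sub_eq_add_neg]
      linear_combination -this
  obtain ⟨n, hn⟩ : ∃ n : ℤ, g (2 * π) - g 0 = n * (2 * π * I) := by
    refine Complex.exp_eq_one_iff.1 ?_
    rw [Complex.exp_sub, hge _ trivial, hge _ trivial, ← hp 0, zero_add,
      div_self (fun e => h0 ⟨2 * π, sub_eq_zero.1 e⟩)]
  have hnd : n * d = 1 := by
    have hne : ∀ z ∈ 𝔻, dslope F 0 z ≠ 0 := fun z hz => by
      rcases eq_or_ne z 0 with rfl | hz0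
      · rw [dslope_same]
        exact deriv_ne_zero_of_differentiableOn_of_injOn isOpen_ball hF hb.injOn hz
      · rw [dslope_of_ne _ hz0, slope_def_field, sub_zero]
        exact div_ne_zero (sub_ne_zero.2 fun e => hz0
          (hb.injOn hz (mem_ball_self one_pos) e)) hz0
    have h00 : 𝔻 ∈ nhds 0 := ball_mem_nhds _ one_pos
    obtain ⟨κ, hκ, hκe⟩ := exists_continuousOn_log (convex_ball (0 : ℂ) 1)
      ⟨0, mem_ball_self one_pos⟩ isOpen_ball
      ((continuousOn_dslope h00).2 ⟨hF.continuousOn, hF.differentiableAt h00⟩) hne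
    have hδ : 0 < infDist (F 0) (range γ) :=
      (hcpt.isClosed.notMem_iff_infDist_pos ⟨γ 0, 0, rfl⟩).1 h0
    obtain ⟨t, h1, ht⟩ := ((hlim _ hδ).and self_mem_nhdsWithin).exists
    set E : ℝ → ℂ := fun x => Complex.exp (I * (x + t * I))
    have hEc : Continuous E := by fun_prop
    have hEp : ∀ x, E (x + 2 * π) = E x := fun x => exp_I_mul_periodic x t
    have hφ0 : ∀ x, φ x - F 0 ≠ 0 := fun x e => h0 (by rw [← sub_eq_zero.1 e]; exact hmem x)
    have hFE : Continuous fun x => F (E x) := hF.continuousOn.comp_continuous hEc (hball t ht)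
    have hκE : Continuous fun x => κ (E x) := hκ.comp_continuous hEc (hball t ht)
    have hFE0 : ∀ x, F (E x) - F 0 = E x * Complex.exp (κ (E x)) := fun x => by
      rw [hκe _ (hball t ht x), dslope_of_ne _ (Complex.exp_ne_zero _), slope_def_field, sub_zero,
        mul_div_cancel₀ _ (Complex.exp_ne_zero _)]
    have hslit : ∀ x, (F (E x) - F 0) / (φ x - F 0) ∈ Complex.slitPlane := fun x => by
      refine Complex.ball_one_subset_slitPlane ?_
      have := infDist_le_dist_of_mem (x := F 0) (hmem x)
      rw [dist_comm, dist_eq_norm] at this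
      rw [mem_ball, dist_eq_norm, div_sub_one (hφ0 x), norm_div,
        div_lt_one (norm_pos_iff.2 (hφ0 x)), sub_sub_sub_cancel_right]
      exact (h1 x).trans_le this
    have hlog : Continuous fun x => Complex.log ((F (E x) - F 0) / (φ x - F 0)) :=
      ((hFE.sub continuous_const).div (hφ.sub continuous_const) hφ0).clog hslit
    have hc := Continuous.eq_of_exp_eq_one (c := fun x : ℝ => I * (x + t * I) +
      κ (E x) - g (ψ x) - Complex.log ((F (E x) - F 0) / (φ x - F 0)))
      (((Continuous.add (by fun_prop) hκE).sub (hg.comp hψ)).sub hlog) (fun x => by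
        rw [Complex.exp_sub, Complex.exp_sub, Complex.exp_add, hge _ trivial, hγψ,
          Complex.exp_log (Complex.slitPlane_ne_zero (hslit x)), ← hFE0]
        refine div_self (div_ne_zero ?_ (hφ0 x))
        rw [hFE0]
        exact mul_ne_zero (Complex.exp_ne_zero _) (Complex.exp_ne_zero _)) (0 + 2 * π) 0
    simp only [hEp, hφp] at hc
    have h2 := hgz d (ψ 0)
    rw [← hd, hn] at h2
    rw [zero_add] at hc
    push_cast at hc
    have h3 : (2 * π * I) * ((n * d : ℤ) : ℂ) = (2 * π * I) * 1 := by
      push_cast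
      linear_combination -hc - h2
    exact_mod_cast mul_left_cancel₀ Complex.two_pi_I_ne_zero h3
  have hd1 : |ψ (2 * π) - ψ 0| = 2 * π := by
    have : |d| = 1 := Int.isUnit_iff_abs_eq.1 (.of_mul_eq_one_right n hnd)
    rw [hd, add_sub_cancel_left, abs_mul, ← Int.cast_abs, this, Int.cast_one, one_mul,
      abs_of_pos two_pi_pos]
  refine ⟨fun x hx y hy hxy => ?_, Set.Subset.antisymm (range_subset_iff.2 hmem) ?_⟩
  · obtain ⟨k, hk⟩ := exists_int_of_periodic_injOn hp hi (s := ψ x) (t := ψ y) (by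
      rw [hγψ, hγψ, hxy])
    have hlt : |ψ x - ψ y| < 2 * π := by
      rw [← hd1]
      rcases hψ.strictMono_of_inj hψi with hm | hm
      · have e1 := hm.monotone hx.1
        have e2 := hm hx.2
        have e3 := hm.monotone hy.1
        have e4 := hm hy.2
        rw [abs_of_pos (by linarith : 0 < ψ (2 * π) - ψ 0)]
        exact abs_lt.2 ⟨by linarith, by linarith⟩
      · have e1 := hm.antitone hx.1
        have e2 := hm hx.2
        have e3 := hm.antitone hy.1
        have e4 := hm hy.2
        rw [abs_of_neg (by linarith : ψ (2 * π) - ψ 0 < 0)]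
        exact abs_lt.2 ⟨by linarith, by linarith⟩
    have hk0 : k = 0 := by
      rw [hk, add_sub_cancel_left, abs_mul, abs_of_pos two_pi_pos,
        mul_lt_iff_lt_one_left two_pi_pos] at hlt
      exact Int.abs_lt_one_iff.1 (by exact_mod_cast hlt)
    refine hψi ?_
    rw [hk, hk0]
    simp
  · rintro _ ⟨θ, rfl⟩
    have hper : Periodic γ (2 * π) := hp
    set m := min (ψ 0) (ψ (2 * π)) with hm
    have hmm : max (ψ 0) (ψ (2 * π)) = m + 2 * π := by
      have := max_sub_min_eq_abs (ψ 0) (ψ (2 * π))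
      rw [hd1] at this
      linarith
    have h1 := toIcoMod_mem_Ico two_pi_pos m θ
    have h2 : toIcoMod two_pi_pos m θ ∈ uIcc (ψ 0) (ψ (2 * π)) :=
      ⟨h1.1, by rw [hmm]; exact h1.2.le⟩
    obtain ⟨x, -, hx⟩ := intermediate_value_uIcc hψ.continuousOn h2
    refine ⟨x, ?_⟩
    rw [← hγψ, hx]
    exact Periodic.sub_zsmul_eq hp _

/-- A curve with unit speed in the metric sense has unit speed almost everywhere. -/
lemma HasUnitSpeedOn.lipschitzWith_and_ae_hasDerivAt {u : ℝ → ℂ} (hu : HasUnitSpeedOn u univ) :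
    LipschitzWith 1 u ∧ ∀ᵐ t : ℝ, ∃ v : ℂ, HasDerivAt u v t ∧ ‖v‖ = 1 := by
  have hvar : ∀ x y : ℝ, eVariationOn u (Icc x y) = ofReal (y - x) := fun x y => by
    have := hu (mem_univ x) (mem_univ y)
    rwa [univ_inter, NNReal.coe_one, one_mul] at this
  have hlip : LipschitzWith 1 u := by
    intro x y
    rw [ENNReal.coe_one, one_mul]
    wlog hxy : x ≤ y generalizing x y
    · rw [edist_comm, edist_comm x]
      exact this y x (not_le.1 hxy).le
    rw [edist_comm x, edist_dist y, dist_eq, abs_of_nonneg (sub_nonneg.2 hxy), ← hvar]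
    exact eVariationOn.edist_le u (left_mem_Icc.2 hxy) (right_mem_Icc.2 hxy)
  refine ⟨hlip, ?_⟩
  have hae : ∀ᵐ t : ℝ, HasDerivAt u (deriv u t) t := by
    filter_upwards [hlip.ae_differentiableAt_real] with t ht using ht.hasDerivAt
  have hle : ∀ t, ‖deriv u t‖ ≤ 1 := fun t => by
    simpa using norm_deriv_le_of_lipschitz (x₀ := t) hlip
  have hintv : ∀ a b, IntervalIntegrable (deriv u) volume a b ∧ ∫ x in a..b, deriv u x = u b - u a :=
    fun a b => (hlip.lipschitzOnWith).integral_eq_sub_of_ae_hasDerivAt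
      (hae.mono fun t ht _ => ht)
  set G : ℝ → ℝ := fun t => ∫ x in (0 : ℝ)..t, ‖deriv u x‖
  have hGsub : ∀ a b, G b - G a = ∫ x in a..b, ‖deriv u x‖ := fun a b =>
    intervalIntegral.integral_interval_sub_left (hintv _ _).1.norm (hintv _ _).1.norm
  have hGm : Monotone G := fun a b hab => by
    rw [← sub_nonneg, hGsub]
    exact intervalIntegral.integral_nonneg hab fun x _ => norm_nonneg _
  have hGu : ∀ x y, x ≤ y → edist (u y) (u x) ≤ edist (G y) (G x) := fun x y hxy => by
    rw [edist_dist, edist_dist, dist_eq_norm, dist_eq,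
      abs_of_nonneg (sub_nonneg.2 (hGm hxy)), hGsub, ← (hintv x y).2]
    exact ofReal_le_ofReal (intervalIntegral.norm_integral_le_integral_norm hxy)
  have hGge : ∀ a b, a ≤ b → b - a ≤ ∫ x in a..b, ‖deriv u x‖ := fun a b hab => by
    rw [← hGsub]
    refine (ofReal_le_ofReal_iff (sub_nonneg.2 (hGm hab))).1 ?_
    rw [← hvar]
    have h1 : eVariationOn u (Icc a b) ≤ eVariationOn G (Icc a b) := by
      unfold eVariationOn
      exact iSup_mono fun p => Finset.sum_le_sum fun i _ => hGu _ _ (p.2.2.1 i.le_succ)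
    have := (hGm.monotoneOn (Icc a b)).eVariationOn_eq (left_mem_Icc.2 hab)
      (right_mem_Icc.2 hab)
    rw [Set.inter_self] at this
    exact h1.trans this.le
  have hzero : ∀ n : ℕ, ∀ᵐ t : ℝ, t ∈ Ioc (-(n : ℝ)) n → 1 - ‖deriv u t‖ = 0 := fun n => by
    have hn : (-(n : ℝ)) ≤ n := by linarith [n.cast_nonneg (α := ℝ)]
    have hi : IntervalIntegrable (fun t => 1 - ‖deriv u t‖) volume (-(n : ℝ)) n :=
      intervalIntegrable_const.sub (hintv _ _).1.norm
    have h0 : 0 ≤ᵐ[volume.restrict (Ioc (-(n : ℝ)) n)] fun t => 1 - ‖deriv u t‖ :=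
      Eventually.of_forall fun t => sub_nonneg.2 (hle t)
    have hI : ∫ t in (-(n : ℝ))..n, (1 - ‖deriv u t‖) = 0 := by
      refine le_antisymm ?_ (intervalIntegral.integral_nonneg hn fun t _ => sub_nonneg.2 (hle t))
      rw [intervalIntegral.integral_sub intervalIntegrable_const (hintv _ _).1.norm,
        intervalIntegral.integral_const, smul_eq_mul, mul_one]
      linarith [hGge _ _ hn]
    rw [intervalIntegral.integral_of_le hn,
      integral_eq_zero_iff_of_nonneg_ae h0 ((intervalIntegrable_iff_integrableOn_Ioc_of_le hn).1 hi),
      Filter.EventuallyEq, ae_restrict_iff' measurableSet_Ioc] at hI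
    exact hI
  filter_upwards [hae, ae_all_iff.2 hzero] with t ht h
  obtain ⟨n, hn⟩ := exists_nat_gt |t|
  refine ⟨_, ht, ?_⟩
  linarith [h n ⟨(abs_lt.1 hn).1, (abs_lt.1 hn).2.le⟩]

/-- A periodic curve whose length is locally comparable to its chords can be reparametrised
by arclength. -/
theorem exists_unitCurve_reparam {φ : ℝ → ℂ} {L : ℝ} (hφ : Continuous φ)
    (hp : ∀ x, φ (x + 2 * π) = φ x) (hi : InjOn φ (Ico 0 (2 * π))) (hL : 0 < L)
    (hloc : ∀ a, InjOn φ (Icc a (a + L)))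
    (hvar : ∀ a L', 0 < L' → L' ≤ L →
      eVariationOn φ (Icc a (a + L')) ≤ ofReal (2 * ‖φ (a + L') - φ a‖)) :
    ∃ c : ℝ, 0 < c ∧ ∃ A : ℝ ≃o ℝ, A 0 = 0 ∧ (∀ θ, A (θ + 2 * π) = A θ + 2 * π) ∧
      UnitCurve (fun θ => φ (A θ) / c) ∧
      ∀ x y, x ≤ y → y ≤ x + L → c * (A.symm y - A.symm x) ≤ 2 * ‖φ y - φ x‖ := by
  have hchain : ∀ (n : ℕ) a, eVariationOn φ (Icc a (a + n * L)) ≠ ⊤ := by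
    intro n a
    induction n with
    | zero => simp [eVariationOn.subsingleton]
    | succ n ih =>
      have := eVariationOn.Icc_add_Icc φ (s := univ) (a := a) (b := a + n * L)
        (c := a + n * L + L) (by linarith [mul_nonneg n.cast_nonneg hL.le]) (by linarith)
        (mem_univ _)
      simp only [univ_inter] at this
      rw [Nat.cast_succ, add_one_mul, ← add_assoc, ← this]
      exact ENNReal.add_ne_top.2 ⟨ih, ((hvar _ _ hL le_rfl).trans_lt ofReal_lt_top).ne⟩
  have hfin : ∀ x y, eVariationOn φ (Icc x y) ≠ ⊤ := fun x y => by
    obtain ⟨n, hn⟩ := exists_nat_gt ((y - x) / L)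
    have hn' := (div_lt_iff₀ hL).1 hn
    exact ne_top_of_le_ne_top (hchain n x)
      (eVariationOn.mono _ (Icc_subset_Icc_right (by linarith)))
  have hbv : LocallyBoundedVariationOn φ univ := fun x y _ _ => by
    rw [univ_inter]
    exact hfin x y
  set V : ℝ → ℝ := variationOnFromTo φ univ 0 with hVdef
  have hV : ∀ x y, x ≤ y → V y - V x = (eVariationOn φ (Icc x y)).toReal := fun x y hxy => by
    have h1 := variationOnFromTo.add hbv (mem_univ 0) (mem_univ x) (mem_univ y)
    rw [variationOnFromTo.eq_of_le φ univ hxy, univ_inter] at h1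
    rw [hVdef, ← h1]
    ring
  have hchord : ∀ x y, x ≤ y → ‖φ y - φ x‖ ≤ V y - V x := fun x y hxy => by
    rw [hV x y hxy, ← dist_eq_norm, ← ENNReal.ofReal_le_iff_le_toReal (hfin x y), ← edist_dist]
    exact eVariationOn.edist_le φ (right_mem_Icc.2 hxy) (left_mem_Icc.2 hxy)
  have hup : ∀ x y, x ≤ y → y ≤ x + L → V y - V x ≤ 2 * ‖φ y - φ x‖ := fun x y hxy hyL => by
    rcases hxy.eq_or_lt with rfl | hlt
    · simp
    have := hvar x (y - x) (sub_pos.2 hlt) (by linarith)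
    rw [add_sub_cancel] at this
    rw [hV x y hxy]
    exact ENNReal.toReal_le_of_le_ofReal (by positivity) this
  have hVmono : Monotone V := fun x y hxy =>
    sub_nonneg.1 ((norm_nonneg _).trans (hchord x y hxy))
  have hVs : StrictMono V := fun x y hxy => by
    have hz : x < min y (x + L) := lt_min hxy (by linarith)
    have h1 : φ (min y (x + L)) - φ x ≠ 0 := fun h0 => hz.ne'
      (hloc x ⟨hz.le, min_le_right _ _⟩ ⟨le_rfl, by linarith⟩ (sub_eq_zero.1 h0))
    linarith [norm_pos_iff.2 h1, hchord x _ hz.le, hVmono (min_le_left y (x + L))]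
  have hVc : Continuous V := by
    refine continuous_iff_continuousAt.2 fun x => ?_
    rw [ContinuousAt, tendsto_iff_dist_tendsto_zero]
    have h0 : Tendsto (fun y => 2 * ‖φ y - φ x‖) (nhds x) (nhds 0) := by
      have : Continuous fun y => 2 * ‖φ y - φ x‖ := by fun_prop
      simpa using this.tendsto x
    refine squeeze_zero' (Eventually.of_forall fun _ => dist_nonneg) ?_ h0
    filter_upwards [Ioo_mem_nhds (sub_lt_self x hL) (lt_add_of_pos_right x hL)] with y hy
    rw [dist_eq]
    rcases le_total x y with hxy | hxy
    · rw [abs_of_nonneg (sub_nonneg.2 (hVmono hxy))]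
      exact hup x y hxy hy.2.le
    · rw [abs_sub_comm, abs_of_nonneg (sub_nonneg.2 (hVmono hxy)), norm_sub_rev]
      exact hup y x hxy (by linarith [hy.1])
  have hV0 : V 0 = 0 := variationOnFromTo.self φ univ 0
  have hVp : ∀ x, V (x + 2 * π) = V x + V (2 * π) := by
    have key : ∀ x y, x ≤ y → V (y + 2 * π) - V (x + 2 * π) = V y - V x := fun x y hxy => by
      rw [hV _ _ hxy, hV _ _ (by linarith)]
      have := eVariationOn.comp_eq_of_monotoneOn φ (t := Icc x y) (fun t => t + 2 * π)
        (fun a _ b _ hab => by simpa using hab)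
      rw [image_add_const_Icc] at this
      rw [← this, show φ ∘ (fun t => t + 2 * π) = φ from funext hp]
    intro x
    rcases le_total 0 x with h | h
    · have := key _ _ h
      rw [zero_add, hV0] at this
      linarith
    · have := key _ _ h
      rw [zero_add, hV0] at this
      linarith
  have hℓ : 0 < V (2 * π) := hV0 ▸ hVs two_pi_pos
  have hVn : ∀ n : ℕ, V (n * (2 * π)) = n * V (2 * π) ∧ V (-(n * (2 * π))) = -(n * V (2 * π)) := by
    intro n
    induction n with
    | zero => simp [hV0]
    | succ n ih =>
      push_cast
      constructor
      · rw [add_one_mul, hVp, ih.1]; ring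
      · have := hVp (-((n + 1) * (2 * π)))
        rw [show -((n + 1) * (2 * π)) + 2 * π = -(n * (2 * π)) by ring, ih.2] at this
        linarith
  have hVsurj : Function.Surjective V := by
    refine hVc.surjective (Filter.tendsto_atTop_atTop_of_monotone hVmono fun b => ?_)
      (Filter.tendsto_atBot_atBot_of_monotone hVmono fun b => ?_)
    all_goals
      obtain ⟨n, hn⟩ := exists_nat_gt (|b| / V (2 * π))
      have hn' := (div_lt_iff₀ hℓ).1 hn
    · exact ⟨n * (2 * π), by linarith [(hVn n).1, le_abs_self b]⟩
    · exact ⟨-(n * (2 * π)), by linarith [(hVn n).2, neg_abs_le b]⟩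
  set e : ℝ ≃o ℝ := hVs.orderIsoOfSurjective V hVsurj
  have hVe : ∀ t, V (e.symm t) = t := fun t => e.apply_symm_apply t
  have hu : HasUnitSpeedOn (φ ∘ e.symm) univ := by
    refine hasConstantSpeedOnWith_iff_ordered.2 fun x _ y _ hxy => ?_
    rw [univ_inter, eVariationOn.comp_eq_of_monotoneOn φ _ (e.symm.monotone.monotoneOn _),
      OrderIso.image_Icc, ← ofReal_toReal (hfin _ _), ← hV _ _ (e.symm.monotone hxy), hVe,
      hVe, NNReal.coe_one, one_mul]
  obtain ⟨hulip, hud⟩ := hu.lipschitzWith_and_ae_hasDerivAt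
  set c := V (2 * π) / (2 * π) with hc
  have hc0 : 0 < c := div_pos hℓ two_pi_pos
  have hcC : (c : ℂ) ≠ 0 := by exact_mod_cast hc0.ne'
  set A : ℝ ≃o ℝ := (OrderIso.mulRight₀ c hc0).trans e.symm
  have hAe : ∀ θ, A θ = e.symm (θ * c) := fun θ => rfl
  have hAs : ∀ x, c * A.symm x = V x := fun x => by
    have h1 : V (A (A.symm x)) = A.symm x * c := hVe _
    rw [A.apply_symm_apply] at h1
    rw [h1, mul_comm]
  have hAp : ∀ θ, A (θ + 2 * π) = A θ + 2 * π := fun θ => hVs.injective <| by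
    rw [hVp, hAe, hAe, hVe, hVe, hc]
    field_simp
  have hA0 : A 0 = 0 := hVs.injective (by rw [hAe, hVe, hV0, zero_mul])
  refine ⟨c, hc0, A, hA0, hAp, ⟨?_, fun θ => ?_, ?_, ?_⟩, fun x y hxy hyL => ?_⟩
  · refine LipschitzWith.of_dist_le_mul fun x y => ?_
    have h1 := hulip.dist_le_mul (x * c) (y * c)
    rw [NNReal.coe_one, one_mul] at h1 ⊢
    rw [dist_eq_norm, dist_eq, ← sub_mul, abs_mul, abs_of_pos hc0] at h1
    rw [dist_eq_norm, ← sub_div, norm_div, norm_real, norm_of_nonneg hc0.le,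
      div_le_iff₀ hc0]
    exact h1
  · simp only [hAp, hp]
  · intro s hs t ht hst
    have hm : ∀ r ∈ Ico 0 (2 * π), A r ∈ Ico 0 (2 * π) := fun r hr => by
      have h1 := A.monotone hr.1
      have h2 := A.strictMono hr.2
      have h3 := hAp 0
      rw [zero_add, hA0, zero_add] at h3
      exact ⟨hA0 ▸ h1, h3 ▸ h2⟩
    exact A.injective (hi (hm s hs) (hm t ht) ((div_left_inj' hcC).1 hst))
  · have hq : ∀ᵐ θ : ℝ, ∃ v : ℂ, HasDerivAt (φ ∘ e.symm) v (θ * c) ∧ ‖v‖ = 1 := by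
      have hmap := Real.map_volume_mul_right hc0.ne'
      refine ae_of_ae_map (μ := volume) (p := fun t => ∃ v : ℂ, HasDerivAt (φ ∘ e.symm) v t ∧ ‖v‖ = 1)
        (measurable_mul_const c).aemeasurable ?_
      rw [hmap]
      exact Measure.ae_smul_measure hud _
    filter_upwards [hq] with θ ⟨v, hv, hv1⟩
    refine ⟨v, ?_, hv1⟩
    have h1 := (hv.scomp θ ((hasDerivAt_id θ).mul_const c)).div_const (c : ℂ)
    refine h1.congr_deriv ?_
    rw [one_mul, real_smul, mul_div_cancel_left₀ _ hcC]
  · rw [mul_sub, hAs, hAs]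
    exact hup x y hxy hyL

lemma lintegral_Ioi_one_div_sq {r : ℝ} (hr : 0 < r) :
    ∫⁻ t in Ioi r, ofReal (1 / t ^ 2) = ofReal (1 / r) := by
  have hder : ∀ t ∈ Ici r, HasDerivAt (fun t : ℝ => -t⁻¹) (1 / t ^ 2) t := fun t ht =>
    (hasDerivAt_inv (hr.trans_le ht).ne').neg.congr_deriv (by rw [neg_neg, one_div])
  have hlim : Tendsto (fun t : ℝ => -t⁻¹) atTop (nhds 0) := by
    simpa using (tendsto_inv_atTop_zero (𝕜 := ℝ)).neg
  have hpos : ∀ t ∈ Ioi r, (0 : ℝ) ≤ 1 / t ^ 2 := fun t _ => by positivity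
  rw [← ofReal_integral_eq_lintegral_ofReal (integrableOn_Ioi_deriv_of_nonneg' hder hpos hlim)
    ((ae_restrict_iff' measurableSet_Ioi).2 (Eventually.of_forall hpos)),
    integral_Ioi_of_hasDerivAt_of_nonneg' hder hpos hlim, zero_sub, neg_neg, one_div]

lemma lintegral_one_div_sq_mul_tsum_le {f : ℝ → ENNReal} (hf : Measurable f) (R : ℝ) :
    ∫⁻ t in Ioo 0 R, ofReal (1 / t ^ 2) * ∑' k : ℕ, f (t / 2 ^ k) ≤
      2 * ∫⁻ t in Ioo 0 R, ofReal (1 / t ^ 2) * f t := by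
  set g : ℝ → ENNReal := (Ioo 0 R).indicator fun t => ofReal (1 / t ^ 2) * f t with hg
  have hm : Measurable fun t : ℝ => ofReal (1 / t ^ 2) := by fun_prop
  have hgm : Measurable g := (hm.mul hf).indicator measurableSet_Ioo
  simp_rw [← ENNReal.tsum_mul_left]
  have hmk : ∀ k : ℕ, Measurable fun t : ℝ => ofReal (1 / t ^ 2) * f (t / 2 ^ k) :=
    fun k => hm.mul (hf.comp (measurable_id.div_const _))
  rw [lintegral_tsum fun k => (hmk k).aemeasurable]
  have key : ∀ k : ℕ, ∫⁻ t in Ioo 0 R, ofReal (1 / t ^ 2) * f (t / 2 ^ k) ≤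
      2⁻¹ ^ k * ∫⁻ t, g t := fun k => by
    have hc : (0 : ℝ) < (2 ^ k)⁻¹ := by positivity
    calc _ ≤ ∫⁻ t, ofReal ((2 ^ k)⁻¹ * (2 ^ k)⁻¹) * g (t * (2 ^ k)⁻¹) := by
          rw [← lintegral_indicator measurableSet_Ioo]
          refine lintegral_mono fun t => ?_
          by_cases ht : t ∈ Ioo 0 R
          · have h1 : t * (2 ^ k)⁻¹ ∈ Ioo 0 R := ⟨mul_pos ht.1 hc,
              (mul_le_of_le_one_right ht.1.le (inv_le_one_of_one_le₀
                (one_le_pow₀ one_le_two))).trans_lt ht.2⟩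
            rw [hg, indicator_of_mem ht, indicator_of_mem h1, ← mul_assoc,
              ← ofReal_mul (by positivity), div_eq_mul_inv t]
            refine le_of_eq ?_
            congr 2
            have := ht.1.ne'
            field_simp
          · rw [indicator_of_notMem ht]
            exact zero_le
      _ = ofReal ((2 ^ k)⁻¹ * (2 ^ k)⁻¹) * ∫⁻ t, g t ∂(Measure.map (· * (2 ^ k)⁻¹) volume) := by
          rw [lintegral_ofReal_mul,
            lintegral_map hgm (measurable_mul_const _)]
      _ = 2⁻¹ ^ k * ∫⁻ t, g t := by
          rw [Real.map_volume_mul_right hc.ne', lintegral_smul_measure, smul_eq_mul, ← mul_assoc,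
            ← ofReal_mul (by positivity), inv_inv, abs_of_pos (by positivity), mul_assoc,
            inv_mul_cancel₀ (by positivity), mul_one, ofReal_inv_of_pos (by positivity),
            ofReal_pow zero_le_two, ENNReal.ofReal_ofNat, ENNReal.inv_pow]
  refine (ENNReal.tsum_le_tsum key).trans_eq ?_
  rw [ENNReal.tsum_mul_right, ENNReal.tsum_geometric, ENNReal.one_sub_inv_two, inv_inv,
    lintegral_indicator measurableSet_Ioo]

namespace UnitCurve
variable {w : ℝ → ℂ} (hw : UnitCurve w)
include hw

/-- Dyadic summation of the mean relative deficit of the chords of an arclength curve. -/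
lemma lintegral_deficit_le_tsum {δ : ℝ → ENNReal} {R : ℝ}
    (hδ : ∀ L ∈ Ioo 0 R, ∫⁻ θ in Ioc 0 (2 * π), ofReal
      ((‖w (θ + L / 2) - w θ‖ + ‖w (θ + L) - w (θ + L / 2)‖ - ‖w (θ + L) - w θ‖) / L) ≤ δ L)
    {L : ℝ} (hL : L ∈ Ioo 0 R) :
    ∫⁻ θ in Ioc 0 (2 * π), ofReal (1 - ‖w (θ + L) - w θ‖ / L) ≤
      ∑' k : ℕ, δ (L / 2 ^ k) := by
  have hc := hw.continuous
  set d : ℝ → ENNReal := fun L => ∫⁻ θ in Ioc 0 (2 * π),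
    ofReal (1 - ‖w (θ + L) - w θ‖ / L)
  have hdm : ∀ M, Measurable fun θ => ofReal (1 - ‖w (θ + M) - w θ‖ / M) := fun M =>
    (continuous_ofReal.comp (by fun_prop)).measurable
  have hstep : ∀ L ∈ Ioo 0 R, d L ≤ d (L / 2) + δ L := fun L hL => by
    set g : ℝ → ENNReal := fun θ => ofReal (1 - ‖w (θ + L / 2) - w θ‖ / (L / 2)) with hg
    have hgp : Periodic g (2 * π) := fun θ => by
      simp only [hg]
      rw [add_right_comm, hw.per, hw.per]
    have hgi := hgp.setLIntegral_Ioc_add two_pi_pos 0 (L / 2)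
    rw [zero_add] at hgi
    have e : d (L / 2) = ∫⁻ θ in Ioc 0 (2 * π), 2⁻¹ * (g θ + g (θ + L / 2)) := by
      rw [lintegral_const_mul' _ _ (by simp), lintegral_add_left (hdm _), hgi, ← two_mul, ← mul_assoc,
        ENNReal.inv_mul_cancel two_ne_zero ENNReal.ofNat_ne_top, one_mul]
    have hm : Measurable fun θ => 2⁻¹ * (g θ + g (θ + L / 2)) :=
      ((hdm _).add ((hdm _).comp (measurable_add_const _))).const_mul _
    rw [e]
    refine le_trans ?_ (add_le_add_right (hδ L hL) _)
    rw [← lintegral_add_left hm]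
    refine lintegral_mono fun θ => ?_
    have e2 : (2⁻¹ : ENNReal) = ofReal 2⁻¹ := by
      rw [ofReal_inv_of_pos two_pos, ENNReal.ofReal_ofNat]
    have hL0 := hL.1
    have hn : ∀ s t : ℝ, s + L / 2 = t → 0 ≤ 1 - ‖w t - w s‖ / (L / 2) := fun s t hst => by
      rw [sub_nonneg, div_le_one (by positivity)]
      refine (hw.norm_sub_le _ _).trans_eq ?_
      rw [← hst, add_sub_cancel_left, abs_of_pos (by positivity)]
    have h2 : θ + L / 2 + L / 2 = θ + L := by ring
    simp only [hg, h2]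
    rw [e2, ← ofReal_add (hn _ _ rfl) (hn _ _ h2), ← ofReal_mul (by norm_num)]
    refine le_trans (ofReal_le_ofReal (le_of_eq ?_)) ENNReal.ofReal_add_le
    field_simp
    ring
  have hsum : ∀ n : ℕ, d L ≤ d (L / 2 ^ n) + ∑ k ∈ Finset.range n, δ (L / 2 ^ k) := by
    intro n
    induction n with
    | zero => simp
    | succ n ih =>
      have := hstep (L / 2 ^ n) ⟨div_pos hL.1 (by positivity),
        (div_le_self hL.1.le (one_le_pow₀ one_le_two)).trans_lt hL.2⟩
      rw [div_div, ← pow_succ] at this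
      rw [Finset.sum_range_succ, add_comm (∑ k ∈ Finset.range n, _), ← add_assoc]
      exact ih.trans (by gcongr)
  have h0 : Tendsto (fun n : ℕ => L / (2 : ℝ) ^ n) atTop (nhdsWithin 0 {0}ᶜ) := by
    refine tendsto_nhdsWithin_iff.2 ⟨?_, Eventually.of_forall fun n =>
      (div_pos hL.1 (by positivity)).ne'⟩
    simpa [div_eq_mul_inv] using
      (tendsto_pow_atTop_nhds_zero_of_lt_one (r := (2 : ℝ)⁻¹) (by norm_num) (by norm_num)).const_mul L
  have hlim : Tendsto (fun n : ℕ => d (L / 2 ^ n)) atTop (nhds 0) := by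
    have := tendsto_lintegral_of_dominated_convergence (μ := volume.restrict (Ioc 0 (2 * π)))
      (F := fun (n : ℕ) θ => ofReal (1 - ‖w (θ + L / 2 ^ n) - w θ‖ / (L / 2 ^ n)))
      (f := fun _ => 0) (fun _ => 1) (fun n => hdm _)
      (fun n => Eventually.of_forall fun θ => ENNReal.ofReal_le_one.2
        (sub_le_self _ (div_nonneg (norm_nonneg _) (div_pos hL.1 (by positivity)).le)))
      (by simp [ENNReal.mul_eq_top]) ?_
    · rwa [lintegral_zero] at this
    refine ae_restrict_of_ae ?_
    filter_upwards [hw.hasDerivAt] with θ hθ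
    have h1 := ((hasDerivAt_iff_tendsto_slope_zero.1 hθ.1).comp h0).norm.const_sub 1
    rw [hθ.2, sub_self] at h1
    rw [← ENNReal.ofReal_zero]
    refine (ENNReal.tendsto_ofReal h1).congr fun n => ?_
    simp only [Function.comp_apply]
    rw [norm_smul, norm_inv, norm_of_nonneg (div_pos hL.1 (by positivity)).le, inv_mul_eq_div]
  refine ge_of_tendsto' (f := fun n : ℕ => d (L / 2 ^ n) + ∑' k : ℕ, δ (L / 2 ^ k)) (by simpa using hlim.add_const (∑' k : ℕ, δ (L / 2 ^ k))) fun n => ?_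
  exact (hsum n).trans (add_le_add_right (ENNReal.sum_le_tsum _) _)

end UnitCurve

/-- The weight with which the point `(y, x)` of the half plane enters the `boxMean` over the image
under `A` of the parameter interval `[θ, θ + L]`; here `q = ((θ, L), (y, x))`. -/
noncomputable def shadowKernel (A : ℝ → ℝ) : (ℝ × ℝ) × ℝ × ℝ → ENNReal :=
  {q | q.2.1 < 3 * (A (q.1.1 + q.1.2) - A q.1.1) ∧
    |q.2.2 - A q.1.1| ≤ 2 * (A (q.1.1 + q.1.2) - A q.1.1)}.indicator
    fun q => ofReal (q.2.1 / (A (q.1.1 + q.1.2) - A q.1.1))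

lemma measurable_shadowKernel {A : ℝ → ℝ} (hA : Continuous A) : Measurable (shadowKernel A) := by
  have h1 : Continuous fun q : (ℝ × ℝ) × ℝ × ℝ => A (q.1.1 + q.1.2) - A q.1.1 := by fun_prop
  refine Measurable.indicator (by fun_prop) ?_
  exact (measurableSet_lt (g := fun q : (ℝ × ℝ) × ℝ × ℝ => 3 * (A (q.1.1 + q.1.2) - A q.1.1))
    (by fun_prop) (by fun_prop)).inter (measurableSet_le (f := fun q : (ℝ × ℝ) × ℝ × ℝ =>
      |q.2.2 - A q.1.1|) (by fun_prop) (h1.measurable.const_mul 2))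

lemma boxMean_le_lintegral_shadowKernel {A : ℝ → ℝ} {Q : ℝ → ℝ → ENNReal} {θ L : ℝ}
    (hm : Measurable fun z : ℝ × ℝ => shadowKernel A ((θ, L), z) * Q z.2 z.1)
    (h3 : 3 * (A (θ + L) - A θ) ≤ 1) (h0 : 0 ≤ A θ) (h1 : A θ ≤ 2 * π) :
    boxMean Q (A θ) (A (θ + L) - A θ) ≤ ∫⁻ z in Ioo 0 1 ×ˢ Ioc (-π) (3 * π),
      shadowKernel A ((θ, L), z) * Q z.2 z.1 := by
  have hpi := pi_gt_three
  rw [Measure.volume_eq_prod, ← Measure.prod_restrict, lintegral_prod _ hm.aemeasurable, boxMean]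
  refine (setLIntegral_mono' measurableSet_Ioo fun y hy => ?_).trans
    (lintegral_mono_set (Ioo_subset_Ioo_right h3))
  refine (setLIntegral_mono' measurableSet_Ioc fun x hx => ?_).trans
    (lintegral_mono_set (Ioc_subset_Ioc (by linarith) (by linarith)))
  rw [mul_comm, shadowKernel, indicator_of_mem]
  exact ⟨hy.2, abs_le.2 ⟨by linarith [hx.1], by linarith [hx.2]⟩⟩

namespace SmallAffineApprox
variable {φ : ℝ → ℂ} {p : ℝ → ℝ → ℂ} {Q : ℝ → ℝ → ENNReal} {L₁ : ℝ}
  (h : SmallAffineApprox φ p Q L₁) {A : ℝ ≃o ℝ} (hw : UnitCurve fun θ => φ (A θ))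
  (hA : ∀ x y, x ≤ y → y ≤ x + L₁ → A.symm y - A.symm x ≤ 2 * ‖φ y - φ x‖)
include h hw hA

lemma symm_sub_le {a x ρ : ℝ} (hρ : 0 < ρ) (hρ1 : 12 * ρ ≤ L₁) (hx : |x - a| ≤ 4 * ρ) :
    A.symm (x + 4 * ρ) - A.symm (x - 4 * ρ) ≤ 27 * (A.symm (a + ρ) - A.symm a) := by
  have hx' := abs_le.1 hx
  have h1 := (h.le_norm_sub (a := x - 4 * ρ) (by positivity : 0 < 12 * ρ) hρ1 (x := a) (y := a + ρ)
    ⟨by linarith, by linarith⟩ ⟨by linarith, by linarith⟩ (by linarith)).1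
  have h2 := (h.le_norm_sub (a := x - 4 * ρ) (by positivity : 0 < 12 * ρ) hρ1 (x := x - 4 * ρ)
    (y := x + 4 * ρ) ⟨by linarith, by linarith⟩ ⟨by linarith, by linarith⟩ (by linarith)).2
  have h3 := hw.norm_sub_le (A.symm (a + ρ)) (A.symm a)
  simp only [OrderIso.apply_symm_apply] at h3
  rw [abs_of_nonneg (sub_nonneg.2 (A.symm.monotone (by linarith)))] at h3
  have h4 := hA (x - 4 * ρ) (x + 4 * ρ) (by linarith) (by linarith)
  have := mul_nonneg (norm_nonneg (p (x - 4 * ρ) (12 * ρ))) hρ.le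
  nlinarith

lemma lintegral_shadowKernel_le {R : ℝ}
    (hR : ∀ θ ∈ Ioc 0 (2 * π), ∀ L ∈ Ioo 0 R, A (θ + L) - A θ ≤ L₁ / 12)
    {x y : ℝ} (hy : 0 < y) :
    ∫⁻ θ in Ioc 0 (2 * π), ∫⁻ L in Ioo 0 R,
      ofReal (1 / L ^ 2) * shadowKernel A ((θ, L), (y, x)) ≤ ofReal 81 * 2 := by
  set ρ : ℕ → ℝ := fun j => 2 ^ j * (y / 3) with hρ
  have hρ0 : ∀ j, 0 < ρ j := fun j => by positivity
  set N : ℕ → ℝ := fun j => A.symm (x + 4 * ρ j) - A.symm (x - 4 * ρ j)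
  have hN0 : ∀ j, 0 < N j := fun j => sub_pos.2 (A.symm.strictMono (by linarith [hρ0 j]))
  set T : ℕ → ℝ → ENNReal := fun j =>
    (Icc (A.symm (x - 4 * ρ j)) (A.symm (x + 4 * ρ j))).indicator
      fun _ => ofReal (81 / (2 ^ j * N j)) with hT
  have hinner : ∀ θ ∈ Ioc 0 (2 * π), ∫⁻ L in Ioo 0 R,
      ofReal (1 / L ^ 2) * shadowKernel A ((θ, L), (y, x)) ≤ ∑' j, T j θ := fun θ hθ => by
    set r := max (y / 3) (|x - A θ| / 2)
    have hr0 : 0 < r := lt_max_of_lt_left (by positivity)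
    have hK : ∀ L, r ≤ A (θ + L) - A θ ∨ shadowKernel A ((θ, L), (y, x)) = 0 := fun L => by
      refine or_iff_not_imp_left.2 fun hlt => indicator_of_notMem (fun hq => hlt ?_) _
      exact max_le (by linarith [hq.1]) (by linarith [hq.2])
    rcases lt_or_ge (L₁ / 12) r with hrL | hrL
    · refine (setLIntegral_congr_fun measurableSet_Ioo fun L hL => ?_).trans_le
        (lintegral_zero.trans_le zero_le)
      rw [(hK L).resolve_left fun hc => by linarith [hR θ hθ L hL], mul_zero]
    obtain ⟨j, hj1, hj2⟩ := exists_nat_pow_near (x := r / (y / 3)) (y := 2)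
      ((one_le_div (by positivity)).2 (le_max_left _ _)) one_lt_two
    rw [le_div_iff₀ (by positivity)] at hj1
    rw [div_lt_iff₀ (by positivity), pow_succ] at hj2
    have hj1' : ρ j ≤ r := hj1
    have hxr : |x - A θ| ≤ 4 * ρ j := by
      have := le_max_right (y / 3) (|x - A θ| / 2)
      simp only [hρ]
      linarith
    have hdbl := h.symm_sub_le hw hA (hρ0 j) (by linarith) hxr
    have hmono := A.symm.monotone (by linarith : A θ + ρ j ≤ A θ + r)
    rw [A.symm_apply_apply] at hdbl
    set M := A.symm (A θ + r) - θ
    have hNM : N j ≤ 27 * M := by linarith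
    have hM0 : 0 < M := by linarith [hN0 j]
    refine le_trans ?_ (ENNReal.le_tsum j)
    have hx' := abs_le.1 hxr
    have hmem : θ ∈ Icc (A.symm (x - 4 * ρ j)) (A.symm (x + 4 * ρ j)) :=
      ⟨A.symm_apply_le.2 (by linarith), A.le_symm_apply.2 (by linarith)⟩
    rw [hT]
    simp only
    rw [indicator_of_mem hmem]
    calc _ ≤ ∫⁻ L in Ioo 0 R, (Ici M).indicator
            (fun L => ofReal (y / r) * ofReal (1 / L ^ 2)) L := by
          refine setLIntegral_mono' measurableSet_Ioo fun L _ => ?_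
          rcases hK L with hL | hL
          · have hML : L ∈ Ici M := by
              have : A.symm (A θ + r) ≤ θ + L := A.symm_apply_le.2 (by linarith)
              rw [mem_Ici]
              linarith
            rw [indicator_of_mem hML, mul_comm]
            refine mul_le_mul_left (le_trans (indicator_le_self' (fun _ _ => zero_le) _) ?_) _
            exact ofReal_le_ofReal (div_le_div_of_nonneg_left hy.le hr0 hL)
          · rw [hL, mul_zero]
            exact zero_le
      _ ≤ ofReal (y / r) * ofReal (1 / M) := by
          refine (setLIntegral_le_lintegral _ _).trans_eq ?_
          rw [lintegral_indicator measurableSet_Ici, lintegral_ofReal_mul,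
            ← setLIntegral_congr Ioi_ae_eq_Ici, lintegral_Ioi_one_div_sq hM0]
      _ ≤ _ := by
          rw [← ofReal_mul (by positivity)]
          refine ofReal_le_ofReal ?_
          rw [div_mul_div_comm, mul_one, div_le_div_iff₀ (by positivity)
            (mul_pos (by positivity) (hN0 j))]
          calc y * (2 ^ j * N j) ≤ y * (2 ^ j * (27 * M)) := by gcongr
            _ = 81 * (2 ^ j * (y / 3) * M) := by ring
            _ ≤ 81 * (r * M) := by gcongr
  refine (setLIntegral_mono' measurableSet_Ioc hinner).trans ?_
  have h2 : ofReal 81 * 2 = ∑' j : ℕ, ofReal 81 * 2⁻¹ ^ j := by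
    rw [ENNReal.tsum_mul_left, ENNReal.tsum_geometric, ENNReal.one_sub_inv_two, inv_inv]
  rw [lintegral_tsum fun j => (measurable_const.indicator measurableSet_Icc).aemeasurable, h2]
  refine ENNReal.tsum_le_tsum fun j => (setLIntegral_le_lintegral _ _).trans_eq ?_
  have hNj := hN0 j
  rw [lintegral_indicator measurableSet_Icc, setLIntegral_const, Real.volume_Icc,
    ← ofReal_mul (by positivity), ← ENNReal.ofReal_ofNat, ← ofReal_inv_of_pos two_pos,
    ← ofReal_pow (by norm_num), ← ofReal_mul (by norm_num)]
  congr 1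
  change 81 / (2 ^ j * N j) * N j = _
  field_simp
  rw [← mul_pow, mul_one_div_cancel two_ne_zero, one_pow]
end SmallAffineApprox

namespace SmallAffineApprox
variable {φ : ℝ → ℂ} {p : ℝ → ℝ → ℂ} {Q : ℝ → ℝ → ENNReal} {L₁ : ℝ}
  (h : SmallAffineApprox φ p Q L₁)
include h

lemma setLIntegral_density_lt_top :
    ∫⁻ z in Ioo (0 : ℝ) 1 ×ˢ Ioc (-π) (3 * π), Q z.2 z.1 < ⊤ := by
  have hm : Measurable fun z : ℝ × ℝ => Q z.2 z.1 := h.measurable.comp measurable_swap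
  rw [Measure.volume_eq_prod, ← Measure.prod_restrict, lintegral_prod _ hm.aemeasurable]
  refine lt_of_le_of_lt (lintegral_mono fun y => ?_)
    ((lintegral_const_mul' 2 _ (by simp)).trans_lt (mul_lt_top (by simp) h.lt_top))
  have hp : Periodic (fun x => Q x y) (2 * π) := fun x => h.density_periodic x y
  have h1 := hp.setLIntegral_Ioc_eq two_pi_pos (-π) 0
  have h2 := hp.setLIntegral_Ioc_eq two_pi_pos π 0
  rw [show -π + 2 * π = π by ring, zero_add] at h1
  rw [show π + 2 * π = 3 * π by ring, zero_add] at h2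
  rw [← Ioc_union_Ioc_eq_Ioc (by linarith [pi_pos] : -π ≤ π) (by linarith [pi_pos]), two_mul]
  exact (lintegral_union_le _ _ _).trans_eq (by rw [h1, h2])

variable {A : ℝ ≃o ℝ} (hw : UnitCurve fun θ => φ (A θ))
  (hA : ∀ x y, x ≤ y → y ≤ x + L₁ → A.symm y - A.symm x ≤ 2 * ‖φ y - φ x‖)
include hw hA

lemma chord_excess_le {θ L : ℝ} (hL : 0 < L) (hL1 : A (θ + L) - A θ ≤ L₁) :
    ofReal ((‖φ (A (θ + L / 2)) - φ (A θ)‖ + ‖φ (A (θ + L)) - φ (A (θ + L / 2))‖ -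
      ‖φ (A (θ + L)) - φ (A θ)‖) / L) ≤
        ofReal 20480 * boxMean Q (A θ) (A (θ + L) - A θ) := by
  have m1 : A θ < A (θ + L / 2) := A.strictMono (by linarith)
  have m2 : A (θ + L / 2) < A (θ + L) := A.strictMono (by linarith)
  set l := A (θ + L) - A θ
  have hl0 : 0 < l := by linarith
  have e : A θ + l = A (θ + L) := by ring
  have hb := h.boxMean_le (A θ) hl0 hL1
  have hbt : boxMean Q (A θ) l ≠ ⊤ := (hb.trans_lt ofReal_lt_top).ne
  have h1 := (h.le_norm_sub hl0 hL1 ⟨le_rfl, by linarith⟩ ⟨by linarith, le_rfl⟩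
    (by linarith : A θ ≤ A θ + l)).1
  have h2 := hw.norm_sub_le (θ + L) θ
  simp only [e] at h1 h2
  rw [add_sub_cancel_left, abs_of_pos hL] at h2
  have hu := hA _ _ m1.le (by linarith)
  have hv := hA _ _ m2.le (by linarith)
  simp only [OrderIso.symm_apply_apply] at hu hv
  have key := h.excess_le hl0 hL1 (m := A (θ + L / 2)) ⟨m1.le, by linarith⟩ toReal_nonneg
    (ENNReal.toReal_le_of_le_ofReal (by positivity) hb) (ofReal_toReal hbt).ge
    (by linarith) (by rw [e]; linarith)
  rw [e] at key
  rw [← ofReal_toReal hbt, ← ofReal_mul (by norm_num)]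
  refine ofReal_le_ofReal ((div_le_iff₀ hL).2 (key.trans ?_))
  gcongr

theorem moebiusEnergy_lt_top (hA0 : A 0 = 0) (hAp : ∀ θ, A (θ + 2 * π) = A θ + 2 * π) :
    moebiusEnergy (fun θ => φ (A θ)) < ⊤ := by
  have hAc : Continuous A := A.continuous
  have hsc : Continuous A.symm := A.symm.continuous
  have hc : Continuous fun θ => φ (A θ) := hw.continuous
  have hpi := pi_pos
  have hL1 := h.pos
  obtain ⟨R, hR0, hRpi, hR⟩ : ∃ R : ℝ, 0 < R ∧ R ≤ π ∧
      ∀ θ ∈ Ioc 0 (2 * π), ∀ L ∈ Ioo 0 R, A (θ + L) - A θ ≤ L₁ / 12 := by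
    have hcont : Continuous fun θ => A.symm (A θ + L₁ / 12) - θ := by fun_prop
    obtain ⟨t, -, ht⟩ := (isCompact_Icc (a := 0) (b := 2 * π)).exists_isMinOn
      (nonempty_Icc.2 two_pi_pos.le) hcont.continuousOn
    have ht0 : t < A.symm (A t + L₁ / 12) := A.lt_symm_apply.2 (by linarith)
    refine ⟨min (A.symm (A t + L₁ / 12) - t) π, lt_min (sub_pos.2 ht0) hpi, min_le_right _ _,
      fun θ hθ L hL => ?_⟩
    have h1 : A.symm (A t + L₁ / 12) - t ≤ A.symm (A θ + L₁ / 12) - θ := ht ⟨hθ.1.le, hθ.2⟩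
    have h2 : θ + L ≤ A.symm (A θ + L₁ / 12) := by
      linarith [hL.2.trans_le (min_le_left _ _)]
    linarith [A.le_symm_apply.1 h2]
  set S := Ioo (0 : ℝ) 1 ×ˢ Ioc (-π) (3 * π)
  have hQm : Measurable fun q : (ℝ × ℝ) × ℝ × ℝ => Q q.2.2 q.2.1 :=
    h.measurable.comp (measurable_swap.comp measurable_snd)
  have hk := measurable_shadowKernel hAc
  have hkQ : Measurable fun q : (ℝ × ℝ) × ℝ × ℝ => shadowKernel A q * Q q.2.2 q.2.1 := hk.mul hQm
  have hjm : Measurable fun q : ℝ × ℝ => ∫⁻ z in S, shadowKernel A (q, z) * Q z.2 z.1 :=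
    hkQ.lintegral_prod_right'
  set J : ℝ → ENNReal := fun L => ∫⁻ θ in Ioc 0 (2 * π),
    ∫⁻ z in S, shadowKernel A ((θ, L), z) * Q z.2 z.1 with hJ
  have hJm : Measurable J := hjm.lintegral_prod_left'
  have hsq : Measurable fun q : ℝ × ℝ => ofReal (1 / q.2 ^ 2) := by fun_prop
  have hJfin : ∫⁻ L in Ioo 0 R, ofReal (1 / L ^ 2) * J L < ⊤ := by
    have e : ∫⁻ L in Ioo 0 R, ofReal (1 / L ^ 2) * J L =
        ∫⁻ z in S, ∫⁻ q, Q z.2 z.1 * (ofReal (1 / q.2 ^ 2) * shadowKernel A (q, z))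
          ∂(volume.restrict (Ioc 0 (2 * π))).prod (volume.restrict (Ioo 0 R)) := by
      have hfm : Measurable fun q : (ℝ × ℝ) × ℝ × ℝ =>
        Q q.2.2 q.2.1 * (ofReal (1 / q.1.2 ^ 2) * shadowKernel A q) :=
        hQm.mul ((hsq.comp measurable_fst).mul hk)
      rw [← lintegral_lintegral_swap hfm.aemeasurable,
        lintegral_prod_symm _ hfm.lintegral_prod_right'.aemeasurable]
      refine lintegral_congr fun L => ?_
      rw [hJ, ← lintegral_ofReal_mul]
      refine lintegral_congr fun θ => ?_
      rw [← lintegral_ofReal_mul]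
      exact lintegral_congr fun z => by ring
    rw [e]
    refine lt_of_le_of_lt (setLIntegral_mono' (measurableSet_Ioo.prod measurableSet_Ioc)
      (g := fun z => (ofReal 81 * 2) * Q z.2 z.1) fun z hz => ?_) ?_
    · have hzm : Measurable fun q : ℝ × ℝ =>
        ofReal (1 / q.2 ^ 2) * shadowKernel A (q, z) :=
        hsq.mul (hk.comp (measurable_id.prodMk measurable_const))
      rw [lintegral_const_mul _ hzm, lintegral_prod _ hzm.aemeasurable, mul_comm]
      exact mul_le_mul_left (h.lintegral_shadowKernel_le hw hA hR hz.1.1) _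
    · rw [lintegral_const_mul' _ _ (ENNReal.mul_ne_top ofReal_ne_top (by simp))]
      exact mul_lt_top (mul_lt_top ofReal_lt_top (by simp))
        h.setLIntegral_density_lt_top
  have hAθ : ∀ θ ∈ Ioc 0 (2 * π), 0 ≤ A θ ∧ A θ ≤ 2 * π := fun θ hθ => by
    have h2 := hAp 0
    rw [zero_add, hA0, zero_add] at h2
    exact ⟨hA0 ▸ A.monotone hθ.1.le, h2 ▸ A.monotone hθ.2⟩
  have hdef := fun L (hL : L ∈ Ioo 0 R) =>
    hw.lintegral_deficit_le_tsum (δ := fun L => ofReal 20480 * J L) (R := R)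
    (fun L hL => by
      rw [hJ, ← lintegral_ofReal_mul]
      refine setLIntegral_mono' measurableSet_Ioc fun θ hθ => ?_
      have hRL := hR θ hθ L hL
      refine (h.chord_excess_le hw hA hL.1 (by linarith)).trans (mul_le_mul_right ?_ _)
      exact boxMean_le_lintegral_shadowKernel (hkQ.comp measurable_prodMk_left)
        (by linarith [h.le_one]) (hAθ θ hθ).1 (hAθ θ hθ).2) hL
  have hn : Continuous fun q : ℝ × ℝ => ‖φ (A (q.1 + q.2)) - φ (A q.1)‖ :=
    ((hc.comp (continuous_fst.add continuous_snd)).sub (hc.comp continuous_fst)).norm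
  have hfm : Measurable fun q : ℝ × ℝ =>
      ofReal (1 / ‖φ (A (q.1 + q.2)) - φ (A q.1)‖ ^ 2 - 1 / q.2 ^ 2) := by
    have := hn.measurable
    fun_prop
  set E : ℝ → ENNReal := fun L => ∫⁻ θ in Ioc 0 (2 * π),
    ofReal (1 / ‖φ (A (θ + L)) - φ (A θ)‖ ^ 2 - 1 / L ^ 2) with hE
  have hEm : Measurable E := hfm.lintegral_prod_left'
  have hEfin : ∫⁻ L in Ioo 0 R, E L < ⊤ := by
    refine lt_of_le_of_lt (setLIntegral_mono' measurableSet_Ioo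
      (g := fun L => ofReal 8 * (ofReal (1 / L ^ 2) *
        ∑' k : ℕ, ofReal 20480 * J (L / 2 ^ k))) fun L hL => ?_) ?_
    · refine le_trans ?_ (mul_le_mul_right (mul_le_mul_right (hdef L hL) _) _)
      rw [← mul_assoc, ← ofReal_mul (by norm_num),
        ← lintegral_ofReal_mul]
      refine setLIntegral_mono' measurableSet_Ioc fun θ hθ => ?_
      rw [← ofReal_mul (by positivity)]
      have hRL := hR θ hθ L hL
      have hL0 := hL.1
      have h1 := hA (A θ) (A (θ + L)) (A.monotone (by linarith)) (by linarith)
      have h2 := hw.norm_sub_le (θ + L) θ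
      simp only [OrderIso.symm_apply_apply] at h1
      rw [add_sub_cancel_left] at h1 h2
      rw [abs_of_pos hL0] at h2
      set d := ‖φ (A (θ + L)) - φ (A θ)‖
      have hd : 0 < d := by linarith
      refine ofReal_le_ofReal ?_
      rw [div_sub_div _ _ (by positivity) (by positivity), div_le_iff₀ (by positivity)]
      have e : 8 * (1 / L ^ 2) * (1 - d / L) * (d ^ 2 * L ^ 2) = (L - d) * (8 * d ^ 2 / L) := by
        field_simp
      have h3 : L + d ≤ 8 * d ^ 2 / L := (le_div_iff₀ hL0).2 (by nlinarith)
      rw [e]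
      nlinarith [mul_le_mul_of_nonneg_left h3 (sub_nonneg.2 h2)]
    · rw [lintegral_ofReal_mul]
      refine mul_lt_top ofReal_lt_top
        ((lintegral_one_div_sq_mul_tsum_le (hJm.const_mul _) R).trans_lt
        (mul_lt_top (by simp) ?_))
      simp_rw [mul_left_comm _ (ofReal 20480)]
      rw [lintegral_ofReal_mul]
      exact mul_lt_top ofReal_lt_top hJfin
  have hEneg : ∀ L, E (-L) = E L := fun L => by
    have hp : Periodic (fun θ => ofReal
        (1 / ‖φ (A (θ + -L)) - φ (A θ)‖ ^ 2 - 1 / (-L) ^ 2)) (2 * π) := fun θ => by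
      simp only [add_right_comm θ (2 * π), hAp, h.periodic]
    have := hp.setLIntegral_Ioc_add two_pi_pos 0 L
    rw [zero_add] at this
    simp only [hE]
    rw [← this]
    refine lintegral_congr fun θ => ?_
    rw [add_neg_cancel_right, norm_sub_rev, neg_sq]
  obtain ⟨M, hM, hME⟩ : ∃ M : ENNReal, M ≠ ⊤ ∧ ∀ L ∈ Icc R π, E L ≤ M := by
    obtain ⟨q, hq, hmin⟩ := ((isCompact_Icc (a := 0) (b := 2 * π)).prod
      (isCompact_Icc (a := R) (b := π))).exists_isMinOn
      ⟨(0, R), ⟨le_rfl, two_pi_pos.le⟩, le_rfl, hRpi⟩ hn.continuousOn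
    have hpos : 0 < ‖φ (A (q.1 + q.2)) - φ (A q.1)‖ := norm_pos_iff.2 <| sub_ne_zero.2 fun h0 => by
      have := hw.injective_Ico q.1 ⟨by linarith [hq.2.1], by linarith [hq.2.2]⟩
        ⟨le_rfl, by linarith⟩ h0
      linarith [hq.2.1]
    refine ⟨∫⁻ θ in Ioc 0 (2 * π),
      ofReal (1 / ‖φ (A (q.1 + q.2)) - φ (A q.1)‖ ^ 2), ?_, fun L hL =>
      setLIntegral_mono' measurableSet_Ioc fun θ hθ => ofReal_le_ofReal ?_⟩
    · rw [setLIntegral_const, volume_Ioc]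
      exact ENNReal.mul_ne_top ofReal_ne_top ofReal_ne_top
    · refine (sub_le_self _ (by positivity)).trans ?_
      gcongr
      exact hmin (show (θ, L) ∈ Icc 0 (2 * π) ×ˢ Icc R π from ⟨⟨hθ.1.le, hθ.2⟩, hL⟩)
  set G := (Ioo 0 R).indicator E with hG
  have hGm : Measurable G := hEm.indicator measurableSet_Ioo
  have hGfin : ∫⁻ L, G L < ⊤ := by rwa [hG, lintegral_indicator measurableSet_Ioo]
  have hpos : ∀ L ∈ Ioc 0 π, E L ≤ M + G L := fun L hL => by
    rcases lt_or_ge L R with hlt | hge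
    · rw [hG, indicator_of_mem (show L ∈ Ioo 0 R from ⟨hL.1, hlt⟩)]
      exact le_add_self
    · exact (hME L ⟨hge, hL.2⟩).trans le_self_add
  have hbd : ∀ L ∈ Icc (-π) π, E L ≤ M + G L + G (-L) := fun L hL => by
    rcases lt_trichotomy L 0 with hneg | rfl | hp
    · rw [← hEneg, add_right_comm]
      exact (hpos _ ⟨by linarith, by linarith [hL.1]⟩).trans le_self_add
    · simp [hE]
    · exact (hpos L ⟨hp, hL.2⟩).trans le_self_add
  rw [moebiusEnergy, lintegral_lintegral_swap hfm.aemeasurable]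
  refine (setLIntegral_mono' measurableSet_Ioc fun L hL => hbd L ⟨hL.1.le, hL.2⟩).trans_lt ?_
  have hMG : Measurable fun L => M + G L := measurable_const.add hGm
  rw [lintegral_add_left hMG, lintegral_add_left measurable_const,
    setLIntegral_const]
  refine ENNReal.add_lt_top.2 ⟨ENNReal.add_lt_top.2 ⟨mul_lt_top hM.lt_top (by simp), ?_⟩, ?_⟩
  · exact (setLIntegral_le_lintegral _ _).trans_lt hGfin
  · exact ((setLIntegral_le_lintegral _ _).trans_eq (lintegral_neg_eq_self G)).trans_lt hGfin

end SmallAffineApprox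

lemma SmallAffineApprox.div_const {φ : ℝ → ℂ} {p : ℝ → ℝ → ℂ} {Q : ℝ → ℝ → ENNReal} {L₁ c : ℝ}
    (h : SmallAffineApprox φ p Q L₁) (hc : 0 < c) :
    SmallAffineApprox (fun x => φ x / c) (fun a L => p a L / c) Q L₁ :=
  { h with
    continuous := h.continuous.div_const _
    periodic := fun x => by simp only [h.periodic]
    ne_zero := fun a L hL => div_ne_zero (h.ne_zero a L hL) (by exact_mod_cast hc.ne')
    approx := fun a L δ x hL hL1 hδ hδ1 hb hx => by
      have := div_le_div_of_nonneg_right (h.approx a L δ x hL hL1 hδ hδ1 hb hx) hc.le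
      rw [show φ x / c - φ a / c - p a L / c * (x - a) = (φ x - φ a - p a L * (x - a)) / c by ring,
        norm_div, norm_div, Complex.norm_of_nonneg hc.le]
      exact this.trans_eq (by ring) }

lemma SmallAffineApprox.injOn_Icc {φ : ℝ → ℂ} {p : ℝ → ℝ → ℂ} {Q : ℝ → ℝ → ENNReal} {L₁ : ℝ}
    (h : SmallAffineApprox φ p Q L₁) (a : ℝ) : InjOn φ (Icc a (a + L₁)) := by
  have key : ∀ x y, x < y → y ≤ x + L₁ → φ x ≠ φ y := fun x y hxy hyx he => by
    have h1 := (h.le_norm_sub (a := x) (L := y - x) (x := x) (y := y) (by linarith) (by linarith)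
      ⟨le_rfl, by linarith⟩ ⟨hxy.le, by linarith⟩ hxy.le).1
    rw [he, sub_self, norm_zero] at h1
    have h2 := norm_pos_iff.2 (h.ne_zero x (y - x) (by linarith))
    nlinarith [mul_pos h2 (sub_pos.2 hxy)]
  intro x hx y hy he
  rcases lt_trichotomy x y with hlt | heq | hlt
  · exact (key x y hlt (by linarith [hx.1, hy.2]) he).elim
  · exact heq
  · exact (key y x hlt (by linarith [hy.1, hx.2]) he.symm).elim

/-- A Riemann map with square integrable pre-Schwarzian derivative has a rectifiable boundary curve
of finite Möbius energy. -/
theorem exists_arclength_param_of_lintegral_preSchwarzian_lt_top {γ : ℝ → ℂ} {F : ℂ → ℂ} {Ω : Set ℂ}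
    (hγ : Continuous γ) (hp : ∀ θ, γ (θ + 2 * π) = γ θ) (hi : InjOn γ (Ico 0 (2 * π)))
    (hΩb : IsBounded Ω) (hcl : closure Ω ⊆ Ω ∪ range γ)
    (hdisj : Disjoint Ω (range γ)) (hF : DifferentiableOn ℂ F (ball 0 1))
    (hb : BijOn F (ball 0 1) Ω)
    (hE : ∫⁻ z in 𝔻, ofReal (‖deriv (deriv F) z / deriv F z‖ ^ 2) < ⊤) :
    ∃ c : ℝ, 0 < c ∧ ∃ w : ℝ → ℂ, LipschitzWith (toNNReal c) w ∧
      (∀ θ, w (θ + 2 * π) = w θ) ∧ InjOn w (Ico 0 (2 * π)) ∧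
      range w = range γ ∧ (∀ᵐ θ : ℝ, ∃ v : ℂ, HasDerivAt w v θ ∧ ‖v‖ = c) ∧
      (∫⁻ θ in Ioc 0 (2 * π), ∫⁻ σ in Ioc 0 (2 * π), ofReal
        ((1 / ‖w θ - w σ‖ ^ 2 - 1 / (c * min |θ - σ| (2 * π - |θ - σ|)) ^ 2) * c ^ 2)) < ⊤ := by
  obtain ⟨φ, p, Q, L₀, h0, hlim⟩ := exists_affineApprox hF hb.injOn hE
  obtain ⟨L₁, h⟩ := h0.exists_small
  obtain ⟨hφi, hr⟩ := boundary_injOn_and_range_eq hγ hp hi hΩb hcl hdisj hF hb h.continuous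
    h.periodic h.pos h.injOn_Icc hlim
  obtain ⟨c, hc, A, hA0, hAp, hu, hA⟩ := exists_unitCurve_reparam h.continuous h.periodic hφi h.pos
    h.injOn_Icc fun a L hL hL1 => h.eVariationOn_le hL hL1
  have hc' : (c : ℂ) ≠ 0 := by exact_mod_cast hc.ne'
  have hcn : ‖(c : ℂ)‖ = c := Complex.norm_of_nonneg hc.le
  have hper : ∀ θ, φ (A (θ + 2 * π)) = φ (A θ) := fun θ => by rw [hAp, h.periodic]
  refine ⟨c, hc, fun θ => φ (A θ), LipschitzWith.of_dist_le_mul fun x y => ?_, hper,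
    fun x hx y hy he => hu.inj hx hy (congrArg (· / (c : ℂ)) he), ?_, ?_, ?_⟩
  · have := hu.lip.dist_le_mul x y
    rw [dist_eq_norm, ← sub_div, norm_div, hcn, div_le_iff₀ hc, NNReal.coe_one, one_mul] at this
    rwa [dist_eq_norm, coe_toNNReal _ hc.le, mul_comm]
  · rw [← hr]
    exact A.surjective.range_comp φ
  · filter_upwards [hu.der] with θ ⟨v, hv, hvn⟩
    refine ⟨v * c, (hv.mul_const (c : ℂ)).congr_of_eventuallyEq ?_, by rw [norm_mul, hvn, hcn, one_mul]⟩
    exact .of_forall fun θ => (div_mul_cancel₀ _ hc').symm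
  · rw [lintegral_moebius_eq_moebiusEnergy hc hper]
    refine (h.div_const hc).moebiusEnergy_lt_top hu (fun x y hxy hyx => ?_) hA0 hAp
    rw [← sub_div, norm_div, hcn, ← mul_div_assoc, le_div_iff₀ hc, mul_comm]
    exact hA x y hxy hyx

end

theorem wp_quasicircle_iff_finite_moebius_energy
    -- the Jordan curve `Γ = range γ`, parametrized `2π`-periodically and injectively
    (γ : ℝ → ℂ) (hγc : Continuous γ) (hγp : ∀ θ, γ (θ + 2 * π) = γ θ)
    (hγi : Set.InjOn γ (Set.Ico 0 (2 * π)))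
    -- `Γ` is a quasicircle: Ahlfors' bounded turning condition
    (hqc : ∃ C : ℝ, 0 < C ∧ ∀ s t : ℝ, s ≤ t → t ≤ s + 2 * π →
      min (Metric.diam (γ '' Set.Icc s t)) (Metric.diam (γ '' Set.Icc t (s + 2 * π)))
        ≤ C * ‖γ s - γ t‖)
    -- interior `Ω` and exterior `Ωstar`
    (Ω Ωstar : Set ℂ)
    (hΩo : IsOpen Ω) (hΩconn : IsConnected Ω) (hΩso : IsOpen Ωstar)
    (hΩsconn : IsConnected Ωstar) (hdisj : Disjoint Ω Ωstar)
    (hunion : Ω ∪ Ωstar = (Set.range γ)ᶜ)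
    (hΩbdd : Bornology.IsBounded Ω) (hΩsunbdd : ¬ Bornology.IsBounded Ωstar)
    -- the interior Riemann map `F : 𝔻 → Ω`
    (F : ℂ → ℂ) (hF : DifferentiableOn ℂ F (ball (0 : ℂ) 1))
    (hFbij : Set.BijOn F (ball (0 : ℂ) 1) Ω) :
    (∫⁻ z in ball (0 : ℂ) 1,
        ENNReal.ofReal (‖deriv (deriv F) z / deriv F z‖ ^ 2)) < ⊤ ↔
      -- `Γ` is rectifiable, with arclength parametrization `w` and length `ℓ` …
      ∃ ℓ : ℝ, 0 < ℓ ∧ ∃ w : ℝ → ℂ,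
        LipschitzWith (Real.toNNReal (ℓ / (2 * π))) w ∧
        (∀ θ, w (θ + 2 * π) = w θ) ∧
        Set.InjOn w (Set.Ico 0 (2 * π)) ∧
        Set.range w = Set.range γ ∧
        (∀ᵐ θ : ℝ, ∃ v : ℂ, HasDerivAt w v θ ∧ ‖v‖ = ℓ / (2 * π)) ∧
        -- … and the Möbius energy of `Γ` is finite
        (∫⁻ θ in Set.Ioc 0 (2 * π), ∫⁻ σ in Set.Ioc 0 (2 * π),
            ENNReal.ofReal
              ((1 / ‖w θ - w σ‖ ^ 2 -
                  1 / ((ℓ / (2 * π)) * min |θ - σ| (2 * π - |θ - σ|)) ^ 2) *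
                (ℓ / (2 * π)) ^ 2)) < ⊤ := by
  have hcl := closure_subset_of_union_eq_compl hΩso hdisj hunion
  have hdisj' : Disjoint Ω (Set.range γ) :=
    Set.disjoint_left.2 fun z hz => hunion.subset (Or.inl hz)
  constructor
  · intro hE
    obtain ⟨c, hc, w, hw⟩ := exists_arclength_param_of_lintegral_preSchwarzian_lt_top hγc hγp hγi
      hΩbdd hcl hdisj' hF hFbij hE
    refine ⟨c * (2 * π), by positivity, w, ?_⟩
    rwa [mul_div_cancel_right₀ c two_pi_pos.ne']
  · rintro ⟨ℓ, hℓ, w, hwl, hwp, hwi, hwr, hwd, hE⟩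
    exact lintegral_preSchwarzian_lt_top_of_moebius hΩo hΩconn.isPreconnected hΩso
      hΩsconn.isPreconnected hdisj hunion hΩbdd hΩsunbdd hF hFbij (div_pos hℓ two_pi_pos) hwl hwp hwi
      hwr hwd hE
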